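/- Let Φ={φ_i}_{i∈Λ} be an analytic IFS on I=[0,1] with 0<|φ_i'(x)|<1 for all i∈Λ and x∈I. Suppose the maps in Φ do not have a common fixed point and that Φ is exponentially separated. Let p=(p_i)_{i∈Λ} be a positive probability vector and μ the associated self-conformal measure. Then μ is exact dimensional with dimension min{1, H(p)/χ}; that is, for μ-a.e. x∈I, lim_{δ→0} log μ(B(x,δ))/log δ = min{1, H(p)/χ}. -/

import Mathlib

open MeasureTheory Filter Set Metric Topology

noncomputable section

/-- The unit interval `I = [0,1]`. -/
def unitI : Set ℝ := Set.Icc 0 1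

/-- For a word `u = i₁…iₙ`, `compWord φ u = φ_{i₁} ∘ … ∘ φ_{iₙ}`. -/
def compWord {Λ : Type*} (φ : Λ → ℝ → ℝ) : List Λ → ℝ → ℝ
  | [] => id
  | i :: u => φ i ∘ compWord φ u

/-- Exponential separation of the IFS `φ`. -/
def ExpSep {Λ : Type*} (φ : Λ → ℝ → ℝ) : Prop :=
  ∃ c : ℝ, 0 < c ∧ ∀ N : ℕ, ∃ n, N ≤ n ∧ ∀ u₁ u₂ : List Λ,
    u₁.length = n → u₂.length = n → u₁ ≠ u₂ →
      ∃ x ∈ unitI, c ^ n ≤ |compWord φ u₁ x - compWord φ u₂ x|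

/-- `μ` is exact dimensional with dimension `d`. -/
def ExactDimWith (μ : Measure ℝ) (d : ℝ) : Prop :=
  ∀ᵐ x ∂μ, Tendsto (fun δ : ℝ =>
      Real.log (μ (Metric.closedBall x δ)).toReal / Real.log δ)
    (nhdsWithin 0 (Set.Ioi 0)) (nhds d)

set_option linter.unusedSectionVars false

namespace SelfConformal

/-! ### Conditional entropies of functions on finite weighted spaces -/

section Entropy

variable {Ω Ω' Ω₁ Ω₂ α α' β β' γ : Type*} [Fintype Ω] [Fintype Ω'] [Fintype Ω₁] [Fintype Ω₂]

open Classical in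
/-- The `w`-mass of the level set of `f` through `ω`. -/
def mass (w : Ω → ℝ) (f : Ω → α) (ω : Ω) : ℝ := ∑ ω', if f ω' = f ω then w ω' else 0

/-- The unnormalised entropy `-∑ w log (mass w f)`. -/
def sent (w : Ω → ℝ) (f : Ω → α) : ℝ := -∑ ω, w ω * Real.log (mass w f ω)

/-- The conditional entropy of `f` given `g`, with weights `w`. -/
def cent (w : Ω → ℝ) (f : Ω → α) (g : Ω → β) : ℝ := sent w (fun ω => (f ω, g ω)) - sent w g

/-- The entropy of `f`, with weights `w`. -/
def ent (w : Ω → ℝ) (f : Ω → α) : ℝ := cent w f (fun _ => ())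

variable {w : Ω → ℝ} {f : Ω → α} {g : Ω → β}

lemma mass_nonneg (hw : ∀ ω, 0 ≤ w ω) (f : Ω → α) (ω : Ω) : 0 ≤ mass w f ω :=
  Finset.sum_nonneg fun ω' _ => by split_ifs <;> simp [hw]

lemma le_mass (hw : ∀ ω, 0 ≤ w ω) (f : Ω → α) (ω : Ω) : w ω ≤ mass w f ω := by
  classical
  have := Finset.single_le_sum (f := fun ω' => if f ω' = f ω then w ω' else 0)
    (fun ω' _ => by split_ifs <;> simp [hw]) (Finset.mem_univ ω)
  simp only [if_true] at this
  exact this.trans (le_of_eq (by unfold mass; congr!))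

lemma mass_pos (hw : ∀ ω, 0 ≤ w ω) (f : Ω → α) {ω : Ω} (h : 0 < w ω) : 0 < mass w f ω :=
  h.trans_le (le_mass hw f ω)

lemma mass_mono (hw : ∀ ω, 0 ≤ w ω) {ω : Ω} (h : ∀ ω', f ω' = f ω → g ω' = g ω) :
    mass w f ω ≤ mass w g ω := by
  refine Finset.sum_le_sum fun ω' _ => ?_
  by_cases h1 : f ω' = f ω
  · simp [h1, h ω' h1]
  · rw [if_neg h1]; split_ifs <;> simp [hw]

lemma mass_congr {ω : Ω} (h : ∀ ω', f ω' = f ω ↔ g ω' = g ω) : mass w f ω = mass w g ω := by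
  refine Finset.sum_congr rfl fun ω' _ => ?_
  by_cases h1 : f ω' = f ω
  · rw [if_pos h1, if_pos ((h ω').1 h1)]
  · rw [if_neg h1, if_neg (fun h2 => h1 ((h ω').2 h2))]

lemma mass_eq_of_eq {ω ω' : Ω} (h : f ω = f ω') : mass w f ω = mass w f ω' := by
  unfold mass; rw [h]

lemma sent_congr (h : ∀ ω ω', f ω' = f ω ↔ g ω' = g ω) : sent w f = sent w g := by
  simp only [sent, mass_congr (h _)]

lemma cent_congr {f' : Ω → α'} {g' : Ω → β'} (hg : ∀ ω ω', g ω' = g ω ↔ g' ω' = g' ω)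
    (hf : ∀ ω ω', g ω' = g ω → (f ω' = f ω ↔ f' ω' = f' ω)) : cent w f g = cent w f' g' := by
  unfold cent
  rw [sent_congr hg, sent_congr (f := fun ω => (f ω, g ω)) (g := fun ω => (f' ω, g' ω))]
  intro ω ω'
  simp only [Prod.mk.injEq]
  constructor
  · rintro ⟨h1, h2⟩; exact ⟨(hf _ _ h2).1 h1, (hg _ _).1 h2⟩
  · rintro ⟨h1, h2⟩; exact ⟨(hf _ _ ((hg _ _).2 h2)).2 h1, (hg _ _).2 h2⟩

lemma cent_chain (w : Ω → ℝ) (f : Ω → α) (g : Ω → β) (h : Ω → γ) :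
    cent w (fun ω => (f ω, g ω)) h = cent w g h + cent w f (fun ω => (g ω, h ω)) := by
  unfold cent
  rw [sent_congr (f := fun ω => ((f ω, g ω), h ω)) (g := fun ω => (f ω, (g ω, h ω)))]
  · ring
  · intro ω ω'; simp only [Prod.mk.injEq]; tauto

lemma cent_eq_sum (w : Ω → ℝ) (f : Ω → α) (g : Ω → β) : cent w f g =
    ∑ ω, w ω * (Real.log (mass w g ω) - Real.log (mass w (fun ω => (f ω, g ω)) ω)) := by
  simp only [cent, sent, mul_sub, Finset.sum_sub_distrib]; ring

lemma cent_nonneg (hw : ∀ ω, 0 ≤ w ω) (f : Ω → α) (g : Ω → β) : 0 ≤ cent w f g := by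
  rw [cent_eq_sum]
  refine Finset.sum_nonneg fun ω _ => ?_
  rcases (hw ω).eq_or_lt with h | h
  · simp [← h]
  · refine mul_nonneg h.le (sub_nonneg.2 (Real.log_le_log (mass_pos hw _ h) (mass_mono hw ?_)))
    intro ω' h; simp only [Prod.mk.injEq] at h; exact h.2

open Classical in
lemma sum_div_mass_le (w : Ω → ℝ) (f : Ω → α) {F : α → ℝ} (hF : ∀ ω, 0 ≤ F (f ω)) :
    ∑ ω, w ω / mass w f ω * F (f ω) ≤ ∑ c ∈ Finset.univ.image f, F c := by
  rw [← Finset.sum_fiberwise_of_maps_to (s := Finset.univ) (t := Finset.univ.image f) (g := f)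
    (fun x _ => Finset.mem_image_of_mem f (Finset.mem_univ x))]
  refine Finset.sum_le_sum fun c hc => ?_
  obtain ⟨ω₀, -, rfl⟩ := Finset.mem_image.1 hc
  have h1 : ∑ ω with f ω = f ω₀, w ω / mass w f ω * F (f ω)
      = (∑ ω with f ω = f ω₀, w ω) / mass w f ω₀ * F (f ω₀) := by
    rw [Finset.sum_div, Finset.sum_mul]
    refine Finset.sum_congr rfl fun ω hω => ?_
    rw [mass_eq_of_eq (Finset.mem_filter.1 hω).2, (Finset.mem_filter.1 hω).2]
  have h2 : ∑ ω with f ω = f ω₀, w ω = mass w f ω₀ := by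
    rw [Finset.sum_filter]; unfold mass; congr!
  rw [h1, h2]
  exact mul_le_of_le_one_left (hF _) (div_self_le_one _)

open Classical in
lemma cent_gibbs (hw : ∀ ω, 0 ≤ w ω) (f : Ω → α) (g : Ω → β) (q : α → β → ℝ)
    (hq0 : ∀ a c, 0 ≤ q a c) (hq : ∀ ω, 0 < w ω → 0 < q (f ω) (g ω))
    (hs : ∀ ω₀, ∑ a ∈ (Finset.univ.filter fun ω => g ω = g ω₀).image f, q a (g ω₀) ≤ 1) :
    cent w f g ≤ ∑ ω, w ω * -Real.log (q (f ω) (g ω)) := by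
  have key : ∑ ω, w ω * (q (f ω) (g ω) * mass w g ω / mass w (fun ω => (f ω, g ω)) ω)
      ≤ ∑ ω, w ω := by
    by_cases hne : Nonempty Ω
    swap
    · simp only [not_nonempty_iff] at hne; simp
    let G : β → ℝ := fun c => ∑ ω, if g ω = c then w ω else 0
    have hG0 : ∀ c, 0 ≤ G c := fun c => Finset.sum_nonneg fun ω _ => by split_ifs <;> simp [hw]
    have hG : ∀ ω, mass w g ω = G (g ω) := fun ω => by unfold mass; rfl
    have h1 := sum_div_mass_le w (fun ω => (f ω, g ω)) (F := fun c => q c.1 c.2 * G c.2)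
      (fun ω => mul_nonneg (hq0 _ _) (hG0 _))
    have h2 : ∑ c ∈ Finset.univ.image (fun ω => (f ω, g ω)), q c.1 c.2 * G c.2
        ≤ ∑ c ∈ Finset.univ.image g, G c := by
      rw [← Finset.sum_fiberwise_of_maps_to (t := Finset.univ.image g) (g := Prod.snd)]
      · refine Finset.sum_le_sum fun c hc => ?_
        obtain ⟨ω₀, -, rfl⟩ := Finset.mem_image.1 hc
        calc _ = ∑ a ∈ (Finset.univ.filter fun ω => g ω = g ω₀).image f, q a (g ω₀) * G (g ω₀) := by
              refine Finset.sum_bij' (fun x _ => x.1) (fun a _ => (a, g ω₀)) ?_ ?_ ?_ ?_ ?_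
              · rintro ⟨a, b⟩ h
                simp only [Finset.mem_filter, Finset.mem_image, Finset.mem_univ, true_and,
                  Prod.mk.injEq] at h ⊢
                obtain ⟨⟨ω, h1, h2⟩, rfl⟩ := h
                exact ⟨ω, h2, h1⟩
              · intro a h
                simp only [Finset.mem_filter, Finset.mem_image, Finset.mem_univ, true_and,
                  Prod.mk.injEq] at h ⊢
                obtain ⟨ω, h1, h2⟩ := h
                exact ⟨⟨ω, h2, h1⟩, trivial⟩
              · rintro ⟨a, b⟩ h
                simp only [Finset.mem_filter] at h
                simp [h.2]
              · intro a _; rfl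
              · rintro ⟨a, b⟩ h
                simp only [Finset.mem_filter] at h
                simp [h.2]
          _ ≤ 1 * G (g ω₀) := by
              rw [← Finset.sum_mul]; exact mul_le_mul_of_nonneg_right (hs ω₀) (hG0 _)
          _ = _ := one_mul _
      · intro x hx
        obtain ⟨ω₀, -, rfl⟩ := Finset.mem_image.1 hx
        exact Finset.mem_image_of_mem _ (Finset.mem_univ _)
    have h3 : ∑ c ∈ Finset.univ.image g, G c = ∑ ω, w ω := by
      rw [← Finset.sum_fiberwise_of_maps_to (s := Finset.univ) (t := Finset.univ.image g) (g := g)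
        (fun x _ => Finset.mem_image_of_mem g (Finset.mem_univ x))]
      refine Finset.sum_congr rfl fun c _ => ?_
      rw [Finset.sum_filter]
    rw [← h3]
    refine le_trans (le_of_eq ?_) (h1.trans (le_trans (le_of_eq (by congr!)) h2))
    refine Finset.sum_congr rfl fun ω _ => ?_
    rw [← hG]; ring
  rw [cent_eq_sum, ← sub_nonpos, ← Finset.sum_sub_distrib]
  calc _ ≤ ∑ ω, (w ω * (q (f ω) (g ω) * mass w g ω / mass w (fun ω => (f ω, g ω)) ω) - w ω) := by
        refine Finset.sum_le_sum fun ω _ => ?_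
        rcases (hw ω).eq_or_lt with h | h
        · simp [← h]
        have p1 := mass_pos hw g h
        have p2 := mass_pos hw (fun ω => (f ω, g ω)) h
        have p3 := hq ω h
        have := Real.log_le_sub_one_of_pos (x := q (f ω) (g ω) * mass w g ω /
          mass w (fun ω => (f ω, g ω)) ω) (by positivity)
        rw [Real.log_div (by positivity) (by positivity), Real.log_mul (by positivity)
          (by positivity)] at this
        nlinarith
    _ ≤ 0 := by rw [Finset.sum_sub_distrib]; linarith

lemma cent_anti (hw : ∀ ω, 0 ≤ w ω) (f : Ω → α) {g : Ω → β} {g' : Ω → β'}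
    (h : ∀ ω ω', g' ω' = g' ω → g ω' = g ω) : cent w f g' ≤ cent w f g := by
  classical
  by_cases hne : Nonempty Ω
  swap
  · simp only [not_nonempty_iff] at hne; simp [cent_eq_sum]
  -- conditional probabilities given `g` as a test kernel
  let J : α → β → ℝ := fun a c => ∑ ω, if f ω = a ∧ g ω = c then w ω else 0
  let G : β → ℝ := fun c => ∑ ω, if g ω = c then w ω else 0
  have hJ0 : ∀ a c, 0 ≤ J a c := fun a c =>
    Finset.sum_nonneg fun ω _ => by split_ifs <;> simp [hw]
  have hG0 : ∀ c, 0 ≤ G c := fun c => Finset.sum_nonneg fun ω _ => by split_ifs <;> simp [hw]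
  have hJ : ∀ ω, mass w (fun ω => (f ω, g ω)) ω = J (f ω) (g ω) := fun ω => by
    simp only [mass, Prod.mk.injEq, J]
  have hG : ∀ ω, mass w g ω = G (g ω) := fun ω => by simp only [mass, G]
  have hcho : ∀ ω, ∃ c : β, True := fun ω => ⟨g ω, trivial⟩
  let r : β' → β := fun b => if hb : ∃ ω, g' ω = b then g hb.choose else g (Classical.arbitrary Ω)
  have hr : ∀ ω, r (g' ω) = g ω := fun ω => by
    have hb : ∃ ω', g' ω' = g' ω := ⟨ω, rfl⟩
    simp only [r, dif_pos hb]
    exact h _ _ hb.choose_spec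
  have := cent_gibbs hw f g' (fun a b => J a (r b) / G (r b))
    (fun a b => div_nonneg (hJ0 _ _) (hG0 _)) (fun ω hω => by
      rw [hr, ← hJ, ← hG]; exact div_pos (mass_pos hw _ hω) (mass_pos hw _ hω)) (fun ω₀ => by
      simp only [hr]
      rw [← Finset.sum_div]
      refine div_le_one_of_le₀ ?_ (hG0 _)
      simp only [J, G]
      rw [Finset.sum_comm]
      refine Finset.sum_le_sum fun ω _ => ?_
      by_cases hg : g ω = g ω₀
      · simp only [hg, and_true, if_true]
        rw [Finset.sum_ite_eq]
        split_ifs <;> simp [hw]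
      · simp [hg])
  refine this.trans (le_of_eq ?_)
  rw [cent_eq_sum]
  refine Finset.sum_congr rfl fun ω _ => ?_
  rcases (hw ω).eq_or_lt with h | h
  · simp [← h]
  · rw [hr, ← hJ, ← hG, Real.log_div (mass_pos hw _ h).ne' (mass_pos hw _ h).ne']; ring

open Classical in
lemma cent_le_log_card (hw : ∀ ω, 0 ≤ w ω) (f : Ω → α) (g : Ω → β) {M : ℝ}
    (hM : ∀ ω₀, (((Finset.univ.filter fun ω => g ω = g ω₀).image f).card : ℝ) ≤ M) :
    cent w f g ≤ (∑ ω, w ω) * Real.log M := by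
  by_cases hne : Nonempty Ω
  swap
  · simp only [not_nonempty_iff] at hne; simp [cent_eq_sum]
  have hM1 : 1 ≤ M := by
    obtain ⟨ω₀⟩ := hne
    refine le_trans ?_ (hM ω₀)
    exact_mod_cast Finset.card_pos.2 ⟨f ω₀, Finset.mem_image_of_mem _ (by simp)⟩
  have h := cent_gibbs hw f g (fun _ _ => 1 / M) (fun _ _ => by positivity)
    (fun _ _ => by positivity) (fun ω₀ => by
      rw [Finset.sum_const, nsmul_eq_mul, mul_one_div]
      exact div_le_one_of_le₀ (hM ω₀) (by positivity))
  refine h.trans (le_of_eq ?_)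
  rw [Finset.sum_mul]; simp

lemma cent_le_log_of_maps (hw : ∀ ω, 0 ≤ w ω) (f : Ω → α) (g : Ω → β) {M : ℕ}
    (e : β → α → ℕ) (he : ∀ ω, e (g ω) (f ω) < M)
    (hinj : ∀ ω ω', g ω = g ω' → e (g ω) (f ω) = e (g ω) (f ω') → f ω = f ω') :
    cent w f g ≤ (∑ ω, w ω) * Real.log M := by
  classical
  refine cent_le_log_card hw f g fun ω₀ => ?_
  norm_cast
  rw [← Finset.card_range M]
  refine Finset.card_le_card_of_injOn (e (g ω₀)) ?_ ?_
  · intro a ha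
    simp only [Finset.coe_image, Set.mem_image, Finset.coe_filter, Set.mem_ofPred_eq,
      Finset.mem_univ, true_and] at ha
    obtain ⟨ω, h1, rfl⟩ := ha
    have := he ω
    rw [h1] at this
    simpa using this
  · intro a ha a' ha' hh
    simp only [Finset.coe_image, Set.mem_image, Finset.coe_filter, Set.mem_ofPred_eq,
      Finset.mem_univ, true_and] at ha ha'
    obtain ⟨ω, h1, rfl⟩ := ha
    obtain ⟨ω', h1', rfl⟩ := ha'
    exact hinj ω ω' (h1.trans h1'.symm) (by rw [h1]; exact hh)

lemma cent_eq_zero (h : ∀ ω ω', g ω' = g ω → f ω' = f ω) : cent w f g = 0 := by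
  unfold cent
  rw [sent_congr (g := g), sub_self]
  intro ω ω'; simp only [Prod.mk.injEq]; exact ⟨fun h => h.2, fun h' => ⟨h _ _ h', h'⟩⟩

lemma cent_add_of_determined {f' : Ω → α'}
    (h : ∀ ω ω', g ω' = g ω → f' ω' = f' ω → f ω' = f ω) :
    cent w f' g = cent w f g + cent w f' (fun ω => (f ω, g ω)) := by
  rw [← cent_chain]
  refine cent_congr (fun _ _ => Iff.rfl) fun ω ω' hg => ?_
  simp only [Prod.mk.injEq]
  exact ⟨fun hh => ⟨hh, h _ _ hg hh⟩, fun hh => hh.1⟩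

lemma cent_mono (hw : ∀ ω, 0 ≤ w ω) {f' : Ω → α'}
    (h : ∀ ω ω', g ω' = g ω → f' ω' = f' ω → f ω' = f ω) : cent w f g ≤ cent w f' g := by
  rw [cent_add_of_determined (f := f) h]
  linarith [cent_nonneg hw f' (fun ω => (f ω, g ω))]

lemma cent_pair_le (hw : ∀ ω, 0 ≤ w ω) (f : Ω → α) (f' : Ω → α') (g : Ω → β) :
    cent w (fun ω => (f ω, f' ω)) g ≤ cent w f' g + cent w f g := by
  rw [cent_chain]
  have := cent_anti hw f (g := g) (g' := fun ω => (f' ω, g ω)) (fun ω ω' h => (Prod.mk.inj h).2)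
  linarith

lemma cent_le_add (hw : ∀ ω, 0 ≤ w ω) (f : Ω → α) (f' : Ω → α') (g : Ω → β) :
    cent w f g ≤ cent w f' g + cent w f (fun ω => (f' ω, g ω)) := by
  rw [← cent_chain]
  exact cent_mono hw fun ω ω' _ h => (Prod.mk.inj h).1

/-- Replacing an observable by another one costs at most the conditional entropy. -/
lemma cent_le_add' (hw : ∀ ω, 0 ≤ w ω) (f : Ω → α) (f' : Ω → α') (g : Ω → β) :
    cent w f g ≤ cent w f' g + cent w f f' := by
  have := cent_anti hw f (g := f') (g' := fun ω => (f' ω, g ω)) (fun ω ω' h => (Prod.mk.inj h).1)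
  have h1 := cent_le_add hw f f' g
  linarith only [this, h1]

/-- Replacing the conditioning observable costs at most the conditional entropy. -/
lemma cent_le_add_right (hw : ∀ ω, 0 ≤ w ω) (f : Ω → α) (g : Ω → β) (g' : Ω → β') :
    cent w f g ≤ cent w f g' + cent w g' g := by
  have h1 := cent_le_add hw f g' g
  have h2 := cent_anti hw f (g := g') (g' := fun ω => (g' ω, g ω))
    (fun ω ω' h => (Prod.mk.inj h).1)
  linarith

lemma ent_pair (w : Ω → ℝ) (f : Ω → α) (g : Ω → β) :
    ent w (fun ω => (f ω, g ω)) = ent w g + cent w f g := by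
  unfold ent
  rw [cent_chain]
  congr 1
  exact cent_congr (fun ω ω' => by simp) (fun _ _ _ => Iff.rfl)

lemma ent_of_determined {f' : Ω → α'} (h : ∀ ω ω', f' ω' = f' ω → f ω' = f ω) :
    ent w f' = ent w f + cent w f' f := by
  rw [← ent_pair]
  refine cent_congr (fun _ _ => Iff.rfl) fun ω ω' _ => ?_
  simp only [Prod.mk.injEq]
  exact ⟨fun hh => ⟨hh, h _ _ hh⟩, fun hh => hh.1⟩

lemma ent_nonneg (hw : ∀ ω, 0 ≤ w ω) (f : Ω → α) : 0 ≤ ent w f := cent_nonneg hw _ _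

lemma cent_le_ent (hw : ∀ ω, 0 ≤ w ω) (f : Ω → α) (g : Ω → β) : cent w f g ≤ ent w f :=
  cent_anti hw f fun _ _ _ => rfl

lemma ent_mono (hw : ∀ ω, 0 ≤ w ω) {f' : Ω → α'} (h : ∀ ω ω', f' ω' = f' ω → f ω' = f ω) :
    ent w f ≤ ent w f' := cent_mono hw fun ω ω' _ => h ω ω'

lemma ent_le_add (hw : ∀ ω, 0 ≤ w ω) (f : Ω → α) (g : Ω → β) :
    ent w f ≤ ent w g + cent w f g := by
  rw [← ent_pair]; exact ent_mono hw fun ω ω' h => (Prod.mk.inj h).1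

/-- Integer valued observables at bounded distance. -/
lemma cent_int_le (hw : ∀ ω, 0 ≤ w ω) {f g : Ω → ℤ} {M : ℕ} (h : ∀ ω, |f ω - g ω| ≤ M) :
    cent w f g ≤ (∑ ω, w ω) * Real.log (2 * M + 1) := by
  have := cent_le_log_of_maps hw f g (M := 2 * M + 1) (fun b a => (a - b + M).toNat)
    (fun ω => by have := abs_le.1 (h ω); omega)
    (fun ω ω' hg he => by
      have h1 := abs_le.1 (h ω); have h2 := abs_le.1 (h ω'); rw [hg] at *; omega)
  simpa using this

lemma ent_int_le (hw : ∀ ω, 0 ≤ w ω) {f g : Ω → ℤ} {M : ℕ} (h : ∀ ω, |f ω - g ω| ≤ M) :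
    ent w f ≤ ent w g + (∑ ω, w ω) * Real.log (2 * M + 1) :=
  (ent_le_add hw f g).trans (by gcongr; exact cent_int_le hw h)

end Entropy
end SelfConformal

namespace SelfConformal

section Entropy

variable {Ω Ω' Ω₁ Ω₂ α α' β β' γ : Type*} [Fintype Ω] [Fintype Ω'] [Fintype Ω₁] [Fintype Ω₂]
variable {w : Ω → ℝ} {f : Ω → α} {g : Ω → β}

lemma mass_const (w : Ω → ℝ) (c : α) (ω : Ω) : mass w (fun _ => c) ω = ∑ ω, w ω := by
  simp [mass]

lemma ent_eq_sum (w : Ω → ℝ) (f : Ω → α) :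
    ent w f = ∑ ω, w ω * (Real.log (∑ ω, w ω) - Real.log (mass w f ω)) := by
  rw [ent, cent_eq_sum]
  refine Finset.sum_congr rfl fun ω _ => ?_
  rw [mass_const, mass_congr (f := fun ω => (f ω, ())) (g := f) (fun ω' => by simp)]

lemma mass_smul (c : ℝ) (w : Ω → ℝ) (f : Ω → α) (ω : Ω) :
    mass (fun ω => c * w ω) f ω = c * mass w f ω := by
  unfold mass; rw [Finset.mul_sum]; refine Finset.sum_congr rfl fun _ _ => ?_
  split_ifs <;> simp

lemma cent_smul {c : ℝ} (hc : 0 ≤ c) (hw : ∀ ω, 0 ≤ w ω) (f : Ω → α) (g : Ω → β) :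
    cent (fun ω => c * w ω) f g = c * cent w f g := by
  simp only [cent_eq_sum, mass_smul, Finset.mul_sum]
  refine Finset.sum_congr rfl fun ω _ => ?_
  rcases hc.eq_or_lt with h | h
  · simp [← h]
  rcases (hw ω).eq_or_lt with h' | h'
  · simp [← h']
  rw [Real.log_mul h.ne' (mass_pos hw _ h').ne', Real.log_mul h.ne' (mass_pos hw _ h').ne']
  ring

lemma ent_smul {c : ℝ} (hc : 0 ≤ c) (hw : ∀ ω, 0 ≤ w ω) (f : Ω → α) :
    ent (fun ω => c * w ω) f = c * ent w f := cent_smul hc hw _ _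

open Classical in
/-- `w'` is the image of the weight `w` under `T`. -/
def IsPush (T : Ω → Ω') (w : Ω → ℝ) (w' : Ω' → ℝ) : Prop :=
  ∀ ω', w' ω' = ∑ ω, if T ω = ω' then w ω else 0

lemma IsPush.sum {T : Ω → Ω'} {w' : Ω' → ℝ} (h : IsPush T w w') (F : Ω' → ℝ) :
    ∑ ω, w ω * F (T ω) = ∑ ω', w' ω' * F ω' := by
  classical
  simp only [h _, Finset.sum_mul]
  rw [Finset.sum_comm]
  refine Finset.sum_congr rfl fun ω _ => ?_
  simp [ite_mul]

lemma IsPush.total {T : Ω → Ω'} {w' : Ω' → ℝ} (h : IsPush T w w') : ∑ ω, w ω = ∑ ω', w' ω' := by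
  simpa using h.sum (fun _ => 1)

lemma IsPush.mass {T : Ω → Ω'} {w' : Ω' → ℝ} (h : IsPush T w w') (f : Ω' → α) (ω : Ω) :
    mass w (fun ω => f (T ω)) ω = mass w' f (T ω) := by
  classical
  have := h.sum (fun ω' => if f ω' = f (T ω) then 1 else 0)
  simpa [SelfConformal.mass, mul_ite] using this

lemma IsPush.cent {T : Ω → Ω'} {w' : Ω' → ℝ} (h : IsPush T w w') (f : Ω' → α) (g : Ω' → β) :
    cent w (fun ω => f (T ω)) (fun ω => g (T ω)) = cent w' f g := by
  rw [cent_eq_sum, cent_eq_sum, ← h.sum]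
  refine Finset.sum_congr rfl fun ω _ => ?_
  rw [h.mass g, h.mass (fun ω => (f ω, g ω))]

lemma IsPush.ent {T : Ω → Ω'} {w' : Ω' → ℝ} (h : IsPush T w w') (f : Ω' → α) :
    ent w (fun ω => f (T ω)) = ent w' f := h.cent f (fun _ => ())

lemma isPush_equiv (e : Ω ≃ Ω') {w : Ω → ℝ} {w' : Ω' → ℝ} (h : ∀ ω, w ω = w' (e ω)) :
    IsPush e w w' := by
  classical
  intro ω'
  rw [Finset.sum_eq_single (e.symm ω')]
  · simp [h]
  · intro b _ hb; rw [if_neg]; rintro rfl; simp at hb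
  · simp

open Classical in
lemma mass_restrict (w : Ω → ℝ) (k : Ω → α) (h : Ω → γ) (ω : Ω) :
    mass (fun ω' => if h ω' = h ω then w ω' else 0) k ω = mass w (fun ω => (k ω, h ω)) ω := by
  unfold mass
  refine Finset.sum_congr rfl fun ω' _ => ?_
  simp only [Prod.mk.injEq]
  by_cases h1 : k ω' = k ω <;> by_cases h2 : h ω' = h ω <;> simp [h1, h2]

open Classical in
lemma cent_fiber (w : Ω → ℝ) (f : Ω → α) (g : Ω → β) (h : Ω → γ) (t : Finset γ)
    (ht : ∀ ω, h ω ∈ t) : cent w f (fun ω => (g ω, h ω)) =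
      ∑ z ∈ t, cent (fun ω => if h ω = z then w ω else 0) f g := by
  simp only [cent_eq_sum]
  rw [Finset.sum_comm]
  refine Finset.sum_congr rfl fun ω _ => ?_
  rw [Finset.sum_eq_single (h ω)]
  · rw [if_pos rfl, mass_restrict, mass_restrict, mass_congr (f := fun ω => ((f ω, g ω), h ω))
      (g := fun ω => (f ω, (g ω, h ω)))]
    intro ω'; simp only [Prod.mk.injEq]; tauto
  · intro z _ hz
    rw [if_neg (Ne.symm hz), zero_mul]
  · intro hh; exact absurd (ht ω) hh

/-- The product weight. -/
def wprod (w₁ : Ω₁ → ℝ) (w₂ : Ω₂ → ℝ) (ω : Ω₁ × Ω₂) : ℝ := w₁ ω.1 * w₂ ω.2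

lemma wprod_nonneg {w₁ : Ω₁ → ℝ} {w₂ : Ω₂ → ℝ} (h₁ : ∀ ω, 0 ≤ w₁ ω) (h₂ : ∀ ω, 0 ≤ w₂ ω)
    (ω : Ω₁ × Ω₂) : 0 ≤ wprod w₁ w₂ ω := mul_nonneg (h₁ _) (h₂ _)

lemma sum_wprod_mul (w₁ : Ω₁ → ℝ) (w₂ : Ω₂ → ℝ) (F : Ω₁ × Ω₂ → ℝ) :
    ∑ ω, wprod w₁ w₂ ω * F ω = ∑ ω₁, w₁ ω₁ * ∑ ω₂, w₂ ω₂ * F (ω₁, ω₂) := by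
  rw [Fintype.sum_prod_type]
  simp only [wprod, Finset.mul_sum, mul_assoc]

lemma sum_wprod (w₁ : Ω₁ → ℝ) (w₂ : Ω₂ → ℝ) :
    ∑ ω, wprod w₁ w₂ ω = (∑ ω₁, w₁ ω₁) * ∑ ω₂, w₂ ω₂ := by
  have := sum_wprod_mul w₁ w₂ (fun _ => 1)
  simp only [mul_one] at this
  rw [this, Finset.sum_mul]

lemma isPush_fst (w₁ : Ω₁ → ℝ) {w₂ : Ω₂ → ℝ} (h : ∑ ω, w₂ ω = 1) :
    IsPush Prod.fst (wprod w₁ w₂) w₁ := by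
  classical
  intro ω'
  rw [Fintype.sum_prod_type]
  simp only [wprod]
  rw [Finset.sum_eq_single ω']
  · simp [← Finset.mul_sum, h]
  · intro b _ hb; simp [hb]
  · simp

lemma isPush_snd {w₁ : Ω₁ → ℝ} (w₂ : Ω₂ → ℝ) (h : ∑ ω, w₁ ω = 1) :
    IsPush Prod.snd (wprod w₁ w₂) w₂ := by
  classical
  intro ω'
  rw [Fintype.sum_prod_type_right]
  simp only [wprod]
  rw [Finset.sum_eq_single ω']
  · simp [← Finset.sum_mul, h]
  · intro b _ hb; simp [hb]
  · simp

lemma mass_wprod (w₁ : Ω₁ → ℝ) (w₂ : Ω₂ → ℝ) (F : Ω₁ → Ω₂ → α) (ω : Ω₁ × Ω₂) :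
    mass (wprod w₁ w₂) (fun ω => (F ω.1 ω.2, ω.1)) ω = w₁ ω.1 * mass w₂ (F ω.1) ω.2 := by
  classical
  have := sum_wprod_mul w₁ w₂ (fun ω' => if (F ω'.1 ω'.2, ω'.1) = (F ω.1 ω.2, ω.1) then 1 else 0)
  simp only [mul_ite, mul_one, mul_zero] at this
  have e : mass (wprod w₁ w₂) (fun ω => (F ω.1 ω.2, ω.1)) ω = ∑ ω', if (F ω'.1 ω'.2, ω'.1) =
      (F ω.1 ω.2, ω.1) then wprod w₁ w₂ ω' else 0 := by unfold mass; congr!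
  rw [e, this, Finset.sum_eq_single ω.1]
  · unfold mass; simp
  · intro b _ hb; simp [hb]
  · simp

/-- Entropy conditioned on the first coordinate of a product. -/
lemma cent_wprod {w₁ : Ω₁ → ℝ} {w₂ : Ω₂ → ℝ} (h₁ : ∀ ω, 0 ≤ w₁ ω) (h₂ : ∀ ω, 0 ≤ w₂ ω)
    (F : Ω₁ → Ω₂ → α) (G : Ω₁ → Ω₂ → β) :
    cent (wprod w₁ w₂) (fun ω => F ω.1 ω.2) (fun ω => (G ω.1 ω.2, ω.1)) =
      ∑ ω₁, w₁ ω₁ * cent w₂ (F ω₁) (G ω₁) := by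
  simp only [cent_eq_sum]
  rw [sum_wprod_mul]
  refine Finset.sum_congr rfl fun ω₁ _ => ?_
  rcases (h₁ ω₁).eq_or_lt with h | h
  · simp [← h]
  congr 1
  refine Finset.sum_congr rfl fun ω₂ _ => ?_
  rcases (h₂ ω₂).eq_or_lt with h' | h'
  · simp [← h']
  rw [mass_wprod, mass_congr (f := fun ω : Ω₁ × Ω₂ => (F ω.1 ω.2, (G ω.1 ω.2, ω.1)))
    (g := fun ω => ((F ω.1 ω.2, G ω.1 ω.2), ω.1)) (fun ω' => by simp only [Prod.mk.injEq]; tauto),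
    mass_wprod w₁ w₂ (fun a b => (F a b, G a b)),
    Real.log_mul h.ne' (mass_pos h₂ _ h').ne', Real.log_mul h.ne' (mass_pos h₂ _ h').ne']
  ring

/-- Averaging does not increase conditional entropy. -/
lemma sum_cent_le {w₁ : Ω₁ → ℝ} {w₂ : Ω₂ → ℝ} (h₁ : ∀ ω, 0 ≤ w₁ ω) (h₂ : ∀ ω, 0 ≤ w₂ ω)
    (F : Ω₁ → Ω₂ → α) (G : Ω₁ → Ω₂ → β) :
    ∑ ω₁, w₁ ω₁ * cent w₂ (F ω₁) (G ω₁) ≤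
      cent (wprod w₁ w₂) (fun ω => F ω.1 ω.2) (fun ω => G ω.1 ω.2) := by
  rw [← cent_wprod h₁ h₂]
  exact cent_anti (wprod_nonneg h₁ h₂) _ fun _ _ h => (Prod.mk.inj h).1

/-- Independence. -/
lemma cent_wprod_snd {w₁ : Ω₁ → ℝ} {w₂ : Ω₂ → ℝ} (h₁ : ∀ ω, 0 ≤ w₁ ω) (h₂ : ∀ ω, 0 ≤ w₂ ω)
    (f : Ω₂ → α) (g : Ω₂ → β) :
    cent (wprod w₁ w₂) (fun ω => f ω.2) (fun ω => (g ω.2, ω.1)) =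
      (∑ ω₁, w₁ ω₁) * cent w₂ f g := by
  rw [cent_wprod h₁ h₂ (fun _ => f) (fun _ => g), Finset.sum_mul]

lemma ent_ge_of_mass_le (hw : ∀ ω, 0 ≤ w ω) (f : Ω → α) {W M : ℝ} (hW : ∑ ω, w ω = W)
    (hM : ∀ ω, 0 < w ω → mass w f ω ≤ M) : W * (Real.log W - Real.log M) ≤ ent w f := by
  rw [ent_eq_sum, hW]
  nth_rewrite 1 [← hW]
  rw [Finset.sum_mul]
  refine Finset.sum_le_sum fun ω _ => ?_
  rcases (hw ω).eq_or_lt with h | h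
  · simp [← h]
  exact mul_le_mul_of_nonneg_left (by
    have := Real.log_le_log (mass_pos hw f h) (hM ω h); linarith) h.le

lemma ent_gibbs (hw : ∀ ω, 0 ≤ w ω) (f : Ω → α) (q : α → ℝ) (hq0 : ∀ a, 0 ≤ q a)
    (hq : ∀ ω, 0 < w ω → 0 < q (f ω)) (hs : ∀ s : Finset α, ∑ a ∈ s, q a ≤ 1) :
    ent w f ≤ ∑ ω, w ω * -Real.log (q (f ω)) :=
  cent_gibbs hw f (fun _ => ()) (fun a _ => q a) (fun a _ => hq0 a) hq (fun _ => hs _)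

open Classical in
lemma cent_decide (w : Ω → ℝ) (f : Ω → α) (g : Ω → β) (P : Ω → Prop) :
    cent w f (fun ω => (g ω, decide (P ω))) = cent (fun ω => if P ω then w ω else 0) f g
      + cent (fun ω => if P ω then 0 else w ω) f g := by
  rw [cent_fiber w f g (fun ω => decide (P ω)) Finset.univ (fun _ => Finset.mem_univ _),
    Fintype.sum_bool]
  congr 2
  · ext ω; by_cases h : P ω <;> simp [h]
  · ext ω; by_cases h : P ω <;> simp [h]

open Classical in
/-- Splitting a weight into the parts where a predicate holds or fails. -/
lemma cent_le_split (hw : ∀ ω, 0 ≤ w ω) (f : Ω → α) (g : Ω → β) (P : Ω → Prop) :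
    cent w f g ≤ (∑ ω, w ω) * Real.log 2 + cent (fun ω => if P ω then w ω else 0) f g
      + cent (fun ω => if P ω then 0 else w ω) f g := by
  have h1 := cent_le_add_right hw f g (fun ω => (g ω, decide (P ω)))
  have h2 := cent_decide w f g P
  have h3 : cent w (fun ω => (g ω, decide (P ω))) g ≤ (∑ ω, w ω) * Real.log 2 := by
    have h4 := cent_le_log_of_maps hw (fun ω => (g ω, decide (P ω))) g (M := 2)
      (fun _ a => if a.2 then 1 else 0) (fun ω => by dsimp only; split_ifs <;> norm_num)
      (fun ω ω' h h' => by
        simp only [Prod.mk.injEq]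
        refine ⟨h, ?_⟩
        by_cases a : P ω <;> by_cases b : P ω' <;> simp_all)
    exact_mod_cast h4
  linarith

end Entropy
end SelfConformal

namespace SelfConformal

section Pi

variable {Ω Ω' : Type*} [Fintype Ω'] [Fintype Ω]

/-- The product weight on `Fin k → Ω`. -/
def wpi (w : Ω → ℝ) (k : ℕ) (x : Fin k → Ω) : ℝ := ∏ l, w (x l)

lemma wpi_nonneg {w : Ω → ℝ} (hw : ∀ ω, 0 ≤ w ω) (k : ℕ) (x : Fin k → Ω) : 0 ≤ wpi w k x :=
  Finset.prod_nonneg fun _ _ => hw _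

lemma wpi_cons (w : Ω → ℝ) (k : ℕ) (a : Ω) (x : Fin k → Ω) :
    wpi w (k + 1) (Fin.cons a x : Fin (k + 1) → Ω) = w a * wpi w k x := by
  simp [wpi, Fin.prod_univ_succ]

lemma sum_pi_succ (k : ℕ) (F : (Fin (k + 1) → Ω) → ℝ) :
    ∑ x, F x = ∑ a, ∑ y : Fin k → Ω, F (Fin.cons a y) := by
  rw [← Fintype.sum_prod_type']
  exact (Fintype.sum_equiv (Fin.consEquiv fun _ => Ω) _ _ fun _ => rfl).symm

lemma isPush_cons (w : Ω → ℝ) (k : ℕ) :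
    IsPush (fun x : Ω × (Fin k → Ω) => (Fin.cons x.1 x.2 : Fin (k + 1) → Ω))
      (wprod w (wpi w k)) (wpi w (k + 1)) :=
  isPush_equiv (Fin.consEquiv fun _ => Ω) fun ω => (wpi_cons w k ω.1 ω.2).symm

lemma sum_wpi {w : Ω → ℝ} (hw : ∑ ω, w ω = 1) (k : ℕ) : ∑ x, wpi w k x = 1 := by
  induction k with
  | zero => simp [wpi]
  | succ k ih => rw [← (isPush_cons w k).total, sum_wprod, hw, ih, one_mul]

lemma IsPush.pi {T : Ω → Ω'} {w : Ω → ℝ} {w' : Ω' → ℝ} (h : IsPush T w w') (k : ℕ) :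
    IsPush (fun x : Fin k → Ω => fun l => T (x l)) (wpi w k) (wpi w' k) := by
  classical
  intro y
  simp only [wpi, h _]
  rw [Finset.prod_univ_sum, Fintype.piFinset_univ]
  refine Finset.sum_congr rfl fun x _ => ?_
  by_cases hx : (fun l => T (x l)) = y
  · rw [if_pos hx]
    exact Finset.prod_congr rfl fun l _ => by rw [← hx, if_pos rfl]
  · rw [if_neg hx]
    obtain ⟨l, hl⟩ := Function.ne_iff.1 hx
    exact Finset.prod_eq_zero (Finset.mem_univ l) (if_neg hl)

lemma sum_wpi_mul_sum {w : Ω → ℝ} (hw : ∑ ω, w ω = 1) (G : Ω → ℝ) (k : ℕ) :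
    ∑ x, wpi w k x * ∑ l, G (x l) = k * ∑ ω, w ω * G ω := by
  induction k with
  | zero => simp
  | succ k ih =>
    rw [← (isPush_cons w k).sum, sum_wprod_mul]
    simp only [Fin.sum_univ_succ, Fin.cons_zero, Fin.cons_succ, mul_add, Finset.sum_add_distrib, ih,
      ← Finset.sum_mul, sum_wpi hw, hw]
    push_cast; ring_nf

end Pi

section Growth

variable {Ω Ω₁ Ω₂ Ω₃ : Type*} [Fintype Ω] [Fintype Ω₁] [Fintype Ω₂] [Fintype Ω₃]

lemma ent_add_left {w₁ : Ω₁ → ℝ} {w₂ : Ω₂ → ℝ} (h₁ : ∀ ω, 0 ≤ w₁ ω) (h₂ : ∀ ω, 0 ≤ w₂ ω)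
    (s₁ : ∑ ω, w₁ ω = 1) (s₂ : ∑ ω, w₂ ω = 1) (a : Ω₁ → ℤ) (b : Ω₂ → ℤ) :
    ent (wprod w₁ w₂) (fun ω => a ω.1 + b ω.2) - ent w₂ b =
      ent w₁ a - cent (wprod w₁ w₂) (fun ω => a ω.1) (fun ω => a ω.1 + b ω.2) := by
  have e1 := ent_pair (wprod w₁ w₂) (fun ω => a ω.1) (fun ω => a ω.1 + b ω.2)
  have e2 := ent_pair (wprod w₁ w₂) (fun ω => b ω.2) (fun ω => a ω.1)
  have e3 : ent (wprod w₁ w₂) (fun ω => (a ω.1, a ω.1 + b ω.2)) =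
      ent (wprod w₁ w₂) (fun ω => (b ω.2, a ω.1)) := by
    refine cent_congr (fun _ _ => Iff.rfl) fun ω ω' _ => ?_
    simp only [Prod.mk.injEq]; constructor <;> rintro ⟨h, h'⟩ <;> constructor <;> omega
  have e4 := (isPush_fst w₁ s₂).ent a
  have e5 : cent (wprod w₁ w₂) (fun ω => b ω.2) (fun ω => a ω.1) = ent w₂ b := by
    refine le_antisymm ((cent_le_ent (wprod_nonneg h₁ h₂) _ _).trans
      (le_of_eq ((isPush_snd w₂ s₁).ent b))) ?_
    have h3 := cent_wprod_snd h₁ h₂ b (fun _ => ())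
    rw [s₁, one_mul] at h3
    rw [ent, ← h3]
    exact cent_anti (wprod_nonneg h₁ h₂) _ fun ω ω' h => by rw [(Prod.mk.inj h).2]
  linarith

/-- Adding an independent variable decreases entropy increments. -/
lemma ent_add_increment_le {w₁ : Ω₁ → ℝ} {w₂ : Ω₂ → ℝ} {w₃ : Ω₃ → ℝ} (h₁ : ∀ ω, 0 ≤ w₁ ω)
    (h₂ : ∀ ω, 0 ≤ w₂ ω) (h₃ : ∀ ω, 0 ≤ w₃ ω) (s₁ : ∑ ω, w₁ ω = 1) (s₂ : ∑ ω, w₂ ω = 1)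
    (s₃ : ∑ ω, w₃ ω = 1) (a : Ω₁ → ℤ) (b : Ω₂ → ℤ) (c : Ω₃ → ℤ) :
    ent (wprod w₁ (wprod w₃ w₂)) (fun ω => a ω.1 + (c ω.2.1 + b ω.2.2)) -
      ent (wprod w₃ w₂) (fun ω => c ω.1 + b ω.2) ≤
    ent (wprod w₁ w₂) (fun ω => a ω.1 + b ω.2) - ent w₂ b := by
  have s : ∑ ω, wprod w₃ w₂ ω = 1 := by rw [sum_wprod, s₂, s₃, one_mul]
  rw [ent_add_left h₁ (wprod_nonneg h₃ h₂) s₁ s a (fun ω => c ω.1 + b ω.2),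
    ent_add_left h₁ h₂ s₁ s₂]
  have hn := wprod_nonneg h₁ (wprod_nonneg h₃ h₂)
  have key : cent (wprod w₁ (wprod w₃ w₂)) (fun ω => a ω.1) (fun ω => (a ω.1 + b ω.2.2, ω.2.1)) =
      cent (wprod w₁ w₂) (fun ω => a ω.1) (fun ω => a ω.1 + b ω.2) := by
    let e : Ω₁ × (Ω₃ × Ω₂) ≃ Ω₃ × (Ω₁ × Ω₂) :=
      ⟨fun x => (x.2.1, (x.1, x.2.2)), fun x => (x.2.1, (x.1, x.2.2)), fun _ => rfl, fun _ => rfl⟩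
    have he : IsPush e (wprod w₁ (wprod w₃ w₂)) (wprod w₃ (wprod w₁ w₂)) :=
      isPush_equiv e fun ω => by simp only [wprod, e, Equiv.coe_fn_mk]; ring
    rw [show cent (wprod w₁ (wprod w₃ w₂)) (fun ω => a ω.1)
      (fun ω => (a ω.1 + b ω.2.2, ω.2.1)) = _ from
      he.cent (fun ω => a ω.2.1) (fun ω => (a ω.2.1 + b ω.2.2, ω.1)),
      cent_wprod_snd h₃ (wprod_nonneg h₁ h₂) (fun ω => a ω.1) (fun ω => a ω.1 + b ω.2), s₃, one_mul]
  have := cent_anti hn (fun ω => a ω.1) (g := fun ω => a ω.1 + (c ω.2.1 + b ω.2.2))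
    (g' := fun ω => (a ω.1 + b ω.2.2, ω.2.1)) (fun ω ω' h => by
      obtain ⟨h1, h2⟩ := Prod.mk.inj h
      rw [h2]; omega)
  linarith

/-- The Kaimanovich–Vershik inequality for sums of independent integer variables. -/
lemma ent_sum_le {w₁ : Ω₁ → ℝ} {w₂ : Ω₂ → ℝ} (h₁ : ∀ ω, 0 ≤ w₁ ω)
    (h₂ : ∀ ω, 0 ≤ w₂ ω) (s₁ : ∑ ω, w₁ ω = 1) (s₂ : ∑ ω, w₂ ω = 1) (a : Ω₁ → ℤ) (b : Ω₂ → ℤ)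
    (k : ℕ) :
    ent (wprod (wpi w₁ k) w₂) (fun ω => ∑ l, a (ω.1 l) + b ω.2) - ent w₂ b ≤
      k * (ent (wprod w₁ w₂) (fun ω => a ω.1 + b ω.2) - ent w₂ b) := by
  induction k with
  | zero =>
    have := (isPush_snd w₂ (sum_wpi s₁ 0)).ent b
    simp [this]
  | succ k ih =>
    let T : Ω₁ × ((Fin k → Ω₁) × Ω₂) ≃ (Fin (k + 1) → Ω₁) × Ω₂ :=
      (Equiv.prodAssoc _ _ _).symm.trans ((Fin.consEquiv fun _ => Ω₁).prodCongr (Equiv.refl _))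
    have hT : IsPush T (wprod w₁ (wprod (wpi w₁ k) w₂)) (wprod (wpi w₁ (k + 1)) w₂) := by
      refine isPush_equiv T fun ω => ?_
      have := wpi_cons w₁ k ω.1 ω.2.1
      change w₁ ω.1 * (wpi w₁ k ω.2.1 * w₂ ω.2.2) = wpi w₁ (k + 1) (Fin.cons ω.1 ω.2.1) * w₂ ω.2.2
      rw [this]; ring
    have h1 := ent_add_increment_le h₁ h₂ (wpi_nonneg h₁ k) s₁ s₂ (sum_wpi s₁ k) a b
      (fun x => ∑ l, a (x l))
    have h2 := hT.ent (fun ω => ∑ l, a (ω.1 l) + b ω.2)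
    rw [← h2]
    have h3 : (fun ω => ∑ l, a ((T ω).1 l) + b (T ω).2) =
        fun ω : Ω₁ × ((Fin k → Ω₁) × Ω₂) => a ω.1 + (∑ l, a (ω.2.1 l) + b ω.2.2) := by
      funext ω
      change ∑ l, a ((Fin.cons ω.1 ω.2.1 : Fin (k + 1) → Ω₁) l) + b ω.2.2 = _
      rw [Fin.sum_univ_succ]; simp [add_assoc]
    rw [h3]
    push_cast
    linarith

/-- The entropy of a natural number valued variable is controlled by its mean. -/
lemma ent_nat_le {w : Ω → ℝ} (hw : ∀ ω, 0 ≤ w ω) (N : Ω → ℕ) :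
    ent w N ≤ Real.log 2 * ∑ ω, w ω * (N ω + 1) := by
  have := ent_gibbs hw N (fun n => (1 / 2 : ℝ) / 2 ^ n) (fun _ => by positivity)
    (fun _ _ => by positivity) (fun s => by
      have h4 := (summable_geometric_two' (1 : ℝ)).sum_le_tsum s (fun _ _ => by positivity)
      rw [tsum_geometric_two'] at h4
      exact h4)
  refine this.trans (le_of_eq ?_)
  rw [Finset.mul_sum]
  refine Finset.sum_congr rfl fun ω _ => ?_
  rw [Real.log_div (by norm_num) (by positivity), Real.log_pow, one_div, Real.log_inv]
  ring

/-- An integer variable with bounded mean absolute deviation has bounded entropy. -/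
lemma ent_int_le_of_dev {w : Ω → ℝ} (hw : ∀ ω, 0 ≤ w ω) (t : Ω → ℤ) (t₀ : ℤ) :
    ent w t ≤ Real.log 2 * ∑ ω, w ω * ((|t ω - t₀| : ℤ) + 2) := by
  have h1 := ent_le_add hw t (fun ω => (t ω - t₀).natAbs)
  have h2 := ent_nat_le hw (fun ω => (t ω - t₀).natAbs)
  have h3 := cent_le_log_of_maps hw t (fun ω => (t ω - t₀).natAbs) (M := 2)
    (fun _ a => if a ≥ t₀ then 1 else 0) (fun ω => by split_ifs <;> norm_num)
    (fun ω ω' h h' => by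
      split_ifs at h' <;> omega)
  have h4 : Real.log 2 * ∑ ω, w ω * ((|t ω - t₀| : ℤ) + 2) =
      Real.log 2 * (∑ ω, w ω * (((t ω - t₀).natAbs : ℝ) + 1)) + (∑ ω, w ω) * Real.log 2 := by
    have : ∀ ω, (((t ω - t₀).natAbs : ℝ)) = ((|t ω - t₀| : ℤ) : ℝ) := fun ω => by
      rw [← Int.natCast_natAbs]; simp
    simp only [this, mul_add, Finset.sum_add_distrib, mul_one, ← Finset.sum_mul]; ring
  rw [h4]
  push_cast at h3
  linarith

end Growth
end SelfConformal

namespace SelfConformal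

lemma floor_intCast_div (a : ℤ) {lam : ℤ} (hl : 0 < lam) : ⌊(a : ℝ) / lam⌋ = a / lam := by
  have hl' : (0 : ℝ) < lam := by exact_mod_cast hl
  have e1 := Int.emod_nonneg a hl.ne'
  have e2 := Int.emod_lt_of_pos a hl
  have e3 := Int.emod_add_mul_ediv a lam
  rw [Int.floor_eq_iff, le_div_iff₀ hl', div_lt_iff₀ hl']
  constructor
  · have : a / lam * lam ≤ a := by linarith [mul_comm lam (a / lam)]
    exact_mod_cast this
  · have : a < (a / lam + 1) * lam := by linarith [mul_comm lam (a / lam)]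
    exact_mod_cast this

/-- The fair coin weight. -/
def wcoin (_ : Bool) : ℝ := 1 / 2

lemma wcoin_nonneg (e : Bool) : 0 ≤ wcoin e := by norm_num [wcoin]

lemma sum_wcoin : ∑ e, wcoin e = 1 := by norm_num [wcoin]

lemma wpi_wcoin (k : ℕ) (x : Fin k → Bool) : wpi wcoin k x = (1 / 2) ^ k := by
  simp [wpi, wcoin]

lemma coin_variance (k : ℕ) (c : ℝ) (d : Fin k → ℝ) :
    ∑ e, wpi wcoin k e * (c + ∑ l, (if e l then 1 / 2 else -1 / 2) * d l) ^ 2 =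
      c ^ 2 + 1 / 4 * ∑ l, d l ^ 2 := by
  induction k generalizing c with
  | zero => simp [wpi]
  | succ k ih =>
    rw [sum_pi_succ, Fintype.sum_bool]
    simp only [wpi_cons, Fin.sum_univ_succ, Fin.cons_zero, Fin.cons_succ, if_true, mul_assoc,
      ← Finset.mul_sum, ← add_assoc]
    rw [ih, ih]
    simp only [wcoin, Bool.false_eq_true, if_false]; ring

lemma centralBinom_sq_le (m : ℕ) : m.centralBinom ^ 2 * (2 * m + 1) ≤ 4 ^ (2 * m) := by
  induction m with
  | zero => simp
  | succ m ih =>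
    have h := Nat.succ_mul_centralBinom_succ m
    have h2 : (m + 1) ^ 2 * ((m + 1).centralBinom ^ 2 * (2 * (m + 1) + 1)) ≤
        (m + 1) ^ 2 * 4 ^ (2 * (m + 1)) := by
      calc _ = ((m + 1) * (m + 1).centralBinom) ^ 2 * (2 * m + 3) := by ring
        _ = (4 * ((2 * m + 1) * (2 * m + 3))) * (m.centralBinom ^ 2 * (2 * m + 1)) := by
            rw [h]; ring
        _ ≤ (4 * (4 * (m + 1) ^ 2)) * 4 ^ (2 * m) := by
            have h3 : (2 * m + 1) * (2 * m + 3) ≤ 4 * (m + 1) ^ 2 := by nlinarith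
            gcongr
        _ = _ := by ring
    exact Nat.le_of_mul_le_mul_left h2 (by positivity)

lemma choose_half_sq_le (n : ℕ) : (n.choose (n / 2)) ^ 2 * n ≤ 4 ^ n := by
  rcases Nat.even_or_odd' n with ⟨m, rfl | rfl⟩
  · have h := centralBinom_sq_le m
    rw [Nat.centralBinom] at h
    rw [Nat.mul_div_cancel_left m (by norm_num)]
    nlinarith [Nat.zero_le ((2 * m).choose m ^ 2)]
  · have h := centralBinom_sq_le (m + 1)
    rw [show (2 * m + 1) / 2 = m by omega]
    have h2 : (m + 1).centralBinom = 2 * (2 * m + 1).choose m := by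
      rw [Nat.centralBinom, show 2 * (m + 1) = (2 * m + 1) + 1 by ring, Nat.choose_succ_succ,
        Nat.choose_symm_half]; ring
    rw [h2, show 2 * (m + 1) = 2 * m + 1 + 1 by ring, pow_succ 4] at h
    nlinarith [Nat.zero_le ((2 * m + 1).choose m ^ 2)]

open Classical in
/-- The Littlewood–Offord–Erdős bound. -/
lemma littlewood_offord (k : ℕ) (d : Fin k → ℤ) (lam c x : ℤ) (hlam : 0 < lam) :
    let n := (Finset.univ.filter fun l => lam ≤ |d l|).card
    (Finset.univ.filter fun e : Fin k → Bool => (c + ∑ l, if e l then d l else 0) / lam = x).card ≤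
      n.choose (n / 2) * 2 ^ (k - n) := by
  intro n
  let G : Finset (Fin k) := Finset.univ.filter fun l => lam ≤ |d l|
  let S : Finset (Fin k → Bool) := Finset.univ.filter
    fun e : Fin k → Bool => (c + ∑ l, if e l then d l else 0) / lam = x
  let r : (Fin k → Bool) → ({l // l ∉ G} → Bool) := fun e l => e l
  have h1 := Finset.card_le_mul_card_image (f := r) S (n.choose (n / 2)) ?_
  · refine h1.trans (Nat.mul_le_mul_left _ ((Finset.card_le_univ _).trans (le_of_eq ?_)))
    rw [Fintype.card_fun, Fintype.card_bool]
    congr 1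
    have : Fintype.card {l // l ∉ G} = Fintype.card (Fin k) - Fintype.card {l // l ∈ G} :=
      Fintype.card_subtype_compl _
    rw [this, Fintype.card_coe, Fintype.card_fin]
  intro ρ _
  let A : (Fin k → Bool) → Finset {l // l ∈ G} :=
    fun e => Finset.univ.filter fun l => e l = decide (0 < d l)
  have hA : ∀ e e' : Fin k → Bool, r e = ρ → r e' = ρ → ∀ l, e l ≠ e' l → l ∈ G := by
    intro e e' he he' l hl
    by_contra hG
    exact hl ((congrFun he ⟨l, hG⟩).trans (congrFun he' ⟨l, hG⟩).symm)
  have hinj : ∀ e ∈ S.filter (fun e => r e = ρ), ∀ e' ∈ S.filter (fun e => r e = ρ),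
      A e = A e' → e = e' := by
    intro e he e' he' hh
    funext l
    by_contra hl
    have hG := hA e e' (Finset.mem_filter.1 he).2 (Finset.mem_filter.1 he').2 l hl
    have h2 : (⟨l, hG⟩ : {l // l ∈ G}) ∈ A e ↔ (⟨l, hG⟩ : {l // l ∈ G}) ∈ A e' := by rw [hh]
    simp only [A, Finset.mem_filter, Finset.mem_univ, true_and] at h2
    cases h3 : e l <;> cases h4 : e' l <;> cases h5 : decide (0 < d l) <;> simp_all
  have hanti : IsAntichain (· ⊆ ·) ((S.filter (fun e => r e = ρ)).image A :
      Set (Finset {l // l ∈ G})) := by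
    intro a ha b hb hab hsub
    simp only [Finset.coe_image, Set.mem_image, Finset.mem_coe] at ha hb
    obtain ⟨e, he, rfl⟩ := ha
    obtain ⟨e', he', rfl⟩ := hb
    have hr := (Finset.mem_filter.1 he).2
    have hr' := (Finset.mem_filter.1 he').2
    have hx := (Finset.mem_filter.1 (Finset.mem_filter.1 he).1).2
    have hx' := (Finset.mem_filter.1 (Finset.mem_filter.1 he').1).2
    have hne : e ≠ e' := fun h => hab (by rw [h])
    obtain ⟨l₀, hl₀⟩ := Function.ne_iff.1 hne
    have hterm : ∀ l, e l ≠ e' l →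
        (if e' l then d l else 0) - (if e l then d l else 0) = |d l| := by
      intro l hl
      have hG := hA e e' hr hr' l hl
      have hm : (⟨l, hG⟩ : {l // l ∈ G}) ∈ A e → (⟨l, hG⟩ : {l // l ∈ G}) ∈ A e' :=
        fun h => hsub h
      simp only [A, Finset.mem_filter, Finset.mem_univ, true_and] at hm
      by_cases h5 : 0 < d l
      · rw [abs_of_pos h5]
        cases h3 : e l <;> cases h4 : e' l <;> simp_all
      · rw [abs_of_nonpos (not_lt.1 h5)]
        cases h3 : e l <;> cases h4 : e' l <;> simp_all
    have hge : lam ≤ ∑ l, ((if e' l then d l else 0) - (if e l then d l else 0)) := by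
      have h6 : ∀ l ∈ Finset.univ, 0 ≤ (if e' l then d l else 0) - (if e l then d l else 0) := by
        intro l _
        by_cases hl : e l = e' l
        · rw [hl]; simp
        · rw [hterm l hl]; exact abs_nonneg _
      have h7 := Finset.single_le_sum h6 (Finset.mem_univ l₀)
      rw [hterm l₀ hl₀] at h7
      exact (Finset.mem_filter.1 (hA e e' hr hr' l₀ hl₀)).2.trans h7
    rw [Finset.sum_sub_distrib] at hge
    have e1 := Int.emod_nonneg (c + ∑ l, if e l then d l else 0) hlam.ne'
    have e2 := Int.emod_lt_of_pos (c + ∑ l, if e' l then d l else 0) hlam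
    have e3 := Int.emod_add_mul_ediv (c + ∑ l, if e l then d l else 0) lam
    have e4 := Int.emod_add_mul_ediv (c + ∑ l, if e' l then d l else 0) lam
    rw [hx] at e3; rw [hx'] at e4
    omega
  have h8 := hanti.sperner
  rw [Finset.card_image_of_injOn (fun e he e' he' => hinj e he e' he')] at h8
  rwa [Fintype.card_coe] at h8

open Classical in
lemma coin_ent_ge (k : ℕ) (d : Fin k → ℤ) (lam c : ℤ) (hlam : 0 < lam) {n : ℕ}
    (hn : n = (Finset.univ.filter fun l => lam ≤ |d l|).card) (hn0 : 0 < n) :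
    1 / 2 * Real.log n ≤
      ent (wpi wcoin k) (fun e => (c + ∑ l, if e l then d l else 0) / lam) := by
  have hnk : n ≤ k := by rw [hn]; exact (Finset.card_le_univ _).trans (by simp)
  have hchoose : ((n.choose (n / 2) : ℝ)) ^ 2 * n ≤ 4 ^ n := by
    exact_mod_cast choose_half_sq_le n
  have hcp : 0 < (n.choose (n / 2) : ℝ) := by exact_mod_cast Nat.choose_pos (Nat.div_le_self _ _)
  have hn0' : 0 < (n : ℝ) := by exact_mod_cast hn0
  have key := ent_ge_of_mass_le (wpi_nonneg wcoin_nonneg k)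
    (fun e => (c + ∑ l, if e l then d l else 0) / lam) (sum_wpi sum_wcoin k)
    (M := n.choose (n / 2) / 2 ^ n) (fun e _ => by
      unfold mass
      simp only [wpi_wcoin]
      rw [← Finset.sum_filter, Finset.sum_const, nsmul_eq_mul]
      have := littlewood_offord k d lam c ((c + ∑ l, if e l then d l else 0) / lam) hlam
      simp only [← hn] at this
      have h2 : ((Finset.univ.filter fun e' : Fin k → Bool => (c + ∑ l, if e' l then d l else 0) / lam
        = (c + ∑ l, if e l then d l else 0) / lam).card : ℝ) ≤ n.choose (n / 2) * 2 ^ (k - n) := by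
        exact_mod_cast this
      calc _ ≤ (n.choose (n / 2) * 2 ^ (k - n) : ℝ) * (1 / 2) ^ k := by gcongr
        _ = _ := by
          rw [eq_div_iff (by positivity), mul_assoc, mul_assoc, mul_comm ((1 / 2 : ℝ) ^ k),
            ← mul_assoc, ← mul_assoc, mul_assoc _ _ ((2 : ℝ) ^ n), ← pow_add,
            Nat.sub_add_cancel hnk]
          simp)
  refine le_trans ?_ key
  rw [Real.log_one, one_mul, zero_sub, Real.log_div hcp.ne' (by positivity), Real.log_pow]
  have := Real.log_le_log (by positivity) hchoose
  rw [Real.log_mul (by positivity) (by positivity), Real.log_pow, Real.log_pow,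
    show (4 : ℝ) = 2 ^ 2 by norm_num, Real.log_pow] at this
  push_cast at this
  linarith

/-- The coarse scale entropy of a sum of independent bits with bounded coefficients. -/
lemma coin_ent_le (k : ℕ) (d : Fin k → ℤ) {lam : ℤ} (hlam : 0 < lam)
    (hd : ∑ l, (d l : ℝ) ^ 2 ≤ (lam : ℝ) ^ 2) :
    ent (wpi wcoin k) (fun e => (∑ l, if e l then d l else 0) / lam) ≤ 6 * Real.log 2 := by
  have hl : (0 : ℝ) < lam := by exact_mod_cast hlam
  have h1 := ent_int_le_of_dev (wpi_nonneg wcoin_nonneg k)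
    (fun e => (∑ l, if e l then d l else 0) / lam) ⌊(∑ l, (d l : ℝ)) / 2 / lam⌋
  have hv := coin_variance k 0 (fun l => (d l : ℝ))
  have h2 : ∀ e : Fin k → Bool, ((|(∑ l, if e l then d l else 0) / lam -
      ⌊(∑ l, (d l : ℝ)) / 2 / lam⌋| : ℤ) : ℝ) + 2 ≤
      4 + (0 + ∑ l, (if e l then 1 / 2 else -1 / 2) * (d l : ℝ)) ^ 2 / (lam : ℝ) ^ 2 := by
    intro e
    set y : ℝ := (∑ l, (d l : ℝ)) / 2 / lam
    set z : ℝ := ((∑ l, if e l then d l else 0 : ℤ) : ℝ) / lam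
    have hz : (∑ l, if e l then d l else 0) / lam = ⌊z⌋ := by
      simp only [z]; rw [floor_intCast_div _ hlam]
    rw [hz]
    have hyz : z - y = (0 + ∑ l, (if e l then 1 / 2 else -1 / 2) * (d l : ℝ)) / lam := by
      simp only [z, y]
      rw [← sub_div, zero_add]
      congr 1
      push_cast
      rw [Finset.sum_div, ← Finset.sum_sub_distrib]
      refine Finset.sum_congr rfl fun l _ => ?_
      split_ifs <;> ring
    rw [← div_pow, ← hyz]
    push_cast
    have a1 := Int.floor_le z; have a2 := Int.lt_floor_add_one z
    have a3 := Int.floor_le y; have a4 := Int.lt_floor_add_one y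
    rcases abs_cases ((⌊z⌋ : ℝ) - ⌊y⌋) with ⟨h, -⟩ | ⟨h, -⟩ <;> rw [h] <;>
      nlinarith [sq_nonneg (z - y - 1 / 2), sq_nonneg (z - y + 1 / 2)]
  refine h1.trans ?_
  rw [mul_comm]
  gcongr
  calc _ ≤ ∑ e : Fin k → Bool, wpi wcoin k e * (4 + (0 + ∑ l, (if e l then 1 / 2 else -1 / 2) *
        (d l : ℝ)) ^ 2 / (lam : ℝ) ^ 2) :=
        Finset.sum_le_sum fun e _ => mul_le_mul_of_nonneg_left (h2 e) (wpi_nonneg wcoin_nonneg k e)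
    _ = 4 + (1 / 4 * ∑ l, (d l : ℝ) ^ 2) / (lam : ℝ) ^ 2 := by
        simp only [mul_add, ← mul_div_assoc, Finset.sum_add_distrib, ← Finset.sum_div, hv,
          ← Finset.sum_mul, sum_wpi sum_wcoin]
        norm_num
    _ ≤ 4 + 1 := by
        gcongr
        rw [div_le_one (by positivity)]
        nlinarith [Finset.sum_nonneg (s := Finset.univ) fun l _ => sq_nonneg (d l : ℝ)]
    _ ≤ 6 := by norm_num

end SelfConformal

namespace SelfConformal

section Push

variable {Ω Ω' Ω'' Ω₁ Ω₁' Ω₂ Ω₂' α β : Type*} [Fintype Ω] [Fintype Ω'] [Fintype Ω'']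
  [Fintype Ω₁] [Fintype Ω₁'] [Fintype Ω₂] [Fintype Ω₂']

lemma isPush_of_sum {T : Ω → Ω'} {w : Ω → ℝ} {w' : Ω' → ℝ}
    (h : ∀ F : Ω' → ℝ, ∑ ω, w ω * F (T ω) = ∑ ω', w' ω' * F ω') : IsPush T w w' := by
  classical
  intro ω'
  have := h (fun x => if x = ω' then 1 else 0)
  simp only [mul_ite, mul_one, mul_zero, Finset.sum_ite_eq', Finset.mem_univ, if_true] at this
  rw [← this]

lemma IsPush.comp {T : Ω → Ω'} {T' : Ω' → Ω''} {w : Ω → ℝ} {w' : Ω' → ℝ} {w'' : Ω'' → ℝ}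
    (h' : IsPush T' w' w'') (h : IsPush T w w') : IsPush (fun ω => T' (T ω)) w w'' :=
  isPush_of_sum fun F => by rw [h.sum (fun x => F (T' x)), h'.sum]

lemma isPush_id (w : Ω → ℝ) : IsPush (fun ω => ω) w w := isPush_of_sum fun _ => rfl

lemma IsPush.prod {T : Ω₁ → Ω₁'} {T' : Ω₂ → Ω₂'} {w₁ : Ω₁ → ℝ} {w₁' : Ω₁' → ℝ} {w₂ : Ω₂ → ℝ}
    {w₂' : Ω₂' → ℝ} (h : IsPush T w₁ w₁') (h' : IsPush T' w₂ w₂') :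
    IsPush (fun x : Ω₁ × Ω₂ => (T x.1, T' x.2)) (wprod w₁ w₂) (wprod w₁' w₂') :=
  isPush_of_sum fun F => by
    rw [sum_wprod_mul, sum_wprod_mul, ← h.sum]
    exact Finset.sum_congr rfl fun ω _ => by
      rw [← h'.sum]

lemma isPush_swap (w₁ : Ω₁ → ℝ) (w₂ : Ω₂ → ℝ) :
    IsPush (fun x : Ω₁ × Ω₂ => (x.2, x.1)) (wprod w₁ w₂) (wprod w₂ w₁) :=
  isPush_equiv (Equiv.prodComm Ω₁ Ω₂) fun ω => by simp [wprod, mul_comm]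

open Classical in
lemma isPush_subtype (w : Ω → ℝ) {P : Ω → Prop} (h : ∀ ω, ¬ P ω → w ω = 0) :
    IsPush (Subtype.val : {ω // P ω} → Ω) (fun x => w x) w :=
  isPush_of_sum fun F => by
    rw [← Fintype.sum_subtype_add_sum_subtype P (fun ω => w ω * F ω), left_eq_add]
    exact Finset.sum_eq_zero fun x _ => by rw [h _ x.2, zero_mul]

lemma cent_le_log_of_maps_supp {w : Ω → ℝ} (hw : ∀ ω, 0 ≤ w ω) (f : Ω → α) (g : Ω → β)
    {P : Ω → Prop} (hP : ∀ ω, ¬ P ω → w ω = 0) {M : ℕ}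
    (e : β → α → ℕ) (he : ∀ ω, P ω → e (g ω) (f ω) < M)
    (hinj : ∀ ω ω', P ω → P ω' → g ω = g ω' → e (g ω) (f ω) = e (g ω) (f ω') → f ω = f ω') :
    cent w f g ≤ (∑ ω, w ω) * Real.log M := by
  classical
  have h := isPush_subtype w hP
  rw [← h.cent f g, ← h.total]
  exact cent_le_log_of_maps (Ω := {ω // P ω}) (w := fun x => w x) (fun x => hw x)
    (fun x => f x) (fun x => g x) e (fun x : {ω // P ω} => he x x.2)
    (fun (x x' : {ω // P ω}) => hinj x x' x.2 x'.2)

lemma sum_cent_le_snd {w₁ : Ω₁ → ℝ} {w₂ : Ω₂ → ℝ} (h₁ : ∀ ω, 0 ≤ w₁ ω) (h₂ : ∀ ω, 0 ≤ w₂ ω)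
    (F : Ω₁ → Ω₂ → α) (G : Ω₂ → β) :
    ∑ ω₂, w₂ ω₂ * ent w₁ (fun ω₁ => F ω₁ ω₂) ≤
      cent (wprod w₁ w₂) (fun ω => F ω.1 ω.2) (fun ω => G ω.2) := by
  have h1 := (isPush_swap w₂ w₁).cent (fun ω => F ω.1 ω.2) (fun ω => G ω.2)
  rw [← h1]
  refine le_trans (le_of_eq ?_) (cent_anti (wprod_nonneg h₂ h₁) (fun ω => F ω.2 ω.1)
    (g' := fun ω : Ω₂ × Ω₁ => ((), ω.1)) (fun ω ω' h => by simp only [Prod.mk.injEq] at h; rw [h.2]))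
  rw [cent_wprod h₂ h₁ (fun b a => F a b) (fun _ _ => ())]
  rfl

end Push

section Coupling

variable {Ω Ω₁ Ω₂ α β : Type*} [Fintype Ω] [Fintype Ω₁] [Fintype Ω₂]

open Classical in
/-- Two copies of `w`, conditionally independent given `f`. -/
def wcoup (w : Ω → ℝ) (f : Ω → α) (x : Ω × Ω) : ℝ :=
  if f x.2 = f x.1 then w x.1 * w x.2 / mass w f x.1 else 0

variable {w : Ω → ℝ}

lemma wcoup_nonneg (hw : ∀ ω, 0 ≤ w ω) (f : Ω → α) (x : Ω × Ω) : 0 ≤ wcoup w f x := by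
  unfold wcoup; split_ifs
  · exact div_nonneg (mul_nonneg (hw _) (hw _)) (mass_nonneg hw _ _)
  · exact le_rfl

lemma sum_wcoup_right (hw : ∀ ω, 0 ≤ w ω) (f : Ω → α) (ω : Ω) : ∑ ω', wcoup w f (ω, ω') = w ω := by
  classical
  rcases (hw ω).eq_or_lt with h | h
  · simp [wcoup, ← h]
  have : ∀ ω', wcoup w f (ω, ω') = w ω / mass w f ω * (if f ω' = f ω then w ω' else 0) := by
    intro ω'; unfold wcoup; split_ifs
    · dsimp only; ring
    · simp
  simp only [this, ← Finset.mul_sum]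
  exact div_mul_cancel₀ _ (mass_pos hw f h).ne'

lemma wcoup_swap (f : Ω → α) (w : Ω → ℝ) (ω ω' : Ω) : wcoup w f (ω, ω') = wcoup w f (ω', ω) := by
  unfold wcoup
  by_cases h : f ω' = f ω
  · rw [if_pos h, if_pos h.symm, mass_eq_of_eq h, mul_comm (w ω)]
  · rw [if_neg h, if_neg (Ne.symm h)]

lemma isPush_wcoup_fst (hw : ∀ ω, 0 ≤ w ω) (f : Ω → α) : IsPush Prod.fst (wcoup w f) w := isPush_of_sum fun F => by
  rw [Fintype.sum_prod_type]
  simp only [← Finset.sum_mul, sum_wcoup_right hw]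

lemma isPush_wcoup_snd (hw : ∀ ω, 0 ≤ w ω) (f : Ω → α) : IsPush Prod.snd (wcoup w f) w := isPush_of_sum fun F => by
  rw [Fintype.sum_prod_type_right]
  simp only [wcoup_swap f w _, ← Finset.sum_mul, sum_wcoup_right hw]

lemma isPush_wcoup_choice (hw : ∀ ω, 0 ≤ w ω) (f : Ω → α) : IsPush (fun x : (Ω × Ω) × Bool => if x.2 then x.1.2 else x.1.1)
    (wprod (wcoup w f) wcoin) w := isPush_of_sum fun F => by
  rw [sum_wprod_mul]
  simp only [Fintype.sum_bool, wcoin, mul_add, Finset.sum_add_distrib, if_true,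
    Bool.false_eq_true, if_false]
  have h1 := (isPush_wcoup_fst hw f).sum F
  have h2 := (isPush_wcoup_snd hw f).sum F
  rw [← h1] at h2
  rw [← h1]
  have e : ∀ g : Ω × Ω → ℝ, ∑ x, wcoup w f x * (1 / 2 * g x) = 1 / 2 * ∑ x, wcoup w f x * g x := by
    intro g; rw [Finset.mul_sum]; exact Finset.sum_congr rfl fun x _ => by ring
  rw [e, e, h2]; ring

lemma cent_wcoup (hw : ∀ ω, 0 ≤ w ω) (f : Ω → α) (g : Ω → β) :
    cent (wcoup w f) (fun x => g x.1) (fun x => x.2) = cent w g f := by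
  classical
  have h1 := isPush_wcoup_fst hw f
  have hm1 : ∀ x : Ω × Ω, mass (wcoup w f) (fun x => x.2) x = w x.2 := by
    intro x
    rw [← sum_wcoup_right hw f x.2]
    simp only [mass, Fintype.sum_prod_type, Finset.sum_ite_eq', Finset.mem_univ, if_true]
    exact Finset.sum_congr rfl fun _ _ => wcoup_swap f w _ _
  have hm2 : ∀ x : Ω × Ω, wcoup w f x ≠ 0 → mass (wcoup w f) (fun x => (g x.1, x.2)) x =
      w x.2 / mass w f x.1 * mass w (fun ω => (g ω, f ω)) x.1 := by
    intro x hx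
    have hf : f x.2 = f x.1 := by
      by_contra h; exact hx (by simp [wcoup, h])
    have : mass (wcoup w f) (fun x => (g x.1, x.2)) x =
        ∑ ω, if g ω = g x.1 then wcoup w f (ω, x.2) else 0 := by
      simp only [mass, Fintype.sum_prod_type, Prod.mk.injEq]
      refine Finset.sum_congr rfl fun ω _ => ?_
      by_cases h : g ω = g x.1 <;> simp [h]
    rw [this, show mass w (fun ω => (g ω, f ω)) x.1 =
      ∑ ω, if (g ω, f ω) = (g x.1, f x.1) then w ω else 0 from by
        unfold mass; exact Finset.sum_congr rfl fun _ _ => by congr, Finset.mul_sum]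
    refine Finset.sum_congr rfl fun ω _ => ?_
    simp only [Prod.mk.injEq, wcoup]
    by_cases h : g ω = g x.1 <;> by_cases h' : f ω = f x.1
    · rw [if_pos h, if_pos (by rw [h', hf]), if_pos ⟨h, h'⟩, mass_eq_of_eq h']; ring
    · rw [if_pos h, if_neg (by rw [hf]; exact Ne.symm h'), if_neg (by tauto)]; simp
    · rw [if_neg h, if_neg (by tauto)]; simp
    · rw [if_neg h, if_neg (by tauto)]; simp
  rw [cent_eq_sum, cent_eq_sum, ← h1.sum]
  refine Finset.sum_congr rfl fun x _ => ?_
  by_cases hx : wcoup w f x = 0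
  · simp [hx]
  rw [hm1, hm2 x hx]
  have p1 : 0 < w x.1 := (hw _).lt_of_ne fun h => hx (by simp [wcoup, ← h])
  have p2 : 0 < w x.2 := (hw _).lt_of_ne fun h => hx (by simp [wcoup, ← h])
  have p3 := mass_pos hw f p1
  have p4 := mass_pos hw (fun ω => (g ω, f ω)) p1
  rw [Real.log_mul (by positivity) p4.ne', Real.log_div p2.ne' p3.ne']
  ring

/-- The probability that two copies in the same cell of size `D` are `lam`-separated. -/
def rho (w : Ω → ℝ) (a : Ω → ℤ) (D lam : ℤ) : ℝ :=
  ∑ x, wcoup w (fun ω => a ω / D) x * (if lam ≤ |a x.2 - a x.1| then 1 else 0)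

lemma cent_le_rho (hw : ∀ ω, 0 ≤ w ω) (h1 : ∑ ω, w ω = 1) (a : Ω → ℤ) {D lam : ℤ} {s : ℕ} (hlam : 0 < lam)
    (hD : D = lam * 2 ^ s) : cent w (fun ω => a ω / lam) (fun ω => a ω / D) ≤
      Real.log 6 + rho w a D lam * (s * Real.log 2) := by
  classical
  set W := wcoup w (fun ω => a ω / D) with hW
  have hW0 : ∀ x, 0 ≤ W x := wcoup_nonneg hw _
  have hW1 : ∑ x, W x = 1 := (isPush_wcoup_fst hw _).total.trans h1
  have hsupp : ∀ x : Ω × Ω, ¬ a x.2 / D = a x.1 / D → W x = 0 := fun x h => by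
    simp [hW, wcoup, h]
  rw [← cent_wcoup hw]
  have hs : cent W (fun x => a x.1 / lam) (fun x => x.2) ≤ (∑ x, W x) * Real.log 2 +
      cent (fun x => if lam ≤ |a x.2 - a x.1| then W x else 0) (fun x => a x.1 / lam)
        (fun x => x.2) +
      cent (fun x => if lam ≤ |a x.2 - a x.1| then 0 else W x) (fun x => a x.1 / lam)
        (fun x => x.2) := by
    convert cent_le_split hW0 (fun x => a x.1 / lam) (fun x => x.2)
      (fun x => lam ≤ |a x.2 - a x.1|)
  have hdiv : ∀ ω, a ω / lam / 2 ^ s = a ω / D := fun ω => by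
    rw [hD, Int.ediv_ediv_of_nonneg hlam.le]
  have hp : (0 : ℤ) < 2 ^ s := by positivity
  have c1 := cent_le_log_of_maps_supp (w := fun x => if lam ≤ |a x.2 - a x.1| then W x else 0)
    (fun x => by split_ifs <;> simp [hW0]) (fun x => a x.1 / lam) (fun x => x.2)
    (P := fun x => a x.2 / D = a x.1 / D) (fun x hx => by rw [hsupp x hx]; simp) (M := 2 ^ s)
    (fun ω v => (v - (a ω / D) * 2 ^ s).toNat) (fun x hx => by
      have e1 := Int.emod_lt_of_pos (a x.1 / lam) hp
      have e2 := Int.emod_add_mul_ediv (a x.1 / lam) (2 ^ s)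
      rw [hdiv, ← hx, mul_comm] at e2
      zify
      rw [Int.toNat_of_nonneg (by have := Int.emod_nonneg (a x.1 / lam) hp.ne'; omega)]
      omega)
    (fun x x' hx hx' hh h => by
      have e1 := Int.emod_nonneg (a x.1 / lam) hp.ne'
      have e2 := Int.emod_add_mul_ediv (a x.1 / lam) (2 ^ s)
      have e3 := Int.emod_nonneg (a x'.1 / lam) hp.ne'
      have e4 := Int.emod_add_mul_ediv (a x'.1 / lam) (2 ^ s)
      rw [hdiv, ← hx, mul_comm] at e2
      rw [hdiv, ← hx', mul_comm, ← hh] at e4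
      omega)
  have c2 := cent_le_log_of_maps_supp (w := fun x => if lam ≤ |a x.2 - a x.1| then 0 else W x)
    (fun x => by split_ifs <;> simp [hW0]) (fun x => a x.1 / lam) (fun x => x.2)
    (P := fun x => ¬ lam ≤ |a x.2 - a x.1|) (fun x hx => by rw [if_pos (not_not.1 hx)]) (M := 3)
    (fun ω v => (v - a ω / lam + 1).toNat) (fun x hx => by
      have e1 := Int.emod_nonneg (a x.1) hlam.ne'
      have e2 := Int.emod_add_mul_ediv (a x.1) lam
      have e3 := Int.emod_nonneg (a x.2) hlam.ne'
      have e4 := Int.emod_add_mul_ediv (a x.2) lam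
      have e5 := Int.emod_lt_of_pos (a x.1) hlam
      have e6 := Int.emod_lt_of_pos (a x.2) hlam
      have h7 := abs_lt.1 (not_le.1 hx)
      have : a x.1 / lam - a x.2 / lam < 2 := by nlinarith
      omega)
    (fun x x' hx hx' hh h => by
      have key : ∀ x : Ω × Ω, ¬ lam ≤ |a x.2 - a x.1| → -1 ≤ a x.1 / lam - a x.2 / lam := by
        intro x hx
        have e1 := Int.emod_nonneg (a x.1) hlam.ne'
        have e2 := Int.emod_add_mul_ediv (a x.1) lam
        have e3 := Int.emod_nonneg (a x.2) hlam.ne'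
        have e4 := Int.emod_add_mul_ediv (a x.2) lam
        have e5 := Int.emod_lt_of_pos (a x.1) hlam
        have e6 := Int.emod_lt_of_pos (a x.2) hlam
        have h7 := abs_lt.1 (not_le.1 hx)
        by_contra h; push Not at h
        have : a x.1 / lam - a x.2 / lam ≤ -2 := by omega
        nlinarith
      have k1 := key x hx
      have k2 := key x' hx'
      rw [← hh] at k2
      omega)
  have t1 : ∑ x, (if lam ≤ |a x.2 - a x.1| then W x else 0) = rho w a D lam := by
    unfold rho; refine Finset.sum_congr rfl fun x _ => ?_
    split_ifs <;> simp [hW]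
  have t2 : ∑ x, (if lam ≤ |a x.2 - a x.1| then 0 else W x) ≤ 1 := by
    rw [← hW1]; refine Finset.sum_le_sum fun x _ => ?_
    split_ifs <;> simp [hW0]
  rw [t1] at c1
  push_cast at c1 c2
  rw [Real.log_pow] at c1
  have l3 : 0 ≤ Real.log 3 := Real.log_nonneg (by norm_num)
  have l6 : Real.log 6 = Real.log 2 + Real.log 3 := by
    rw [← Real.log_mul (by norm_num) (by norm_num)]; norm_num
  rw [hW1] at hs
  have t3 : (∑ x, (if lam ≤ |a x.2 - a x.1| then 0 else W x)) * Real.log 3 ≤ Real.log 3 := by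
    nlinarith
  change cent W _ _ ≤ _
  linarith

end Coupling
end SelfConformal

namespace SelfConformal

section SingleScale

variable {Ω Ω₁ Ω₂ α β : Type*} [Fintype Ω] [Fintype Ω₁] [Fintype Ω₂]

lemma cent_le_log_of_near {w : Ω → ℝ} (hw : ∀ ω, 0 ≤ w ω) (f : Ω → ℤ) (g : Ω → β) {M : ℕ}
    (e : β → ℤ) (h : ∀ ω, e (g ω) ≤ f ω ∧ f ω < e (g ω) + M) :
    cent w f g ≤ (∑ ω, w ω) * Real.log M :=
  cent_le_log_of_maps hw f g (fun b v => (v - e b).toNat) (fun ω => by have := h ω; omega)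
    (fun ω ω' hh h' => by
      have h1 := h ω
      have h2 := h ω'
      rw [← hh] at h2
      omega)

lemma add_ediv_near (x y : ℤ) {lam : ℤ} (hlam : 0 < lam) :
    x / lam + y / lam ≤ (x + y) / lam ∧ (x + y) / lam < x / lam + y / lam + 2 := by
  have e1 := Int.emod_nonneg x hlam.ne'
  have e2 := Int.emod_add_mul_ediv x lam
  have e3 := Int.emod_nonneg y hlam.ne'
  have e4 := Int.emod_add_mul_ediv y lam
  have e5 := Int.emod_lt_of_pos x hlam
  have e6 := Int.emod_lt_of_pos y hlam
  constructor
  · rw [Int.le_ediv_iff_mul_le hlam]; nlinarith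
  · rw [Int.ediv_lt_iff_lt_mul hlam]; nlinarith

lemma isPush_coupled_sum {w₁ : Ω₁ → ℝ} (h₁ : ∀ ω, 0 ≤ w₁ ω) (w₂ : Ω₂ → ℝ) (f : Ω₁ → α) (k : ℕ) :
    IsPush (fun x : (Fin k → Ω₁ × Ω₁) × ((Fin k → Bool) × Ω₂) =>
      ((fun l => if x.2.1 l then (x.1 l).2 else (x.1 l).1 : Fin k → Ω₁), x.2.2))
      (wprod (wpi (wcoup w₁ f) k) (wprod (wpi wcoin k) w₂)) (wprod (wpi w₁ k) w₂) := by
  have h1 : IsPush (fun x : (Fin k → Ω₁ × Ω₁) × ((Fin k → Bool) × Ω₂) =>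
      (((fun l => (x.1 l, x.2.1 l)) : Fin k → (Ω₁ × Ω₁) × Bool), x.2.2))
      (wprod (wpi (wcoup w₁ f) k) (wprod (wpi wcoin k) w₂))
      (wprod (wpi (wprod (wcoup w₁ f) wcoin) k) w₂) :=
    isPush_equiv ((Equiv.prodAssoc _ _ _).symm.trans
      (Equiv.prodCongr (Equiv.arrowProdEquivProdArrow _ _ _).symm (Equiv.refl _))) fun ω => by
        simp [wprod, wpi, Equiv.arrowProdEquivProdArrow, Finset.prod_mul_distrib, mul_assoc]
  have h2 := ((isPush_wcoup_choice h₁ f).pi k).prod (isPush_id w₂)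
  exact h2.comp h1

variable {w₂ : Ω₂ → ℝ}

lemma cent_translate_ge (h₂ : ∀ ω, 0 ≤ w₂ ω) (s₂ : ∑ ω, w₂ ω = 1) (b : Ω₂ → ℤ) (c : ℤ) {lam : ℤ} (hlam : 0 < lam) (g : Ω₂ → β) :
    cent w₂ (fun ω => b ω / lam) g - Real.log 2 ≤ cent w₂ (fun ω => (c + b ω) / lam) g := by
  have h1 := cent_le_add' h₂ (fun ω => b ω / lam) (fun ω => (c + b ω) / lam) g
  have h2 := cent_le_log_of_near h₂ (fun ω => b ω / lam) (fun ω => (c + b ω) / lam) (M := 2)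
    (fun v => v - c / lam - 1) (fun ω => by
      have := add_ediv_near c (b ω) hlam
      push_cast; constructor <;> linarith)
  rw [s₂] at h2
  push_cast at h2
  linarith

/-- The contribution of a fixed difference vector `d`. -/
lemma coin_cent_bounds (h₂ : ∀ ω, 0 ≤ w₂ ω) (s₂ : ∑ ω, w₂ ω = 1) (b : Ω₂ → ℤ) {k : ℕ} (d : Fin k → ℤ) (c : ℤ) {lam Lam : ℤ} (hlam : 0 < lam)
    (hLam : 0 < Lam) (hd : ∑ l, (d l : ℝ) ^ 2 ≤ (Lam : ℝ) ^ 2) :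
    cent (wprod (wpi wcoin k) w₂)
        (fun y => (c + (∑ l, if y.1 l then d l else 0) + b y.2) / Lam) (fun y => b y.2 / Lam) ≤ 8 ∧
    cent w₂ (fun y => b y / lam) (fun y => b y / Lam) - 1 ≤
      cent (wprod (wpi wcoin k) w₂)
        (fun y => (c + (∑ l, if y.1 l then d l else 0) + b y.2) / lam) (fun y => b y.2 / Lam) ∧
    (0 < (Finset.univ.filter fun l => lam ≤ |d l|).card →
      1 / 2 * Real.log (Finset.univ.filter fun l => lam ≤ |d l|).card ≤
      cent (wprod (wpi wcoin k) w₂)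
        (fun y => (c + (∑ l, if y.1 l then d l else 0) + b y.2) / lam)
        (fun y => b y.2 / Lam)) := by
  have hE := wpi_nonneg wcoin_nonneg k
  have sE := sum_wpi sum_wcoin k
  have l2 : Real.log 2 ≤ 1 := by linarith [Real.log_two_lt_d9]
  refine ⟨?_, ?_, ?_⟩
  · have a1 := cent_le_add (wprod_nonneg hE h₂)
      (fun y : (Fin k → Bool) × Ω₂ => (c + (∑ l, if y.1 l then d l else 0) + b y.2) / Lam)
      (fun y => (∑ l, if y.1 l then d l else 0) / Lam) (fun y => b y.2 / Lam)
    have a2 := cent_le_ent (wprod_nonneg hE h₂)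
      (fun y : (Fin k → Bool) × Ω₂ => (∑ l, if y.1 l then d l else 0) / Lam)
      (fun y => b y.2 / Lam)
    rw [(isPush_fst (wpi wcoin k) s₂).ent (fun e => (∑ l, if e l then d l else 0) / Lam)] at a2
    have a3 := coin_ent_le k d hLam hd
    have a4 := cent_le_log_of_near (wprod_nonneg hE h₂) (M := 4)
      (fun y : (Fin k → Bool) × Ω₂ => (c + (∑ l, if y.1 l then d l else 0) + b y.2) / Lam)
      (fun y => ((∑ l, if y.1 l then d l else 0) / Lam, b y.2 / Lam))
      (fun v => c / Lam + v.1 + v.2) (fun y => by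
        have e1 := add_ediv_near c (∑ l, if y.1 l then d l else 0) hLam
        have e2 := add_ediv_near (c + ∑ l, if y.1 l then d l else 0) (b y.2) hLam
        push_cast; constructor <;> linarith)
    rw [sum_wprod, sE, s₂] at a4
    have : Real.log 4 = 2 * Real.log 2 := by
      rw [show (4 : ℝ) = 2 ^ 2 by norm_num, Real.log_pow]; norm_num
    push_cast at a4
    linarith
  · have a1 := cent_anti (wprod_nonneg hE h₂)
      (fun y : (Fin k → Bool) × Ω₂ => (c + (∑ l, if y.1 l then d l else 0) + b y.2) / lam)
      (g := fun y => b y.2 / Lam) (g' := fun y => (b y.2 / Lam, y.1))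
      (fun _ _ h => (Prod.mk.inj h).1)
    rw [cent_wprod hE h₂ (fun e ω => (c + (∑ l, if e l then d l else 0) + b ω) / lam)
      (fun _ ω => b ω / Lam)] at a1
    refine le_trans ?_ a1
    calc _ = ∑ e, wpi wcoin k e * (cent w₂ (fun y => b y / lam) (fun y => b y / Lam) - 1) := by
          rw [← Finset.sum_mul, sE, one_mul]
      _ ≤ _ := Finset.sum_le_sum fun e _ => mul_le_mul_of_nonneg_left ?_ (hE e)
    have := cent_translate_ge h₂ s₂ b (c + ∑ l, if e l then d l else 0) hlam (fun y => b y / Lam)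
    linarith
  · intro hn
    refine le_trans ?_ (sum_cent_le_snd hE h₂
      (fun e ω => (c + (∑ l, if e l then d l else 0) + b ω) / lam) (fun ω => b ω / Lam))
    calc _ = ∑ ω, w₂ ω * (1 / 2 * Real.log (Finset.univ.filter fun l => lam ≤ |d l|).card) := by
          rw [← Finset.sum_mul, s₂, one_mul]
      _ ≤ _ := Finset.sum_le_sum fun ω _ => mul_le_mul_of_nonneg_left ?_ (h₂ ω)
    have := coin_ent_ge k d lam (c + b ω) hlam rfl hn
    refine this.trans (le_of_eq ?_)
    congr 1; funext e; congr 1; ring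

/-- The entropy increment of a random walk at a single scale. -/
lemma single_scale (h₂ : ∀ ω, 0 ≤ w₂ ω) (s₂ : ∑ ω, w₂ ω = 1) (b : Ω₂ → ℤ) {w₁ : Ω₁ → ℝ} (h₁ : ∀ ω, 0 ≤ w₁ ω) (s₁ : ∑ ω, w₁ ω = 1) (a : Ω₁ → ℤ)
    {lam : ℤ} (hlam : 0 < lam) (s L : ℕ) {η : ℝ} (hη : 0 < η) {D Lam : ℤ}
    (hD : D = lam * 2 ^ s) (hLam : Lam = D * 2 ^ L) :
    ∃ π : ℝ, 0 ≤ π ∧ π ≤ 1 ∧ rho w₁ a D lam - η ≤ π ∧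
      cent w₂ (fun y => b y / lam) (fun y => b y / Lam) +
        π * (L * Real.log 2 + 1 / 2 * Real.log η -
          cent w₂ (fun y => b y / lam) (fun y => b y / Lam)) - 9 ≤
      cent (wprod (wpi w₁ (4 ^ L)) w₂) (fun x => (∑ l, a (x.1 l) + b x.2) / lam)
        (fun x => (∑ l, a (x.1 l) + b x.2) / Lam) := by
  classical
  obtain ⟨k, hk⟩ : ∃ k, k = 4 ^ L := ⟨_, rfl⟩
  rw [← hk]
  set Wc := wcoup w₁ (fun ω => a ω / D) with hWc
  have hWc0 : ∀ x, 0 ≤ Wc x := wcoup_nonneg h₁ _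
  have hWc1 : ∑ x, Wc x = 1 := (isPush_wcoup_fst h₁ _).total.trans s₁
  have hZ := wpi_nonneg hWc0 k
  have sZ := sum_wpi hWc1 k
  have hB := wprod_nonneg (wpi_nonneg wcoin_nonneg k) h₂
  have hD0 : 0 < D := by rw [hD]; positivity
  have hL0 : 0 < Lam := by rw [hLam]; positivity
  set bi := cent w₂ (fun y => b y / lam) (fun y => b y / Lam) with hbi
  let N : (Fin k → Ω₁ × Ω₁) → ℕ := fun z =>
    (Finset.univ.filter fun l => lam ≤ |a (z l).2 - a (z l).1|).card
  have hk0 : (0 : ℝ) < k := by rw [hk]; positivity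
  refine ⟨∑ z, wpi Wc k z * (if η * k ≤ N z then 1 else 0), ?_, ?_, ?_, ?_⟩
  · exact Finset.sum_nonneg fun z _ => mul_nonneg (hZ z) (by split_ifs <;> norm_num)
  · refine le_trans (Finset.sum_le_sum fun z _ => ?_) sZ.le
    have := hZ z
    split_ifs <;> simp [this]
  · have e1 := sum_wpi_mul_sum hWc1
      (fun x => if lam ≤ |a x.2 - a x.1| then (1 : ℝ) else 0) k
    change _ = k * rho w₁ a D lam at e1
    have e2 : ∑ z, wpi Wc k z * ∑ l, (if lam ≤ |a (z l).2 - a (z l).1| then (1 : ℝ) else 0) ≤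
        ∑ z, wpi Wc k z * (k * (if η * k ≤ N z then 1 else 0) + η * k) := by
      refine Finset.sum_le_sum fun z _ => mul_le_mul_of_nonneg_left ?_ (hZ z)
      have e3 : ∑ l, (if lam ≤ |a (z l).2 - a (z l).1| then (1 : ℝ) else 0) = N z := by
        simp [N]
      rw [e3]
      have e4 : (N z : ℝ) ≤ k := by
        norm_cast; exact (Finset.card_le_univ _).trans (by simp)
      split_ifs with h
      · have : 0 < η * k := by positivity
        linarith
      · linarith
    rw [e1] at e2
    have e5 : ∑ z, wpi Wc k z * (k * (if η * k ≤ N z then (1 : ℝ) else 0) + η * k) =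
        k * ∑ z, wpi Wc k z * (if η * k ≤ N z then 1 else 0) + η * k := by
      simp only [mul_add, Finset.sum_add_distrib, ← Finset.sum_mul, sZ, one_mul]
      rw [Finset.mul_sum]
      congr 1
      exact Finset.sum_congr rfl fun _ _ => by ring
    rw [e5] at e2
    set π := ∑ z, wpi Wc k z * (if η * k ≤ N z then (1 : ℝ) else 0)
    have : (k : ℝ) * rho w₁ a D lam ≤ k * (π + η) := by linarith
    linarith [le_of_mul_le_mul_left this hk0]
  · have hpush := isPush_coupled_sum h₁ w₂ (fun ω => a ω / D) k
    rw [← hpush.cent]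
    have hsum : ∀ x : (Fin k → Ω₁ × Ω₁) × ((Fin k → Bool) × Ω₂),
        ∑ l, a (if x.2.1 l then (x.1 l).2 else (x.1 l).1) + b x.2.2 =
        (∑ l, a (x.1 l).1) + (∑ l, if x.2.1 l then a (x.1 l).2 - a (x.1 l).1 else 0)
          + b x.2.2 := by
      intro x
      rw [← Finset.sum_add_distrib]
      congr 1
      exact Finset.sum_congr rfl fun l _ => by split_ifs <;> ring
    simp only [hsum]
    let f := fun (mu : ℤ) (z : Fin k → Ω₁ × Ω₁) (y : (Fin k → Bool) × Ω₂) =>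
      ((∑ l, a (z l).1) + (∑ l, if y.1 l then a (z l).2 - a (z l).1 else 0) + b y.2) / mu
    change _ ≤ cent (wprod (wpi Wc k) (wprod (wpi wcoin k) w₂)) (fun x => f lam x.1 x.2) (fun x => f Lam x.1 x.2)
    have c1 := cent_le_add' (wprod_nonneg hZ hB) (fun x => f lam x.1 x.2)
      (fun x => f Lam x.1 x.2) (fun x => (b x.2.2 / Lam, x.1))
    rw [cent_wprod hZ hB (f lam) (fun _ y => b y.2 / Lam),
      cent_wprod hZ hB (f Lam) (fun _ y => b y.2 / Lam)] at c1
    have key : ∑ z, wpi Wc k z * (bi + (if η * k ≤ N z then (1 : ℝ) else 0) *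
          (L * Real.log 2 + 1 / 2 * Real.log η - bi) - 9) ≤
        ∑ z, wpi Wc k z * (cent (wprod (wpi wcoin k) w₂) (f lam z) (fun y => b y.2 / Lam) -
          cent (wprod (wpi wcoin k) w₂) (f Lam z) (fun y => b y.2 / Lam)) := by
      refine Finset.sum_le_sum fun z _ => ?_
      rcases (hZ z).eq_or_lt with h0 | h0
      · simp [← h0]
      refine mul_le_mul_of_nonneg_left ?_ h0.le
      have hd : ∀ l, |a (z l).2 - a (z l).1| < D := by
        intro l
        have hne : Wc (z l) ≠ 0 := fun h => h0.ne' (Finset.prod_eq_zero (Finset.mem_univ l) h)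
        have heq : a (z l).2 / D = a (z l).1 / D := by
          by_contra h; exact hne (by simp [hWc, wcoup, h])
        have e1 := Int.emod_nonneg (a (z l).1) hD0.ne'
        have e2 := Int.emod_add_mul_ediv (a (z l).1) D
        have e3 := Int.emod_nonneg (a (z l).2) hD0.ne'
        have e4 := Int.emod_add_mul_ediv (a (z l).2) D
        have e5 := Int.emod_lt_of_pos (a (z l).1) hD0
        have e6 := Int.emod_lt_of_pos (a (z l).2) hD0
        rw [heq] at e4
        rw [abs_lt]; constructor <;> linarith
      have hd2 : ∑ l, (((a (z l).2 - a (z l).1 : ℤ)) : ℝ) ^ 2 ≤ (Lam : ℝ) ^ 2 := by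
        have : ∀ l ∈ Finset.univ, (((a (z l).2 - a (z l).1 : ℤ)) : ℝ) ^ 2 ≤ (D : ℝ) ^ 2 := by
          intro l _
          rw [← sq_abs]
          have := (hd l).le
          have h' : |((a (z l).2 - a (z l).1 : ℤ) : ℝ)| ≤ D := by exact_mod_cast this
          gcongr
        refine (Finset.sum_le_card_nsmul _ _ _ this).trans (le_of_eq ?_)
        simp only [Finset.card_univ, Fintype.card_fin, nsmul_eq_mul, hk, hLam]
        push_cast
        rw [mul_pow, ← pow_mul, mul_comm L 2, pow_mul]; norm_num; ring
      obtain ⟨b1, b2, b3⟩ := coin_cent_bounds h₂ s₂ b (fun l => a (z l).2 - a (z l).1)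
        (∑ l, a (z l).1) hlam hL0 hd2
      change cent (wprod (wpi wcoin k) w₂) (f Lam z) (fun y => b y.2 / Lam) ≤ 8 at b1
      change bi - 1 ≤ cent (wprod (wpi wcoin k) w₂) (f lam z) (fun y => b y.2 / Lam) at b2
      change 0 < N z → 1 / 2 * Real.log (N z) ≤ cent (wprod (wpi wcoin k) w₂) (f lam z)
        (fun y => b y.2 / Lam) at b3
      split_ifs with hn
      · have hp : 0 < η * k := by positivity
        have hN : 0 < N z := by
          have := hp.trans_le hn
          exact_mod_cast this
        have g1 := Real.log_le_log hp hn
        rw [Real.log_mul hη.ne' hk0.ne'] at g1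
        have g2 : Real.log (k : ℝ) = 2 * (L * Real.log 2) := by
          rw [hk]; push_cast
          rw [Real.log_pow, show (4 : ℝ) = 2 ^ 2 by norm_num, Real.log_pow]; push_cast; ring
        have := b3 hN
        linarith
      · linarith
    simp only [mul_sub, mul_add, Finset.sum_sub_distrib, Finset.sum_add_distrib, ← Finset.sum_mul,
      sZ, ← mul_assoc] at key
    linarith

end SingleScale
end SelfConformal

namespace SelfConformal

section Growth

variable {Ω Ω₁ Ω₂ α β : Type*} [Fintype Ω] [Fintype Ω₁] [Fintype Ω₂]

lemma ent_div_eq (w : Ω → ℝ) (f : Ω → ℤ) {lam : ℤ} (hlam : 0 ≤ lam) (c : ℤ) :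
    ent w (fun ω => f ω / lam) = ent w (fun ω => f ω / (lam * c)) +
      cent w (fun ω => f ω / lam) (fun ω => f ω / (lam * c)) := by
  rw [← ent_pair]
  refine cent_congr (fun _ _ => Iff.rfl) fun ω ω' _ => ?_
  simp only [Prod.mk.injEq, ← Int.ediv_ediv_of_nonneg hlam]
  exact ⟨fun h => ⟨h, by rw [h]⟩, fun h => h.1⟩

lemma ent_div_mono {w : Ω → ℝ} (hw : ∀ ω, 0 ≤ w ω) (f : Ω → ℤ) {lam : ℤ} (hlam : 0 ≤ lam) (c : ℤ) :
    ent w (fun ω => f ω / (lam * c)) ≤ ent w (fun ω => f ω / lam) := by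
  rw [ent_div_eq w f hlam c]
  linarith [cent_nonneg hw (fun ω => f ω / lam) (fun ω => f ω / (lam * c))]

lemma ent_div_step {w : Ω → ℝ} (hw : ∀ ω, 0 ≤ w ω) (h1 : ∑ ω, w ω = 1) (f : Ω → ℤ) {lam : ℤ}
    (hlam : 0 ≤ lam) (r : ℕ) :
    ent w (fun ω => f ω / lam) ≤ ent w (fun ω => f ω / (lam * 2 ^ r)) + r * Real.log 2 := by
  rw [ent_div_eq w f hlam (2 ^ r)]
  have h := cent_le_log_of_near hw (fun ω => f ω / lam) (fun ω => f ω / (lam * 2 ^ r))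
    (M := 2 ^ r) (fun v => v * 2 ^ r) (fun ω => by
      rw [← Int.ediv_ediv_of_nonneg hlam]
      have hp : (0 : ℤ) < 2 ^ r := by positivity
      have e1 := Int.emod_nonneg (f ω / lam) hp.ne'
      have e2 := Int.emod_add_mul_ediv (f ω / lam) (2 ^ r)
      have e3 := Int.emod_lt_of_pos (f ω / lam) hp
      push_cast
      constructor <;> nlinarith)
  rw [h1] at h
  push_cast at h
  rw [Real.log_pow] at h
  linarith

lemma sum_range_shift_sub (F : ℕ → ℝ) (n q : ℕ) :
    ∑ j ∈ Finset.range n, (F (j + q) - F j) = ∑ t ∈ Finset.range q, (F (n + t) - F t) := by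
  have h1 := Finset.sum_range_add F q n
  have h2 := Finset.sum_range_add F n q
  rw [add_comm q n, h2] at h1
  simp only [Finset.sum_sub_distrib, add_comm _ q]
  linarith

/-- Entropy of an integer variable at the scale `2 ^ (m - j)`. -/
def scEnt (w : Ω → ℝ) (f : Ω → ℤ) (m j : ℕ) : ℝ := ent w (fun ω => f ω / 2 ^ (m - j))

lemma scEnt_mono {w : Ω → ℝ} (hw : ∀ ω, 0 ≤ w ω) (f : Ω → ℤ) (m : ℕ) {i j : ℕ} (h : i ≤ j) :
    scEnt w f m i ≤ scEnt w f m j := by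
  unfold scEnt
  obtain ⟨r, hr⟩ : ∃ r, m - i = m - j + r := ⟨m - i - (m - j), by omega⟩
  rw [hr, pow_add]
  exact ent_div_mono hw f (by positivity) _

lemma scEnt_nonneg {w : Ω → ℝ} (hw : ∀ ω, 0 ≤ w ω) (f : Ω → ℤ) (m j : ℕ) : 0 ≤ scEnt w f m j :=
  ent_nonneg hw _

lemma scEnt_self (w : Ω → ℝ) (f : Ω → ℤ) (m : ℕ) : scEnt w f m m = ent w f := by
  simp [scEnt]

lemma scEnt_step {w : Ω → ℝ} (hw : ∀ ω, 0 ≤ w ω) (h1 : ∑ ω, w ω = 1) (f : Ω → ℤ) (m i r : ℕ) :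
    scEnt w f m (i + r) ≤ scEnt w f m i + r * Real.log 2 := by
  unfold scEnt
  obtain ⟨r', hr, hr'⟩ : ∃ r', m - i = m - (i + r) + r' ∧ r' ≤ r :=
    ⟨m - i - (m - (i + r)), by omega, by omega⟩
  have := ent_div_step hw h1 f (lam := 2 ^ (m - (i + r))) (by positivity) r'
  rw [hr, pow_add]
  have h3 : (r' : ℝ) * Real.log 2 ≤ r * Real.log 2 := by
    have := Real.log_nonneg (show (1 : ℝ) ≤ 2 by norm_num)
    gcongr
  linarith

lemma scEnt_zero_le {w : Ω → ℝ} (hw : ∀ ω, 0 ≤ w ω) (h1 : ∑ ω, w ω = 1) (f : Ω → ℤ) (m : ℕ)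
    (A : ℤ) (hA : ∀ ω, A ≤ f ω ∧ f ω < A + 2 ^ m) : scEnt w f m 0 ≤ Real.log 2 := by
  have h := cent_le_log_of_near hw (fun ω => f ω / 2 ^ (m - 0)) (fun _ => ()) (M := 2)
    (fun _ => A / 2 ^ m) (fun ω => by
      have hp : (0 : ℤ) < 2 ^ m := by positivity
      rw [Nat.sub_zero]
      refine ⟨Int.ediv_le_ediv hp (hA ω).1, ?_⟩
      rw [Int.ediv_lt_iff_lt_mul hp]
      have := Int.emod_lt_of_pos A hp
      have e2 := Int.emod_add_mul_ediv A (2 ^ m)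
      have := hA ω
      push_cast; nlinarith)
  rw [h1] at h
  simpa [scEnt, ent] using h

variable {w₁ : Ω₁ → ℝ} {w₂ : Ω₂ → ℝ}

lemma sum_rho_ge (h₁ : ∀ ω, 0 ≤ w₁ ω) (s₁ : ∑ ω, w₁ ω = 1) (a : Ω₁ → ℤ) (m s L : ℕ) (hs : 0 < s) (hm : s + L ≤ m) (A : ℤ)
    (hA : ∀ ω, A ≤ a ω ∧ a ω < A + 2 ^ m) :
    s * (ent w₁ a - (2 * (s + L) + 1) * Real.log 2) ≤
      (m - (s + L) + 1 : ℕ) * Real.log 6 + s * Real.log 2 *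
      ∑ j ∈ Finset.range (m - (s + L) + 1), rho w₁ a (2 ^ (m - (j + L))) (2 ^ (m - (j + (s + L)))) := by
  set n := m - (s + L) + 1 with hn
  have l2 := Real.log_nonneg (show (1 : ℝ) ≤ 2 by norm_num)
  have hr : ∀ j ∈ Finset.range n, scEnt w₁ a m (j + s + L) - scEnt w₁ a m (j + L) ≤
      Real.log 6 + rho w₁ a (2 ^ (m - (j + L))) (2 ^ (m - (j + (s + L)))) * (s * Real.log 2) := by
    intro j hj
    rw [Finset.mem_range] at hj
    have e : (2 : ℤ) ^ (m - (j + L)) = 2 ^ (m - (j + (s + L))) * 2 ^ s := by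
      rw [← pow_add]; congr 1; omega
    have h := cent_le_rho h₁ s₁ a (s := s) (lam := 2 ^ (m - (j + (s + L)))) (by positivity) e
    have h' := ent_div_eq w₁ a (lam := 2 ^ (m - (j + (s + L)))) (by positivity) (2 ^ s)
    rw [← e] at h'
    unfold scEnt
    rw [add_assoc]
    linarith
  have h1 := Finset.sum_le_sum hr
  have h2 := sum_range_shift_sub (fun j => scEnt w₁ a m (j + L)) n s
  rw [h2] at h1
  have h3 : ∀ t ∈ Finset.range s, ent w₁ a - (2 * (s + L) + 1) * Real.log 2 ≤
      scEnt w₁ a m (n + t + L) - scEnt w₁ a m (t + L) := by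
    intro t ht
    rw [Finset.mem_range] at ht
    have e1 := scEnt_step h₁ s₁ a m (n + t + L) (s - 1 - t)
    rw [show n + t + L + (s - 1 - t) = m by omega, scEnt_self] at e1
    have e2 := scEnt_step h₁ s₁ a m 0 (t + L)
    rw [zero_add] at e2
    have e3 := scEnt_zero_le h₁ s₁ a m A hA
    have e4 : ((s - 1 - t : ℕ) : ℝ) * Real.log 2 ≤ (s + L) * Real.log 2 := by
      gcongr; norm_cast; omega
    have e5 : ((t + L : ℕ) : ℝ) * Real.log 2 ≤ (s + L) * Real.log 2 := by
      gcongr; norm_cast; omega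
    linarith
  have h4 := Finset.sum_le_sum h3
  simp only [Finset.sum_const, Finset.card_range, nsmul_eq_mul] at h4
  rw [Finset.sum_add_distrib, ← Finset.sum_mul, Finset.sum_const, Finset.card_range,
    nsmul_eq_mul] at h1
  linarith

lemma sum_scales_ge (h₁ : ∀ ω, 0 ≤ w₁ ω) (h₂ : ∀ ω, 0 ≤ w₂ ω)
    (s₁ : ∑ ω, w₁ ω = 1) (s₂ : ∑ ω, w₂ ω = 1) (a : Ω₁ → ℤ) (b : Ω₂ → ℤ) (m s L : ℕ) (hm : s + L ≤ m) {η α' C : ℝ} (hη : 0 < η)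
    (h : ℕ → ℝ) (hh : h (s + L) ≤ α' * (s + L : ℕ) + C)
    (hΓ : 0 ≤ L * Real.log 2 + 1 / 2 * Real.log η - α' * (s + L : ℕ))
    (hb : ∀ j1 j2, j2 ≤ j1 → j1 ≤ m → h (j1 - j2) - C ≤ scEnt w₂ b m j1 - scEnt w₂ b m j2) :
    (m - (s + L) + 1 : ℕ) * (h (s + L) - C - 9) +
      (L * Real.log 2 + 1 / 2 * Real.log η - α' * (s + L : ℕ)) *
      (∑ j ∈ Finset.range (m - (s + L) + 1),
        (rho w₁ a (2 ^ (m - (j + L))) (2 ^ (m - (j + (s + L)))) - η)) ≤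
      (s + L : ℕ) * ent (wprod (wpi w₁ (4 ^ L)) w₂) (fun x => ∑ l, a (x.1 l) + b x.2) := by
  set n := m - (s + L) + 1 with hn
  set Γ := L * Real.log 2 + 1 / 2 * Real.log η - α' * (s + L : ℕ) with hΓd
  set S : (Fin (4 ^ L) → Ω₁) × Ω₂ → ℤ := fun x => ∑ l, a (x.1 l) + b x.2 with hS
  have hw := wprod_nonneg (wpi_nonneg h₁ (4 ^ L)) h₂
  have step : ∀ j ∈ Finset.range n, h (s + L) - C - 9 +
      Γ * (rho w₁ a (2 ^ (m - (j + L))) (2 ^ (m - (j + (s + L)))) - η) ≤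
      scEnt (wprod (wpi w₁ (4 ^ L)) w₂) S m (j + (s + L)) -
        scEnt (wprod (wpi w₁ (4 ^ L)) w₂) S m j := by
    intro j hj
    rw [Finset.mem_range] at hj
    have e : (2 : ℤ) ^ (m - (j + L)) = 2 ^ (m - (j + (s + L))) * 2 ^ s := by
      rw [← pow_add]; congr 1; omega
    have e' : (2 : ℤ) ^ (m - j) = 2 ^ (m - (j + L)) * 2 ^ L := by
      rw [← pow_add]; congr 1; omega
    have e'' : (2 : ℤ) ^ (m - j) = 2 ^ (m - (j + (s + L))) * 2 ^ (s + L) := by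
      rw [← pow_add]; congr 1; omega
    obtain ⟨π, p0, p1, p2, p3⟩ := single_scale h₂ s₂ b h₁ s₁ a
      (lam := 2 ^ (m - (j + (s + L)))) (by positivity) s L hη e e'
    have k1 := ent_div_eq (wprod (wpi w₁ (4 ^ L)) w₂) S (lam := 2 ^ (m - (j + (s + L))))
      (by positivity) (2 ^ (s + L))
    have k2 := ent_div_eq w₂ b (lam := 2 ^ (m - (j + (s + L)))) (by positivity) (2 ^ (s + L))
    rw [← e''] at k1 k2
    have k3 := hb (j + (s + L)) j (by omega) (by omega)
    rw [Nat.add_sub_cancel_left] at k3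
    unfold scEnt at k3 ⊢
    rw [k2] at k3
    rw [k1]
    set bi := cent w₂ (fun y => b y / 2 ^ (m - (j + (s + L)))) (fun y => b y / 2 ^ (m - j))
    have k4 : h (s + L) - C ≤ bi := by linarith
    have k5 : (h (s + L) - C) * (1 - π) ≤ bi * (1 - π) :=
      mul_le_mul_of_nonneg_right k4 (by linarith)
    have k6 : π * Γ ≤ π * (L * Real.log 2 + 1 / 2 * Real.log η - h (s + L) + C) :=
      mul_le_mul_of_nonneg_left (by rw [hΓd]; linarith) p0
    have k7 := mul_le_mul_of_nonneg_left p2 hΓ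
    change _ ≤ cent _ (fun x => S x / _) (fun x => S x / _) at p3
    linarith
  have h1 := Finset.sum_le_sum step
  rw [sum_range_shift_sub, Finset.sum_add_distrib, ← Finset.mul_sum, Finset.sum_const,
    Finset.card_range, nsmul_eq_mul] at h1
  refine h1.trans ?_
  have h3 : ∀ t ∈ Finset.range (s + L), scEnt (wprod (wpi w₁ (4 ^ L)) w₂) S m (n + t) -
      scEnt (wprod (wpi w₁ (4 ^ L)) w₂) S m t ≤ ent (wprod (wpi w₁ (4 ^ L)) w₂) S := by
    intro t ht
    rw [Finset.mem_range] at ht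
    have e1 := scEnt_mono hw S m (show n + t ≤ m by omega)
    rw [scEnt_self] at e1
    linarith [scEnt_nonneg hw S m t]
  refine (Finset.sum_le_sum h3).trans (le_of_eq ?_)
  rw [Finset.sum_const, Finset.card_range, nsmul_eq_mul]

end Growth
end SelfConformal

namespace SelfConformal

set_option maxHeartbeats 1000000 in
/-- Entropy growth: adding an independent variable of positive entropy rate to a variable whose
scale entropies are all at least those of `h` increases the entropy, if `h` has rate `< log 2`. -/
lemma entropy_growth {h : ℕ → ℝ} {α C : ℝ} (hα0 : 0 ≤ α) (hα : α < Real.log 2)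
    (hle : ∀ r, h r ≤ α * r + C) (hlim : Tendsto (fun r => h r / (r : ℝ)) atTop (𝓝 α))
    {ε : ℝ} (hε : 0 < ε) :
    ∃ c : ℝ, 0 < c ∧ ∃ m₀ : ℕ, ∀ m, m₀ ≤ m → ∀ (Ω₁ Ω₂ : Type) [Fintype Ω₁] [Fintype Ω₂]
      (w₁ : Ω₁ → ℝ) (w₂ : Ω₂ → ℝ), (∀ ω, 0 ≤ w₁ ω) → (∀ ω, 0 ≤ w₂ ω) → ∑ ω, w₁ ω = 1 →
      ∑ ω, w₂ ω = 1 → ∀ (a : Ω₁ → ℤ) (b : Ω₂ → ℤ) (A : ℤ), (∀ ω, A ≤ a ω ∧ a ω < A + 2 ^ m) →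
      (∀ j1 j2, j2 ≤ j1 → j1 ≤ m → h (j1 - j2) - C ≤ scEnt w₂ b m j1 - scEnt w₂ b m j2) →
      h m - C + c * (ent w₁ a - ε * m) ≤ ent (wprod w₁ w₂) (fun x => a x.1 + b x.2) := by
  have l2 : 0 < Real.log 2 := Real.log_pos (by norm_num)
  have l2' : Real.log 2 ≤ 1 := by linarith [Real.log_two_lt_d9]
  have l6 : Real.log 6 ≤ 2 := by
    rw [Real.log_le_iff_le_exp (by norm_num)]
    have := Real.exp_one_gt_d9
    rw [show (2 : ℝ) = 1 + 1 by norm_num, Real.exp_add]; nlinarith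
  set θ := Real.log 2 - α with hθ
  have hθ0 : 0 < θ := by linarith
  obtain ⟨s, hs0, hs⟩ : ∃ s : ℕ, 0 < s ∧ 12 / ε ≤ s :=
    ⟨⌈12 / ε⌉₊ + 1, by omega, by push_cast; linarith [Nat.le_ceil (12 / ε)]⟩
  have hs' : 12 ≤ ε * s := by rwa [div_le_iff₀' hε] at hs
  set η := ε / 6 with hη
  have hη0 : 0 < η := by positivity
  set δ := ε * θ / 24 with hδ
  have hδ0 : 0 < δ := by positivity
  have ev1 : ∀ᶠ r : ℕ in atTop, (α - δ) * r ≤ h r := by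
    have := hlim.eventually (lt_mem_nhds (show α - δ < α by linarith))
    filter_upwards [this, eventually_gt_atTop 0] with r hr hr0
    have : (0 : ℝ) < r := by exact_mod_cast hr0
    rw [lt_div_iff₀ this] at hr
    exact hr.le
  have ev1' := (tendsto_add_atTop_nat s).eventually ev1
  have ev2 := tendsto_natCast_atTop_atTop (R := ℝ) |>.eventually_ge_atTop
    (2 * (α * s - 1 / 2 * Real.log η) / θ)
  have ev3 := tendsto_natCast_atTop_atTop (R := ℝ) |>.eventually_ge_atTop
    ((C + 9 + δ * s) / δ)
  obtain ⟨L, hL1, hL2, hL3, hL0⟩ := (ev1'.and (ev2.and (ev3.and (eventually_gt_atTop 0)))).exists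
  rw [div_le_iff₀' hθ0] at hL2
  rw [div_le_iff₀' hδ0] at hL3
  rw [add_comm L s] at hL1
  have hL0' : (0 : ℝ) < L := by exact_mod_cast hL0
  obtain ⟨q, hq⟩ : ∃ q, q = s + L := ⟨_, rfl⟩
  have hqr : (q : ℝ) = s + L := by rw [hq]; push_cast; ring
  rw [← hq] at hL1
  obtain ⟨Γ, hΓ⟩ : ∃ Γ, Γ = L * Real.log 2 + 1 / 2 * Real.log η - α * q := ⟨_, rfl⟩
  have hΓ1 : θ * L / 2 ≤ Γ := by
    rw [hΓ, hqr, hθ]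
    rw [hθ] at hL2
    nlinarith
  have hΓ0 : 0 < Γ := lt_of_lt_of_le (by positivity) hΓ1
  have hbias : Real.log 2 * (C + 9 + α * q - h q) ≤ ε / 6 * Γ := by
    have e1 : C + 9 + α * q - h q ≤ ε / 6 * Γ := by
      have : ε / 6 * (θ * L / 2) ≤ ε / 6 * Γ := by gcongr
      rw [hqr] at hL1 ⊢
      rw [hδ] at *
      nlinarith
    have : 0 < ε / 6 * Γ := by positivity
    rcases le_or_gt 0 (C + 9 + α * q - h q) with h0 | h0
    · nlinarith
    · nlinarith
  have hq0 : (0 : ℝ) < q := by rw [hqr]; positivity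
  obtain ⟨k, hk⟩ : ∃ k, k = 4 ^ L := ⟨_, rfl⟩
  have hk1 : (1 : ℝ) ≤ k := by rw [hk]; push_cast; exact one_le_pow₀ (by norm_num)
  have hk0 : (0 : ℝ) < k := by linarith
  obtain ⟨m₀, hm₀⟩ : ∃ m₀ : ℕ, (Γ * (2 * q + 1) + α * q ^ 2 * Real.log 2) / (Γ * ε / 2) ≤ m₀ :=
    exists_nat_ge _
  refine ⟨Γ / (q * Real.log 2 * k), by positivity, max m₀ q, ?_⟩
  intro m hm Ω₁ Ω₂ _ _ w₁ w₂ h₁ h₂ s₁ s₂ a b A hA hb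
  have hm1 : m₀ ≤ m := (le_max_left _ _).trans hm
  have hm2 : q ≤ m := (le_max_right _ _).trans hm
  have hm3 : Γ * (2 * q + 1) + α * q ^ 2 * Real.log 2 ≤ Γ * ε / 2 * m := by
    rw [div_le_iff₀' (by positivity)] at hm₀
    refine hm₀.trans ?_
    gcongr
  have r1 := sum_rho_ge h₁ s₁ a m s L hs0 (hq ▸ hm2) A hA
  have r2 := sum_scales_ge h₁ h₂ s₁ s₂ a b m s L (hq ▸ hm2) hη0 h (by rw [← hq]; exact hle q)
    (by rw [← hq, ← hΓ]; exact hΓ0.le) hb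
  have r3 := ent_sum_le h₁ h₂ s₁ s₂ a b (4 ^ L)
  have r4 := hb m 0 (Nat.zero_le _) le_rfl
  rw [scEnt_self, Nat.sub_zero] at r4
  have r4' := scEnt_nonneg h₂ b m 0
  rw [Finset.sum_sub_distrib, Finset.sum_const, Finset.card_range, nsmul_eq_mul] at r2
  rw [← hq] at r1 r2
  rw [← hΓ] at r2
  rw [← hk] at r2 r3
  set R := ∑ j ∈ Finset.range (m - q + 1), rho w₁ a (2 ^ (m - (j + L))) (2 ^ (m - (j + q)))
  set FS := ent (wprod (wpi w₁ k) w₂) (fun x => ∑ l, a (x.1 l) + b x.2)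
  set AB := ent (wprod w₁ w₂) (fun x => a x.1 + b x.2)
  set B := ent w₂ b
  set E := ent w₁ a
  have hn : (((m - q + 1 : ℕ)) : ℝ) = m - q + 1 := by push_cast [Nat.cast_sub hm2]; ring
  rw [hn] at r1 r2
  set n : ℝ := m - q + 1 with hnd
  have hq1 : (1 : ℝ) ≤ q := by
    have : 1 ≤ q := by omega
    exact_mod_cast this
  have hmq : (q : ℝ) ≤ m := by exact_mod_cast hm2
  have hn0 : 0 ≤ n := by linarith
  have hnm : n ≤ m := by linarith
  have t1 : E - (2 * q + 1) - n * ε / 6 ≤ Real.log 2 * R := by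
    have hsr : (0 : ℝ) < s := by exact_mod_cast hs0
    have e1 : n * Real.log 6 ≤ n * (ε * s / 6) := by gcongr; linarith
    have e2 : (2 * q + 1) * Real.log 2 ≤ (2 * q + 1) * 1 := by gcongr
    have e3 : s * (E - (2 * q + 1)) ≤ s * (n * ε / 6 + Real.log 2 * R) := by
      have : s * (E - (2 * q + 1)) ≤ s * (E - (2 * (s + L) + 1) * Real.log 2) :=
        mul_le_mul_of_nonneg_left (by rw [← hqr]; linarith) hsr.le
      linarith
    linarith [le_of_mul_le_mul_left e3 hsr]
  have t2 : n * Real.log 2 * (h q - C - 9) + Γ * (E - (2 * q + 1) - n * ε / 3) ≤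
      q * Real.log 2 * FS := by
    have e1 := mul_le_mul_of_nonneg_left r2 l2.le
    have e2 := mul_le_mul_of_nonneg_left t1 hΓ0.le
    have e3 : Γ * (n * η * Real.log 2) ≤ Γ * (n * ε / 6) := by
      have : n * η * Real.log 2 ≤ n * η * 1 := by gcongr
      rw [hη] at *
      gcongr; linarith
    linarith
  have t3 : n * (Real.log 2 * (α * q) - ε / 6 * Γ) ≤ n * (Real.log 2 * (h q - C - 9)) := by
    gcongr; linarith
  have t4 : q * Real.log 2 * (α * m) + Γ * (E - ε * m) ≤ q * Real.log 2 * FS := by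
    have e1 : Γ * (n * ε / 2) ≤ Γ * (m * ε / 2) := by gcongr
    have e2 : (m - q) * (Real.log 2 * (α * q)) ≤ n * (Real.log 2 * (α * q)) := by
      have : 0 ≤ Real.log 2 * (α * q) := by positivity
      gcongr; linarith
    linarith
  have hql : 0 < q * Real.log 2 := by positivity
  have t5 : α * m + Γ / (q * Real.log 2) * (E - ε * m) ≤ FS := by
    refine le_of_mul_le_mul_left (le_trans (le_of_eq ?_) t4) hql
    field_simp
  have t6 := hle m
  have t7 : k * (h m - C + Γ / (q * Real.log 2 * k) * (E - ε * m)) ≤ k * AB := by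
    have e1 : k * (Γ / (q * Real.log 2 * k) * (E - ε * m)) =
        Γ / (q * Real.log 2) * (E - ε * m) := by field_simp
    have e2 : (k - 1) * (h m - C) ≤ (k - 1) * B :=
      mul_le_mul_of_nonneg_left (by linarith) (by linarith)
    rw [mul_add, e1]
    linarith
  exact le_of_mul_le_mul_left t7 hk0

end SelfConformal

namespace SelfConformal

section Words

variable {Λ : Type} {φ : Λ → ℝ → ℝ}

/-- The derivative of `compWord φ u`, written as the product given by the chain rule. -/
def dWord (φ : Λ → ℝ → ℝ) : List Λ → ℝ → ℝ
  | [], _ => 1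
  | i :: u, x => deriv (φ i) (compWord φ u x) * dWord φ u x

lemma compWord_append (u v : List Λ) (x : ℝ) :
    compWord φ (u ++ v) x = compWord φ u (compWord φ v x) := by
  induction u with
  | nil => rfl
  | cons i u ih => simp [compWord, ih]

lemma dWord_append (u v : List Λ) (x : ℝ) :
    dWord φ (u ++ v) x = dWord φ u (compWord φ v x) * dWord φ v x := by
  induction u with
  | nil => simp [dWord]
  | cons i u ih => simp [dWord, ih, compWord_append, mul_assoc]

lemma zero_mem_unitI : (0 : ℝ) ∈ unitI := by simp [unitI]

lemma convex_unitI : Convex ℝ unitI := convex_Icc 0 1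

lemma abs_sub_le_one {x y : ℝ} (hx : x ∈ unitI) (hy : y ∈ unitI) : |x - y| ≤ 1 := by
  obtain ⟨h1, h2⟩ := hx
  obtain ⟨h3, h4⟩ := hy
  rw [abs_le]; constructor <;> linarith

/-- Uniform regularity of a contracting analytic IFS: contraction rates, bounded distortion and
Lipschitz control of derivatives of compositions. -/
structure Reg (φ : Λ → ℝ → ℝ) (ρ₀ ρ₁ K : ℝ) : Prop where
  anal : ∀ i, AnalyticOnNhd ℝ (φ i) unitI
  maps : ∀ i, Set.MapsTo (φ i) unitI unitI
  pos : 0 < ρ₀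
  lt_one : ρ₁ < 1
  lower : ∀ i, ∀ x ∈ unitI, ρ₀ ≤ |deriv (φ i) x|
  upper : ∀ i, ∀ x ∈ unitI, |deriv (φ i) x| ≤ ρ₁
  one_le : 1 ≤ K
  dist : ∀ u, ∀ x ∈ unitI, ∀ y ∈ unitI, |dWord φ u x| ≤ K * |dWord φ u y|
  lip : ∀ u, ∀ x ∈ unitI, ∀ y ∈ unitI,
    |dWord φ u x - dWord φ u y| ≤ K * |dWord φ u y| * |x - y|

lemma mapsTo_compWord (maps : ∀ i, Set.MapsTo (φ i) unitI unitI) (u : List Λ) :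
    Set.MapsTo (compWord φ u) unitI unitI := by
  induction u with
  | nil => exact fun x hx => hx
  | cons i u ih => exact (maps i).comp ih

lemma analyticOnNhd_compWord (anal : ∀ i, AnalyticOnNhd ℝ (φ i) unitI)
    (maps : ∀ i, Set.MapsTo (φ i) unitI unitI) (u : List Λ) :
    AnalyticOnNhd ℝ (compWord φ u) unitI := by
  induction u with
  | nil => exact fun x _ => analyticAt_id
  | cons i u ih =>
    exact fun x hx => (anal i _ (mapsTo_compWord maps u hx)).comp (ih x hx)

lemma hasDerivAt_compWord (anal : ∀ i, AnalyticOnNhd ℝ (φ i) unitI)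
    (maps : ∀ i, Set.MapsTo (φ i) unitI unitI) (u : List Λ) {x : ℝ} (hx : x ∈ unitI) :
    HasDerivAt (compWord φ u) (dWord φ u x) x := by
  induction u with
  | nil => exact hasDerivAt_id x
  | cons i u ih =>
    exact ((anal i _ (mapsTo_compWord maps u hx)).differentiableAt.hasDerivAt).comp x ih

lemma abs_dWord_le {ρ₁ : ℝ} (h0 : 0 ≤ ρ₁) (maps : ∀ i, Set.MapsTo (φ i) unitI unitI)
    (upper : ∀ i, ∀ x ∈ unitI, |deriv (φ i) x| ≤ ρ₁) (u : List Λ) {x : ℝ} (hx : x ∈ unitI) :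
    |dWord φ u x| ≤ ρ₁ ^ u.length := by
  induction u with
  | nil => simp [dWord]
  | cons i u ih =>
    rw [dWord, abs_mul, List.length_cons, pow_succ']
    exact mul_le_mul (upper i _ (mapsTo_compWord maps u hx)) ih (abs_nonneg _) h0

lemma le_abs_dWord {ρ₀ : ℝ} (h0 : 0 ≤ ρ₀) (maps : ∀ i, Set.MapsTo (φ i) unitI unitI)
    (lower : ∀ i, ∀ x ∈ unitI, ρ₀ ≤ |deriv (φ i) x|) (u : List Λ) {x : ℝ} (hx : x ∈ unitI) :
    ρ₀ ^ u.length ≤ |dWord φ u x| := by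
  induction u with
  | nil => simp [dWord]
  | cons i u ih =>
    rw [dWord, abs_mul, List.length_cons, pow_succ']
    exact mul_le_mul (lower i _ (mapsTo_compWord maps u hx)) ih (pow_nonneg h0 _) (abs_nonneg _)

lemma abs_sub_compWord_le_of_abs_dWord (anal : ∀ i, AnalyticOnNhd ℝ (φ i) unitI)
    (maps : ∀ i, Set.MapsTo (φ i) unitI unitI) (u : List Λ) {C x y : ℝ} (hx : x ∈ unitI)
    (hy : y ∈ unitI) (hC : ∀ z ∈ unitI, |dWord φ u z| ≤ C) :
    |compWord φ u x - compWord φ u y| ≤ C * |x - y| := by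
  refine convex_unitI.norm_image_sub_le_of_norm_hasDerivWithin_le (f := compWord φ u)
    (f' := dWord φ u) (fun z hz => (hasDerivAt_compWord anal maps u hz).hasDerivWithinAt) hC hy hx

lemma exp_mul_sub_one_le {t d : ℝ} (hd0 : 0 ≤ d) (hd1 : d ≤ 1) :
    Real.exp (t * d) - 1 ≤ d * (Real.exp t - 1) := by
  have := convexOn_exp.2 (Set.mem_univ t) (Set.mem_univ 0) hd0 (by linarith : 0 ≤ 1 - d) (by ring)
  simp only [smul_eq_mul, mul_zero, add_zero, Real.exp_zero, mul_one] at this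
  rw [mul_comm t d]; linarith

lemma abs_dWord_sub_le {ρ₀ ρ₁ L : ℝ} (anal : ∀ i, AnalyticOnNhd ℝ (φ i) unitI)
    (maps : ∀ i, Set.MapsTo (φ i) unitI unitI) (h0 : 0 < ρ₀) (h1 : 0 ≤ ρ₁) (hL : 0 ≤ L)
    (lower : ∀ i, ∀ x ∈ unitI, ρ₀ ≤ |deriv (φ i) x|)
    (upper : ∀ i, ∀ x ∈ unitI, |deriv (φ i) x| ≤ ρ₁)
    (hlip : ∀ i, ∀ x ∈ unitI, ∀ y ∈ unitI, |deriv (φ i) x - deriv (φ i) y| ≤ L * |x - y|)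
    (u : List Λ) {x y : ℝ} (hx : x ∈ unitI) (hy : y ∈ unitI) :
    |dWord φ u x - dWord φ u y| ≤ |dWord φ u y| *
      (Real.exp (L / ρ₀ * (∑ j ∈ Finset.range u.length, ρ₁ ^ j) * |x - y|) - 1) := by
  induction u with
  | nil => simp [dWord]
  | cons i u ih =>
    have mx := mapsTo_compWord maps u hx
    have my := mapsTo_compWord maps u hy
    have hd := abs_sub_compWord_le_of_abs_dWord anal maps u hx hy
      fun z hz => abs_dWord_le h1 maps upper u hz
    rw [List.length_cons, Finset.sum_range_succ]
    set A := L / ρ₀ * (∑ j ∈ Finset.range u.length, ρ₁ ^ j) * |x - y| with hA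
    set e := L / ρ₀ * ρ₁ ^ u.length * |x - y| with he
    have hAe : L / ρ₀ * (∑ j ∈ Finset.range u.length, ρ₁ ^ j + ρ₁ ^ u.length) * |x - y| =
        e + A := by rw [hA, he]; ring
    rw [hAe, Real.exp_add]
    have e0 : 0 ≤ e := by positivity
    have hψ : |deriv (φ i) (compWord φ u x) - deriv (φ i) (compWord φ u y)| ≤
        |deriv (φ i) (compWord φ u y)| * (Real.exp e - 1) := by
      have h2 := hlip i _ mx _ my
      have h3 := lower i _ my
      have h4 : e ≤ Real.exp e - 1 := by linarith [Real.add_one_le_exp e]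
      calc _ ≤ L * (ρ₁ ^ u.length * |x - y|) := h2.trans (by gcongr)
        _ = ρ₀ * e := by rw [he]; field_simp
        _ ≤ _ := by gcongr
    have hsplit : dWord φ (i :: u) x - dWord φ (i :: u) y =
        (deriv (φ i) (compWord φ u x) - deriv (φ i) (compWord φ u y)) *
          (dWord φ u x - dWord φ u y) +
        (deriv (φ i) (compWord φ u x) - deriv (φ i) (compWord φ u y)) * dWord φ u y +
        deriv (φ i) (compWord φ u y) * (dWord φ u x - dWord φ u y) := by
      simp only [dWord]; ring
    rw [hsplit]
    refine (abs_add_three _ _ _).trans ?_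
    simp only [abs_mul, dWord]
    have hE : 1 ≤ Real.exp e := Real.one_le_exp e0
    have p1 := mul_le_mul hψ ih (abs_nonneg _) (by have := abs_nonneg (deriv (φ i) (compWord φ u y)); nlinarith)
    have p2 := mul_le_mul_of_nonneg_right hψ (abs_nonneg (dWord φ u y))
    have p3 := mul_le_mul_of_nonneg_left ih (abs_nonneg (deriv (φ i) (compWord φ u y)))
    linarith

lemma exists_reg [Fintype Λ] [Nonempty Λ] (anal : ∀ i, AnalyticOnNhd ℝ (φ i) unitI)
    (maps : ∀ i, Set.MapsTo (φ i) unitI unitI)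
    (hderiv : ∀ i, ∀ x ∈ unitI, 0 < |deriv (φ i) x| ∧ |deriv (φ i) x| < 1) :
    ∃ ρ₀ ρ₁ K, Reg φ ρ₀ ρ₁ K := by
  have hcomp : IsCompact unitI := isCompact_Icc
  have hne : unitI.Nonempty := ⟨0, zero_mem_unitI⟩
  have hcont : ∀ i, ContinuousOn (fun x => |deriv (φ i) x|) unitI := fun i =>
    (anal i).deriv.continuousOn.abs
  have hmin : ∀ i, ∃ r, 0 < r ∧ ∀ x ∈ unitI, r ≤ |deriv (φ i) x| := fun i => by
    obtain ⟨z, hz, hm⟩ := hcomp.exists_isMinOn hne (hcont i)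
    exact ⟨_, (hderiv i z hz).1, fun x hx => hm hx⟩
  have hmax : ∀ i, ∃ r, r < 1 ∧ ∀ x ∈ unitI, |deriv (φ i) x| ≤ r := fun i => by
    obtain ⟨z, hz, hm⟩ := hcomp.exists_isMaxOn hne (hcont i)
    exact ⟨_, (hderiv i z hz).2, fun x hx => hm hx⟩
  have hlip : ∀ i, ∃ L, 0 ≤ L ∧ ∀ x ∈ unitI, |deriv (deriv (φ i)) x| ≤ L := fun i => by
    obtain ⟨z, hz, hm⟩ := hcomp.exists_isMaxOn hne (anal i).deriv.deriv.continuousOn.abs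
    exact ⟨_, abs_nonneg _, fun x hx => hm hx⟩
  choose r0 h0 h0' using hmin
  choose r1 h1 h1' using hmax
  choose L hL hL' using hlip
  obtain ⟨i0, -, hi0⟩ := Finset.exists_min_image Finset.univ r0 Finset.univ_nonempty
  obtain ⟨i1, -, hi1⟩ := Finset.exists_max_image Finset.univ r1 Finset.univ_nonempty
  obtain ⟨i2, -, hi2⟩ := Finset.exists_max_image Finset.univ L Finset.univ_nonempty
  have lower : ∀ i, ∀ x ∈ unitI, r0 i0 ≤ |deriv (φ i) x| := fun i x hx =>
    (hi0 i (Finset.mem_univ _)).trans (h0' i x hx)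
  have upper : ∀ i, ∀ x ∈ unitI, |deriv (φ i) x| ≤ r1 i1 := fun i x hx =>
    (h1' i x hx).trans (hi1 i (Finset.mem_univ _))
  have r1pos : 0 ≤ r1 i1 := (abs_nonneg _).trans (upper i1 0 zero_mem_unitI)
  have lip : ∀ i, ∀ x ∈ unitI, ∀ y ∈ unitI,
      |deriv (φ i) x - deriv (φ i) y| ≤ L i2 * |x - y| := fun i x hx y hy =>
    convex_unitI.norm_image_sub_le_of_norm_deriv_le (f := deriv (φ i))
      (fun z hz => ((anal i).deriv z hz).differentiableAt)
      (fun z hz => (hL' i z hz).trans (hi2 i (Finset.mem_univ _))) hy hx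
  set S := L i2 / r0 i0 * (1 / (1 - r1 i1)) with hS
  have key : ∀ u, ∀ x ∈ unitI, ∀ y ∈ unitI,
      |dWord φ u x - dWord φ u y| ≤ (Real.exp S - 1) * |dWord φ u y| * |x - y| := by
    intro u x hx y hy
    refine (abs_dWord_sub_le anal maps (h0 i0) r1pos (hL i2) lower upper lip u hx hy).trans ?_
    have hgeo : ∑ j ∈ Finset.range u.length, r1 i1 ^ j ≤ 1 / (1 - r1 i1) := by
      rw [geom_sum_eq (ne_of_lt (h1 i1)), ← neg_div_neg_eq, neg_sub, neg_sub]
      have : 0 < 1 - r1 i1 := by linarith [h1 i1]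
      gcongr
      linarith [pow_nonneg r1pos u.length]
    have h3 : Real.exp (L i2 / r0 i0 * (∑ j ∈ Finset.range u.length, r1 i1 ^ j) * |x - y|) - 1 ≤
        |x - y| * (Real.exp S - 1) := by
      refine le_trans ?_ (exp_mul_sub_one_le (abs_nonneg _) (abs_sub_le_one hx hy))
      have := (h0 i0).le
      have := hL i2
      rw [hS]
      gcongr
    calc _ ≤ |dWord φ u y| * (|x - y| * (Real.exp S - 1)) := by gcongr
      _ = _ := by ring
  have S0 : 0 ≤ S := by
    have := (h0 i0).le
    have := hL i2
    have : 0 < 1 - r1 i1 := by linarith [h1 i1]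
    positivity
  have hS1 := Real.one_le_exp S0
  refine ⟨r0 i0, r1 i1, Real.exp S, anal, maps, h0 i0, h1 i1, lower, upper, hS1, ?_, ?_⟩
  · intro u x hx y hy
    have h2 := key u x hx y hy
    have h3 := abs_sub_le_one hx hy
    have h4 : (Real.exp S - 1) * |dWord φ u y| * |x - y| ≤ (Real.exp S - 1) * |dWord φ u y| :=
      mul_le_of_le_one_right (mul_nonneg (by linarith) (abs_nonneg _)) h3
    have h5 := abs_sub_abs_le_abs_sub (dWord φ u x) (dWord φ u y)
    linarith
  · intro u x hx y hy
    refine (key u x hx y hy).trans ?_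
    gcongr
    linarith

namespace Reg

variable {ρ₀ ρ₁ K : ℝ}

lemma mapsTo (hR : Reg φ ρ₀ ρ₁ K) (u : List Λ) : Set.MapsTo (compWord φ u) unitI unitI := mapsTo_compWord hR.maps u

lemma mem (hR : Reg φ ρ₀ ρ₁ K) (u : List Λ) {x : ℝ} (hx : x ∈ unitI) : compWord φ u x ∈ unitI := hR.mapsTo u hx

lemma analytic (hR : Reg φ ρ₀ ρ₁ K) (u : List Λ) : AnalyticOnNhd ℝ (compWord φ u) unitI :=
  analyticOnNhd_compWord hR.anal hR.maps u

lemma hasDerivAt (hR : Reg φ ρ₀ ρ₁ K) (u : List Λ) {x : ℝ} (hx : x ∈ unitI) :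
    HasDerivAt (compWord φ u) (dWord φ u x) x :=
  hasDerivAt_compWord hR.anal hR.maps u hx

lemma le_abs_dWord (hR : Reg φ ρ₀ ρ₁ K) (u : List Λ) {x : ℝ} (hx : x ∈ unitI) :
    ρ₀ ^ u.length ≤ |dWord φ u x| :=
  SelfConformal.le_abs_dWord hR.pos.le hR.maps hR.lower u hx

lemma dWord_pos (hR : Reg φ ρ₀ ρ₁ K) (u : List Λ) {x : ℝ} (hx : x ∈ unitI) : 0 < |dWord φ u x| :=
  (pow_pos hR.pos _).trans_le (hR.le_abs_dWord u hx)

lemma Kpos (hR : Reg φ ρ₀ ρ₁ K) : 0 < K := zero_lt_one.trans_le hR.one_le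

lemma abs_sub_le (hR : Reg φ ρ₀ ρ₁ K) (u : List Λ) {x y z : ℝ} (hx : x ∈ unitI) (hy : y ∈ unitI) (hz : z ∈ unitI) :
    |compWord φ u x - compWord φ u y| ≤ K * |dWord φ u z| * |x - y| :=
  abs_sub_compWord_le_of_abs_dWord hR.anal hR.maps u hx hy fun t ht => hR.dist u t ht z hz

lemma le_abs_sub (hR : Reg φ ρ₀ ρ₁ K) (u : List Λ) {x y z : ℝ} (hx : x ∈ unitI) (hy : y ∈ unitI) (hz : z ∈ unitI) :
    |dWord φ u z| * |x - y| ≤ K * |compWord φ u x - compWord φ u y| := by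
  wlog hxy : x < y generalizing x y
  · rcases (not_lt.1 hxy).eq_or_lt with h | h
    · simp [h]
    · rw [abs_sub_comm x y, abs_sub_comm (compWord φ u x)]
      exact this hy hx h
  have hsub : Set.Icc x y ⊆ unitI := Set.Icc_subset_Icc hx.1 hy.2
  obtain ⟨c, hc, hc'⟩ := exists_hasDerivAt_eq_slope (compWord φ u) (dWord φ u) hxy
    (fun t ht => (hR.hasDerivAt u (hsub ht)).continuousAt.continuousWithinAt)
    (fun t ht => hR.hasDerivAt u (hsub (Set.Ioo_subset_Icc_self ht)))
  rw [eq_div_iff (by linarith)] at hc'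
  have := hR.dist u z hz c (hsub (Set.Ioo_subset_Icc_self hc))
  rw [abs_sub_comm x y, abs_sub_comm (compWord φ u x), ← hc', abs_mul, ← mul_assoc]
  gcongr

/-- Second order Taylor estimate, uniform in the word. -/
lemma linearise (hR : Reg φ ρ₀ ρ₁ K) (u : List Λ) {x y : ℝ} (hx : x ∈ unitI) (hy : y ∈ unitI) :
    |compWord φ u y - compWord φ u x - dWord φ u x * (y - x)| ≤
      K * |dWord φ u x| * |y - x| ^ 2 := by
  have hsub : Set.uIcc x y ⊆ unitI := Set.uIcc_subset_Icc hx hy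
  have h := (convex_uIcc x y).norm_image_sub_le_of_norm_hasDerivWithin_le
    (f := fun t => compWord φ u t - dWord φ u x * t) (f' := fun t => dWord φ u t - dWord φ u x * 1)
    (C := K * |dWord φ u x| * |y - x|)
    (fun z hz => ((hR.hasDerivAt u (hsub hz)).sub
      ((hasDerivAt_id z).const_mul _)).hasDerivWithinAt) (fun z hz => by
        rw [mul_one, Real.norm_eq_abs]
        refine (hR.lip u z (hsub hz) x hx).trans ?_
        have := hR.Kpos.le
        gcongr ?_ * ?_
        exact Set.abs_sub_left_of_mem_uIcc hz) (Set.left_mem_uIcc) (Set.right_mem_uIcc)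
  rw [Real.norm_eq_abs, Real.norm_eq_abs] at h
  calc _ = |compWord φ u y - dWord φ u x * y - (compWord φ u x - dWord φ u x * x)| := by
        congr 1; ring
    _ ≤ _ := h
    _ = _ := by ring

lemma rho_one_nonneg [Nonempty Λ] (hR : Reg φ ρ₀ ρ₁ K) : 0 ≤ ρ₁ :=
  (abs_nonneg _).trans (hR.upper (Classical.arbitrary Λ) 0 zero_mem_unitI)

lemma rho_one_pos [Nonempty Λ] (hR : Reg φ ρ₀ ρ₁ K) : 0 < ρ₁ :=
  hR.pos.trans_le ((hR.lower (Classical.arbitrary Λ) 0 zero_mem_unitI).trans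
    (hR.upper (Classical.arbitrary Λ) 0 zero_mem_unitI))

lemma abs_dWord_le [Nonempty Λ] (hR : Reg φ ρ₀ ρ₁ K) (u : List Λ) {x : ℝ} (hx : x ∈ unitI) :
    |dWord φ u x| ≤ ρ₁ ^ u.length :=
  SelfConformal.abs_dWord_le hR.rho_one_nonneg hR.maps hR.upper u hx

end Reg

end Words

end SelfConformal

namespace SelfConformal

section SmoothBounds

variable {Λ : Type} {φ : Λ → ℝ → ℝ}

lemma abs_iteratedDeriv_comp_le {g f : ℝ → ℝ} (hg : AnalyticOnNhd ℝ g unitI)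
    (hf : AnalyticOnNhd ℝ f unitI) (hmap : Set.MapsTo f unitI unitI) {n : ℕ} {x C D : ℝ}
    (hx : x ∈ unitI) (hC : ∀ i ≤ n, |iteratedDeriv i g (f x)| ≤ C)
    (hD : ∀ i, 1 ≤ i → i ≤ n → |iteratedDeriv i f x| ≤ D ^ i) :
    |iteratedDeriv n (g ∘ f) x| ≤ n.factorial * C * D ^ n := by
  have hu : UniqueDiffOn ℝ unitI := uniqueDiffOn_Icc zero_lt_one
  have key : ∀ (k : ℕ) (F : ℝ → ℝ) (z : ℝ), AnalyticAt ℝ F z → z ∈ unitI →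
      ‖iteratedFDerivWithin ℝ k F unitI z‖ = |iteratedDeriv k F z| := fun k F z hF hz => by
    rw [iteratedFDerivWithin_eq_iteratedFDeriv hu hF.contDiffAt hz,
      norm_iteratedFDeriv_eq_norm_iteratedDeriv, Real.norm_eq_abs]
  rw [← key n _ x ((hg _ (hmap hx)).comp (hf x hx)) hx]
  refine norm_iteratedFDerivWithin_comp_le (N := n) (hg.contDiffOn hu) (hf.contDiffOn hu) le_rfl hu hu
    hmap hx (fun i hi => ?_) (fun i h1 hi => ?_)
  · rw [key i g _ (hg _ (hmap hx)) (hmap hx)]; exact hC i hi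
  · rw [key i f x (hf x hx) hx]; exact hD i h1 hi

lemma exists_iteratedDeriv_bound [Fintype Λ] {g : Λ → ℝ → ℝ}
    (hg : ∀ i, AnalyticOnNhd ℝ (g i) unitI) (n : ℕ) :
    ∃ C, 0 ≤ C ∧ ∀ i, ∀ k ≤ n, ∀ x ∈ unitI, |iteratedDeriv k (g i) x| ≤ C := by
  have hcomp : IsCompact unitI := isCompact_Icc
  have h1 : ∀ (i : Λ) (k : ℕ), ∃ C, 0 ≤ C ∧ ∀ x ∈ unitI, |iteratedDeriv k (g i) x| ≤ C := by
    intro i k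
    have hc : ContinuousOn (fun x => |iteratedDeriv k (g i) x|) unitI := by
      rw [iteratedDeriv_eq_iterate]
      exact ((hg i).iterated_deriv k).continuousOn.abs
    obtain ⟨z, hz, hm⟩ := hcomp.exists_isMaxOn ⟨0, zero_mem_unitI⟩ hc
    exact ⟨_, abs_nonneg _, fun x hx => hm hx⟩
  choose C hC hC' using h1
  refine ⟨∑ i, ∑ k ∈ Finset.range (n + 1), C i k,
    Finset.sum_nonneg fun i _ => Finset.sum_nonneg fun k _ => hC i k, fun i k hk x hx => ?_⟩
  refine (hC' i k x hx).trans ?_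
  refine (Finset.single_le_sum (f := fun k => C i k) (fun k _ => hC i k)
    (Finset.mem_range.2 (Nat.lt_succ_of_le hk))).trans ?_
  exact Finset.single_le_sum (f := fun i => ∑ k ∈ Finset.range (n + 1), C i k)
    (fun i _ => Finset.sum_nonneg fun k _ => hC i k) (Finset.mem_univ i)

/-- All derivatives of compositions are bounded uniformly in the word. -/
lemma Reg.exists_bound [Fintype Λ] [Nonempty Λ] {ρ₀ ρ₁ K : ℝ} (hR : Reg φ ρ₀ ρ₁ K) (r : ℕ) :
    ∃ C, 1 ≤ C ∧ ∀ k ≤ r, ∀ u, ∀ x ∈ unitI, |iteratedDeriv k (compWord φ u) x| ≤ C := by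
  induction r with
  | zero =>
    refine ⟨1, le_rfl, fun k hk u x hx => ?_⟩
    obtain rfl := Nat.le_zero.1 hk
    have := hR.mem u hx
    rw [iteratedDeriv_zero, abs_le]
    exact ⟨by linarith [this.1], this.2⟩
  | succ r ih =>
    obtain ⟨C, hC1, hC⟩ := ih
    obtain ⟨E, hE0, hE⟩ := exists_iteratedDeriv_bound (fun i => (hR.anal i).deriv) r
    have hρ := hR.rho_one_nonneg
    have hρ1 := hR.lt_one
    set B : ℝ := ∑ j ∈ Finset.range r, (r.choose (j + 1) : ℝ) *
      (((j + 1).factorial : ℝ) * E * C ^ (j + 1)) * C with hB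
    have hB0 : 0 ≤ B := Finset.sum_nonneg fun j _ => by positivity
    have key : ∀ u, ∀ x ∈ unitI, |iteratedDeriv (r + 1) (compWord φ u) x| ≤
        1 + B / (1 - ρ₁) := by
      have hBB : ρ₁ * (1 + B / (1 - ρ₁)) + B ≤ 1 + B / (1 - ρ₁) := by
        have : B / (1 - ρ₁) * (1 - ρ₁) = B := by field_simp [ne_of_gt (sub_pos.2 hρ1)]
        nlinarith
      have hge : 1 ≤ 1 + B / (1 - ρ₁) := by
        have := div_nonneg hB0 (sub_pos.2 hρ1).le
        linarith
      intro u
      induction u with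
      | nil =>
        intro x hx
        change |iteratedDeriv (r + 1) id x| ≤ _
        refine le_trans ?_ hge
        rw [iteratedDeriv_id]
        have := abs_le.2 ⟨by linarith [hx.1], hx.2⟩
        split_ifs <;> simp_all
      | cons i u ihu =>
        intro x hx
        have hfu := hR.analytic u
        have hgd := (hR.anal i).deriv
        have hmem := hR.mem u hx
        have hev : deriv (compWord φ (i :: u)) =ᶠ[nhds x]
            (deriv (φ i) ∘ compWord φ u) * deriv (compWord φ u) := by
          have e1 := (hfu x hx).eventually_analyticAt
          have e2 := (hfu x hx).continuousAt.eventually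
            (hR.anal i _ hmem).eventually_analyticAt
          filter_upwards [e1, e2] with y h1 h2
          exact deriv_comp y h2.differentiableAt h1.differentiableAt
        have a1 : AnalyticAt ℝ (deriv (φ i) ∘ compWord φ u) x := (hgd _ hmem).comp (hfu x hx)
        rw [iteratedDeriv_succ', hev.iteratedDeriv_eq, iteratedDeriv_mul a1.contDiffAt
          (hfu x hx).deriv.contDiffAt, Finset.sum_range_succ']
        refine (abs_add_le _ _).trans ?_
        rw [add_comm]
        refine le_trans (add_le_add ?_ ?_) hBB
        · rw [iteratedDeriv_zero, Nat.choose_zero_right, Nat.cast_one, one_mul, Nat.sub_zero,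
            ← iteratedDeriv_succ', abs_mul]
          exact mul_le_mul (hR.upper i _ hmem) (ihu x hx) (abs_nonneg _) hρ
        · refine (Finset.abs_sum_le_sum_abs _ _).trans (Finset.sum_le_sum fun j hj => ?_)
          have hj' := Finset.mem_range.1 hj
          rw [abs_mul, abs_mul, Nat.abs_cast, ← iteratedDeriv_succ']
          have h1 : |iteratedDeriv (j + 1) (deriv (φ i) ∘ compWord φ u) x| ≤
              ((j + 1).factorial : ℝ) * E * C ^ (j + 1) := by
            refine abs_iteratedDeriv_comp_le hgd hfu (hR.mapsTo u) hx
              (fun k hk => hE i k (by omega) _ hmem) (fun k h1 hk => ?_)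
            exact (hC k (by omega) u x hx).trans (le_self_pow₀ hC1 (by omega))
          have h2 := hC (r - (j + 1) + 1) (by omega) u x hx
          gcongr
    refine ⟨max C (1 + B / (1 - ρ₁)), hC1.trans (le_max_left _ _), fun k hk u x hx => ?_⟩
    rcases Nat.lt_or_ge k (r + 1) with h | h
    · exact (hC k (by omega) u x hx).trans (le_max_left _ _)
    · obtain rfl : k = r + 1 := by omega
      exact (key u x hx).trans (le_max_right _ _)

end SmoothBounds

section Interpolation

lemma interp_aux {a b ℓ c B : ℝ} (hℓ : 0 < ℓ) (hab : b - a ≤ ℓ) (hc : 0 < c) (k : ℕ) :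
    ∀ (F : ℕ → ℝ → ℝ) (δ : ℝ) (t : ℕ → ℝ),
      (∀ r < k, ∀ x ∈ Set.Icc a b, HasDerivAt (F r) (F (r + 1) x) x) →
      (∀ i < 2 ^ k, t i ∈ Set.Icc a b) → (∀ i, i + 1 < 2 ^ k → c * ℓ ≤ t (i + 1) - t i) →
      (∀ i < 2 ^ k, |F 0 (t i)| ≤ δ) → (∀ x ∈ Set.Icc a b, |F k x| ≤ B) →
      ∀ x ∈ Set.Icc a b,
        |F 0 x| ≤ (∑ r ∈ Finset.range k, (2 / c) ^ r) * δ + B * ℓ ^ k ∧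
        (1 ≤ k → ℓ * |F 1 x| ≤ (∑ r ∈ Finset.range k, (2 / c) ^ r) * δ + B * ℓ ^ k) := by
  induction k with
  | zero =>
    intro F δ t _ _ _ _ hB x hx
    refine ⟨by simpa using hB x hx, fun h => absurd h (by norm_num)⟩
  | succ k ih =>
    intro F δ t hF ht hsep hδ hB x hx
    have hz : ∀ i, ∃ z, i < 2 ^ k →
        (z ∈ Set.Ioo (t (2 * i)) (t (2 * i + 1)) ∧ |F 1 z| ≤ 2 / (c * ℓ) * δ) := by
      intro i
      by_cases hi : i < 2 ^ k
      · have h1 : 2 * i + 1 < 2 ^ (k + 1) := by rw [pow_succ]; omega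
        have h0 : 2 * i < 2 ^ (k + 1) := by omega
        have hs := hsep _ h1
        have hpos : 0 < c * ℓ := mul_pos hc hℓ
        have hlt : t (2 * i) < t (2 * i + 1) := by linarith
        have hsub : Set.Icc (t (2 * i)) (t (2 * i + 1)) ⊆ Set.Icc a b :=
          Set.Icc_subset_Icc (ht _ h0).1 (ht _ h1).2
        obtain ⟨z, hz, hz'⟩ := exists_hasDerivAt_eq_slope (F 0) (F 1) hlt
          (fun y hy => (hF 0 (Nat.succ_pos _) y (hsub hy)).continuousAt.continuousWithinAt)
          (fun y hy => hF 0 (Nat.succ_pos _) y (hsub (Set.Ioo_subset_Icc_self hy)))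
        refine ⟨z, fun _ => ⟨hz, ?_⟩⟩
        rw [hz', abs_div, abs_of_pos (sub_pos.2 hlt), div_mul_eq_mul_div]
        have h3 : |F 0 (t (2 * i + 1)) - F 0 (t (2 * i))| ≤ 2 * δ :=
          (abs_sub _ _).trans (by linarith [hδ _ h1, hδ _ h0])
        exact div_le_div₀ ((abs_nonneg _).trans h3) h3 hpos hs
      · exact ⟨0, fun h => absurd h hi⟩
    choose z hz using hz
    have h01 : 0 < 2 ^ (k + 1) := by positivity
    have hstep := ih (fun r => F (r + 1)) (2 / (c * ℓ) * δ) z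
      (fun r hr y hy => hF (r + 1) (by omega) y hy)
      (fun i hi => by
        have h1 : 2 * i + 1 < 2 ^ (k + 1) := by rw [pow_succ]; omega
        obtain ⟨⟨z1, z2⟩, -⟩ := hz i hi
        exact ⟨(ht _ (by omega)).1.trans z1.le, z2.le.trans (ht _ h1).2⟩)
      (fun i hi => by
        have h1 : 2 * i + 1 + 1 < 2 ^ (k + 1) := by rw [pow_succ]; omega
        obtain ⟨⟨_, z2⟩, -⟩ := hz i (by omega)
        obtain ⟨⟨z3, _⟩, -⟩ := hz (i + 1) hi
        have := hsep _ h1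
        have e : 2 * (i + 1) = 2 * i + 1 + 1 := by ring
        rw [e] at z3
        linarith)
      (fun i hi => (hz i hi).2) hB
    set S := ∑ r ∈ Finset.range k, (2 / c) ^ r with hS
    have hS' : ∑ r ∈ Finset.range (k + 1), (2 / c) ^ r = 2 / c * S + 1 := by
      rw [Finset.sum_range_succ', hS, Finset.mul_sum, pow_zero]
      congr 1
      exact Finset.sum_congr rfl fun r _ => pow_succ' _ _
    have hδ0 : 0 ≤ δ := (abs_nonneg _).trans (hδ 0 h01)
    have hb : ∀ y ∈ Set.Icc a b, ℓ * |F 1 y| ≤ 2 / c * S * δ + B * ℓ ^ (k + 1) := fun y hy => by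
      have h1 := mul_le_mul_of_nonneg_left (hstep y hy).1 hℓ.le
      refine h1.trans (le_of_eq ?_)
      field_simp
      ring
    rw [hS']
    refine ⟨?_, fun _ => by linarith [hb x hx]⟩
    have h0 := ht 0 h01
    have hm := (convex_Icc a b).norm_image_sub_le_of_norm_hasDerivWithin_le (f := F 0) (f' := F 1)
      (C := (2 / c * S * δ + B * ℓ ^ (k + 1)) / ℓ)
      (fun y hy => (hF 0 (Nat.succ_pos _) y hy).hasDerivWithinAt)
      (fun y hy => by rw [le_div_iff₀ hℓ, mul_comm]; exact hb y hy) h0 hx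
    rw [Real.norm_eq_abs, Real.norm_eq_abs] at hm
    have hC0 : 0 ≤ (2 / c * S * δ + B * ℓ ^ (k + 1)) / ℓ :=
      div_nonneg ((mul_nonneg hℓ.le (abs_nonneg _)).trans (hb x hx)) hℓ.le
    have hd : |x - t 0| ≤ ℓ := by
      rw [abs_le]; constructor <;> linarith [hx.1, hx.2, h0.1, h0.2]
    have h3 := hm.trans (mul_le_mul_of_nonneg_left hd hC0)
    rw [div_mul_cancel₀ _ hℓ.ne'] at h3
    have h4 := abs_sub_abs_le_abs_sub (F 0 x) (F 0 (t 0))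
    linarith [hδ 0 h01]

/-- A function with bounded `k`-th derivative that is small at `2 ^ k` well separated points of an
interval is small, together with its derivative, on the whole interval. -/
lemma interpolation {a b ℓ c B δ : ℝ} (hℓ : 0 < ℓ) (hab : b - a ≤ ℓ) (hc : 0 < c) {k : ℕ}
    (hk : 1 ≤ k) {F : ℕ → ℝ → ℝ} {ι : Type} [Fintype ι] (hι : Fintype.card ι = 2 ^ k) {t : ι → ℝ}
    (hF : ∀ r < k, ∀ x ∈ Set.Icc a b, HasDerivAt (F r) (F (r + 1) x) x)
    (ht : ∀ i, t i ∈ Set.Icc a b) (hsep : ∀ i j, i ≠ j → c * ℓ ≤ |t i - t j|)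
    (hδ : ∀ i, |F 0 (t i)| ≤ δ) (hB : ∀ x ∈ Set.Icc a b, |F k x| ≤ B) {x : ℝ}
    (hx : x ∈ Set.Icc a b) :
    |F 0 x| ≤ (∑ r ∈ Finset.range k, (2 / c) ^ r) * δ + B * ℓ ^ k ∧
      ℓ * |F 1 x| ≤ (∑ r ∈ Finset.range k, (2 / c) ^ r) * δ + B * ℓ ^ k := by
  classical
  have hpos : 0 < c * ℓ := mul_pos hc hℓ
  have hinj : Function.Injective t := fun i j hij => by
    by_contra hne
    have := hsep i j hne
    rw [hij, sub_self, abs_zero] at this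
    linarith
  have hcard : (Finset.univ.image t).card = 2 ^ k := by
    rw [Finset.card_image_of_injective _ hinj, Finset.card_univ, hι]
  set e := (Finset.univ.image t).orderEmbOfFin hcard with he
  have hmem : ∀ i, ∃ j, t j = e i := fun i => by
    have := (Finset.univ.image t).orderEmbOfFin_mem hcard i
    rw [Finset.mem_image] at this
    obtain ⟨j, -, hj⟩ := this
    exact ⟨j, hj⟩
  have h := interp_aux (B := B) hℓ hab hc k F δ (fun i => if h : i < 2 ^ k then e ⟨i, h⟩ else 0) hF
    (fun i hi => by
      obtain ⟨j, hj⟩ := hmem ⟨i, hi⟩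
      rw [dif_pos hi, ← hj]; exact ht j)
    (fun i hi => by
      have hi' : i < 2 ^ k := by omega
      obtain ⟨j, hj⟩ := hmem ⟨i, hi'⟩
      obtain ⟨j', hj'⟩ := hmem ⟨i + 1, hi⟩
      have hlt : e ⟨i, hi'⟩ < e ⟨i + 1, hi⟩ := e.strictMono (by simp [Fin.lt_def])
      rw [dif_pos hi, dif_pos hi', ← hj, ← hj']
      rw [← hj, ← hj'] at hlt
      have := hsep j' j (fun h => by rw [h] at hlt; exact lt_irrefl _ hlt)
      rwa [abs_of_pos (sub_pos.2 hlt)] at this)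
    (fun i hi => by
      obtain ⟨j, hj⟩ := hmem ⟨i, hi⟩
      rw [dif_pos hi, ← hj]; exact hδ j) hB x hx
  exact ⟨h.1, h.2 hk⟩

end Interpolation

end SelfConformal

namespace SelfConformal

section SeparatedCylinders

variable {Λ : Type} {φ : Λ → ℝ → ℝ} {ρ₀ ρ₁ K : ℝ}

lemma Reg.exists_fixed (hR : Reg φ ρ₀ ρ₁ K) (i : Λ) : ∃ x ∈ unitI, φ i x = x := by
  obtain ⟨x, hx, hf⟩ := exists_mem_Icc_isFixedPt_of_mapsTo (f := φ i) (a := (0 : ℝ)) (b := 1)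
    (hR.anal i).continuousOn zero_le_one (hR.maps i)
  exact ⟨x, hx, hf⟩

lemma compWord_replicate_fixed {i : Λ} {x : ℝ} (h : φ i x = x) (n : ℕ) :
    compWord φ (List.replicate n i) x = x := by
  induction n with
  | zero => rfl
  | succ n ih => simp [List.replicate_succ, compWord, ih, h]

lemma Reg.abs_sub_le_pow [Nonempty Λ] (hR : Reg φ ρ₀ ρ₁ K) (u : List Λ) {x y : ℝ}
    (hx : x ∈ unitI) (hy : y ∈ unitI) :
    |compWord φ u x - compWord φ u y| ≤ ρ₁ ^ u.length := by
  have h := abs_sub_compWord_le_of_abs_dWord hR.anal hR.maps u hx hy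
    (fun z hz => hR.abs_dWord_le u hz)
  exact h.trans (mul_le_of_le_one_right (pow_nonneg hR.rho_one_nonneg _) (abs_sub_le_one hx hy))

lemma Reg.exists_two_cylinders [Nonempty Λ] (hR : Reg φ ρ₀ ρ₁ K)
    (hnofix : ¬ ∃ x ∈ unitI, ∀ i, φ i x = x) :
    ∃ n, ∃ v : Bool → List Λ, ∃ s : ℝ, 0 < s ∧ (∀ b, (v b).length = n) ∧
      ∀ b b', b ≠ b' → ∀ x ∈ unitI, ∀ y ∈ unitI,
        s ≤ |compWord φ (v b) x - compWord φ (v b') y| := by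
  let i : Λ := Classical.arbitrary Λ
  obtain ⟨xi, hxi, hi⟩ := hR.exists_fixed i
  push Not at hnofix
  obtain ⟨j, hj⟩ := hnofix xi hxi
  obtain ⟨xj, hxj, hj'⟩ := hR.exists_fixed j
  have hne : xi ≠ xj := fun h => hj (by rw [h]; exact hj')
  have hpos : 0 < |xi - xj| := abs_pos.2 (sub_ne_zero.2 hne)
  obtain ⟨n, hn⟩ := exists_pow_lt_of_lt_one (show 0 < |xi - xj| / 4 by positivity) hR.lt_one
  have key : ∀ x ∈ unitI, ∀ y ∈ unitI, |xi - xj| / 2 ≤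
      |compWord φ (List.replicate n i) x - compWord φ (List.replicate n j) y| := by
    intro x hx y hy
    have h1 := hR.abs_sub_le_pow (List.replicate n i) hx hxi
    have h2 := hR.abs_sub_le_pow (List.replicate n j) hxj hy
    rw [compWord_replicate_fixed hi, List.length_replicate] at h1
    rw [compWord_replicate_fixed hj', List.length_replicate] at h2
    have h3 := abs_add_three (xi - compWord φ (List.replicate n i) x)
      (compWord φ (List.replicate n i) x - compWord φ (List.replicate n j) y)
      (compWord φ (List.replicate n j) y - xj)
    rw [show xi - compWord φ (List.replicate n i) x +
      (compWord φ (List.replicate n i) x - compWord φ (List.replicate n j) y) +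
      (compWord φ (List.replicate n j) y - xj) = xi - xj by ring] at h3
    rw [abs_sub_comm] at h1 h2
    linarith
  refine ⟨n, fun b => List.replicate n (cond b i j), |xi - xj| / 2, by positivity,
    fun b => List.length_replicate, fun b b' hb x hx y hy => ?_⟩
  cases b <;> cases b'
  · exact absurd rfl hb
  · exact (key y hy x hx).trans_eq (abs_sub_comm _ _)
  · exact key x hx y hy
  · exact absurd rfl hb

/-- There are `2 ^ k` words of equal length with pairwise separated cylinders. -/
lemma Reg.exists_cylinders [Nonempty Λ] (hR : Reg φ ρ₀ ρ₁ K)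
    (hnofix : ¬ ∃ x ∈ unitI, ∀ i, φ i x = x) (k : ℕ) :
    ∃ n, ∃ v : (Fin k → Bool) → List Λ, ∃ s : ℝ, 0 < s ∧ (∀ b, (v b).length = n) ∧
      ∀ b b', b ≠ b' → ∀ x ∈ unitI, ∀ y ∈ unitI,
        s ≤ |compWord φ (v b) x - compWord φ (v b') y| := by
  obtain ⟨n₀, v₀, s₀, hs₀, hl₀, h₀⟩ := hR.exists_two_cylinders hnofix
  induction k with
  | zero =>
    exact ⟨0, fun _ => [], 1, one_pos, fun _ => rfl,
      fun b b' hb => absurd (Subsingleton.elim b b') hb⟩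
  | succ k ih =>
    obtain ⟨n, v, s, hs, hl, h⟩ := ih
    have hK := hR.Kpos
    have hρ := hR.pos
    refine ⟨n₀ + n, fun b => v₀ (b 0) ++ v (fun i => b i.succ), min s₀ (ρ₀ ^ n₀ * s / K),
      lt_min hs₀ (by positivity), fun b => by simp [hl₀, hl], fun b b' hb x hx y hy => ?_⟩
    rw [compWord_append, compWord_append]
    by_cases hb0 : b 0 = b' 0
    · refine (min_le_right _ _).trans ?_
      have hne : (fun i : Fin k => b i.succ) ≠ fun i => b' i.succ := fun he => by
        refine hb (funext fun i => ?_)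
        induction i using Fin.cases with
        | zero => exact hb0
        | succ i => exact congrFun he i
      rw [← hb0]
      have h1 := h _ _ hne x hx y hy
      have mx := hR.mem (v fun i => b i.succ) hx
      have my := hR.mem (v fun i => b' i.succ) hy
      have h2 := hR.le_abs_sub (v₀ (b 0)) mx my mx
      have h3 := hR.le_abs_dWord (v₀ (b 0)) mx
      rw [hl₀] at h3
      rw [div_le_iff₀ hK, mul_comm _ K]
      exact (mul_le_mul h3 h1 hs.le (abs_nonneg _)).trans h2
    · exact (min_le_left _ _).trans (h₀ _ _ hb0 _ (hR.mem _ hx) _ (hR.mem _ hy))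

end SeparatedCylinders

end SelfConformal

namespace SelfConformal

section FloorEntropy

variable {Ω β : Type*} [Fintype Ω] {w : Ω → ℝ}

lemma abs_floor_sub_le {x y : ℝ} {M : ℕ} (h : |x - y| ≤ M) : |⌊x⌋ - ⌊y⌋| ≤ (M : ℤ) := by
  rw [abs_le] at h ⊢
  have h1 : ⌊x⌋ ≤ ⌊y⌋ + M := by
    rw [← Int.floor_add_natCast]; exact Int.floor_le_floor (by linarith)
  have h2 : ⌊y⌋ ≤ ⌊x⌋ + M := by
    rw [← Int.floor_add_natCast]; exact Int.floor_le_floor (by linarith)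
  constructor <;> linarith

lemma abs_sub_le_one_of_floor_eq {x y : ℝ} (h : ⌊x⌋ = ⌊y⌋) : |x - y| ≤ 1 :=
  (Int.abs_sub_lt_one_of_floor_eq_floor h).le

/-- If `f` oscillates by at most `M` on the fibers of `g`, its conditional entropy is bounded. -/
lemma cent_le_of_osc (hw : ∀ ω, 0 ≤ w ω) (f : Ω → ℤ) (g : Ω → β) {M : ℕ}
    (h : ∀ ω ω', g ω = g ω' → |f ω - f ω'| ≤ M) :
    cent w f g ≤ (∑ ω, w ω) * Real.log (2 * M + 1) := by
  classical
  let e : β → ℤ := fun z => if hz : ∃ ω, g ω = z then f hz.choose - M else 0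
  have := cent_le_log_of_near hw f g (M := 2 * M + 1) e (fun ω => by
    have hz : ∃ ω', g ω' = g ω := ⟨ω, rfl⟩
    have he : e (g ω) = f hz.choose - M := dif_pos hz
    have h1 := abs_le.1 (h ω hz.choose hz.choose_spec.symm)
    rw [he]; push_cast
    constructor <;> linarith [h1.1, h1.2])
  exact_mod_cast this

lemma cent_floor_le_of_osc (hw : ∀ ω, 0 ≤ w ω) (f : Ω → ℝ) (g : Ω → β) {M : ℕ}
    (h : ∀ ω ω', g ω = g ω' → |f ω - f ω'| ≤ M) :
    cent w (fun ω => ⌊f ω⌋) g ≤ (∑ ω, w ω) * Real.log (2 * M + 1) :=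
  cent_le_of_osc hw _ g fun ω ω' hg => abs_floor_sub_le (h ω ω' hg)

lemma ent_floor_le (hw : ∀ ω, 0 ≤ w ω) {f g : Ω → ℝ} {M : ℕ} (h : ∀ ω, |f ω - g ω| ≤ M) :
    ent w (fun ω => ⌊f ω⌋) ≤ ent w (fun ω => ⌊g ω⌋) + (∑ ω, w ω) * Real.log (2 * M + 1) :=
  ent_int_le hw fun ω => abs_floor_sub_le (h ω)

/-- Entropy at unit scale under a Lipschitz change of variables. -/
lemma ent_floor_le_of_lipschitz (hw : ∀ ω, 0 ≤ w ω) {f g : Ω → ℝ} {M : ℕ}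
    (h : ∀ ω ω', |f ω - f ω'| ≤ M * |g ω - g ω'|) :
    ent w (fun ω => ⌊f ω⌋) ≤ ent w (fun ω => ⌊g ω⌋) + (∑ ω, w ω) * Real.log (2 * M + 1) := by
  refine (ent_le_add hw _ (fun ω => ⌊g ω⌋)).trans (add_le_add le_rfl ?_)
  refine cent_floor_le_of_osc hw f _ fun ω ω' hg => (h ω ω').trans ?_
  exact mul_le_of_le_one_right (Nat.cast_nonneg _) (abs_sub_le_one_of_floor_eq hg)

lemma ent_le_of_osc (hw : ∀ ω, 0 ≤ w ω) (f : Ω → ℝ) {M : ℕ} (h : ∀ ω ω', |f ω - f ω'| ≤ M) :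
    ent w (fun ω => ⌊f ω⌋) ≤ (∑ ω, w ω) * Real.log (2 * M + 1) :=
  cent_floor_le_of_osc hw f _ fun ω ω' _ => h ω ω'

lemma floor_two_pow_div (x : ℝ) {i j : ℕ} (h : i ≤ j) :
    ⌊2 ^ j * x⌋ / 2 ^ (j - i) = ⌊2 ^ i * x⌋ := by
  have h2 : (0 : ℤ) < 2 ^ (j - i) := by positivity
  rw [← floor_intCast_div _ h2]
  have h3 : (2 : ℝ) ^ j = 2 ^ i * 2 ^ (j - i) := by rw [← pow_add, Nat.add_sub_cancel' h]
  have h4 := Int.floor_div_natCast ((2 : ℝ) ^ j * x) (2 ^ (j - i))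
  have h5 : (2 : ℝ) ^ j * x / ((2 ^ (j - i) : ℕ) : ℝ) = 2 ^ i * x := by
    push_cast; rw [h3]; field_simp
  rw [h5] at h4
  rw [h4, floor_intCast_div _ h2]
  push_cast; rfl

lemma floor_two_pow_determined {x y : ℝ} {i j : ℕ} (h : i ≤ j) (e : ⌊2 ^ j * x⌋ = ⌊2 ^ j * y⌋) :
    ⌊2 ^ i * x⌋ = ⌊2 ^ i * y⌋ := by
  rw [← floor_two_pow_div x h, ← floor_two_pow_div y h, e]

lemma ent_floor_sub (w : Ω → ℝ) (f : Ω → ℝ) {i j : ℕ} (h : i ≤ j) :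
    ent w (fun ω => ⌊2 ^ j * f ω⌋) = ent w (fun ω => ⌊2 ^ i * f ω⌋) +
      cent w (fun ω => ⌊2 ^ j * f ω⌋) (fun ω => ⌊2 ^ i * f ω⌋) :=
  ent_of_determined fun _ _ e => floor_two_pow_determined h e

end FloorEntropy

section WordEntropy

variable {Λ : Type} [Fintype Λ] {φ : Λ → ℝ → ℝ} {ρ₀ ρ₁ K : ℝ} {p : Λ → ℝ}

/-- The image of the base point under the word `Y`. -/
def pt (φ : Λ → ℝ → ℝ) {N : ℕ} (Y : Fin N → Λ) : ℝ := compWord φ (List.ofFn Y) 0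

lemma Reg.pt_mem (hR : Reg φ ρ₀ ρ₁ K) {N : ℕ} (Y : Fin N → Λ) : pt φ Y ∈ unitI :=
  hR.mem _ zero_mem_unitI

lemma isPush_append (p : Λ → ℝ) (a b : ℕ) :
    IsPush (fun x : (Fin a → Λ) × (Fin b → Λ) => (Fin.append x.1 x.2 : Fin (a + b) → Λ))
      (wprod (wpi p a) (wpi p b)) (wpi p (a + b)) :=
  isPush_equiv (Fin.appendEquiv a b) fun ω => by
    simp [wprod, wpi, Fin.appendEquiv, Fin.prod_univ_add]

lemma pt_append {a b : ℕ} (x : Fin a → Λ) (y : Fin b → Λ) :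
    pt φ (Fin.append x y) = compWord φ (List.ofFn x) (pt φ y) := by
  rw [pt, List.ofFn_fin_append, compWord_append, pt]

lemma pt_cons {a : ℕ} (i : Λ) (y : Fin a → Λ) :
    pt φ (Fin.cons i y : Fin (a + 1) → Λ) = φ i (pt φ y) := by
  simp [pt, List.ofFn_succ, compWord]

/-- The entropy of the discretised measure at scale `2 ^ (-r)`. -/
def hEnt (φ : Λ → ℝ → ℝ) (p : Λ → ℝ) (C₀ r : ℕ) : ℝ :=
  ent (wpi p (C₀ * r)) (fun Y => ⌊2 ^ r * pt φ Y⌋)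

lemma two_pow_mul_rho_le {C₀ : ℕ} (h0 : 0 ≤ ρ₁) (hC₀ : ρ₁ ^ C₀ ≤ 1 / 2) (r : ℕ) :
    2 ^ r * ρ₁ ^ (C₀ * r) ≤ 1 := by
  rw [pow_mul, ← mul_pow]
  exact pow_le_one₀ (by positivity) (by linarith)

variable [Nonempty Λ]

lemma hEnt_trunc (hR : Reg φ ρ₀ ρ₁ K) (hp : ∀ i, 0 ≤ p i) (hp1 : ∑ i, p i = 1) {C₀ : ℕ}
    (hC₀ : ρ₁ ^ C₀ ≤ 1 / 2) {r N : ℕ} (hN : C₀ * r ≤ N) :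
    |ent (wpi p N) (fun Y => ⌊2 ^ r * pt φ Y⌋) - hEnt φ p C₀ r| ≤ Real.log 3 := by
  obtain ⟨M, rfl⟩ := Nat.exists_eq_add_of_le hN
  have hnn : ∀ ω, 0 ≤ wprod (wpi p (C₀ * r)) (wpi p M) ω :=
    wprod_nonneg (wpi_nonneg hp _) (wpi_nonneg hp _)
  have hs : ∑ ω, wprod (wpi p (C₀ * r)) (wpi p M) ω = 1 := by
    rw [sum_wprod, sum_wpi hp1, sum_wpi hp1, one_mul]
  have hclose : ∀ ω : (Fin (C₀ * r) → Λ) × (Fin M → Λ),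
      |2 ^ r * pt φ (Fin.append ω.1 ω.2) - 2 ^ r * pt φ ω.1| ≤ ((1 : ℕ) : ℝ) := fun ω => by
    rw [← mul_sub, abs_mul, abs_of_pos (by positivity : (0 : ℝ) < 2 ^ r), pt_append, pt]
    have := hR.abs_sub_le_pow (List.ofFn ω.1) (hR.pt_mem ω.2) zero_mem_unitI
    rw [List.length_ofFn] at this
    refine (mul_le_mul_of_nonneg_left this (by positivity)).trans ?_
    simpa using two_pow_mul_rho_le hR.rho_one_nonneg hC₀ r
  have e1 := (isPush_append p (C₀ * r) M).ent (fun Y => ⌊2 ^ r * pt φ Y⌋)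
  have e2 := (isPush_fst (wpi p (C₀ * r)) (sum_wpi hp1 M)).ent (fun Y => ⌊2 ^ r * pt φ Y⌋)
  have h1 := ent_floor_le hnn hclose
  have h2 := ent_floor_le hnn fun ω => (abs_sub_comm _ _).trans_le (hclose ω)
  rw [e1, e2, hs] at h1
  rw [e1, e2, hs] at h2
  rw [abs_le, hEnt]
  norm_num at h1 h2 ⊢
  constructor <;> linarith

/-- Comparison of the discretised entropy of an affine image of a cylinder with `hEnt`. -/
lemma ent_cylinder_bounds (hR : Reg φ ρ₀ ρ₁ K) (hp : ∀ i, 0 ≤ p i) (hp1 : ∑ i, p i = 1) {C₀ : ℕ}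
    (hC₀ : ρ₁ ^ C₀ ≤ 1 / 2) (B : ℕ) (A t : ℝ) (x : List Λ) {r N : ℕ} (hN : C₀ * r ≤ N) :
    (K ≤ B * (|A| * |dWord φ x 0|) → hEnt φ p C₀ r - (Real.log 3 + Real.log (2 * B + 1)) ≤
      ent (wpi p N) (fun Y => ⌊2 ^ r * (A * compWord φ x (pt φ Y) + t)⌋)) ∧
    (K * (|A| * |dWord φ x 0|) ≤ B →
      ent (wpi p N) (fun Y => ⌊2 ^ r * (A * compWord φ x (pt φ Y) + t)⌋) ≤
        hEnt φ p C₀ r + (Real.log 3 + Real.log (2 * B + 1))) := by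
  have htr := abs_le.1 (hEnt_trunc hR hp hp1 hC₀ hN)
  have hs := sum_wpi hp1 N
  have hw := wpi_nonneg hp N
  have h2r : (0 : ℝ) < 2 ^ r := by positivity
  have e : ∀ Y Y' : Fin N → Λ, |2 ^ r * (A * compWord φ x (pt φ Y) + t) -
      2 ^ r * (A * compWord φ x (pt φ Y') + t)| =
      2 ^ r * (|A| * |compWord φ x (pt φ Y) - compWord φ x (pt φ Y')|) := fun Y Y' => by
    rw [show 2 ^ r * (A * compWord φ x (pt φ Y) + t) - 2 ^ r * (A * compWord φ x (pt φ Y') + t) =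
      2 ^ r * (A * (compWord φ x (pt φ Y) - compWord φ x (pt φ Y'))) by ring, abs_mul, abs_mul,
      abs_of_pos h2r]
  have e' : ∀ Y Y' : Fin N → Λ, |2 ^ r * pt φ Y - 2 ^ r * pt φ Y'| =
      2 ^ r * |pt φ Y - pt φ Y'| := fun Y Y' => by
    rw [← mul_sub, abs_mul, abs_of_pos h2r]
  constructor
  · intro hB
    have := ent_floor_le_of_lipschitz hw (f := fun Y => 2 ^ r * pt φ Y)
      (g := fun Y => 2 ^ r * (A * compWord φ x (pt φ Y) + t)) (M := B) (fun Y Y' => by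
        rw [e, e', ← mul_assoc, mul_comm (B : ℝ), mul_assoc]
        refine mul_le_mul_of_nonneg_left ?_ h2r.le
        have h1 := hR.le_abs_sub x (hR.pt_mem Y) (hR.pt_mem Y') zero_mem_unitI
        have h2 := mul_le_mul_of_nonneg_right hB (abs_nonneg (pt φ Y - pt φ Y'))
        have h3 := mul_le_mul_of_nonneg_left h1 (by positivity : (0 : ℝ) ≤ B * |A|)
        have hK := hR.Kpos
        nlinarith)
    rw [hs, one_mul] at this
    linarith [htr.1]
  · intro hB
    have := ent_floor_le_of_lipschitz hw (g := fun Y => 2 ^ r * pt φ Y)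
      (f := fun Y => 2 ^ r * (A * compWord φ x (pt φ Y) + t)) (M := B) (fun Y Y' => by
        rw [e, e', ← mul_assoc (B : ℝ), mul_comm (B : ℝ), mul_assoc]
        refine mul_le_mul_of_nonneg_left ?_ h2r.le
        have h1 := hR.abs_sub_le x (hR.pt_mem Y) (hR.pt_mem Y') zero_mem_unitI
        have h2 := mul_le_mul_of_nonneg_right hB (abs_nonneg (pt φ Y - pt φ Y'))
        have h3 := mul_le_mul_of_nonneg_left h1 (abs_nonneg A)
        nlinarith)
    rw [hs, one_mul] at this
    linarith [htr.2]

end WordEntropy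

end SelfConformal

namespace SelfConformal

section Tree

variable {Λ : Type} [Fintype Λ] {φ : Λ → ℝ → ℝ} {ρ₀ ρ₁ K : ℝ} {p : Λ → ℝ}

variable [Nonempty Λ]

lemma Reg.dWord_append_le (hR : Reg φ ρ₀ ρ₁ K) (x y : List Λ) :
    |dWord φ (x ++ y) 0| ≤ K * |dWord φ x 0| * ρ₁ ^ y.length := by
  rw [dWord_append, abs_mul]
  have h1 := hR.dist x _ (hR.mem y zero_mem_unitI) 0 zero_mem_unitI
  have h2 := hR.abs_dWord_le y zero_mem_unitI
  exact mul_le_mul h1 h2 (abs_nonneg _) (mul_nonneg hR.Kpos.le (abs_nonneg _))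

lemma Reg.le_dWord_append_singleton (hR : Reg φ ρ₀ ρ₁ K) (x : List Λ) (i : Λ) :
    ρ₀ / K * |dWord φ x 0| ≤ |dWord φ (x ++ [i]) 0| := by
  rw [dWord_append, abs_mul, div_mul_eq_mul_div, div_le_iff₀ hR.Kpos]
  have h1 := hR.dist x 0 zero_mem_unitI _ (hR.mem [i] zero_mem_unitI)
  have h2 := hR.le_abs_dWord [i] zero_mem_unitI
  rw [List.length_singleton, pow_one] at h2
  have h3 := mul_le_mul h2 h1 (abs_nonneg _) (abs_nonneg _)
  linarith

/-- Induction along the tree of words, stopping when the size of the cylinder drops below `σ`. -/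
lemma Reg.tree (hR : Reg φ ρ₀ ρ₁ K) (hp : ∀ i, 0 ≤ p i) {Θ g : ℕ → List Λ → ℝ} {σ : ℝ} {Nb : ℕ}
    (P : List Λ → Prop)
    (hP : ∀ x i, P x → P (x ++ [i]))
    (hΘ : ∀ N x, ∑ i, p i * Θ N (x ++ [i]) ≤ Θ (N + 1) x)
    (hg : ∀ N x, g (N + 1) x ≤ ∑ i, p i * g N (x ++ [i]))
    (hleaf : ∀ N x, P x → Nb ≤ N → ρ₀ / K * σ ≤ |dWord φ x 0| → |dWord φ x 0| ≤ σ →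
      g N x ≤ Θ N x)
    (x : List Λ) (k : ℕ) : ∀ (y : List Λ) (N : ℕ), P (x ++ y) →
      ρ₀ / K * σ ≤ |dWord φ (x ++ y) 0| →
      K * |dWord φ x 0| * ρ₁ ^ (y.length + k) ≤ σ → Nb + k ≤ N →
      g N (x ++ y) ≤ Θ N (x ++ y) := by
  induction k with
  | zero =>
    intro y N hPx h1 h2 hN
    exact hleaf N _ hPx hN h1 ((hR.dWord_append_le x y).trans h2)
  | succ k ih =>
    intro y N hPx h1 h2 hN
    by_cases hs : |dWord φ (x ++ y) 0| ≤ σ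
    · exact hleaf N _ hPx (by omega) h1 hs
    obtain ⟨N, rfl⟩ : ∃ N', N = N' + 1 := ⟨N - 1, by omega⟩
    refine (hg N _).trans (le_trans (Finset.sum_le_sum fun i _ => ?_) (hΘ N _))
    refine mul_le_mul_of_nonneg_left ?_ (hp i)
    rw [List.append_assoc]
    refine ih (y ++ [i]) N (by rw [← List.append_assoc]; exact hP _ _ hPx) ?_ ?_ (by omega)
    · rw [← List.append_assoc]
      refine le_trans ?_ (hR.le_dWord_append_singleton (x ++ y) i)
      have := hR.pos; have := hR.Kpos
      have := not_le.1 hs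
      gcongr
    · rw [List.length_append, List.length_singleton, add_assoc, add_comm 1 k]
      exact h2

lemma compWord_append_pt (x : List Λ) (i : Λ) {N : ℕ} (Y : Fin N → Λ) :
    compWord φ (x ++ [i]) (pt φ Y) = compWord φ x (pt φ (Fin.cons i Y : Fin (N + 1) → Λ)) := by
  rw [compWord_append, pt_cons]; rfl

/-- Lower bound for the conditional entropy between the scales `1` and `2 ^ (-j)` of a cylinder
of size at least of order one. -/
lemma cent_cylinder_ge (hR : Reg φ ρ₀ ρ₁ K) (hp : ∀ i, 0 ≤ p i) (hp1 : ∑ i, p i = 1) {C₀ : ℕ}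
    (hC₀ : ρ₁ ^ C₀ ≤ 1 / 2) {s : ℝ} (hs : 0 < s) (hs1 : K * s ≤ 1) {B : ℕ}
    (hB : K ≤ B * (ρ₀ / K * s)) (A t : ℝ) (x : List Λ) {j k N : ℕ}
    (hx : ρ₀ / K * s ≤ |A| * |dWord φ x 0|) (hk : K * (|A| * |dWord φ x 0|) * ρ₁ ^ k ≤ s)
    (hN : C₀ * j + k ≤ N) :
    hEnt φ p C₀ j - (2 * Real.log 3 + Real.log (2 * B + 1)) ≤
      cent (wpi p N) (fun Y => ⌊2 ^ j * (A * compWord φ x (pt φ Y) + t)⌋)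
        (fun Y => ⌊A * compWord φ x (pt φ Y) + t⌋) := by
  have hA : 0 < |A| := by
    rcases (abs_nonneg A).eq_or_lt with h | h
    · rw [← h, zero_mul] at hx
      have := hR.pos; have := hR.Kpos
      have : 0 < ρ₀ / K * s := by positivity
      linarith
    · exact h
  have hKpos := hR.Kpos
  have htree := hR.tree hp (σ := s / |A|) (Nb := C₀ * j) (fun _ => True) (fun _ _ _ => trivial)
    (g := fun _ _ => hEnt φ p C₀ j - (2 * Real.log 3 + Real.log (2 * B + 1)))
    (Θ := fun N x => cent (wpi p N) (fun Y => ⌊2 ^ j * (A * compWord φ x (pt φ Y) + t)⌋)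
        (fun Y => ⌊A * compWord φ x (pt φ Y) + t⌋)) ?_ ?_ ?_ x k [] N trivial ?_ ?_ hN
  · simpa using htree
  · intro N x
    have h1 := sum_cent_le hp (wpi_nonneg hp N)
      (fun i Y => ⌊2 ^ j * (A * compWord φ (x ++ [i]) (pt φ Y) + t)⌋)
      (fun i Y => ⌊A * compWord φ (x ++ [i]) (pt φ Y) + t⌋)
    refine h1.trans (le_of_eq ?_)
    rw [← (isPush_cons p N).cent]
    simp only [compWord_append_pt]
  · intro N x
    rw [← Finset.sum_mul, hp1, one_mul]
  · intro N x _ hN h1 h2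
    have hlow : ρ₀ / K * s ≤ |A| * |dWord φ x 0| := by
      rw [← mul_div_assoc, div_le_iff₀ hA] at h1; linarith
    have hup : |A| * |dWord φ x 0| ≤ s := by
      rw [le_div_iff₀ hA] at h2; linarith
    have hcyl := (ent_cylinder_bounds hR hp hp1 hC₀ B A t x hN).1
      (hB.trans (by gcongr))
    have hw := wpi_nonneg hp N
    have h3 := ent_le_add hw (fun Y => ⌊2 ^ j * (A * compWord φ x (pt φ Y) + t)⌋)
      (fun Y => ⌊A * compWord φ x (pt φ Y) + t⌋)
    have h4 := ent_le_of_osc hw (fun Y => A * compWord φ x (pt φ Y) + t) (M := 1)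
      (fun Y Y' => by
        rw [add_sub_add_right_eq_sub, ← mul_sub, abs_mul]
        have h5 := hR.abs_sub_le x (hR.pt_mem Y) (hR.pt_mem Y') zero_mem_unitI
        have h6 := abs_sub_le_one (hR.pt_mem Y) (hR.pt_mem Y')
        have h7 : K * |dWord φ x 0| * |pt φ Y - pt φ Y'| ≤ K * |dWord φ x 0| :=
          mul_le_of_le_one_right (by positivity) h6
        have h8 := mul_le_mul_of_nonneg_left (h5.trans h7) hA.le
        have h9 := mul_le_mul_of_nonneg_left hup hKpos.le
        push_cast
        linarith)
    rw [sum_wpi hp1, one_mul] at h4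
    norm_num at h4
    linarith
  · rw [List.append_nil, ← mul_div_assoc, div_le_iff₀ hA]; linarith
  · rw [List.length_nil, zero_add, le_div_iff₀ hA]; linarith

end Tree

section Fekete

variable {Λ : Type} [Fintype Λ] {φ : Λ → ℝ → ℝ} {ρ₀ ρ₁ K : ℝ} {p : Λ → ℝ} [Nonempty Λ]

lemma hEnt_nonneg (hp : ∀ i, 0 ≤ p i) (C₀ r : ℕ) : 0 ≤ hEnt φ p C₀ r :=
  ent_nonneg (wpi_nonneg hp _) _

lemma hEnt_le (hR : Reg φ ρ₀ ρ₁ K) (hp : ∀ i, 0 ≤ p i) (hp1 : ∑ i, p i = 1) (C₀ r : ℕ) :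
    hEnt φ p C₀ r ≤ r * Real.log 2 + Real.log 2 := by
  have h := cent_le_log_of_near (wpi_nonneg hp (C₀ * r)) (fun Y => ⌊2 ^ r * pt φ Y⌋)
    (fun _ => ()) (M := 2 ^ (r + 1)) (fun _ => 0) (fun Y => by
      have h1 := hR.pt_mem Y
      have h2 : (0 : ℝ) < 2 ^ r := by positivity
      refine ⟨Int.floor_nonneg.2 (mul_nonneg h2.le h1.1), ?_⟩
      rw [Int.floor_lt]
      push_cast
      rw [pow_succ]
      nlinarith [h1.2])
  rw [sum_wpi hp1, one_mul] at h
  refine h.trans (le_of_eq ?_)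
  push_cast
  rw [Real.log_pow]; push_cast; ring

lemma exists_pow_mul_le {ρ : ℝ} (h0 : 0 ≤ ρ) (h1 : ρ < 1) (C : ℝ) {s : ℝ} (hs : 0 < s) :
    ∃ k : ℕ, C * ρ ^ k ≤ s := by
  have ht : Tendsto (fun k : ℕ => C * ρ ^ k) atTop (𝓝 (C * 0)) :=
    (tendsto_pow_atTop_nhds_zero_of_lt_one h0 h1).const_mul C
  rw [mul_zero] at ht
  exact ((ht.eventually (gt_mem_nhds hs)).exists).imp fun k hk => hk.le

lemma hEnt_superadd (hR : Reg φ ρ₀ ρ₁ K) (hp : ∀ i, 0 ≤ p i) (hp1 : ∑ i, p i = 1) {C₀ : ℕ}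
    (hC₀ : ρ₁ ^ C₀ ≤ 1 / 2) :
    ∃ C, 0 ≤ C ∧ ∀ r t, hEnt φ p C₀ r + hEnt φ p C₀ t - C ≤ hEnt φ p C₀ (t + r) := by
  have hK := hR.Kpos
  have hρ := hR.pos
  have hs : 0 < min (1 / K) (K / ρ₀) := by positivity
  set s := min (1 / K) (K / ρ₀) with hs_def
  have hs1 : K * s ≤ 1 := by
    have := min_le_left (1 / K) (K / ρ₀)
    rw [← hs_def, le_div_iff₀ hK] at this; linarith
  have hs2 : ρ₀ / K * s ≤ 1 := by
    have := min_le_right (1 / K) (K / ρ₀)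
    rw [← hs_def, le_div_iff₀ hρ] at this
    rw [div_mul_eq_mul_div, div_le_iff₀ hK]; linarith
  obtain ⟨B, hB⟩ := exists_nat_ge (K / (ρ₀ / K * s))
  have hB' : K ≤ B * (ρ₀ / K * s) := by rwa [div_le_iff₀ (by positivity)] at hB
  refine ⟨2 * Real.log 3 + Real.log (2 * B + 1) + 2 * Real.log 3, ?_, fun r t => ?_⟩
  · have h1 := Real.log_nonneg (by norm_num : (1 : ℝ) ≤ 3)
    have h2 := Real.log_nonneg (by linarith [(Nat.cast_nonneg B : (0 : ℝ) ≤ B)] :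
      (1 : ℝ) ≤ 2 * B + 1)
    linarith
  obtain ⟨k, hk⟩ := exists_pow_mul_le hR.rho_one_nonneg hR.lt_one (K * (2 ^ t * 1)) hs
  obtain ⟨N, hN1, hN2⟩ : ∃ N, C₀ * r + k ≤ N ∧ C₀ * (t + r) ≤ N :=
    ⟨max _ _, le_max_left _ _, le_max_right _ _⟩
  have h2t : (1 : ℝ) ≤ 2 ^ t := one_le_pow₀ (by norm_num)
  have h1 := cent_cylinder_ge (φ := φ) hR hp hp1 hC₀ hs hs1 hB' (2 ^ t) 0 [] (j := r) (k := k) (N := N)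
    (by simp only [dWord, abs_pow, Nat.abs_ofNat, abs_one, mul_one]; linarith)
    (by simpa [dWord] using hk) hN1
  have h2 := abs_le.1 (hEnt_trunc hR hp hp1 hC₀ (r := t) (N := N) (by nlinarith))
  have h3 := abs_le.1 (hEnt_trunc hR hp hp1 hC₀ hN2)
  have h4 := ent_floor_sub (wpi p N) (pt φ) (Nat.le_add_right t r)
  simp only [compWord, id, add_zero, ← mul_assoc, ← pow_add, add_comm r t] at h1
  linarith [h2.1, h3.2]

/-- The entropy dimension (in nats per binary scale) exists. -/
lemma exists_entropy_dim (hR : Reg φ ρ₀ ρ₁ K) (hp : ∀ i, 0 ≤ p i) (hp1 : ∑ i, p i = 1) {C₀ : ℕ}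
    (hC₀ : ρ₁ ^ C₀ ≤ 1 / 2) :
    ∃ α C, 0 ≤ α ∧ 0 ≤ C ∧ (∀ r : ℕ, hEnt φ p C₀ r ≤ α * r + C) ∧
      Tendsto (fun r : ℕ => hEnt φ p C₀ r / r) atTop (𝓝 α) := by
  obtain ⟨C, hC, hsup⟩ := hEnt_superadd (φ := φ) (p := p) hR hp hp1 hC₀
  have hsub : Subadditive fun n => C - hEnt φ p C₀ n := fun m n => by
    have := hsup n m
    linarith
  have hl2 := Real.log_nonneg (by norm_num : (1 : ℝ) ≤ 2)
  have hbdd : BddBelow (Set.range fun n : ℕ => (C - hEnt φ p C₀ n) / n) := by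
    refine ⟨-(2 * Real.log 2), ?_⟩
    rintro _ ⟨n, rfl⟩
    rcases Nat.eq_zero_or_pos n with h | h
    · subst h; simp; linarith
    · have hn : (1 : ℝ) ≤ n := by exact_mod_cast h
      dsimp only
      rw [le_div_iff₀ (by linarith)]
      have := hEnt_le (φ := φ) hR hp hp1 C₀ n
      nlinarith
  have ht := hsub.tendsto_lim hbdd
  have hlim : Tendsto (fun r : ℕ => hEnt φ p C₀ r / r) atTop (𝓝 (-hsub.lim)) := by
    have h0 : Tendsto (fun n : ℕ => C / (n : ℝ)) atTop (𝓝 0) := tendsto_const_div_atTop_nhds_zero_nat C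
    have := h0.sub ht
    rw [zero_sub] at this
    refine this.congr fun n => ?_
    rw [← sub_div]; congr 1; ring
  refine ⟨-hsub.lim, C + hEnt φ p C₀ 0, ?_, add_nonneg hC (hEnt_nonneg hp _ _), fun r => ?_, hlim⟩
  · exact ge_of_tendsto' hlim fun r => div_nonneg (hEnt_nonneg hp _ _) (Nat.cast_nonneg _)
  · rcases Nat.eq_zero_or_pos r with h | h
    · subst h; simp; exact hC
    · have := hsub.lim_le_div hbdd h.ne'
      rw [le_div_iff₀ (by exact_mod_cast h)] at this
      have := hEnt_nonneg (φ := φ) hp C₀ 0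
      linarith

end Fekete

end SelfConformal

namespace SelfConformal

/-- The conclusion of `entropy_growth` at the scale `m`. -/
def GrowthAt (h : ℕ → ℝ) (C c ε : ℝ) (m : ℕ) : Prop :=
  ∀ (Ω₁ Ω₂ : Type) [Fintype Ω₁] [Fintype Ω₂]
      (w₁ : Ω₁ → ℝ) (w₂ : Ω₂ → ℝ), (∀ ω, 0 ≤ w₁ ω) → (∀ ω, 0 ≤ w₂ ω) → ∑ ω, w₁ ω = 1 →
      ∑ ω, w₂ ω = 1 → ∀ (a : Ω₁ → ℤ) (b : Ω₂ → ℤ) (A : ℤ), (∀ ω, A ≤ a ω ∧ a ω < A + 2 ^ m) →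
      (∀ j1 j2, j2 ≤ j1 → j1 ≤ m → h (j1 - j2) - C ≤ scEnt w₂ b m j1 - scEnt w₂ b m j2) →
      h m - C + c * (ent w₁ a - ε * m) ≤ ent (wprod w₁ w₂) (fun x => a x.1 + b x.2)

variable {Ω Ω₁ Ω₂ β : Type} [Fintype Ω] [Fintype Ω₁] [Fintype Ω₂]

lemma GrowthAt.unnormalised {h : ℕ → ℝ} {C c ε : ℝ} {m : ℕ} (hG : GrowthAt h C c ε m)
    {w₁ : Ω₁ → ℝ} {w₂ : Ω₂ → ℝ} (h₁ : ∀ ω, 0 ≤ w₁ ω) (h₂ : ∀ ω, 0 ≤ w₂ ω)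
    (s₂ : ∑ ω, w₂ ω = 1) (a : Ω₁ → ℤ) (b : Ω₂ → ℤ) (A : ℤ) (ha : ∀ ω, A ≤ a ω ∧ a ω < A + 2 ^ m)
    (hb : ∀ j1 j2, j2 ≤ j1 → j1 ≤ m → h (j1 - j2) - C ≤ scEnt w₂ b m j1 - scEnt w₂ b m j2) :
    (∑ ω, w₁ ω) * (h m - C) + c * (ent w₁ a - ε * m * ∑ ω, w₁ ω) ≤
      ent (wprod w₁ w₂) (fun x => a x.1 + b x.2) := by
  rcases (Finset.sum_nonneg fun ω _ => h₁ ω : 0 ≤ ∑ ω, w₁ ω).eq_or_lt with h0 | hW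
  · have hz : w₁ = fun ω => 0 * w₁ ω := by
      funext ω
      rw [zero_mul]
      exact (Finset.sum_eq_zero_iff_of_nonneg fun ω _ => h₁ ω).1 h0.symm ω (Finset.mem_univ _)
    have he : ent w₁ a = 0 := by rw [hz, ent_smul le_rfl h₁, zero_mul]
    rw [← h0, he]
    have := ent_nonneg (wprod_nonneg h₁ h₂) (fun x : Ω₁ × Ω₂ => a x.1 + b x.2)
    linarith
  · set W := ∑ ω, w₁ ω with hWdef
    have hn : ∀ ω, 0 ≤ W⁻¹ * w₁ ω := fun ω => mul_nonneg (inv_nonneg.2 hW.le) (h₁ ω)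
    have h1 := hG Ω₁ Ω₂ (fun ω => W⁻¹ * w₁ ω) w₂ hn h₂
      (by rw [← Finset.mul_sum, ← hWdef, inv_mul_cancel₀ hW.ne']) s₂ a b A ha hb
    have e : wprod (fun ω => W⁻¹ * w₁ ω) w₂ = fun x => W⁻¹ * wprod w₁ w₂ x := by
      funext x; simp only [wprod]; ring
    rw [e, ent_smul (inv_nonneg.2 hW.le) (wprod_nonneg h₁ h₂),
      ent_smul (inv_nonneg.2 hW.le) h₁] at h1
    have h2 := mul_le_mul_of_nonneg_left h1 hW.le
    rw [← mul_assoc, mul_inv_cancel₀ hW.ne', one_mul] at h2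
    refine le_trans (le_of_eq ?_) h2
    field_simp

lemma GrowthAt.window {h : ℕ → ℝ} {C c ε : ℝ} {m : ℕ} (hG : GrowthAt h C c ε m)
    {w₁ : Ω₁ → ℝ} {w₂ : Ω₂ → ℝ} (h₁ : ∀ ω, 0 ≤ w₁ ω) (h₂ : ∀ ω, 0 ≤ w₂ ω)
    (s₂ : ∑ ω, w₂ ω = 1) (f : Ω₁ → Ω₂ → ℝ) (a : Ω₁ → ℝ) (g : Ω₁ → β) (b : β → Ω₂ → ℝ) {M : ℕ}
    (hlin : ∀ ω y, |2 ^ m * f ω y - (2 ^ m * a ω + 2 ^ m * b (g ω) y)| ≤ 2)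
    (hcell : ∀ ω ω', g ω = g ω' → ⌊a ω⌋ = ⌊a ω'⌋)
    (hosc : ∀ ω y, |f ω y - a ω| ≤ M)
    (hb : ∀ ω j1 j2, j2 ≤ j1 → j1 ≤ m → h (j1 - j2) - C ≤
      cent w₂ (fun y => ⌊2 ^ j1 * b (g ω) y⌋) (fun y => ⌊2 ^ j2 * b (g ω) y⌋)) :
    (∑ ω, w₁ ω) * (h m - (C + (Real.log (2 * (2 * M + 1 : ℕ) + 1) + Real.log (2 * (4 : ℕ) + 1)))) +
        c * (cent w₁ (fun ω => ⌊2 ^ m * a ω⌋) g - ε * m * ∑ ω, w₁ ω) ≤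
      cent (wprod w₁ w₂) (fun x => ⌊2 ^ m * f x.1 x.2⌋) (fun x => ⌊f x.1 x.2⌋) := by
  classical
  have hw := wprod_nonneg h₁ h₂
  have hsum : ∑ x, wprod w₁ w₂ x = ∑ ω, w₁ ω := by rw [sum_wprod, s₂, mul_one]
  -- remove the conditioning
  have e1 := cent_anti hw (fun x : Ω₁ × Ω₂ => ⌊2 ^ m * f x.1 x.2⌋)
    (g := fun x => ⌊f x.1 x.2⌋) (g' := fun x => (⌊f x.1 x.2⌋, g x.1))
    (fun x x' hx => (Prod.ext_iff.1 hx).1)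
  have e2 := cent_le_add hw (fun x : Ω₁ × Ω₂ => ⌊2 ^ m * f x.1 x.2⌋) (fun x => ⌊f x.1 x.2⌋)
    (fun x => g x.1)
  have e3 := cent_floor_le_of_osc hw (fun x : Ω₁ × Ω₂ => f x.1 x.2) (fun x => g x.1)
    (M := 2 * M + 1) (fun x x' hx => by
      have t1 := abs_le.1 (hosc x.1 x.2)
      have t2 := abs_le.1 (hosc x'.1 x'.2)
      have t3 := abs_le.1 (abs_sub_le_one_of_floor_eq (hcell _ _ hx))
      push_cast
      rw [abs_le]
      constructor <;> linarith [t1.1, t1.2, t2.1, t2.2, t3.1, t3.2])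
  have e4 := cent_le_add' hw
    (fun x : Ω₁ × Ω₂ => ⌊2 ^ m * a x.1⌋ + ⌊2 ^ m * b (g x.1) x.2⌋)
    (fun x : Ω₁ × Ω₂ => ⌊2 ^ m * f x.1 x.2⌋) (fun x => g x.1)
  have e5 := cent_int_le hw (f := fun x : Ω₁ × Ω₂ => ⌊2 ^ m * a x.1⌋ + ⌊2 ^ m * b (g x.1) x.2⌋)
    (g := fun x : Ω₁ × Ω₂ => ⌊2 ^ m * f x.1 x.2⌋) (M := 4) (fun x => by
      have t0 := abs_le.1 (hlin x.1 x.2)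
      have t1 := Int.floor_le (2 ^ m * f x.1 x.2)
      have t2 := Int.lt_floor_add_one (2 ^ m * f x.1 x.2)
      have t3 := Int.floor_le (2 ^ m * a x.1)
      have t4 := Int.lt_floor_add_one (2 ^ m * a x.1)
      have t5 := Int.floor_le (2 ^ m * b (g x.1) x.2)
      have t6 := Int.lt_floor_add_one (2 ^ m * b (g x.1) x.2)
      have t7 : |((⌊2 ^ m * a x.1⌋ + ⌊2 ^ m * b (g x.1) x.2⌋ - ⌊2 ^ m * f x.1 x.2⌋ : ℤ) : ℝ)| ≤
          ((4 : ℤ) : ℝ) := by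
        push_cast
        rw [abs_le]; constructor <;> linarith [t0.1, t0.2]
      exact_mod_cast t7)
  rw [hsum] at e3 e5
  -- the fibres
  have e6 : cent (wprod w₁ w₂)
      (fun x : Ω₁ × Ω₂ => ⌊2 ^ m * a x.1⌋ + ⌊2 ^ m * b (g x.1) x.2⌋) (fun x => g x.1) =
      ∑ z ∈ Finset.univ.image g, ent (wprod (fun ω => if g ω = z then w₁ ω else 0) w₂)
        (fun x : Ω₁ × Ω₂ => ⌊2 ^ m * a x.1⌋ + ⌊2 ^ m * b (g x.1) x.2⌋) := by
    rw [← cent_congr (g := fun x : Ω₁ × Ω₂ => ((), g x.1)) (f := fun x : Ω₁ × Ω₂ =>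
      ⌊2 ^ m * a x.1⌋ + ⌊2 ^ m * b (g x.1) x.2⌋) (fun x x' => by simp) (fun x x' _ => Iff.rfl)]
    rw [cent_fiber _ _ (fun _ => ()) (fun x : Ω₁ × Ω₂ => g x.1) (Finset.univ.image g) (by simp)]
    refine Finset.sum_congr rfl fun z _ => ?_
    unfold ent
    congr 1
    funext x
    by_cases hx : g x.1 = z <;> simp [wprod, hx]
  have e7 : cent w₁ (fun ω => ⌊2 ^ m * a ω⌋) g = ∑ z ∈ Finset.univ.image g,
      ent (fun ω => if g ω = z then w₁ ω else 0) (fun ω => ⌊2 ^ m * a ω⌋) := by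
    rw [← cent_congr (g := fun ω => ((), g ω)) (f := fun ω => ⌊2 ^ m * a ω⌋)
      (fun x x' => by simp) (fun x x' _ => Iff.rfl)]
    rw [cent_fiber _ _ (fun _ => ()) g (Finset.univ.image g) (by simp)]
    rfl
  have e8 : ∑ ω, w₁ ω = ∑ z ∈ Finset.univ.image g, ∑ ω, if g ω = z then w₁ ω else 0 := by
    rw [Finset.sum_comm]
    refine Finset.sum_congr rfl fun ω _ => ?_
    rw [Finset.sum_ite_eq, if_pos (Finset.mem_image_of_mem _ (Finset.mem_univ _))]
  have e9 : (∑ ω, w₁ ω) * (h m - C) +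
      c * (cent w₁ (fun ω => ⌊2 ^ m * a ω⌋) g - ε * m * ∑ ω, w₁ ω) ≤
      cent (wprod w₁ w₂)
      (fun x : Ω₁ × Ω₂ => ⌊2 ^ m * a x.1⌋ + ⌊2 ^ m * b (g x.1) x.2⌋) (fun x => g x.1) := by
    rw [e6, e7, e8, Finset.sum_mul, Finset.mul_sum, ← Finset.sum_sub_distrib, Finset.mul_sum,
      ← Finset.sum_add_distrib]
    refine Finset.sum_le_sum fun z hz => ?_
    obtain ⟨ω₀, -, rfl⟩ := Finset.mem_image.1 hz
    have hpush := isPush_subtype (fun ω => if g ω = g ω₀ then w₁ ω else 0)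
      (P := fun ω => g ω = g ω₀) (fun ω h => if_neg h)
    have hwe : (fun ω : {ω // g ω = g ω₀} => if g ω.1 = g ω₀ then w₁ ω.1 else 0) =
        fun ω => w₁ ω.1 := by funext ω; exact if_pos ω.2
    rw [hwe] at hpush
    have hpush2 := hpush.prod (isPush_id w₂)
    rw [← hpush.total, ← hpush.ent, ← hpush2.ent]
    have hgr := hG.unnormalised (w₁ := fun ω : {ω // g ω = g ω₀} => w₁ ω.1) (fun ω => h₁ _) h₂ s₂
      (fun ω => ⌊2 ^ m * a ω.1⌋) (fun y => ⌊2 ^ m * b (g ω₀) y⌋) (2 ^ m * ⌊a ω₀⌋) (fun ω => by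
        have hc := floor_two_pow_div (a ω.1) (Nat.zero_le m)
        rw [pow_zero, one_mul, Nat.sub_zero, hcell _ _ ω.2] at hc
        have t1 := Int.mul_ediv_add_emod ⌊2 ^ m * a ω.1⌋ (2 ^ m)
        have t2 := Int.emod_nonneg ⌊2 ^ m * a ω.1⌋ (b := 2 ^ m) (by positivity)
        have t3 := Int.emod_lt_of_pos ⌊2 ^ m * a ω.1⌋ (b := 2 ^ m) (by positivity)
        rw [hc] at t1
        constructor <;> linarith) (fun j1 j2 h12 h1m => by
        have t := hb ω₀ j1 j2 h12 h1m
        have t2 := ent_floor_sub w₂ (b (g ω₀)) h12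
        unfold scEnt
        simp only [floor_two_pow_div _ h1m, floor_two_pow_div _ (h12.trans h1m)]
        linarith)
    refine hgr.trans (le_of_eq ?_)
    congr 1
    funext x
    rw [x.1.2]
  linarith

end SelfConformal

namespace SelfConformal

variable {Λ : Type} [Fintype Λ] {φ : Λ → ℝ → ℝ} {ρ₀ ρ₁ K : ℝ} {p : Λ → ℝ} [Nonempty Λ]
variable {Ω₁ β : Type} [Fintype Ω₁]

lemma isPush_cons_snd (w₁ : Ω₁ → ℝ) (p : Λ → ℝ) (N : ℕ) :
    IsPush (fun x : Λ × (Ω₁ × (Fin N → Λ)) => (x.2.1, (Fin.cons x.1 x.2.2 : Fin (N + 1) → Λ)))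
      (wprod p (wprod w₁ (wpi p N))) (wprod w₁ (wpi p (N + 1))) := by
  have h1 := (isPush_id w₁).prod (isPush_cons p N)
  let e : Λ × (Ω₁ × (Fin N → Λ)) ≃ Ω₁ × (Λ × (Fin N → Λ)) :=
    ⟨fun x => (x.2.1, (x.1, x.2.2)), fun y => (y.2.1, (y.1, y.2.2)), fun _ => rfl, fun _ => rfl⟩
  have h2 : IsPush e (wprod p (wprod w₁ (wpi p N))) (wprod w₁ (wprod p (wpi p N))) :=
    isPush_equiv e (fun x => by simp only [wprod, e, Equiv.coe_fn_mk]; ring)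
  exact h1.comp h2

/-- Lower bound for the entropy between the scales `2 ^ (-i)` and `2 ^ (-i-m)` of the image of a
cylinder under a random word. -/
lemma Reg.window (hR : Reg φ ρ₀ ρ₁ K) (hp : ∀ i, 0 ≤ p i) (hp1 : ∑ i, p i = 1) {C₀ : ℕ}
    (hC₀ : ρ₁ ^ C₀ ≤ 1 / 2) {B M : ℕ} (hB : K ≤ B * (ρ₀ / K * (1 / (2 * K)))) (hM : K ^ 2 ≤ M)
    {C c ε : ℝ} {m : ℕ} (hC : 2 * Real.log 3 + Real.log (2 * B + 1) ≤ C)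
    (hG : GrowthAt (hEnt φ p C₀) C c ε m)
    {w₁ : Ω₁ → ℝ} (h₁ : ∀ ω, 0 ≤ w₁ ω) (U : Ω₁ → List Λ) {D : ℝ} (hD : 0 < D)
    (hDl : ∀ ω, D / 2 ≤ |dWord φ (U ω) 0|) (hDu : ∀ ω, |dWord φ (U ω) 0| ≤ D)
    (i : ℕ) (x : List Λ) (𝒢 : ℝ → Ω₁ → β) {σ : ℝ} (hσ : 2 ^ i * D * σ = 1)
    (hcell : ∀ z ω ω', 𝒢 z ω = 𝒢 z ω' →
      ⌊2 ^ i * compWord φ (U ω) z⌋ = ⌊2 ^ i * compWord φ (U ω') z⌋)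
    (hder : ∀ z ∈ compWord φ x '' unitI, ∀ ω ω', 𝒢 z ω = 𝒢 z ω' →
      2 ^ m * 2 ^ i * (|dWord φ (U ω) z - dWord φ (U ω') z| * (K * σ)) ≤ 1)
    (hquad : 2 ^ m * K ^ 4 * σ ≤ 1) (hx : ρ₀ / K * σ ≤ |dWord φ x 0|) {k₁ k₂ N : ℕ}
    (hk₁ : K * |dWord φ x 0| * ρ₁ ^ k₁ ≤ σ)
    (hk₂ : K * (2 ^ m * K) * ρ₁ ^ k₂ ≤ 1 / (2 * K)) (hN : C₀ * m + k₂ + k₁ ≤ N) :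
    ∑ Y, wpi p N Y * ((∑ ω, w₁ ω) * (hEnt φ p C₀ m -
        (C + (Real.log (2 * (2 * M + 1 : ℕ) + 1) + Real.log (2 * (4 : ℕ) + 1)))) +
        c * (cent w₁ (fun ω => ⌊2 ^ m * (2 ^ i * compWord φ (U ω) (compWord φ x (pt φ Y)))⌋)
          (𝒢 (compWord φ x (pt φ Y))) - ε * m * ∑ ω, w₁ ω)) ≤
      cent (wprod w₁ (wpi p N))
        (fun y => ⌊2 ^ m * (2 ^ i * compWord φ (U y.1) (compWord φ x (pt φ y.2)))⌋)
        (fun y => ⌊2 ^ i * compWord φ (U y.1) (compWord φ x (pt φ y.2))⌋) := by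
  classical
  have hK := hR.Kpos
  have hρ₀ := hR.pos
  have hσ0 : 0 < σ := by
    by_contra h
    have : 2 ^ i * D * σ ≤ 0 := mul_nonpos_of_nonneg_of_nonpos (by positivity) (not_lt.1 h)
    linarith
  rcases isEmpty_or_nonempty Ω₁ with hE | hE
  · simp [cent, sent]
  set G : ℝ → ℝ := fun z => (∑ ω, w₁ ω) * (hEnt φ p C₀ m -
        (C + (Real.log (2 * (2 * M + 1 : ℕ) + 1) + Real.log (2 * (4 : ℕ) + 1)))) +
        c * (cent w₁ (fun ω => ⌊2 ^ m * (2 ^ i * compWord φ (U ω) z)⌋)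
          (𝒢 z) - ε * m * ∑ ω, w₁ ω) with hGdef
  have htree := hR.tree hp (σ := σ) (Nb := C₀ * m + k₂) (fun x' => ∃ y, x' = x ++ y)
    (g := fun N x => ∑ Y, wpi p N Y * G (compWord φ x (pt φ Y)))
    (Θ := fun N x => cent (wprod w₁ (wpi p N))
        (fun y => ⌊2 ^ m * (2 ^ i * compWord φ (U y.1) (compWord φ x (pt φ y.2)))⌋)
        (fun y => ⌊2 ^ i * compWord φ (U y.1) (compWord φ x (pt φ y.2))⌋)) ?_ ?_ ?_ ?_
    x k₁ [] N ⟨[], rfl⟩ (by simpa using hx) (by simpa using hk₁) hN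
  · simp only [List.append_nil] at htree
    exact htree
  · rintro x' j ⟨y, rfl⟩
    exact ⟨y ++ [j], by simp⟩
  · intro N x
    have h1 := sum_cent_le hp (wprod_nonneg h₁ (wpi_nonneg hp N))
      (fun j y => ⌊2 ^ m * (2 ^ i * compWord φ (U y.1) (compWord φ (x ++ [j]) (pt φ y.2)))⌋)
      (fun j y => ⌊2 ^ i * compWord φ (U y.1) (compWord φ (x ++ [j]) (pt φ y.2))⌋)
    refine h1.trans (le_of_eq ?_)
    rw [← (isPush_cons_snd w₁ p N).cent]
    simp only [compWord_append_pt]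
  · intro N x
    rw [← (isPush_cons p N).sum, sum_wprod_mul]
    simp only [compWord_append_pt]
    exact le_rfl
  · rintro N x' ⟨y, rfl⟩ hN h1 h2
    set x' := x ++ y with hx'
    have hleaf : ∀ Y₀ : Fin N → Λ, G (compWord φ x' (pt φ Y₀)) ≤ cent (wprod w₁ (wpi p N))
        (fun y => ⌊2 ^ m * (2 ^ i * compWord φ (U y.1) (compWord φ x' (pt φ y.2)))⌋)
        (fun y => ⌊2 ^ i * compWord φ (U y.1) (compWord φ x' (pt φ y.2))⌋) := by
      intro Y₀
      set z := compWord φ x' (pt φ Y₀) with hz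
      have hzI : z ∈ unitI := hR.mem x' (hR.pt_mem Y₀)
      have hzx : z ∈ compWord φ x '' unitI :=
        ⟨compWord φ y (pt φ Y₀), hR.mem y (hR.pt_mem Y₀), by rw [hz, hx', compWord_append]⟩
      have hXz : ∀ Y : Fin N → Λ, |compWord φ x' (pt φ Y) - z| ≤ K * σ := fun Y => by
        have t1 := hR.abs_sub_le x' (hR.pt_mem Y) (hR.pt_mem Y₀) zero_mem_unitI
        have t2 := abs_sub_le_one (hR.pt_mem Y) (hR.pt_mem Y₀)
        calc _ ≤ K * |dWord φ x' 0| * |pt φ Y - pt φ Y₀| := t1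
          _ ≤ K * σ * 1 := by gcongr
          _ = _ := mul_one _
      have hXI : ∀ Y : Fin N → Λ, compWord φ x' (pt φ Y) ∈ unitI := fun Y =>
        hR.mem x' (hR.pt_mem Y)
      have hDz : ∀ ω, |dWord φ (U ω) z| ≤ K * D := fun ω =>
        (hR.dist _ _ hzI 0 zero_mem_unitI).trans (mul_le_mul_of_nonneg_left (hDu ω) hK.le)
      have hDz' : ∀ ω, D / 2 / K ≤ |dWord φ (U ω) z| := fun ω => by
        rw [div_le_iff₀ hK, mul_comm]
        exact (hDl ω).trans (hR.dist _ 0 zero_mem_unitI _ hzI)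
      have h2i : (0 : ℝ) < 2 ^ i := by positivity
      have h2m : (0 : ℝ) < 2 ^ m := by positivity
      refine hG.window h₁ (wpi_nonneg hp N) (sum_wpi hp1 N)
        (fun ω Y => 2 ^ i * compWord φ (U ω) (compWord φ x' (pt φ Y)))
        (fun ω => 2 ^ i * compWord φ (U ω) z) (𝒢 z)
        (fun γ Y => 2 ^ i * (dWord φ (U (Function.invFun (𝒢 z) γ)) z *
          (compWord φ x' (pt φ Y) - z))) (M := M) ?_ (hcell z) ?_ ?_
      · intro ω Y
        set ω' := Function.invFun (𝒢 z) (𝒢 z ω) with hω'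
        have hωω' : 𝒢 z ω = 𝒢 z ω' := (Function.invFun_eq ⟨ω, rfl⟩).symm
        set X := compWord φ x' (pt φ Y)
        have t1 := hR.linearise (U ω) hzI (hXI Y)
        have t2 := hder z hzx ω ω' hωω'
        have t3 : 2 ^ m * 2 ^ i * (K * |dWord φ (U ω) z| * |X - z| ^ 2) ≤ 1 := by
          calc _ ≤ 2 ^ m * 2 ^ i * (K * (K * D) * (K * σ) ^ 2) := by
                gcongr
                · exact hDz ω
                · exact hXz Y
            _ = 2 ^ m * K ^ 4 * σ * (2 ^ i * D * σ) := by ring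
            _ ≤ 1 := by rw [hσ, mul_one]; exact hquad
        have t4 : |(dWord φ (U ω) z - dWord φ (U ω') z) * (X - z)| ≤
            |dWord φ (U ω) z - dWord φ (U ω') z| * (K * σ) := by
          rw [abs_mul]; exact mul_le_mul_of_nonneg_left (hXz Y) (abs_nonneg _)
        have e : 2 ^ m * (2 ^ i * compWord φ (U ω) X) - (2 ^ m * (2 ^ i * compWord φ (U ω) z) +
            2 ^ m * (2 ^ i * (dWord φ (U ω') z * (X - z)))) =
            2 ^ m * 2 ^ i * ((compWord φ (U ω) X - compWord φ (U ω) z - dWord φ (U ω) z * (X - z)) +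
              (dWord φ (U ω) z - dWord φ (U ω') z) * (X - z)) := by ring
        rw [e, abs_mul, abs_of_pos (mul_pos h2m h2i)]
        have t5 := (abs_add_le (compWord φ (U ω) X - compWord φ (U ω) z - dWord φ (U ω) z * (X - z))
          ((dWord φ (U ω) z - dWord φ (U ω') z) * (X - z))).trans (add_le_add t1 t4)
        have t6 := mul_le_mul_of_nonneg_left t5 (mul_pos h2m h2i).le
        rw [mul_add] at t6
        linarith
      · intro ω Y
        rw [← mul_sub, abs_mul, abs_of_pos h2i]
        have t1 := hR.abs_sub_le (U ω) (hXI Y) hzI zero_mem_unitI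
        calc _ ≤ 2 ^ i * (K * D * (K * σ)) := by
              refine mul_le_mul_of_nonneg_left (t1.trans ?_) h2i.le
              have := hDu ω
              have := hXz Y
              gcongr
          _ = K ^ 2 * (2 ^ i * D * σ) := by ring
          _ ≤ M := by rw [hσ, mul_one]; exact hM
      · intro ω j1 j2 h12 h1m
        set ω' := Function.invFun (𝒢 z) (𝒢 z ω) with hω'
        set A : ℝ := 2 ^ j2 * 2 ^ i * dWord φ (U ω') z with hA
        have hAabs : |A| = 2 ^ j2 * 2 ^ i * |dWord φ (U ω') z| := by
          rw [hA, abs_mul, abs_of_pos (by positivity)]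
        have hlow : ρ₀ / K * (1 / (2 * K)) ≤ |A| * |dWord φ x' 0| := by
          rw [hAabs]
          calc ρ₀ / K * (1 / (2 * K)) = 1 * 2 ^ i * (D / 2 / K) * (ρ₀ / K * σ) := by
                field_simp; linarith
            _ ≤ _ := by
              have := hDz' ω'
              have : (1 : ℝ) ≤ 2 ^ j2 := one_le_pow₀ (by norm_num)
              gcongr
        have hup : |A| * |dWord φ x' 0| ≤ 2 ^ m * K := by
          rw [hAabs]
          calc _ ≤ 2 ^ m * 2 ^ i * (K * D) * σ := by
                have := hDz ω'
                gcongr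
                · norm_num
                · exact h12.trans h1m
            _ = 2 ^ m * K * (2 ^ i * D * σ) := by ring
            _ = _ := by rw [hσ, mul_one]
        have hcyl := cent_cylinder_ge hR hp hp1 hC₀ (s := 1 / (2 * K)) (by positivity)
          (by field_simp; norm_num) hB A (-(A * z)) x' (j := j1 - j2) (k := k₂) (N := N) hlow
          (le_trans (by have := hR.rho_one_nonneg; gcongr) hk₂)
          (by
            have : C₀ * (j1 - j2) ≤ C₀ * m := Nat.mul_le_mul_left _ (by omega)
            omega)
        refine le_trans (by linarith) (hcyl.trans (le_of_eq ?_))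
        have e1 : ∀ Y : Fin N → Λ, (2 : ℝ) ^ (j1 - j2) * (A * compWord φ x' (pt φ Y) + -(A * z)) =
            2 ^ j1 * (2 ^ i * (dWord φ (U ω') z * (compWord φ x' (pt φ Y) - z))) := fun Y => by
          rw [← Nat.sub_add_cancel h12, pow_add, Nat.add_sub_cancel, hA]; ring
        have e2 : ∀ Y : Fin N → Λ, (A * compWord φ x' (pt φ Y) + -(A * z)) =
            2 ^ j2 * (2 ^ i * (dWord φ (U ω') z * (compWord φ x' (pt φ Y) - z))) := fun Y => by
          rw [hA]; ring
        simp only [e1]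
        simp only [e2]
    refine (Finset.sum_le_sum fun Y _ =>
      mul_le_mul_of_nonneg_left (hleaf Y) (wpi_nonneg hp N Y)).trans (le_of_eq ?_)
    rw [← Finset.sum_mul, sum_wpi hp1, one_mul]

end SelfConformal

namespace SelfConformal

/-- A form of the averaging principle for independent coordinates. -/
lemma exists_sum_le_of_average {ι Ω : Type} [Fintype ι] [Fintype Ω] [DecidableEq ι] {w : Ω → ℝ}
    (hw : ∀ ω, 0 ≤ w ω) (hw1 : ∑ ω, w ω = 1) (G : ι → (ι → Ω) → ℝ) (θ : ι → ℝ)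
    (h : ∀ l Y, ∑ y, w y * G l (Function.update Y l y) ≤ θ l) :
    ∃ Y, ∑ l, G l Y ≤ ∑ l, θ l := by
  set W : (ι → Ω) → ℝ := fun Y => ∏ j, w (Y j) with hW
  have hW0 : ∀ Y, 0 ≤ W Y := fun Y => Finset.prod_nonneg fun j _ => hw _
  have hW1 : ∑ Y, W Y = 1 := by
    have := (Finset.prod_univ_sum (fun _ : ι => (Finset.univ : Finset Ω)) (fun _ ω => w ω)).symm
    simpa [hw1, Fintype.piFinset_univ] using this
  have key : ∀ l, ∑ Y, W Y * G l Y ≤ θ l := by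
    intro l
    have h1 : ∑ Y, W Y * G l Y = ∑ Y, W Y * ∑ y, w y * G l (Function.update Y l y) := by
      have h2 : ∑ Y, W Y * G l Y = ∑ x : (ι → Ω) × Ω, W x.1 * w x.2 * G l x.1 := by
        rw [Fintype.sum_prod_type]
        refine Finset.sum_congr rfl fun Y _ => ?_
        simp_rw [mul_assoc, ← Finset.mul_sum, ← Finset.sum_mul, hw1, one_mul]
      let e : (ι → Ω) × Ω → (ι → Ω) × Ω := fun x => (Function.update x.1 l x.2, x.1 l)
      have he : Function.Involutive e := by
        rintro ⟨Y, y⟩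
        simp [e]
      rw [h2, ← Equiv.sum_comp (he.toPerm e), Fintype.sum_prod_type]
      refine Finset.sum_congr rfl fun Y _ => ?_
      rw [Finset.mul_sum]
      refine Finset.sum_congr rfl fun y _ => ?_
      have h3 : W (Function.update Y l y) * w (Y l) = W Y * w y := by
        simp only [hW]
        rw [← Finset.mul_prod_erase _ _ (Finset.mem_univ l),
          ← Finset.mul_prod_erase (Finset.univ) (fun j => w (Y j)) (Finset.mem_univ l)]
        have : ∏ j ∈ Finset.univ.erase l, w (Function.update Y l y j) =
            ∏ j ∈ Finset.univ.erase l, w (Y j) :=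
          Finset.prod_congr rfl fun j hj => by
            rw [Function.update_of_ne (Finset.ne_of_mem_erase hj)]
        rw [this, Function.update_self]
        ring
      change W (Function.update Y l y) * w (Y l) * G l (Function.update Y l y) = _
      rw [h3]
      ring
    rw [h1]
    calc _ ≤ ∑ Y, W Y * θ l := Finset.sum_le_sum fun Y _ => mul_le_mul_of_nonneg_left (h l Y) (hW0 Y)
      _ = θ l := by rw [← Finset.sum_mul, hW1, one_mul]
  by_contra! hcon
  have h4 : ∑ Y, W Y * ∑ l, θ l < ∑ Y, W Y * ∑ l, G l Y := by
    have hex : ∃ Y, 0 < W Y := by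
      by_contra! h5
      have : ∑ Y, W Y ≤ 0 := Finset.sum_nonpos fun Y _ => h5 Y
      linarith
    obtain ⟨Y₀, hY₀⟩ := hex
    exact Finset.sum_lt_sum (fun Y _ => mul_le_mul_of_nonneg_left (hcon Y).le (hW0 Y))
      ⟨Y₀, Finset.mem_univ _, mul_lt_mul_of_pos_left (hcon Y₀) hY₀⟩
  rw [← Finset.sum_mul, hW1, one_mul] at h4
  simp_rw [Finset.mul_sum] at h4
  rw [Finset.sum_comm] at h4
  exact absurd h4 (not_lt.2 (Finset.sum_le_sum fun l _ => key l))

variable {Λ : Type} {φ : Λ → ℝ → ℝ} {ρ₀ ρ₁ K : ℝ}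

/-- Two words whose maps are close on a separated family inside a cylinder are close on the whole
cylinder, up to a high power of its size. -/
lemma Reg.exists_close [Fintype Λ] [Nonempty Λ] (hR : Reg φ ρ₀ ρ₁ K) {k : ℕ} (hk : 1 ≤ k)
    {v : (Fin k → Bool) → List Λ} {s : ℝ} (hs : 0 < s)
    (hv : ∀ b b', b ≠ b' → ∀ x ∈ unitI, ∀ y ∈ unitI,
        s ≤ |compWord φ (v b) x - compWord φ (v b') y|) :
    ∃ C, 1 ≤ C ∧ ∀ w u u' : List Λ, ∀ t : (Fin k → Bool) → ℝ, ∀ δ : ℝ,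
      (∀ l, t l ∈ compWord φ (w ++ v l) '' unitI) →
      (∀ l, |compWord φ u (t l) - compWord φ u' (t l)| ≤ δ) →
      ∀ x ∈ compWord φ w '' unitI,
        |compWord φ u x - compWord φ u' x| ≤ C * (δ + |dWord φ w 0| ^ k) ∧
        |dWord φ w 0| * |dWord φ u x - dWord φ u' x| ≤ C * (δ + |dWord φ w 0| ^ k) := by
  obtain ⟨B, hB1, hB⟩ := hR.exists_bound k
  have hK := hR.Kpos
  set c := s / K ^ 2 with hc
  have hc0 : 0 < c := by positivity
  set S := ∑ r ∈ Finset.range k, (2 / c) ^ r with hS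
  have hS1 : 1 ≤ S := by
    have : (2 / c) ^ 0 ≤ S := Finset.single_le_sum (f := fun r => (2 / c) ^ r)
      (fun r _ => by positivity) (Finset.mem_range.2 hk)
    simpa using this
  have hBK : 0 < 2 * B * K ^ k := by positivity
  refine ⟨S + 2 * B * K ^ k, by linarith, ?_⟩
  intro w u u' t δ ht hδ x hx
  set ℓ := |dWord φ w 0| with hℓ
  have hℓ0 : 0 < ℓ := hR.dWord_pos w zero_mem_unitI
  have hδ0 : 0 ≤ δ := (abs_nonneg _).trans (hδ fun _ => true)
  set J := compWord φ w '' unitI with hJ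
  have hJI : J ⊆ unitI := by
    rintro _ ⟨y, hy, rfl⟩
    exact hR.mem w hy
  have hcont : ContinuousOn (compWord φ w) unitI := (hR.analytic w).continuousOn
  have hIc : IsCompact J := (isCompact_Icc (a := (0 : ℝ)) (b := 1)).image_of_continuousOn hcont
  have hIconn : IsConnected J :=
    (isConnected_Icc (zero_le_one (α := ℝ))).image _ hcont
  have hJeq := eq_Icc_of_connected_compact hIconn hIc
  have hab : sSup J - sInf J ≤ K * ℓ := by
    obtain ⟨y, hy, hye⟩ := hIc.sSup_mem hIconn.nonempty
    obtain ⟨z, hz, hze⟩ := hIc.sInf_mem hIconn.nonempty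
    rw [← hye, ← hze]
    refine (le_abs_self _).trans ((hR.abs_sub_le w hy hz zero_mem_unitI).trans ?_)
    exact mul_le_of_le_one_right (by positivity) (abs_sub_le_one hy hz)
  have hint := interpolation (a := sInf J) (b := sSup J) (ℓ := K * ℓ) (c := c) (B := 2 * B) (δ := δ)
    (by positivity) hab hc0 hk
    (F := fun r x => iteratedDeriv r (compWord φ u) x - iteratedDeriv r (compWord φ u') x)
    (ι := Fin k → Bool) (by rw [Fintype.card_fun, Fintype.card_bool, Fintype.card_fin]) (t := t) ?_ ?_ ?_ ?_ ?_ (x := x) (hJeq ▸ hx)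
  · have hD : iteratedDeriv 1 (compWord φ u) x - iteratedDeriv 1 (compWord φ u') x =
        dWord φ u x - dWord φ u' x := by
      rw [iteratedDeriv_one, iteratedDeriv_one, (hR.hasDerivAt u (hJI hx)).deriv,
        (hR.hasDerivAt u' (hJI hx)).deriv]
    have hle : S * δ + 2 * B * (K * ℓ) ^ k ≤ (S + 2 * B * K ^ k) * (δ + ℓ ^ k) := by
      rw [mul_pow]
      have h1 : 0 ≤ S * ℓ ^ k := mul_nonneg (by linarith) (pow_nonneg hℓ0.le _)
      have h2 : 0 ≤ 2 * B * K ^ k * δ := by positivity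
      nlinarith
    refine ⟨?_, ?_⟩
    · have := hint.1.trans hle
      rwa [iteratedDeriv_zero, iteratedDeriv_zero] at this
    · have := hint.2.trans hle
      rw [hD] at this
      refine le_trans ?_ this
      have := hR.one_le
      have h3 : 0 ≤ ℓ * |dWord φ u x - dWord φ u' x| := by positivity
      nlinarith
  · intro r _ y hy
    have hy' : y ∈ unitI := hJI (hJeq ▸ hy)
    have hd : ∀ u, HasDerivAt (iteratedDeriv r (compWord φ u))
        (iteratedDeriv (r + 1) (compWord φ u) y) y := by
      intro u
      rw [iteratedDeriv_succ]
      have : AnalyticAt ℝ (iteratedDeriv r (compWord φ u)) y := by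
        rw [iteratedDeriv_eq_iterate]
        exact (hR.analytic u y hy').iterated_deriv r
      exact this.differentiableAt.hasDerivAt
    exact (hd u).sub (hd u')
  · intro l
    rw [← hJeq]
    obtain ⟨y, hy, hye⟩ := ht l
    rw [← hye, compWord_append]
    exact ⟨_, hR.mem (v l) hy, rfl⟩
  · intro l l' hll
    obtain ⟨y, hy, hye⟩ := ht l
    obtain ⟨z, hz, hze⟩ := ht l'
    rw [← hye, ← hze, compWord_append, compWord_append]
    have h1 := hR.le_abs_sub w (hR.mem (v l) hy) (hR.mem (v l') hz) zero_mem_unitI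
    have h2 := hv l l' hll y hy z hz
    have h3 : ℓ * s ≤ K * |compWord φ w (compWord φ (v l) y) - compWord φ w (compWord φ (v l') z)| :=
      (mul_le_mul_of_nonneg_left h2 hℓ0.le).trans h1
    have h4 : c * (K * ℓ) = ℓ * s / K := by
      rw [hc]; field_simp
    rw [h4, div_le_iff₀ hK]
    linarith
  · intro l
    rw [iteratedDeriv_zero, iteratedDeriv_zero]
    exact hδ l
  · intro y hy
    have hy' : y ∈ unitI := hJI (hJeq ▸ hy)
    refine (abs_sub _ _).trans ?_
    linarith [hB k le_rfl u y hy', hB k le_rfl u' y hy']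

end SelfConformal

namespace SelfConformal

lemma cent_pi_le {Ω ι α β : Type*} [Fintype Ω] [Fintype ι] {w : Ω → ℝ} (hw : ∀ ω, 0 ≤ w ω)
    (f : ι → Ω → α) (g : Ω → β) :
    cent w (fun ω l => f l ω) g ≤ ∑ l, cent w (f l) g := by
  classical
  have key : ∀ s : Finset ι, cent w (fun ω (l : s) => f l ω) g ≤ ∑ l ∈ s, cent w (f l) g := by
    intro s
    induction s using Finset.induction_on with
    | empty =>
      rw [Finset.sum_empty]
      refine (cent_eq_zero fun ω ω' _ => ?_).le
      funext l
      exact absurd l.2 (Finset.notMem_empty _)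
    | insert a s ha ih =>
      rw [Finset.sum_insert ha]
      have h1 : cent w (fun ω (l : ↥(insert a s)) => f l ω) g ≤
          cent w (fun ω => (f a ω, fun l : s => f l ω)) g := by
        refine cent_mono hw fun ω ω' _ h => ?_
        funext l
        rcases Finset.mem_insert.1 l.2 with h2 | h2
        · have := (Prod.mk.inj h).1
          rw [h2]; exact this
        · exact congrFun (Prod.mk.inj h).2 ⟨l, h2⟩
      linarith [cent_pair_le hw (f a) (fun ω (l : s) => f l ω) g]
  refine le_trans (cent_mono hw fun ω ω' _ h => ?_) (key Finset.univ)
  funext l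
  exact congrFun h ⟨l, Finset.mem_univ l⟩

/-- Telescoping of conditional entropies along a refining sequence of observables. -/
lemma sum_cent_succ {Ω β : Type*} [Fintype Ω] (w : Ω → ℝ) (g : ℕ → Ω → β)
    (h : ∀ t ω ω', g (t + 1) ω' = g (t + 1) ω → g t ω' = g t ω) (T : ℕ) :
    ∑ t ∈ Finset.range T, cent w (g (t + 1)) (g t) = ent w (g T) - ent w (g 0) := by
  rw [← Finset.sum_range_sub (fun t => ent w (g t))]
  refine Finset.sum_congr rfl fun t _ => ?_
  have : ent w (g (t + 1)) = ent w (g t) + cent w (g (t + 1)) (g t) := by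
    rw [← ent_pair]
    refine cent_congr (fun _ _ => Iff.rfl) fun ω ω' _ => ?_
    simp only [Prod.mk.injEq]
    exact ⟨fun hh => ⟨hh, h t _ _ hh⟩, fun hh => hh.1⟩
  linarith

variable {Λ : Type} [Fintype Λ] {φ : Λ → ℝ → ℝ} {ρ₀ ρ₁ K : ℝ} {p : Λ → ℝ} [Nonempty Λ]
variable {Ω₁ β : Type} [Fintype Ω₁]

lemma Reg.ent_points_le (hR : Reg φ ρ₀ ρ₁ K) {w₁ : Ω₁ → ℝ} (h₁ : ∀ ω, 0 ≤ w₁ ω)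
    (U : Ω₁ → List Λ) {D : ℝ} (hDu : ∀ ω, |dWord φ (U ω) 0| ≤ D) {ι : Type} [Fintype ι]
    {w : List Λ} {x : ι → ℝ} (hx : ∀ l, x l ∈ compWord φ w '' unitI) (l₀ : ι) {M M₂ q i : ℕ}
    (hM : K ≤ M) (hq : q ≤ i) (hqD : 2 ^ q * D ≤ 1) (hM₂ : 2 ^ i * (K * D * (K * |dWord φ w 0|)) ≤ M₂) :
    ent w₁ (fun ω l => ⌊2 ^ i * compWord φ (U ω) (x l)⌋) ≤
      ent w₁ (fun ω => ⌊2 ^ q * compWord φ (U ω) 0⌋) +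
      (∑ ω, w₁ ω) * (Real.log (2 * (2 ^ (i - q) * (2 * M + 1)) + 1) +
        Fintype.card ι * Real.log (2 * M₂ + 1)) := by
  have hK := hR.Kpos
  have hxI : ∀ l, x l ∈ unitI := fun l => by
    obtain ⟨y, hy, hye⟩ := hx l
    rw [← hye]; exact hR.mem w hy
  have e1 := ent_le_add h₁ (fun ω l => ⌊2 ^ i * compWord φ (U ω) (x l)⌋)
    (fun ω => ⌊2 ^ q * compWord φ (U ω) 0⌋)
  have e2 := cent_le_add' h₁ (fun ω l => ⌊2 ^ i * compWord φ (U ω) (x l)⌋)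
    (fun ω => ⌊2 ^ i * compWord φ (U ω) (x l₀)⌋) (fun ω => ⌊2 ^ q * compWord φ (U ω) 0⌋)
  have e3 := cent_floor_le_of_osc h₁ (fun ω => 2 ^ i * compWord φ (U ω) (x l₀))
    (fun ω => ⌊2 ^ q * compWord φ (U ω) 0⌋) (M := 2 ^ (i - q) * (2 * M + 1)) (by
      intro ω ω' h
      have h0 := abs_sub_le_one_of_floor_eq h
      have hp : (2 : ℝ) ^ i = 2 ^ (i - q) * 2 ^ q := by rw [← pow_add]; congr 1; omega
      have hd : ∀ ω, 2 ^ q * |compWord φ (U ω) (x l₀) - compWord φ (U ω) 0| ≤ M := by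
        intro ω
        have h3 := hR.abs_sub_le (U ω) (hxI l₀) zero_mem_unitI zero_mem_unitI
        have h4 : K * |dWord φ (U ω) 0| * |x l₀ - 0| ≤ K * D :=
          (mul_le_of_le_one_right (by positivity) (abs_sub_le_one (hxI l₀) zero_mem_unitI)).trans
            (mul_le_mul_of_nonneg_left (hDu ω) hK.le)
        calc _ ≤ 2 ^ q * (K * D) := mul_le_mul_of_nonneg_left (h3.trans h4) (by positivity)
          _ = K * (2 ^ q * D) := by ring
          _ ≤ K * 1 := mul_le_mul_of_nonneg_left hqD hK.le
          _ ≤ M := by linarith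
      have h5 : 2 ^ q * |compWord φ (U ω) (x l₀) - compWord φ (U ω') (x l₀)| ≤ 2 * M + 1 := by
        rw [← mul_sub, abs_mul, abs_of_pos (by positivity : (0 : ℝ) < 2 ^ q)] at h0
        have h6 : |compWord φ (U ω) (x l₀) - compWord φ (U ω') (x l₀)| ≤
            |compWord φ (U ω) (x l₀) - compWord φ (U ω) 0| +
            |compWord φ (U ω') (x l₀) - compWord φ (U ω') 0| +
            |compWord φ (U ω) 0 - compWord φ (U ω') 0| := by
          rw [abs_sub_comm (compWord φ (U ω') (x l₀))]
          refine le_trans (le_of_eq ?_) ((abs_add_le _ _).trans (add_le_add_left (abs_add_le _ _) _))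
          ring_nf
        have h7 := mul_le_mul_of_nonneg_left h6 (by positivity : (0 : ℝ) ≤ 2 ^ q)
        linarith [hd ω, hd ω']
      rw [← mul_sub, abs_mul, abs_of_pos (by positivity : (0 : ℝ) < 2 ^ i), hp, mul_assoc]
      push_cast
      exact mul_le_mul_of_nonneg_left h5 (by positivity))
  have e4 := cent_pi_le h₁ (fun l ω => ⌊2 ^ i * compWord φ (U ω) (x l)⌋)
    (fun ω => ⌊2 ^ i * compWord φ (U ω) (x l₀)⌋)
  have e5 : ∀ l, cent w₁ (fun ω => ⌊2 ^ i * compWord φ (U ω) (x l)⌋)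
      (fun ω => ⌊2 ^ i * compWord φ (U ω) (x l₀)⌋) ≤ (∑ ω, w₁ ω) * Real.log (2 * M₂ + 1) := by
    intro l
    refine cent_int_le h₁ fun ω => abs_floor_sub_le ?_
    rw [← mul_sub, abs_mul, abs_of_pos (by positivity : (0 : ℝ) < 2 ^ i)]
    refine le_trans (mul_le_mul_of_nonneg_left ?_ (by positivity)) hM₂
    refine (hR.abs_sub_le (U ω) (hxI l) (hxI l₀) zero_mem_unitI).trans ?_
    have hxx : |x l - x l₀| ≤ K * |dWord φ w 0| := by
      obtain ⟨y, hy, hye⟩ := hx l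
      obtain ⟨z, hz, hze⟩ := hx l₀
      rw [← hye, ← hze]
      exact (hR.abs_sub_le w hy hz zero_mem_unitI).trans
        (mul_le_of_le_one_right (by positivity) (abs_sub_le_one hy hz))
    have hDω := hDu ω
    have hD0 : 0 ≤ D := (abs_nonneg _).trans hDω
    gcongr
  have e6 := Finset.sum_le_sum fun l (_ : l ∈ Finset.univ) => e5 l
  rw [Finset.sum_const, Finset.card_univ, nsmul_eq_mul] at e6
  push_cast at e3
  linarith

/-- Entropy gained over `T` consecutive windows by the images of separated cylinders under a random
word whose derivative has prescribed size. -/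
lemma Reg.windows_total (hR : Reg φ ρ₀ ρ₁ K) (hp : ∀ i, 0 ≤ p i) (hp1 : ∑ i, p i = 1) {C₀ : ℕ}
    (hC₀ : ρ₁ ^ C₀ ≤ 1 / 2) {B M : ℕ} (hB : K ≤ B * (ρ₀ / K * (1 / (2 * K)))) (hM : K ^ 2 ≤ M)
    {C c ε : ℝ} {m : ℕ} (hC : 2 * Real.log 3 + Real.log (2 * B + 1) ≤ C) (hc : 0 ≤ c)
    (hG : GrowthAt (hEnt φ p C₀) C c ε m)
    {k : ℕ} {v : (Fin k → Bool) → List Λ} {Ck : ℝ} (hCk : 1 ≤ Ck)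
    (hclose : ∀ w u u' : List Λ, ∀ t : (Fin k → Bool) → ℝ, ∀ δ : ℝ,
      (∀ l, t l ∈ compWord φ (w ++ v l) '' unitI) →
      (∀ l, |compWord φ u (t l) - compWord φ u' (t l)| ≤ δ) →
      ∀ x ∈ compWord φ w '' unitI,
        |compWord φ u x - compWord φ u' x| ≤ Ck * (δ + |dWord φ w 0| ^ k) ∧
        |dWord φ w 0| * |dWord φ u x - dWord φ u' x| ≤ Ck * (δ + |dWord φ w 0| ^ k))
    {w₁ : Ω₁ → ℝ} (h₁ : ∀ ω, 0 ≤ w₁ ω) (U : Ω₁ → List Λ) {D : ℝ} (hD : 0 < D)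
    (hDl : ∀ ω, D / 2 ≤ |dWord φ (U ω) 0|) (hDu : ∀ ω, |dWord φ (U ω) 0| ≤ D)
    (w : List Λ) {i T q M₂ k₁ k₂ N : ℕ} {s : ℝ}
    (hinj : ∀ ω ω', ω ≠ ω' → ∃ x ∈ compWord φ w '' unitI,
      s ≤ |compWord φ (U ω) x - compWord φ (U ω') x|)
    (hs : Ck * (1 / 2 ^ (i + T * m) + |dWord φ w 0| ^ k) < s)
    (hder : 2 ^ m * K * Ck * (1 / 2 ^ i + |dWord φ w 0| ^ k) ≤ D * |dWord φ w 0|)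
    (hquad : 2 ^ m * K ^ 4 ≤ 2 ^ i * D)
    (hx : ∀ l, ρ₀ / K ≤ 2 ^ i * D * |dWord φ (w ++ v l) 0|)
    (hk₁ : K * ρ₁ ^ k₁ * (2 ^ (i + T * m) * D) ≤ 1)
    (hk₂ : K * (2 ^ m * K) * ρ₁ ^ k₂ ≤ 1 / (2 * K)) (hN : C₀ * m + k₂ + k₁ ≤ N)
    (hq : q ≤ i) (hqD : 2 ^ q * D ≤ 1) (hM₂ : 2 ^ i * (K * D * (K * |dWord φ w 0|)) ≤ M₂) :
    T * 2 ^ k * ((∑ ω, w₁ ω) * (hEnt φ p C₀ m -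
        (C + (Real.log (2 * (2 * M + 1 : ℕ) + 1) + Real.log (2 * (4 : ℕ) + 1))))) +
      c * (ent w₁ (fun ω => ω) - ent w₁ (fun ω => ⌊2 ^ q * compWord φ (U ω) 0⌋) -
        (∑ ω, w₁ ω) * (Real.log (2 * (2 ^ (i - q) * (2 * M + 1)) + 1) +
          2 ^ k * Real.log (2 * M₂ + 1)) - ε * m * (T * 2 ^ k) * ∑ ω, w₁ ω) ≤
    ∑ l, ∑ t ∈ Finset.range T, cent (wprod w₁ (wpi p N))
      (fun y => ⌊2 ^ (i + (t + 1) * m) *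
        compWord φ (U y.1) (compWord φ (w ++ v l) (pt φ y.2))⌋)
      (fun y => ⌊2 ^ (i + t * m) * compWord φ (U y.1) (compWord φ (w ++ v l) (pt φ y.2))⌋) := by
  classical
  have hK := hR.Kpos
  set W := ∑ ω, w₁ ω with hW
  set A := C + (Real.log (2 * (2 * M + 1 : ℕ) + 1) + Real.log (2 * (4 : ℕ) + 1)) with hA
  set pts : ((Fin k → Bool) → (Fin N → Λ)) → (Fin k → Bool) → ℝ :=
    fun Y l => compWord φ (w ++ v l) (pt φ (Y l)) with hpts
  set 𝒢 : ℕ → ((Fin k → Bool) → ℝ) → Ω₁ → ((Fin k → Bool) → ℤ) :=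
    fun t z ω l => ⌊2 ^ (i + t * m) * compWord φ (U ω) (z l)⌋ with h𝒢
  set ℓ := |dWord φ w 0| with hℓ
  have hℓ0 : 0 < ℓ := hR.dWord_pos w zero_mem_unitI
  have hptI : ∀ Y l, pts Y l ∈ compWord φ (w ++ v l) '' unitI := fun Y l =>
    ⟨_, hR.pt_mem (Y l), rfl⟩
  have hsubw : ∀ l z, z ∈ compWord φ (w ++ v l) '' unitI → z ∈ compWord φ w '' unitI := by
    rintro l _ ⟨y, hy, rfl⟩
    rw [compWord_append]
    exact ⟨_, hR.mem (v l) hy, rfl⟩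
  have hδ : ∀ t z ω ω', 𝒢 t z ω = 𝒢 t z ω' →
      ∀ l, |compWord φ (U ω) (z l) - compWord φ (U ω') (z l)| ≤ 1 / 2 ^ (i + t * m) := by
    intro t z ω ω' h l
    have := abs_sub_le_one_of_floor_eq (congrFun h l)
    rw [← mul_sub, abs_mul, abs_of_pos (by positivity : (0 : ℝ) < 2 ^ (i + t * m))] at this
    rw [le_div_iff₀ (by positivity)]
    linarith
  obtain ⟨Y, hY⟩ := exists_sum_le_of_average (wpi_nonneg hp N) (sum_wpi hp1 N)
    (fun l Y => ∑ t ∈ Finset.range T, (W * (hEnt φ p C₀ m - A) +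
        c * (cent w₁ (fun ω => ⌊2 ^ m * (2 ^ (i + t * m) * compWord φ (U ω) (pts Y l))⌋)
          (𝒢 t (pts Y)) - ε * m * W)))
    (fun l => ∑ t ∈ Finset.range T, cent (wprod w₁ (wpi p N))
      (fun y => ⌊2 ^ (i + (t + 1) * m) *
        compWord φ (U y.1) (compWord φ (w ++ v l) (pt φ y.2))⌋)
      (fun y => ⌊2 ^ (i + t * m) * compWord φ (U y.1) (compWord φ (w ++ v l) (pt φ y.2))⌋)) (by
    intro l Y
    simp_rw [Finset.mul_sum]
    rw [Finset.sum_comm]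
    refine Finset.sum_le_sum fun t ht => ?_
    have htT : t * m ≤ T * m := Nat.mul_le_mul_right _ (Finset.mem_range.1 ht).le
    have hpD : 0 < 2 ^ (i + t * m) * D := by positivity
    have hσi : ((2 : ℝ) ^ (i + t * m) * D)⁻¹ ≤ (2 ^ i * D)⁻¹ := by
      gcongr
      · norm_num
      · omega
    have hwin := hR.window hp hp1 hC₀ hB hM hC hG h₁ U hD hDl hDu (i + t * m) (w ++ v l)
      (fun z => 𝒢 t (Function.update (pts Y) l z)) (σ := (2 ^ (i + t * m) * D)⁻¹)
      (mul_inv_cancel₀ hpD.ne')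
      (by
        intro z ω ω' h
        have := congrFun h l
        simpa only [h𝒢, Function.update_self] using this)
      (by
        intro z hz ω ω' h
        have hcl := (hclose w (U ω) (U ω') (Function.update (pts Y) l z) (1 / 2 ^ (i + t * m)) (by
            intro l'
            by_cases hl : l' = l
            · subst hl; simpa using hz
            · rw [Function.update_of_ne hl]; exact hptI Y l')
          (hδ t _ ω ω' h) z (hsubw l z hz)).2
        have h2 : (1 : ℝ) / 2 ^ (i + t * m) ≤ 1 / 2 ^ i := by
          gcongr
          · norm_num
          · omega
        have h3 : ℓ * |dWord φ (U ω) z - dWord φ (U ω') z| * (2 ^ m * K) ≤ D * ℓ := by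
          refine le_trans ?_ hder
          calc _ ≤ Ck * (1 / 2 ^ i + ℓ ^ k) * (2 ^ m * K) := by
                refine mul_le_mul_of_nonneg_right (hcl.trans ?_) (by positivity)
                gcongr
            _ = _ := by ring
        have h4 : |dWord φ (U ω) z - dWord φ (U ω') z| * (2 ^ m * K) ≤ D := by
          refine le_of_mul_le_mul_left ?_ hℓ0
          linarith
        calc _ = |dWord φ (U ω) z - dWord φ (U ω') z| * (2 ^ m * K) *
              (2 ^ (i + t * m) * (2 ^ (i + t * m) * D)⁻¹) := by ring
          _ ≤ D * (2 ^ (i + t * m) * (2 ^ (i + t * m) * D)⁻¹) :=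
              mul_le_mul_of_nonneg_right h4 (by positivity)
          _ = 1 := by field_simp)
      (by
        calc _ ≤ 2 ^ m * K ^ 4 * (2 ^ i * D)⁻¹ := mul_le_mul_of_nonneg_left hσi (by positivity)
          _ ≤ 1 := by rw [← div_eq_mul_inv, div_le_one (by positivity)]; exact hquad)
      (by
        have := hR.pos
        calc _ ≤ ρ₀ / K * (2 ^ i * D)⁻¹ := mul_le_mul_of_nonneg_left hσi (by positivity)
          _ ≤ _ := by
            rw [← div_eq_mul_inv, div_le_iff₀ (by positivity), mul_comm]; exact hx l)
      (k₁ := k₁) (k₂ := k₂) (N := N)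
      (by
        have h1 := hR.abs_dWord_le (w ++ v l) zero_mem_unitI
        have h0 := hR.rho_one_nonneg
        have h2 : |dWord φ (w ++ v l) 0| ≤ 1 := h1.trans (pow_le_one₀ h0 hR.lt_one.le)
        rw [← one_div, le_div_iff₀ hpD]
        refine le_trans ?_ hk₁
        calc _ ≤ K * 1 * ρ₁ ^ k₁ * (2 ^ (i + t * m) * D) := by gcongr
          _ ≤ K * ρ₁ ^ k₁ * (2 ^ (i + T * m) * D) := by
            rw [mul_one]
            gcongr
            norm_num) hk₂ hN
    have hpow : ∀ z : ℝ, 2 ^ (i + (t + 1) * m) * z = 2 ^ m * (2 ^ (i + t * m) * z) := by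
      intro z
      rw [add_mul, one_mul, ← add_assoc, pow_add _ (i + t * m) m]
      ring
    simp only [hpow]
    refine le_trans (le_of_eq ?_) hwin
    refine Finset.sum_congr rfl fun y _ => ?_
    have hupd : pts (Function.update Y l y) =
        Function.update (pts Y) l (compWord φ (w ++ v l) (pt φ y)) := by
      funext l'
      by_cases hl : l' = l
      · subst hl; simp [hpts]
      · simp [hpts, Function.update_of_ne hl]
    rw [hupd, Function.update_self])
  refine le_trans ?_ hY
  have hrefine : ∀ t ω ω', 𝒢 (t + 1) (pts Y) ω' = 𝒢 (t + 1) (pts Y) ω →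
      𝒢 t (pts Y) ω' = 𝒢 t (pts Y) ω := by
    intro t ω ω' h
    funext l
    refine floor_two_pow_determined (j := i + (t + 1) * m) ?_ (congrFun h l)
    rw [add_mul]; omega
  have htel := sum_cent_succ w₁ (fun t => 𝒢 t (pts Y)) hrefine T
  have hsum : ∑ t ∈ Finset.range T, cent w₁ (𝒢 (t + 1) (pts Y)) (𝒢 t (pts Y)) ≤
      ∑ l, ∑ t ∈ Finset.range T, cent w₁
        (fun ω => ⌊2 ^ m * (2 ^ (i + t * m) * compWord φ (U ω) (pts Y l))⌋) (𝒢 t (pts Y)) := by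
    rw [Finset.sum_comm]
    refine Finset.sum_le_sum fun t _ => ?_
    refine le_trans (le_of_eq ?_) (cent_pi_le h₁ _ _)
    congr 1
    funext ω l
    simp only [h𝒢]
    rw [add_mul, one_mul, ← add_assoc, pow_add _ (i + t * m) m]
    ring_nf
  have hfin : ent w₁ (𝒢 T (pts Y)) = ent w₁ (fun ω => ω) := by
    refine cent_congr (fun _ _ => Iff.rfl) fun ω ω' _ => ?_
    refine ⟨fun h => ?_, fun h => by rw [h]⟩
    by_contra hne
    obtain ⟨x, hxw, hxs⟩ := hinj ω' ω hne
    have := (hclose w (U ω') (U ω) (pts Y) _ (hptI Y) (hδ T _ _ _ h) x hxw).1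
    linarith
  have hbase := hR.ent_points_le h₁ U hDu (w := w) (x := pts Y)
    (fun l => hsubw l _ (hptI Y l)) (fun _ => true) (M := M) (M₂ := M₂) (q := q) (i := i)
    (by have := hR.one_le; nlinarith) hq hqD hM₂
  have hcard : (Fintype.card (Fin k → Bool) : ℝ) = 2 ^ k := by
    rw [Fintype.card_fun, Fintype.card_bool, Fintype.card_fin]; norm_num
  rw [hcard] at hbase
  have h𝒢0 : ent w₁ (𝒢 0 (pts Y)) = ent w₁ (fun ω l => ⌊2 ^ i * compWord φ (U ω) (pts Y l)⌋) := by
    simp only [h𝒢, zero_mul, add_zero]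
  simp only [Finset.sum_add_distrib, ← Finset.mul_sum, Finset.sum_sub_distrib, Finset.sum_const,
    Finset.card_univ, Finset.card_range, nsmul_eq_mul, hcard]
  have hmain : ent w₁ (fun ω => ω) - ent w₁ (fun ω => ⌊2 ^ q * compWord φ (U ω) 0⌋) -
        W * (Real.log (2 * (2 ^ (i - q) * (2 * M + 1)) + 1) +
          2 ^ k * Real.log (2 * M₂ + 1)) ≤ ∑ l, ∑ t ∈ Finset.range T, cent w₁
        (fun ω => ⌊2 ^ m * (2 ^ (i + t * m) * compWord φ (U ω) (pts Y l))⌋) (𝒢 t (pts Y)) := by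
    linarith
  have := mul_le_mul_of_nonneg_left hmain hc
  linarith

end SelfConformal

namespace SelfConformal

variable {Λ : Type} [Fintype Λ] {φ : Λ → ℝ → ℝ} {ρ₀ ρ₁ K : ℝ} {p : Λ → ℝ} [Nonempty Λ]
variable {μ : Measure ℝ}

lemma sum_wpi_snoc (p : Λ → ℝ) (n : ℕ) (F : List Λ → ℝ) :
    ∑ x, wpi p (n + 1) x * F (List.ofFn x) =
      ∑ x, wpi p n x * ∑ i, p i * F (List.ofFn x ++ [i]) := by
  rw [← Equiv.sum_comp (Fin.snocEquiv fun _ : Fin (n + 1) => Λ), Fintype.sum_prod_type,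
    Finset.sum_comm]
  refine Finset.sum_congr rfl fun x _ => ?_
  rw [Finset.mul_sum]
  refine Finset.sum_congr rfl fun i _ => ?_
  have h1 : (Fin.snocEquiv fun _ : Fin (n + 1) => Λ) (i, x) = Fin.snoc x i := rfl
  have h2 : List.ofFn (Fin.snoc x i : Fin (n + 1) → Λ) = List.ofFn x ++ [i] := by
    rw [List.ofFn_succ']
    simp
  have h3 : wpi p (n + 1) (Fin.snoc x i : Fin (n + 1) → Λ) = wpi p n x * p i := by
    simp [wpi, Fin.prod_univ_castSucc]
  rw [h1, h2, h3, mul_assoc]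

lemma restrict_unitI (hμI : μ unitIᶜ = 0) : μ.restrict unitI = μ :=
  Measure.restrict_eq_self_of_ae_mem (by rwa [ae_iff])

lemma ae_mem_unitI (hμI : μ unitIᶜ = 0) : ∀ᵐ x ∂μ, x ∈ unitI := by rwa [ae_iff]

lemma measurableSet_unitI : MeasurableSet unitI := measurableSet_Icc

lemma integrable_of_continuousOn [IsFiniteMeasure μ] (hμI : μ unitIᶜ = 0) {F : ℝ → ℝ}
    (hF : ContinuousOn F unitI) : Integrable F μ := by
  rw [← restrict_unitI hμI]
  exact hF.integrableOn_compact isCompact_Icc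

lemma aemeasurable_of_continuousOn (hμI : μ unitIᶜ = 0) {F : ℝ → ℝ}
    (hF : ContinuousOn F unitI) : AEMeasurable F μ := by
  rw [← restrict_unitI hμI]
  exact hF.aemeasurable measurableSet_unitI

lemma Reg.continuousOn (hR : Reg φ ρ₀ ρ₁ K) (i : Λ) : ContinuousOn (φ i) unitI :=
  (hR.anal i).continuousOn

lemma map_unitI_compl (hR : Reg φ ρ₀ ρ₁ K) (hμI : μ unitIᶜ = 0) (i : Λ) :
    Measure.map (φ i) μ unitIᶜ = 0 := by
  rw [Measure.map_apply_of_aemeasurable (aemeasurable_of_continuousOn hμI (hR.continuousOn i))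
    measurableSet_unitI.compl]
  exact measure_mono_null (fun x hx hxI => hx (hR.maps i hxI)) hμI

lemma integral_stationary [IsProbabilityMeasure μ] (hR : Reg φ ρ₀ ρ₁ K) (hp : ∀ i, 0 ≤ p i)
    (hμI : μ unitIᶜ = 0) (hμ : μ = ∑ i : Λ, ENNReal.ofReal (p i) • Measure.map (φ i) μ)
    {F : ℝ → ℝ} (hF : ContinuousOn F unitI) :
    ∫ x, F x ∂μ = ∑ i, p i * ∫ x, F (φ i x) ∂μ := by
  have hae : ∀ i, AEMeasurable (φ i) μ := fun i =>
    aemeasurable_of_continuousOn hμI (hR.continuousOn i)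
  have hfin : ∀ i, IsProbabilityMeasure (Measure.map (φ i) μ) := fun i =>
    Measure.isProbabilityMeasure_map (hae i)
  have hint : ∀ i, Integrable F (Measure.map (φ i) μ) := fun i =>
    integrable_of_continuousOn (map_unitI_compl hR hμI i) hF
  conv_lhs => rw [hμ]
  rw [integral_finsetSum_measure fun i _ => (hint i).smul_measure ENNReal.ofReal_ne_top]
  refine Finset.sum_congr rfl fun i _ => ?_
  rw [integral_smul_measure, integral_map (hae i) (hint i).aestronglyMeasurable,
    ENNReal.toReal_ofReal (hp i), smul_eq_mul]

lemma second_moment_le [IsProbabilityMeasure μ] (hR : Reg φ ρ₀ ρ₁ K) (hp : ∀ i, 0 ≤ p i)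
    (hp1 : ∑ i, p i = 1)
    (hμI : μ unitIᶜ = 0) (hμ : μ = ∑ i : Λ, ENNReal.ofReal (p i) • Measure.map (φ i) μ)
    {S : List Λ → ℝ → ℝ} {f : Λ → ℝ → ℝ} {L M : ℝ} (hL : 0 ≤ L)
    (hS : ∀ u, ContinuousOn (S u) unitI)
    (hf : ∀ i, ContinuousOn (f i) unitI) (hM : ∀ i, ∀ x ∈ unitI, |f i x| ≤ M)
    (hSL : ∀ u, ∀ x ∈ unitI, ∀ y ∈ unitI, |S u x - S u y| ≤ L)
    (hnil : ∀ x, S [] x = 0)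
    (happ : ∀ u i, ∀ x ∈ unitI, S (u ++ [i]) x = S u (φ i x) + f i x)
    (hf0 : ∑ i, p i * ∫ x, f i x ∂μ = 0) (n : ℕ) :
    ∑ u, wpi p n u * ∫ x, S (List.ofFn u) x ^ 2 ∂μ ≤ n * (2 * L * M + M ^ 2) := by
  induction n with
  | zero => simp [hnil]
  | succ n ih =>
    rw [sum_wpi_snoc p n (fun u => ∫ x, S u x ^ 2 ∂μ)]
    have key : ∀ u, ∑ i, p i * ∫ x, S (u ++ [i]) x ^ 2 ∂μ ≤
        ∫ x, S u x ^ 2 ∂μ + (2 * L * M + M ^ 2) := by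
      intro u
      have h1 : ∀ i, ∫ x, S (u ++ [i]) x ^ 2 ∂μ ≤ ∫ x, S u (φ i x) ^ 2 ∂μ +
          2 * S u 0 * ∫ x, f i x ∂μ + (2 * L * M + M ^ 2) := by
        intro i
        have hc1 : Integrable (fun x => S u (φ i x) ^ 2) μ :=
          integrable_of_continuousOn hμI (((hS u).comp (hR.continuousOn i) (hR.maps i)).pow 2)
        have hc2 : Integrable (fun x => 2 * S u 0 * f i x) μ :=
          (integrable_of_continuousOn hμI (hf i)).const_mul _
        have hc12 : Integrable (fun x => S u (φ i x) ^ 2 + 2 * S u 0 * f i x) μ := hc1.add hc2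
        have : ∫ x, S u (φ i x) ^ 2 ∂μ + 2 * S u 0 * ∫ x, f i x ∂μ + (2 * L * M + M ^ 2) =
            ∫ x, (S u (φ i x) ^ 2 + 2 * S u 0 * f i x) + (2 * L * M + M ^ 2) ∂μ := by
          rw [integral_add hc12 (integrable_const _), integral_add hc1 hc2,
            integral_const_mul, integral_const]
          simp
        rw [this]
        refine integral_mono_ae (integrable_of_continuousOn hμI ((hS _).pow 2))
          (hc12.add (integrable_const _)) ?_
        filter_upwards [ae_mem_unitI hμI] with x hx
        rw [happ u i x hx]
        have h2 := hSL u _ (hR.maps i hx) 0 zero_mem_unitI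
        have h3 := hM i x hx
        have h4 : (S u (φ i x) - S u 0) * f i x ≤ L * M :=
          (le_abs_self _).trans (by rw [abs_mul]; exact mul_le_mul h2 h3 (abs_nonneg _) hL)
        have h5 : f i x ^ 2 ≤ M ^ 2 := by
          rw [← sq_abs]; exact pow_le_pow_left₀ (abs_nonneg _) h3 2
        nlinarith
      calc _ ≤ ∑ i, p i * (∫ x, S u (φ i x) ^ 2 ∂μ +
          2 * S u 0 * ∫ x, f i x ∂μ + (2 * L * M + M ^ 2)) :=
            Finset.sum_le_sum fun i _ => mul_le_mul_of_nonneg_left (h1 i) (hp i)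
        _ = ∑ i, p i * ∫ x, S u (φ i x) ^ 2 ∂μ + 2 * S u 0 * ∑ i, p i * ∫ x, f i x ∂μ +
            (∑ i, p i) * (2 * L * M + M ^ 2) := by
            rw [Finset.mul_sum, Finset.sum_mul, ← Finset.sum_add_distrib,
              ← Finset.sum_add_distrib]
            refine Finset.sum_congr rfl fun i _ => by ring
        _ = _ := by
            rw [hf0, hp1, integral_stationary hR hp hμI hμ (F := fun x => S u x ^ 2) ((hS u).pow 2)]
            ring
    calc _ ≤ ∑ u, wpi p n u * (∫ x, S (List.ofFn u) x ^ 2 ∂μ + (2 * L * M + M ^ 2)) :=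
          Finset.sum_le_sum fun u _ => mul_le_mul_of_nonneg_left (key _) (wpi_nonneg hp n u)
      _ = ∑ u, wpi p n u * ∫ x, S (List.ofFn u) x ^ 2 ∂μ + (2 * L * M + M ^ 2) := by
          simp_rw [mul_add, Finset.sum_add_distrib, ← Finset.sum_mul]
          rw [sum_wpi hp1]; ring
      _ ≤ _ := by push_cast; linarith

lemma chebyshev {Ω : Type*} [Fintype Ω] {w : Ω → ℝ} (hw : ∀ ω, 0 ≤ w ω) (f : Ω → ℝ) {t : ℝ}
    (ht : 0 < t) :
    ∑ ω, (if t < |f ω| then w ω else 0) ≤ (∑ ω, w ω * f ω ^ 2) / t ^ 2 := by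
  rw [Finset.sum_div]
  refine Finset.sum_le_sum fun ω _ => ?_
  split_ifs with h
  · rw [le_div_iff₀ (by positivity)]
    refine mul_le_mul_of_nonneg_left ?_ (hw ω)
    rw [← sq_abs (f ω)]
    exact pow_le_pow_left₀ ht.le h.le 2
  · exact div_nonneg (mul_nonneg (hw ω) (sq_nonneg _)) (sq_nonneg _)

/-- The additive cocycle `S` deviates from zero by `t` with probability `O(n / t ^ 2)`. -/
lemma deviation_le [IsProbabilityMeasure μ] (hR : Reg φ ρ₀ ρ₁ K) (hp : ∀ i, 0 ≤ p i)
    (hp1 : ∑ i, p i = 1)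
    (hμI : μ unitIᶜ = 0) (hμ : μ = ∑ i : Λ, ENNReal.ofReal (p i) • Measure.map (φ i) μ)
    {S : List Λ → ℝ → ℝ} {f : Λ → ℝ → ℝ} {L M : ℝ} (hL : 0 ≤ L) (hM0 : 0 ≤ M)
    (hS : ∀ u, ContinuousOn (S u) unitI)
    (hf : ∀ i, ContinuousOn (f i) unitI) (hM : ∀ i, ∀ x ∈ unitI, |f i x| ≤ M)
    (hSL : ∀ u, ∀ x ∈ unitI, ∀ y ∈ unitI, |S u x - S u y| ≤ L)
    (hnil : ∀ x, S [] x = 0)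
    (happ : ∀ u i, ∀ x ∈ unitI, S (u ++ [i]) x = S u (φ i x) + f i x)
    (hf0 : ∑ i, p i * ∫ x, f i x ∂μ = 0) :
    ∃ C, 0 ≤ C ∧ ∀ n : ℕ, 1 ≤ n → ∀ t : ℝ, 0 < t →
      ∑ u, (if t < |S (List.ofFn u) 0| then wpi p n u else 0) ≤ C * n / t ^ 2 := by
  refine ⟨2 * (2 * L * M + M ^ 2) + 2 * L ^ 2, by positivity, fun n hn t ht => ?_⟩
  refine (chebyshev (wpi_nonneg hp n) (fun u => S (List.ofFn u) 0) ht).trans ?_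
  gcongr
  have h1 : ∀ u, S u 0 ^ 2 ≤ 2 * ∫ x, S u x ^ 2 ∂μ + 2 * L ^ 2 := by
    intro u
    have hint : Integrable (fun x => S u x ^ 2) μ := integrable_of_continuousOn hμI ((hS u).pow 2)
    have h2 : ∫ _, S u 0 ^ 2 ∂μ ≤ ∫ x, 2 * S u x ^ 2 + 2 * L ^ 2 ∂μ := by
      refine integral_mono_ae (integrable_const _) ((hint.const_mul 2).add (integrable_const _)) ?_
      filter_upwards [ae_mem_unitI hμI] with x hx
      have h3 := hSL u x hx 0 zero_mem_unitI
      have h4 : (S u x - S u 0) ^ 2 ≤ L ^ 2 := by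
        rw [← sq_abs]; exact pow_le_pow_left₀ (abs_nonneg _) h3 2
      nlinarith [sq_nonneg (2 * S u x - S u 0)]
    rw [integral_add (hint.const_mul 2) (integrable_const _), integral_const_mul] at h2
    simpa using h2
  have h5 := second_moment_le hR hp hp1 hμI hμ hL hS hf hM hSL hnil happ hf0 n
  have hn' : (1 : ℝ) ≤ n := by exact_mod_cast hn
  calc _ ≤ ∑ u, wpi p n u * (2 * ∫ x, S (List.ofFn u) x ^ 2 ∂μ + 2 * L ^ 2) :=
        Finset.sum_le_sum fun u _ => mul_le_mul_of_nonneg_left (h1 _) (wpi_nonneg hp n u)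
    _ = 2 * ∑ u, wpi p n u * ∫ x, S (List.ofFn u) x ^ 2 ∂μ + 2 * L ^ 2 := by
        simp_rw [mul_add, Finset.sum_add_distrib, ← Finset.sum_mul]
        rw [sum_wpi hp1, Finset.mul_sum, one_mul]
        congr 1
        exact Finset.sum_congr rfl fun u _ => by ring
    _ ≤ _ := by nlinarith [sq_nonneg L]

/-- The Lyapunov exponent, in natural units. -/
def lyap (φ : Λ → ℝ → ℝ) (p : Λ → ℝ) (μ : Measure ℝ) : ℝ :=
  -∑ i, p i * ∫ x, Real.log |deriv (φ i) x| ∂μ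

lemma Reg.abs_log_sub_le (hR : Reg φ ρ₀ ρ₁ K) (u : List Λ) {x y : ℝ} (hx : x ∈ unitI)
    (hy : y ∈ unitI) : |(Real.log |dWord φ u x| - Real.log |dWord φ u y|)| ≤ Real.log K := by
  have h : ∀ x ∈ unitI, ∀ y ∈ unitI,
      Real.log |dWord φ u x| - Real.log |dWord φ u y| ≤ Real.log K := by
    intro x hx y hy
    rw [sub_le_iff_le_add, ← Real.log_mul hR.Kpos.ne' (hR.dWord_pos u hy).ne']
    exact Real.log_le_log (hR.dWord_pos u hx) (hR.dist u x hx y hy)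
  exact abs_sub_le_iff.2 ⟨h x hx y hy, h y hy x hx⟩

lemma Reg.abs_log_deriv_le (hR : Reg φ ρ₀ ρ₁ K) (i : Λ) {x : ℝ} (hx : x ∈ unitI) :
    |(Real.log |deriv (φ i) x|)| ≤ -Real.log ρ₀ := by
  have h1 := hR.lower i x hx
  have h2 := (hR.upper i x hx).trans hR.lt_one.le
  have h3 : 0 < |deriv (φ i) x| := hR.pos.trans_le h1
  rw [abs_of_nonpos (Real.log_nonpos h3.le h2)]
  exact neg_le_neg (Real.log_le_log hR.pos h1)

lemma Reg.continuousOn_log_deriv (hR : Reg φ ρ₀ ρ₁ K) (i : Λ) :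
    ContinuousOn (fun x => Real.log |deriv (φ i) x|) unitI := by
  refine ContinuousOn.log (hR.anal i).deriv.continuousOn.abs fun x hx => ?_
  exact (hR.pos.trans_le (hR.lower i x hx)).ne'

lemma Reg.continuousOn_dWord (hR : Reg φ ρ₀ ρ₁ K) (u : List Λ) :
    ContinuousOn (dWord φ u) unitI := by
  have : ContinuousOn (deriv (compWord φ u)) unitI := (hR.analytic u).deriv.continuousOn
  exact this.congr fun x hx => (hR.hasDerivAt u hx).deriv.symm

lemma Reg.log_deviation [IsProbabilityMeasure μ] (hR : Reg φ ρ₀ ρ₁ K) (hp : ∀ i, 0 ≤ p i)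
    (hp1 : ∑ i, p i = 1)
    (hμI : μ unitIᶜ = 0) (hμ : μ = ∑ i : Λ, ENNReal.ofReal (p i) • Measure.map (φ i) μ) :
    ∃ C, 0 ≤ C ∧ ∀ n : ℕ, 1 ≤ n → ∀ t : ℝ, 0 < t →
      ∑ u, (if t < |(Real.log |dWord φ (List.ofFn u) 0| + n * lyap φ p μ)| then wpi p n u else 0) ≤
        C * n / t ^ 2 := by
  have hlogint : ∀ i, Integrable (fun x => Real.log |deriv (φ i) x|) μ := fun i =>
    integrable_of_continuousOn hμI (hR.continuousOn_log_deriv i)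
  have hlog0 : 0 ≤ -Real.log ρ₀ := (abs_nonneg _).trans
    (hR.abs_log_deriv_le (Classical.arbitrary Λ) zero_mem_unitI)
  obtain ⟨C, hC, h⟩ := deviation_le hR hp hp1 hμI hμ
    (S := fun u x => Real.log |dWord φ u x| + u.length * lyap φ p μ)
    (f := fun i x => Real.log |deriv (φ i) x| + lyap φ p μ) (L := Real.log K)
    (M := -Real.log ρ₀ + |lyap φ p μ|) (Real.log_nonneg hR.one_le)
    (add_nonneg hlog0 (abs_nonneg _))
    (fun u => (ContinuousOn.log (hR.continuousOn_dWord u).abs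
      fun x hx => (hR.dWord_pos u hx).ne').add continuousOn_const)
    (fun i => (hR.continuousOn_log_deriv i).add continuousOn_const)
    (fun i x hx => (abs_add_le _ _).trans (add_le_add_left (hR.abs_log_deriv_le i hx) _))
    (fun u x hx y hy => by
      rw [add_sub_add_right_eq_sub]; exact hR.abs_log_sub_le u hx hy)
    (fun x => by simp [dWord])
    (fun u i x hx => by
      have h1 : dWord φ (u ++ [i]) x = dWord φ u (φ i x) * deriv (φ i) x := by
        rw [dWord_append]; simp [dWord, compWord]
      have h2 := (hR.dWord_pos u (hR.maps i hx)).ne'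
      have h3 := (hR.pos.trans_le (hR.lower i x hx)).ne'
      rw [h1, abs_mul, Real.log_mul h2 h3, List.length_append, List.length_singleton]
      push_cast; ring)
    (by
      have h1 : ∀ i, ∫ x, (Real.log |deriv (φ i) x| + lyap φ p μ) ∂μ =
          ∫ x, Real.log |deriv (φ i) x| ∂μ + lyap φ p μ := by
        intro i
        rw [integral_add (hlogint i) (integrable_const _)]
        simp
      simp_rw [h1, mul_add, Finset.sum_add_distrib, ← Finset.sum_mul]
      rw [hp1, lyap]; ring)
  refine ⟨C, hC, fun n hn t ht => ?_⟩
  simpa only [List.length_ofFn] using h n hn t ht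

lemma log_wpi (hp : ∀ i, 0 < p i) {n : ℕ} (u : Fin n → Λ) :
    Real.log (wpi p n u) = ((List.ofFn u).map fun i => Real.log (p i)).sum := by
  rw [wpi, Real.log_prod fun i _ => (hp _).ne', List.map_ofFn, List.sum_ofFn]
  rfl

lemma Reg.weight_deviation [IsProbabilityMeasure μ] (hR : Reg φ ρ₀ ρ₁ K) (hp : ∀ i, 0 < p i)
    (hp1 : ∑ i, p i = 1)
    (hμI : μ unitIᶜ = 0) (hμ : μ = ∑ i : Λ, ENNReal.ofReal (p i) • Measure.map (φ i) μ) :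
    ∃ C, 0 ≤ C ∧ ∀ n : ℕ, 1 ≤ n → ∀ t : ℝ, 0 < t →
      ∑ u, (if t < |Real.log (wpi p n u) + n * (-∑ i, p i * Real.log (p i))| then wpi p n u else 0)
        ≤ C * n / t ^ 2 := by
  set H := -∑ i, p i * Real.log (p i) with hH
  set M := ∑ i, |Real.log (p i) + H| with hM
  obtain ⟨C, hC, h⟩ := deviation_le hR (fun i => (hp i).le) hp1 hμI hμ
    (S := fun u _ => (u.map fun i => Real.log (p i)).sum + u.length * H)
    (f := fun i _ => Real.log (p i) + H) (L := 0) (M := M) le_rfl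
    (Finset.sum_nonneg fun i _ => abs_nonneg _)
    (fun u => continuousOn_const) (fun i => continuousOn_const)
    (fun i x _ => Finset.single_le_sum (f := fun i => |Real.log (p i) + H|)
      (fun i _ => abs_nonneg _) (Finset.mem_univ i))
    (fun u x _ y _ => by simp) (fun x => by simp)
    (fun u i x _ => by
      simp only [List.map_append, List.sum_append, List.map_cons, List.map_nil, List.sum_cons,
        List.sum_nil, List.length_append, List.length_singleton]
      push_cast; ring)
    (by
      simp only [integral_const, probReal_univ, one_smul, mul_add, Finset.sum_add_distrib,
        ← Finset.sum_mul]
      rw [hp1, hH]; ring)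
  refine ⟨C, hC, fun n hn t ht => ?_⟩
  have := h n hn t ht
  simpa only [List.length_ofFn, ← log_wpi hp] using this

end SelfConformal

namespace SelfConformal

variable {Λ : Type} [Fintype Λ] {φ : Λ → ℝ → ℝ} {ρ₀ ρ₁ K : ℝ} {p : Λ → ℝ} [Nonempty Λ]
variable {Ω₁ : Type} [Fintype Ω₁]

lemma Reg.window_ge (hR : Reg φ ρ₀ ρ₁ K) (hp : ∀ i, 0 ≤ p i) (hp1 : ∑ i, p i = 1) {C₀ : ℕ}
    (hC₀ : ρ₁ ^ C₀ ≤ 1 / 2) {B : ℕ} (hB : K ≤ B * (ρ₀ / K * (1 / (2 * K))))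
    {w₁ : Ω₁ → ℝ} (h₁ : ∀ ω, 0 ≤ w₁ ω) (U : Ω₁ → List Λ) {D : ℝ}
    (hDl : ∀ ω, D / 2 ≤ |dWord φ (U ω) 0|) (x : List Λ) {i m k₃ N : ℕ}
    (hx : ρ₀ / K ≤ 2 ^ i * D * |dWord φ x 0|)
    (hk₃ : K * 2 ^ i * ρ₁ ^ k₃ ≤ 1 / (2 * K)) (hN : C₀ * m + k₃ ≤ N) :
    (∑ ω, w₁ ω) * (hEnt φ p C₀ m - (2 * Real.log 3 + Real.log (2 * B + 1))) ≤
      cent (wprod w₁ (wpi p N)) (fun y => ⌊2 ^ (i + m) * compWord φ (U y.1) (compWord φ x (pt φ y.2))⌋)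
        (fun y => ⌊2 ^ i * compWord φ (U y.1) (compWord φ x (pt φ y.2))⌋) := by
  have hK := hR.Kpos
  rw [Finset.sum_mul]
  refine le_trans (Finset.sum_le_sum fun ω _ => ?_) (sum_cent_le h₁ (wpi_nonneg hp N)
    (fun ω Y => ⌊2 ^ (i + m) * compWord φ (U ω) (compWord φ x (pt φ Y))⌋)
    (fun ω Y => ⌊2 ^ i * compWord φ (U ω) (compWord φ x (pt φ Y))⌋))
  refine mul_le_mul_of_nonneg_left ?_ (h₁ ω)
  have h2 : |(2 : ℝ) ^ i| = 2 ^ i := abs_of_pos (by positivity)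
  have h3 : |dWord φ (U ω ++ x) 0| ≤ 1 :=
    (hR.abs_dWord_le _ zero_mem_unitI).trans (pow_le_one₀ hR.rho_one_nonneg hR.lt_one.le)
  have h4 : D / 2 * |dWord φ x 0| ≤ K * |dWord φ (U ω ++ x) 0| := by
    rw [dWord_append, abs_mul, ← mul_assoc]
    refine mul_le_mul_of_nonneg_right ?_ (abs_nonneg _)
    exact (hDl ω).trans (hR.dist _ _ zero_mem_unitI _ (hR.mem x zero_mem_unitI))
  have key := cent_cylinder_ge hR hp hp1 hC₀ (s := 1 / (2 * K)) (by positivity)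
    (by rw [mul_one_div, div_le_one (by positivity)]; linarith) hB (2 ^ i) 0 (U ω ++ x) (j := m)
    (k := k₃) (N := N) (by
      rw [h2, mul_one_div, div_le_iff₀ (by positivity)]
      refine hx.trans ?_
      have : (0 : ℝ) < 2 ^ i := by positivity
      nlinarith) (by
      rw [h2]
      refine le_trans ?_ hk₃
      refine mul_le_mul_of_nonneg_right ?_ (pow_nonneg hR.rho_one_nonneg _)
      refine mul_le_mul_of_nonneg_left ?_ hK.le
      exact mul_le_of_le_one_right (by positivity) h3) hN
  simp only [compWord_append, add_zero] at key
  have h5 : ∀ y : ℝ, (2 : ℝ) ^ (i + m) * y = 2 ^ m * (2 ^ i * y) := fun y => by ring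
  simp only [h5]
  exact key

lemma Reg.sum_windows_ge (hR : Reg φ ρ₀ ρ₁ K) (hp : ∀ i, 0 ≤ p i) (hp1 : ∑ i, p i = 1) {C₀ : ℕ}
    (hC₀ : ρ₁ ^ C₀ ≤ 1 / 2) {B M : ℕ} (hB : K ≤ B * (ρ₀ / K * (1 / (2 * K)))) (hM : K ^ 2 ≤ M)
    {C c ε : ℝ} {m : ℕ} (hC : 2 * Real.log 3 + Real.log (2 * B + 1) ≤ C) (hc : 0 ≤ c)
    (hG : GrowthAt (hEnt φ p C₀) C c ε m)
    {k L : ℕ} {v : (Fin k → Bool) → Fin L → Λ} (hv : Function.Injective v) {Ck : ℝ} (hCk : 1 ≤ Ck)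
    (hclose : ∀ w u u' : List Λ, ∀ t : (Fin k → Bool) → ℝ, ∀ δ : ℝ,
      (∀ l, t l ∈ compWord φ (w ++ List.ofFn (v l)) '' unitI) →
      (∀ l, |compWord φ u (t l) - compWord φ u' (t l)| ≤ δ) →
      ∀ x ∈ compWord φ w '' unitI,
        |compWord φ u x - compWord φ u' x| ≤ Ck * (δ + |dWord φ w 0| ^ k) ∧
        |dWord φ w 0| * |dWord φ u x - dWord φ u' x| ≤ Ck * (δ + |dWord φ w 0| ^ k))
    {P : ℝ} (hP0 : 0 ≤ P) (hP : ∀ l, P ≤ wpi p L (v l))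
    {w₁ : Ω₁ → ℝ} (h₁ : ∀ ω, 0 ≤ w₁ ω) (U : Ω₁ → List Λ) {D : ℝ} (hD : 0 < D)
    (hDl : ∀ ω, D / 2 ≤ |dWord φ (U ω) 0|) (hDu : ∀ ω, |dWord φ (U ω) 0| ≤ D)
    (w : List Λ) {i T q M₂ k₁ N : ℕ} {s : ℝ}
    (hinj : ∀ ω ω', ω ≠ ω' → ∃ x ∈ compWord φ w '' unitI,
      s ≤ |compWord φ (U ω) x - compWord φ (U ω') x|)
    (hs : Ck * (1 / 2 ^ (i + T * m) + |dWord φ w 0| ^ k) < s)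
    (hder : 2 ^ m * K * Ck * (1 / 2 ^ i + |dWord φ w 0| ^ k) ≤ D * |dWord φ w 0|)
    (hquad : 2 ^ m * K ^ 4 ≤ 2 ^ i * D)
    (hx : 1 ≤ ρ₀ ^ L * (2 ^ i * D * |dWord φ w 0|))
    (hk₁ : K * ρ₁ ^ k₁ * (2 ^ (i + T * m) * (2 ^ m * K) * (2 * K)) ≤ 1)
    (hD1 : D ≤ 1) (hN : C₀ * m + k₁ + k₁ ≤ N)
    (hq : q ≤ i) (hqD : 2 ^ q * D ≤ 1) (hM₂ : 2 ^ i * (K * D * (K * |dWord φ w 0|)) ≤ M₂) :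
    T * ((∑ ω, w₁ ω) * (hEnt φ p C₀ m -
        (C + (Real.log (2 * (2 * M + 1 : ℕ) + 1) + Real.log (2 * (4 : ℕ) + 1))))) +
      P * (c * (ent w₁ (fun ω => ω) - ent w₁ (fun ω => ⌊2 ^ q * compWord φ (U ω) 0⌋) -
        (∑ ω, w₁ ω) * (Real.log (2 * (2 ^ (i - q) * (2 * M + 1)) + 1) +
          2 ^ k * Real.log (2 * M₂ + 1)) - ε * m * (T * 2 ^ k) * ∑ ω, w₁ ω)) ≤
    ∑ v, wpi p L v * ∑ t ∈ Finset.range T, cent (wprod w₁ (wpi p N))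
      (fun y => ⌊2 ^ (i + (t + 1) * m) *
        compWord φ (U y.1) (compWord φ (w ++ List.ofFn v) (pt φ y.2))⌋)
      (fun y => ⌊2 ^ (i + t * m) *
        compWord φ (U y.1) (compWord φ (w ++ List.ofFn v) (pt φ y.2))⌋) := by
  classical
  have hK := hR.Kpos
  have hK1 := hR.one_le
  have hρ := hR.pos
  have hρ1 := pow_nonneg hR.rho_one_nonneg k₁
  have hx' : ∀ v : Fin L → Λ, ρ₀ / K ≤ 2 ^ i * D * |dWord φ (w ++ List.ofFn v) 0| := by
    intro v
    have h1 : ρ₀ ^ L * |dWord φ w 0| ≤ K * |dWord φ (w ++ List.ofFn v) 0| := by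
      rw [dWord_append, abs_mul, mul_comm (ρ₀ ^ L), ← mul_assoc]
      refine mul_le_mul (hR.dist _ _ zero_mem_unitI _ (hR.mem _ zero_mem_unitI)) ?_ (by positivity)
        (by positivity)
      simpa using hR.le_abs_dWord (List.ofFn v) zero_mem_unitI
    have h2 : ρ₀ ≤ 1 := by
      have := hR.lower (Classical.arbitrary Λ) 0 zero_mem_unitI
      have := hR.upper (Classical.arbitrary Λ) 0 zero_mem_unitI
      have := hR.lt_one
      linarith
    rw [div_le_iff₀ hK]
    have h3 : 0 < 2 ^ i * D := by positivity
    nlinarith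
  set A₀ := hEnt φ p C₀ m -
        (C + (Real.log (2 * (2 * M + 1 : ℕ) + 1) + Real.log (2 * (4 : ℕ) + 1))) with hA₀
  set Q := ∑ ω, w₁ ω with hQ
  have hQ0 : 0 ≤ Q := Finset.sum_nonneg fun ω _ => h₁ ω
  set Θ : (Fin L → Λ) → ℝ := fun v => ∑ t ∈ Finset.range T, cent (wprod w₁ (wpi p N))
      (fun y => ⌊2 ^ (i + (t + 1) * m) *
        compWord φ (U y.1) (compWord φ (w ++ List.ofFn v) (pt φ y.2))⌋)
      (fun y => ⌊2 ^ (i + t * m) *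
        compWord φ (U y.1) (compWord φ (w ++ List.ofFn v) (pt φ y.2))⌋) with hΘ
  have hpow : ∀ t ≤ T, (2 : ℝ) ^ (i + t * m) ≤ 2 ^ (i + T * m) := fun t ht =>
    pow_le_pow_right₀ (by norm_num) (by gcongr)
  have h2m : (1 : ℝ) ≤ 2 ^ m * K := by
    have : (1 : ℝ) ≤ 2 ^ m := one_le_pow₀ (by norm_num)
    nlinarith
  have hiT : (1 : ℝ) ≤ 2 ^ (i + T * m) := one_le_pow₀ (by norm_num)
  have hA : K * ρ₁ ^ k₁ * (2 ^ (i + T * m) * (2 * K)) ≤ 1 := by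
    refine le_trans ?_ hk₁
    gcongr
    exact le_mul_of_one_le_right (by positivity) h2m
  have base : ∀ v, T * (Q * A₀) ≤ Θ v := by
    intro v
    have : ∀ t ∈ Finset.range T, Q * A₀ ≤ cent (wprod w₁ (wpi p N))
      (fun y => ⌊2 ^ (i + (t + 1) * m) *
        compWord φ (U y.1) (compWord φ (w ++ List.ofFn v) (pt φ y.2))⌋)
      (fun y => ⌊2 ^ (i + t * m) *
        compWord φ (U y.1) (compWord φ (w ++ List.ofFn v) (pt φ y.2))⌋) := by
      intro t ht
      have hle := hpow t (Finset.mem_range.1 ht).le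
      have := hR.window_ge hp hp1 hC₀ hB h₁ U hDl (w ++ List.ofFn v) (i := i + t * m) (m := m)
        (k₃ := k₁) (N := N) ((hx' v).trans (by gcongr; exacts [by norm_num, Nat.le_add_right _ _])) (by
          rw [le_div_iff₀ (by positivity)]
          refine le_trans ?_ hA
          calc K * 2 ^ (i + t * m) * ρ₁ ^ k₁ * (2 * K)
              = K * ρ₁ ^ k₁ * (2 ^ (i + t * m) * (2 * K)) := by ring
            _ ≤ _ := by gcongr) (by omega)
      rw [show i + (t + 1) * m = i + t * m + m by ring]
      refine le_trans (mul_le_mul_of_nonneg_left ?_ hQ0) this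
      have h5 : 0 ≤ Real.log (2 * (2 * M + 1 : ℕ) + 1) := Real.log_nonneg (by
        have : (0 : ℝ) ≤ (2 * M + 1 : ℕ) := Nat.cast_nonneg _
        linarith)
      have h6 : 0 ≤ Real.log (2 * (4 : ℕ) + 1) := Real.log_nonneg (by norm_num)
      linarith
    have := Finset.sum_le_sum this
    rwa [Finset.sum_const, Finset.card_range, nsmul_eq_mul] at this
  have gain := hR.windows_total hp hp1 hC₀ hB hM hC hc hG (v := fun l => List.ofFn (v l)) hCk hclose
    h₁ U hD hDl hDu w (k₁ := k₁) (k₂ := k₁) hinj hs hder hquad (fun l => hx' (v l))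
    (by
      refine le_trans ?_ hA
      gcongr
      linarith)
    (by
      rw [le_div_iff₀ (by positivity)]
      refine le_trans ?_ hk₁
      calc K * (2 ^ m * K) * ρ₁ ^ k₁ * (2 * K) = K * ρ₁ ^ k₁ * (1 * (2 ^ m * K) * (2 * K)) := by ring
        _ ≤ _ := by gcongr) hN hq hqD hM₂
  set G := ent w₁ (fun ω => ω) - ent w₁ (fun ω => ⌊2 ^ q * compWord φ (U ω) 0⌋) -
        Q * (Real.log (2 * (2 ^ (i - q) * (2 * M + 1)) + 1) +
          2 ^ k * Real.log (2 * M₂ + 1)) - ε * m * (T * 2 ^ k) * Q with hGdef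
  have h7 : c * G ≤ ∑ l, (Θ (v l) - T * (Q * A₀)) := by
    rw [Finset.sum_sub_distrib, Finset.sum_const, Finset.card_univ, Fintype.card_fun,
      Fintype.card_bool, Fintype.card_fin, nsmul_eq_mul]
    push_cast
    have : T * 2 ^ k * (Q * A₀) + c * G ≤ ∑ l, Θ (v l) := gain
    linarith
  have h8 : ∑ v', wpi p L v' * (Θ v' - T * (Q * A₀)) ≥ ∑ l, wpi p L (v l) * (Θ (v l) - T * (Q * A₀)) := by
    rw [ge_iff_le, ← Finset.sum_image (f := fun v' => wpi p L v' * (Θ v' - T * (Q * A₀)))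
      (g := v) (s := Finset.univ) (fun a _ b _ h => hv h)]
    exact Finset.sum_le_sum_of_subset_of_nonneg (Finset.subset_univ _) fun v' _ _ =>
      mul_nonneg (wpi_nonneg hp L v') (sub_nonneg.2 (base v'))
  have h9 : P * ∑ l, (Θ (v l) - T * (Q * A₀)) ≤ ∑ l, wpi p L (v l) * (Θ (v l) - T * (Q * A₀)) := by
    rw [Finset.mul_sum]
    exact Finset.sum_le_sum fun l _ => mul_le_mul_of_nonneg_right (hP l) (sub_nonneg.2 (base _))
  have h10 : ∑ v', wpi p L v' * (Θ v' - T * (Q * A₀)) = ∑ v', wpi p L v' * Θ v' - T * (Q * A₀) := by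
    simp_rw [mul_sub, Finset.sum_sub_distrib, ← Finset.sum_mul]
    rw [sum_wpi hp1, one_mul]
  have h11 := mul_le_mul_of_nonneg_left h7 hP0
  linarith

end SelfConformal

namespace SelfConformal

variable {Λ : Type} [Fintype Λ] {φ : Λ → ℝ → ℝ} {ρ₀ ρ₁ K : ℝ} {p : Λ → ℝ} [Nonempty Λ]
variable {Ω Ω₁ Ω₂ α β : Type} [Fintype Ω] [Fintype Ω₁] [Fintype Ω₂]

lemma sum_fibers_cent_le {w₁ : Ω₁ → ℝ} {w₂ : Ω₂ → ℝ} (h₁ : ∀ ω, 0 ≤ w₁ ω) (h₂ : ∀ ω, 0 ≤ w₂ ω)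
    (κ : Ω₁ → ℕ) (S : Finset ℕ) (f : Ω₁ × Ω₂ → α) (g : Ω₁ × Ω₂ → β) :
    ∑ z ∈ S, cent (wprod (fun x : {u // κ u = z} => w₁ x) w₂) (fun y => f (y.1.1, y.2))
      (fun y => g (y.1.1, y.2)) ≤ cent (wprod w₁ w₂) f g := by
  have hw := wprod_nonneg h₁ h₂
  have e : ∀ z, cent (wprod (fun x : {u // κ u = z} => w₁ x) w₂) (fun y => f (y.1.1, y.2))
      (fun y => g (y.1.1, y.2)) = cent (fun ω : Ω₁ × Ω₂ => if κ ω.1 = z then wprod w₁ w₂ ω else 0)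
        f g := by
    intro z
    have h1 : IsPush (Subtype.val : {u // κ u = z} → Ω₁) (fun x => w₁ x.1)
        (fun u => if κ u = z then w₁ u else 0) := by
      have h2 : (fun x : {u // κ u = z} => w₁ x.1) = fun x => if κ x.1 = z then w₁ x.1 else 0 := by
        funext x; rw [if_pos x.2]
      rw [h2]
      convert isPush_subtype (fun u => if κ u = z then w₁ u else 0) (P := fun u => κ u = z)
        (fun ω h => if_neg h)
    have h3 : wprod (fun u => if κ u = z then w₁ u else 0) w₂ =
        fun ω : Ω₁ × Ω₂ => if κ ω.1 = z then wprod w₁ w₂ ω else 0 := by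
      funext ω; simp only [wprod, ite_mul, zero_mul]
    rw [← h3]
    exact IsPush.cent (h1.prod (isPush_id w₂)) f g
  calc _ = ∑ z ∈ S, cent (fun ω : Ω₁ × Ω₂ => if κ ω.1 = z then wprod w₁ w₂ ω else 0) f g :=
        Finset.sum_congr rfl fun z _ => e z
    _ ≤ ∑ z ∈ S ∪ Finset.univ.image κ,
        cent (fun ω : Ω₁ × Ω₂ => if κ ω.1 = z then wprod w₁ w₂ ω else 0) f g :=
        Finset.sum_le_sum_of_subset_of_nonneg Finset.subset_union_left fun z _ _ =>
          cent_nonneg (fun ω => by split_ifs; exacts [hw ω, le_rfl]) _ _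
    _ = cent (wprod w₁ w₂) f (fun ω => (g ω, κ ω.1)) := by
        rw [cent_fiber _ f g (fun ω : Ω₁ × Ω₂ => κ ω.1) (S ∪ Finset.univ.image κ)]
        · congr!
        · intro ω
          exact Finset.mem_union_right _ (Finset.mem_image_of_mem _ (Finset.mem_univ _))
    _ ≤ _ := cent_anti hw f fun ω ω' h => (Prod.ext_iff.1 h).1

lemma isPush_four (p : Λ → ℝ) (n₁ n₂ L N : ℕ) :
    IsPush (fun x : ((Fin n₂ → Λ) × (Fin L → Λ)) × ((Fin n₁ → Λ) × (Fin N → Λ)) =>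
      (Fin.append x.2.1 (Fin.append x.1.1 (Fin.append x.1.2 x.2.2)) :
        Fin (n₁ + (n₂ + (L + N))) → Λ))
      (wprod (wprod (wpi p n₂) (wpi p L)) (wprod (wpi p n₁) (wpi p N)))
      (wpi p (n₁ + (n₂ + (L + N)))) := by
  have h1 : IsPush (fun x : ((Fin n₂ → Λ) × (Fin L → Λ)) × ((Fin n₁ → Λ) × (Fin N → Λ)) =>
      (x.2.1, (x.1.1, (x.1.2, x.2.2))))
      (wprod (wprod (wpi p n₂) (wpi p L)) (wprod (wpi p n₁) (wpi p N)))
      (wprod (wpi p n₁) (wprod (wpi p n₂) (wprod (wpi p L) (wpi p N)))) :=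
    isPush_equiv ⟨fun x => (x.2.1, (x.1.1, (x.1.2, x.2.2))),
      fun y => ((y.2.1, y.2.2.1), (y.1, y.2.2.2)), fun x => rfl, fun y => rfl⟩ fun x => by
        simp only [wprod, Equiv.coe_fn_mk]; ring
  have h2 := (isPush_append p n₁ (n₂ + (L + N))).comp ((isPush_id (wpi p n₁)).prod
    ((isPush_append p n₂ (L + N)).comp ((isPush_id (wpi p n₂)).prod (isPush_append p L N))))
  exact h2.comp h1

lemma pt_four {n₁ n₂ L N : ℕ} (u : Fin n₁ → Λ) (w : Fin n₂ → Λ) (v : Fin L → Λ) (Y : Fin N → Λ) :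
    pt φ (Fin.append u (Fin.append w (Fin.append v Y))) = compWord φ (List.ofFn u)
      (compWord φ (List.ofFn w ++ List.ofFn v) (pt φ Y)) := by
  rw [pt_append, pt_append, pt_append, compWord_append]

/-- Entropy between scales is bounded below by averaging over the words in the middle and over
the classes of the words in front. -/
lemma increment_ge (hp : ∀ i, 0 ≤ p i) {n₁ n₂ L N i m T : ℕ} (κ : (Fin n₁ → Λ) → ℕ) (S : Finset ℕ)
    (W : (Fin n₂ → Λ) → Prop) [DecidablePred W] (A : ℕ → ℝ)
    (hA : ∀ w, W w → ∀ z ∈ S, A z ≤ ∑ v, wpi p L v * ∑ t ∈ Finset.range T,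
      cent (wprod (fun x : {u // κ u = z} => wpi p n₁ x) (wpi p N))
      (fun y => ⌊2 ^ (i + (t + 1) * m) *
        compWord φ (List.ofFn y.1.1) (compWord φ (List.ofFn w ++ List.ofFn v) (pt φ y.2))⌋)
      (fun y => ⌊2 ^ (i + t * m) *
        compWord φ (List.ofFn y.1.1) (compWord φ (List.ofFn w ++ List.ofFn v) (pt φ y.2))⌋)) :
    (∑ w, if W w then wpi p n₂ w else 0) * ∑ z ∈ S, A z ≤
      ent (wpi p (n₁ + (n₂ + (L + N)))) (fun Y => ⌊2 ^ (i + T * m) * pt φ Y⌋) -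
      ent (wpi p (n₁ + (n₂ + (L + N)))) (fun Y => ⌊2 ^ i * pt φ Y⌋) := by
  have hn₁ := wpi_nonneg hp n₁
  have hN := wpi_nonneg hp N
  have hw := wprod_nonneg hn₁ hN
  have h1 := sum_cent_succ (wpi p (n₁ + (n₂ + (L + N)))) (fun t Y => ⌊2 ^ (i + t * m) * pt φ Y⌋)
    (fun t ω ω' h => floor_two_pow_determined (by gcongr; omega) h) T
  simp only [zero_mul, add_zero] at h1
  rw [← h1]
  set G : (Fin n₂ → Λ) → (Fin L → Λ) → ℕ → ((Fin n₁ → Λ) × (Fin N → Λ)) → ℤ := fun w v t y =>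
    ⌊2 ^ (i + t * m) *
        compWord φ (List.ofFn y.1) (compWord φ (List.ofFn w ++ List.ofFn v) (pt φ y.2))⌋ with hG
  have h2 : ∀ t, ∑ w, wpi p n₂ w * ∑ v, wpi p L v *
      cent (wprod (wpi p n₁) (wpi p N)) (G w v (t + 1)) (G w v t) ≤
      cent (wpi p (n₁ + (n₂ + (L + N)))) (fun Y => ⌊2 ^ (i + (t + 1) * m) * pt φ Y⌋)
        (fun Y => ⌊2 ^ (i + t * m) * pt φ Y⌋) := by
    intro t
    rw [← (isPush_four p n₁ n₂ L N).cent]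
    simp only [pt_four]
    refine le_trans (le_of_eq ?_) (sum_cent_le (wprod_nonneg (wpi_nonneg hp n₂) (wpi_nonneg hp L)) hw
      (fun a => G a.1 a.2 (t + 1)) (fun a => G a.1 a.2 t))
    rw [sum_wprod_mul]
  refine le_trans ?_ (Finset.sum_le_sum fun t _ => h2 t)
  rw [Finset.sum_comm, Finset.sum_mul]
  refine Finset.sum_le_sum fun w _ => ?_
  rw [← Finset.mul_sum]
  split_ifs with hW
  · refine mul_le_mul_of_nonneg_left ?_ (wpi_nonneg hp n₂ w)
    refine (Finset.sum_le_sum fun z hz => hA w hW z hz).trans ?_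
    rw [Finset.sum_comm, Finset.sum_comm (s := Finset.range T)]
    refine Finset.sum_le_sum fun v _ => ?_
    rw [← Finset.mul_sum, ← Finset.mul_sum]
    refine mul_le_mul_of_nonneg_left ?_ (wpi_nonneg hp L v)
    rw [Finset.sum_comm]
    refine Finset.sum_le_sum fun t _ => ?_
    exact sum_fibers_cent_le hn₁ hN κ S (G w v (t + 1)) (G w v t)
  · rw [zero_mul]
    exact mul_nonneg (wpi_nonneg hp n₂ w) (Finset.sum_nonneg fun t _ => Finset.sum_nonneg
      fun v _ => mul_nonneg (wpi_nonneg hp L v) (cent_nonneg hw _ _))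

end SelfConformal

namespace SelfConformal

variable {Λ : Type} [Fintype Λ] {φ : Λ → ℝ → ℝ} {ρ₀ ρ₁ K : ℝ} {p : Λ → ℝ} [Nonempty Λ]
variable {Ω Ω₁ Ω₂ α β : Type} [Fintype Ω] [Fintype Ω₁] [Fintype Ω₂]

lemma sum_fibers (w : Ω → ℝ) (κ : Ω → ℕ) (S : Finset ℕ) :
    ∑ z ∈ S, ∑ x : {u // κ u = z}, w x = ∑ u, if κ u ∈ S then w u else 0 := by
  have : ∀ z, ∑ x : {u // κ u = z}, w x = ∑ u, if κ u = z then w u else 0 := by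
    intro z
    rw [← Finset.sum_filter, Finset.sum_subtype (p := fun u => κ u = z)]
    simp
  simp_rw [this]
  rw [Finset.sum_comm]
  exact Finset.sum_congr rfl fun u _ => by rw [Finset.sum_ite_eq]

lemma isPush_fiber (w : Ω → ℝ) (κ : Ω → ℕ) (z : ℕ) :
    IsPush (Subtype.val : {u // κ u = z} → Ω) (fun x => w x.1)
      (fun u => if κ u = z then w u else 0) := by
  have h2 : (fun x : {u // κ u = z} => w x.1) = fun x => if κ x.1 = z then w x.1 else 0 := by
    funext x; rw [if_pos x.2]
  rw [h2]
  convert isPush_subtype (fun u => if κ u = z then w u else 0) (P := fun u => κ u = z)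
    (fun ω h => if_neg h)

lemma ent_wpi_id (hp : ∀ i, 0 < p i) (hp1 : ∑ i, p i = 1) (n : ℕ) :
    ent (wpi p n) (fun u => u) = n * -∑ i, p i * Real.log (p i) := by
  have h0 := sum_wpi_mul_sum hp1 (fun i => -Real.log (p i)) n
  simp only [mul_neg, Finset.sum_neg_distrib] at h0
  rw [ent_eq_sum, mul_neg, ← h0, ← Finset.sum_neg_distrib]
  refine Finset.sum_congr rfl fun u _ => ?_
  have : mass (wpi p n) (fun u => u) u = wpi p n u := by
    simp only [mass]
    rw [Finset.sum_eq_single u (fun x _ h => if_neg h) (fun h => absurd (Finset.mem_univ u) h),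
      if_pos rfl]
  rw [sum_wpi hp1, this, Real.log_one, zero_sub, wpi, Real.log_prod fun i _ => (hp _).ne']
  ring

lemma sum_fibers_ent_word_ge (hp : ∀ i, 0 < p i) (hp1 : ∑ i, p i = 1) {n J : ℕ}
    (κ : (Fin n → Λ) → ℕ) (hJ : ∀ u, κ u < J) (S : Finset ℕ) :
    n * (-∑ i, p i * Real.log (p i)) - Real.log J -
      (1 - ∑ u, if κ u ∈ S then wpi p n u else 0) * (n * Real.log (Fintype.card Λ)) ≤
    ∑ z ∈ S, ent (fun x : {u // κ u = z} => wpi p n x) (fun x => x) := by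
  classical
  have hw := wpi_nonneg (fun i => (hp i).le) n
  have hwz : ∀ z u, 0 ≤ (if κ u = z then wpi p n u else 0) := fun z u => by
    split_ifs; exacts [hw u, le_rfl]
  have e : ∀ z, ent (fun x : {u // κ u = z} => wpi p n x) (fun x => x) =
      ent (fun u => if κ u = z then wpi p n u else 0) (fun u => u) := by
    intro z
    have h := (isPush_fiber (wpi p n) κ z).ent (fun u => u)
    have hx : ∀ x : {u // κ u = z}, 0 ≤ wpi p n x.1 := fun x => hw x.1
    refine Eq.trans (le_antisymm ?_ ?_) h
    · exact ent_mono hx fun ω ω' h => Subtype.ext h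
    · exact ent_mono hx fun ω ω' h => congrArg Subtype.val h
  simp_rw [e]
  set t := S ∪ Finset.univ.image κ with ht
  have h1 : ent (wpi p n) (fun u => u) ≤ ent (wpi p n) κ + cent (wpi p n) (fun u => u) κ :=
    ent_le_add hw _ _
  have h2 : ent (wpi p n) κ ≤ Real.log J := by
    have := cent_le_log_of_maps hw κ (fun _ => ()) (M := J) (fun _ a => a) (fun u => hJ u)
      (fun ω ω' _ h => h)
    rwa [sum_wpi hp1, one_mul] at this
  have h3 : cent (wpi p n) (fun u => u) κ =
      ∑ z ∈ t, ent (fun u => if κ u = z then wpi p n u else 0) (fun u => u) := by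
    have := cent_fiber (wpi p n) (fun u => u) (fun _ => ()) κ t fun ω =>
      Finset.mem_union_right _ (Finset.mem_image_of_mem _ (Finset.mem_univ _))
    have h4 : cent (wpi p n) (fun u => u) κ = cent (wpi p n) (fun u => u) (fun ω => ((), κ ω)) :=
      cent_congr (by simp) (by simp)
    rw [h4, this]
    unfold ent
    congr!
  have h5 : ∑ z ∈ t \ S, ent (fun u => if κ u = z then wpi p n u else 0) (fun u => u) ≤
      ∑ z ∈ t \ S, (∑ u, if κ u = z then wpi p n u else 0) * (n * Real.log (Fintype.card Λ)) := by
    refine Finset.sum_le_sum fun z _ => ?_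
    have := cent_le_log_card (hwz z) (fun u => u) (fun _ => ()) (M := (Fintype.card Λ : ℝ) ^ n)
      (fun ω₀ => by
        refine (Nat.cast_le.2 (Finset.card_le_univ _)).trans ?_
        simp)
    rwa [Real.log_pow] at this
  have h6 : ∀ s : Finset ℕ, ∑ z ∈ s, (∑ u, if κ u = z then wpi p n u else 0) =
      ∑ u, if κ u ∈ s then wpi p n u else 0 := by
    intro s
    rw [Finset.sum_comm]
    exact Finset.sum_congr rfl fun u _ => by rw [Finset.sum_ite_eq]
  have h7 : ∑ z ∈ t, (∑ u, if κ u = z then wpi p n u else 0) = 1 := by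
    rw [h6, ← sum_wpi hp1 n]
    refine Finset.sum_congr rfl fun u _ => if_pos ?_
    exact Finset.mem_union_right _ (Finset.mem_image_of_mem _ (Finset.mem_univ _))
  have hsub : S ⊆ t := Finset.subset_union_left
  rw [← Finset.sum_sdiff hsub] at h3 h7
  rw [h6 S] at h7
  rw [← Finset.sum_mul] at h5
  rw [ent_wpi_id hp hp1] at h1
  have h8 : ∑ z ∈ t \ S, (∑ u, if κ u = z then wpi p n u else 0) =
      1 - ∑ u, if κ u ∈ S then wpi p n u else 0 := by linarith
  rw [h8] at h5
  linarith

lemma sum_fibers_ent_floor_le (hR : Reg φ ρ₀ ρ₁ K) (hp : ∀ i, 0 ≤ p i) (hp1 : ∑ i, p i = 1)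
    {C₀ : ℕ} (hC₀ : ρ₁ ^ C₀ ≤ 1 / 2) {n q M : ℕ} (κ : (Fin n → Λ) → ℕ) (S : Finset ℕ) (hM : K ≤ M)
    (hS : ∀ u, κ u ∈ S → 2 ^ q * |dWord φ (List.ofFn u) 0| ≤ 1) :
    ∑ z ∈ S, ent (fun x : {u // κ u = z} => wpi p n x)
      (fun x => ⌊2 ^ q * compWord φ (List.ofFn x.1) 0⌋) ≤
    hEnt φ p C₀ q + Real.log 3 + Real.log (2 * M + 1) := by
  have hw := wpi_nonneg hp n
  set N := C₀ * q with hN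
  have h1 : ∀ z ∈ S, ent (fun x : {u // κ u = z} => wpi p n x)
      (fun x => ⌊2 ^ q * compWord φ (List.ofFn x.1) 0⌋) ≤
      ent (wprod (fun x : {u // κ u = z} => wpi p n x) (wpi p N))
        (fun y => ⌊2 ^ q * compWord φ (List.ofFn y.1.1) (pt φ y.2)⌋) +
      (∑ x : {u // κ u = z}, wpi p n x) * Real.log (2 * M + 1) := by
    intro z hz
    rw [← (isPush_fst (fun x : {u // κ u = z} => wpi p n x) (sum_wpi hp1 N)).ent]
    have := ent_floor_le (wprod_nonneg (fun x : {u // κ u = z} => hw x.1) (wpi_nonneg hp N))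
      (f := fun y => 2 ^ q * compWord φ (List.ofFn y.1.1) 0)
      (g := fun y => 2 ^ q * compWord φ (List.ofFn y.1.1) (pt φ y.2)) (M := M) (fun y => by
        have h2 := hR.abs_sub_le (List.ofFn y.1.1) zero_mem_unitI (hR.pt_mem y.2) zero_mem_unitI
        have h3 := abs_sub_le_one zero_mem_unitI (hR.pt_mem y.2)
        have h4 := hS y.1.1 (by rw [y.1.2]; exact hz)
        rw [← mul_sub, abs_mul, abs_of_pos (by positivity : (0 : ℝ) < 2 ^ q)]
        have h5 := abs_nonneg (dWord φ (List.ofFn y.1.1) 0)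
        have hK := hR.Kpos
        calc _ ≤ 2 ^ q * (K * |dWord φ (List.ofFn y.1.1) 0| * 1) := by
              refine mul_le_mul_of_nonneg_left (h2.trans ?_) (by positivity)
              exact mul_le_mul_of_nonneg_left h3 (by positivity)
          _ = K * (2 ^ q * |dWord φ (List.ofFn y.1.1) 0|) := by ring
          _ ≤ K * 1 := by gcongr
          _ ≤ M := by linarith)
    rwa [sum_wprod, sum_wpi hp1, mul_one] at this
  have h2 := sum_fibers_cent_le hw (wpi_nonneg hp N) κ S
    (fun y => ⌊2 ^ q * compWord φ (List.ofFn y.1) (pt φ y.2)⌋) (fun _ => ())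
  have h3 := (isPush_append p n N).ent (fun Y => ⌊2 ^ q * pt φ Y⌋)
  simp only [pt_append] at h3
  have h4 := (abs_le.1 (hEnt_trunc hR hp hp1 hC₀ (r := q) (N := n + N) (by omega))).2
  have h5 : ∑ z ∈ S, (∑ x : {u // κ u = z}, wpi p n x) ≤ 1 := by
    rw [sum_fibers, ← sum_wpi hp1 n]
    exact Finset.sum_le_sum fun u _ => by split_ifs; exacts [le_rfl, hw u]
  have h6 : 0 ≤ Real.log (2 * M + 1) := Real.log_nonneg (by
    have : (0 : ℝ) ≤ M := Nat.cast_nonneg _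
    linarith)
  have h7 := Finset.sum_le_sum h1
  rw [Finset.sum_add_distrib, ← Finset.sum_mul] at h7
  have h8 := mul_le_mul_of_nonneg_right h5 h6
  have h9 : ∑ z ∈ S, ent (wprod (fun x : {u // κ u = z} => wpi p n x) (wpi p N))
      (fun y => ⌊2 ^ q * compWord φ (List.ofFn y.1.1) (pt φ y.2)⌋) ≤
      ent (wprod (wpi p n) (wpi p N)) (fun y => ⌊2 ^ q * compWord φ (List.ofFn y.1) (pt φ y.2)⌋) := h2
  linarith

end SelfConformal

namespace SelfConformal

/-- The integer scale of a positive number at most one. -/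
def scale (y : ℝ) : ℕ := ⌊-Real.log y / Real.log 2⌋₊

lemma half_pow_eq_exp (z : ℕ) : (1 / 2 : ℝ) ^ z = Real.exp (-(z * Real.log 2)) := by
  rw [Real.exp_neg, mul_comm, Real.exp_mul, Real.exp_log (by norm_num), Real.rpow_natCast, one_div,
    inv_pow]

lemma two_pow_eq_exp (z : ℕ) : (2 : ℝ) ^ z = Real.exp (z * Real.log 2) := by
  rw [mul_comm, Real.exp_mul, Real.exp_log (by norm_num), Real.rpow_natCast]

lemma le_half_pow_scale {y : ℝ} (h0 : 0 < y) (h1 : y ≤ 1) : y ≤ (1 / 2) ^ scale y := by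
  have l2 : 0 < Real.log 2 := Real.log_pos (by norm_num)
  rw [half_pow_eq_exp, ← Real.log_le_iff_le_exp h0]
  have h2 := Nat.floor_le (div_nonneg (neg_nonneg.2 (Real.log_nonpos h0.le h1)) l2.le)
  rw [le_div_iff₀ l2] at h2
  unfold scale
  linarith

lemma half_pow_scale_le {y : ℝ} (h0 : 0 < y) : (1 / 2) ^ scale y / 2 ≤ y := by
  have l2 : 0 < Real.log 2 := Real.log_pos (by norm_num)
  have h : (1 / 2 : ℝ) ^ scale y / 2 = (1 / 2) ^ (scale y + 1) := by rw [pow_succ]; ring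
  rw [h, half_pow_eq_exp, ← Real.le_log_iff_exp_le h0]
  have h2 := Nat.lt_floor_add_one (-Real.log y / Real.log 2)
  rw [div_lt_iff₀ l2] at h2
  unfold scale
  push_cast
  linarith

lemma scale_mem_Icc {y a d : ℝ} (h : |Real.log y + a| ≤ d) :
    scale y ∈ Finset.Icc ⌊(a - d) / Real.log 2⌋₊ ⌊(a + d) / Real.log 2⌋₊ := by
  have l2 : 0 < Real.log 2 := Real.log_pos (by norm_num)
  rw [abs_le] at h
  rw [Finset.mem_Icc]
  constructor <;> refine Nat.floor_le_floor ?_ <;> gcongr <;> linarith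

lemma half_pow_bounds {a d : ℝ} (hda : d ≤ a) (hd : 0 ≤ d) {z : ℕ}
    (hz : z ∈ Finset.Icc ⌊(a - d) / Real.log 2⌋₊ ⌊(a + d) / Real.log 2⌋₊) :
    Real.exp (-a - d) ≤ (1 / 2) ^ z ∧ (1 / 2 : ℝ) ^ z ≤ 2 * Real.exp (d - a) := by
  have l2 : 0 < Real.log 2 := Real.log_pos (by norm_num)
  rw [Finset.mem_Icc] at hz
  have h1 : ((a - d) / Real.log 2) < z + 1 := by
    have h2 := Nat.lt_floor_add_one ((a - d) / Real.log 2)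
    have h3 : ((⌊(a - d) / Real.log 2⌋₊ : ℕ) : ℝ) ≤ z := Nat.cast_le.2 hz.1
    linarith
  have h2 : (z : ℝ) ≤ (a + d) / Real.log 2 :=
    (Nat.cast_le.2 hz.2).trans (Nat.floor_le (div_nonneg (by linarith) l2.le))
  rw [div_lt_iff₀ l2] at h1
  rw [le_div_iff₀ l2] at h2
  rw [half_pow_eq_exp]
  constructor
  · exact Real.exp_le_exp.2 (by linarith)
  · rw [← Real.exp_log (by norm_num : (0 : ℝ) < 2), ← Real.exp_add,
      Real.exp_log (by norm_num : (0 : ℝ) < 2)]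
    exact Real.exp_le_exp.2 (by linarith)

lemma two_pow_floor_bounds {x : ℝ} (hx : 0 ≤ x) :
    Real.exp x / 2 ≤ 2 ^ ⌊x / Real.log 2⌋₊ ∧ (2 : ℝ) ^ ⌊x / Real.log 2⌋₊ ≤ Real.exp x := by
  have l2 : 0 < Real.log 2 := Real.log_pos (by norm_num)
  have h1 := Nat.lt_floor_add_one (x / Real.log 2)
  have h2 := Nat.floor_le (div_nonneg hx l2.le)
  rw [div_lt_iff₀ l2] at h1
  rw [le_div_iff₀ l2] at h2
  rw [two_pow_eq_exp]
  constructor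
  · rw [div_le_iff₀ (by norm_num), ← Real.exp_log (by norm_num : (0 : ℝ) < 2), ← Real.exp_add,
      Real.exp_log (by norm_num : (0 : ℝ) < 2)]
    exact Real.exp_le_exp.2 (by linarith)
  · exact Real.exp_le_exp.2 h2

lemma two_pow_ceil_bounds {x : ℝ} (hx : 0 ≤ x) :
    Real.exp x ≤ 2 ^ ⌈x / Real.log 2⌉₊ ∧ (2 : ℝ) ^ ⌈x / Real.log 2⌉₊ ≤ 2 * Real.exp x := by
  have l2 : 0 < Real.log 2 := Real.log_pos (by norm_num)
  have h1 := Nat.ceil_lt_add_one (div_nonneg hx l2.le)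
  have h2 := Nat.le_ceil (x / Real.log 2)
  rw [div_le_iff₀ l2] at h2
  have h3 : (⌈x / Real.log 2⌉₊ : ℝ) * Real.log 2 ≤ x + Real.log 2 := by
    have := mul_le_mul_of_nonneg_right h1.le l2.le
    rwa [add_mul, div_mul_cancel₀ _ l2.ne', one_mul] at this
  rw [two_pow_eq_exp]
  constructor
  · exact Real.exp_le_exp.2 h2
  · rw [← Real.exp_log (by norm_num : (0 : ℝ) < 2), ← Real.exp_add,
      Real.exp_log (by norm_num : (0 : ℝ) < 2)]
    exact Real.exp_le_exp.2 (by linarith)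

variable {Λ : Type} [Fintype Λ] {φ : Λ → ℝ → ℝ} {ρ₀ ρ₁ K : ℝ} {p : Λ → ℝ} [Nonempty Λ]

lemma log_const_mul_exp_le {A x : ℝ} (hA : 0 ≤ A) (hx : 0 ≤ x) :
    Real.log (A * Real.exp x + 1) ≤ x + Real.log (A + 1) := by
  have h1 : 1 ≤ Real.exp x := Real.one_le_exp hx
  calc _ ≤ Real.log (Real.exp x * (A + 1)) := Real.log_le_log (by positivity) (by nlinarith)
    _ = _ := by rw [Real.log_mul (Real.exp_pos _).ne' (by positivity), Real.log_exp]

lemma log_scale_gap_le {q i : ℕ} {M a b d : ℝ} (hqi : q ≤ i)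
    (hi : (2 : ℝ) ^ i ≤ 2 * Real.exp (a + b + 3 * d)) (hq : Real.exp (a - d) / 2 ≤ 2 ^ q)
    (hbd : 0 ≤ b + 4 * d) (hM : 0 ≤ M) :
    Real.log (2 * (2 ^ (i - q) * (2 * M + 1)) + 1) ≤
      b + 4 * d + Real.log (8 * (2 * M + 1) + 1) := by
  refine le_trans (Real.log_le_log (by positivity) ?_)
    (log_const_mul_exp_le (by positivity) hbd)
  have h1 : (2 : ℝ) ^ (i - q) ≤ 4 * Real.exp (b + 4 * d) := by
    have h2 : (2 : ℝ) ^ (i - q) * 2 ^ q = 2 ^ i := by rw [← pow_add, Nat.sub_add_cancel hqi]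
    have h3 : Real.exp (a + b + 3 * d) = Real.exp (b + 4 * d) * Real.exp (a - d) := by
      rw [← Real.exp_add]; congr 1; ring
    have h4 := Real.exp_pos (a - d)
    have h5 : (0 : ℝ) < 2 ^ (i - q) := by positivity
    have h7 := mul_le_mul_of_nonneg_left hq h5.le
    refine le_of_mul_le_mul_right ?_ h4
    rw [h3] at hi
    linarith
  have h8 := mul_le_mul_of_nonneg_right h1 (by linarith : (0 : ℝ) ≤ 2 * M + 1)
  linarith

lemma log_ceil_le {K d : ℝ} (hd : 0 ≤ d) :
    Real.log (2 * ⌈4 * K ^ 2 * Real.exp (5 * d)⌉₊ + 1) ≤ 5 * d + Real.log (8 * K ^ 2 + 4) := by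
  have h1 : (⌈4 * K ^ 2 * Real.exp (5 * d)⌉₊ : ℝ) ≤ 4 * K ^ 2 * Real.exp (5 * d) + 1 :=
    (Nat.ceil_lt_add_one (by positivity)).le
  have h2 : 1 ≤ Real.exp (5 * d) := Real.one_le_exp (by linarith)
  have h3 : (2 : ℝ) * ⌈4 * K ^ 2 * Real.exp (5 * d)⌉₊ + 1 ≤
      (8 * K ^ 2 + 3) * Real.exp (5 * d) + 1 := by nlinarith
  have h4 := log_const_mul_exp_le (A := 8 * K ^ 2 + 3) (by positivity)
    (by linarith : 0 ≤ 5 * d)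
  rw [add_assoc (8 * K ^ 2), show (3 : ℝ) + 1 = 4 by norm_num] at h4
  exact (Real.log_le_log (by positivity) h3).trans h4

lemma typical_gain_le {T A D η Pu Pw P c g X : ℝ} (hT : 0 ≤ T) (hη : η ≤ 1 / 2)
    (hPu0 : 1 - η ≤ Pu) (hPu1 : Pu ≤ 1) (hPw0 : 1 - η ≤ Pw) (hPw1 : Pw ≤ 1) (hD : 0 ≤ D)
    (hA : A ≤ D) (hPc : 0 ≤ P * c) (hg0 : 0 ≤ g) (hg : g ≤ X) :
    T * (A - 2 * η * D) + P * c * g / 2 ≤ Pw * (T * (Pu * A) + P * (c * X)) := by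
  have hη0 : 0 ≤ η := by linarith
  have hPP : 1 - 2 * η ≤ Pw * Pu := by nlinarith
  have hPP1 : Pw * Pu ≤ 1 := by nlinarith
  have h10 : A - 2 * η * D ≤ Pw * Pu * A := by nlinarith
  have h16 := mul_le_mul_of_nonneg_left h10 hT
  have h13 := mul_le_mul_of_nonneg_left hg hPc
  have h15 : 0 ≤ P * c * g := mul_nonneg hPc hg0
  have h17 : P * c * g * (1 / 2) ≤ P * c * X * Pw := by
    refine mul_le_mul h13 (by linarith) (by norm_num) (h15.trans h13)
  linarith

set_option maxHeartbeats 2000000 in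
/-- The entropy gained between scales `i` and `i + T * m`, for a fixed separated level. -/
lemma Reg.step_inequality (hR : Reg φ ρ₀ ρ₁ K) (hp : ∀ i, 0 < p i) (hp1 : ∑ i, p i = 1) {C₀ : ℕ}
    (hC₀ : ρ₁ ^ C₀ ≤ 1 / 2) {B M : ℕ} (hB : K ≤ B * (ρ₀ / K * (1 / (2 * K)))) (hM : K ^ 2 ≤ M)
    {α C c ε : ℝ} {m : ℕ} (hC : 2 * Real.log 3 + Real.log (2 * B + 1) ≤ C)
    (hle : hEnt φ p C₀ m ≤ α * m + C) (hc : 0 ≤ c) (hε : 0 ≤ ε)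
    (hG : GrowthAt (hEnt φ p C₀) C c ε m)
    {k L : ℕ} {v : (Fin k → Bool) → Fin L → Λ} (hv : Function.Injective v) {Ck : ℝ} (hCk : 1 ≤ Ck)
    (hclose : ∀ w u u' : List Λ, ∀ t : (Fin k → Bool) → ℝ, ∀ δ : ℝ,
      (∀ l, t l ∈ compWord φ (w ++ List.ofFn (v l)) '' unitI) →
      (∀ l, |compWord φ u (t l) - compWord φ u' (t l)| ≤ δ) →
      ∀ x ∈ compWord φ w '' unitI,
        |compWord φ u x - compWord φ u' x| ≤ Ck * (δ + |dWord φ w 0| ^ k) ∧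
        |dWord φ w 0| * |dWord φ u x - dWord φ u' x| ≤ Ck * (δ + |dWord φ w 0| ^ k))
    {P : ℝ} (hP0 : 0 ≤ P) (hP : ∀ l, P ≤ wpi p L (v l))
    {n₁ n₂ T J : ℕ} {s a b d η : ℝ}
    (hsep : ∀ u u' : List Λ, u.length = n₁ + n₂ → u'.length = n₁ + n₂ → u ≠ u' →
      ∃ x ∈ unitI, s ≤ |compWord φ u x - compWord φ u' x|)
    (hd : 0 ≤ d) (hda : d ≤ a) (hb : 0 ≤ b)
    (hu : ∑ u, (if d < |(Real.log |dWord φ (List.ofFn u) 0| + a)| then wpi p n₁ u else 0) ≤ η)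
    (hw : ∑ w, (if d < |(Real.log |dWord φ (List.ofFn w) 0| + b)| then wpi p n₂ w else 0) ≤ η)
    (hη : η ≤ 1 / 2)
    (hJ : n₁ * -Real.log ρ₀ / Real.log 2 < J)
    (hs : Ck * (1 / 2 ^ (T * m) + Real.exp (k * (d - b))) < s)
    (hder : 2 ^ m * K * Ck * (Real.exp (-(a + b + 3 * d)) + Real.exp (k * (d - b))) ≤
      Real.exp (-a - b - 2 * d))
    (hquad : 2 ^ m * K ^ 4 ≤ Real.exp (b + 2 * d)) (hx : 1 ≤ ρ₀ ^ L * Real.exp d)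
    {i q : ℕ} (hi : i = ⌈(a + b + 3 * d) / Real.log 2⌉₊) (hq : q = ⌊(a - d) / Real.log 2⌋₊)
    {g : ℝ} (hg : g = n₁ * (-∑ i, p i * Real.log (p i)) - Real.log J -
      η * (n₁ * Real.log (Fintype.card Λ)) -
      (hEnt φ p C₀ q + Real.log 3 + Real.log (2 * M + 1)) -
      (b + 4 * d + Real.log (8 * (2 * M + 1) + 1) + 2 ^ k * (5 * d + Real.log (8 * K ^ 2 + 4))) -
      ε * m * (T * 2 ^ k)) (hg0 : 0 ≤ g) :
    T * (hEnt φ p C₀ m - (C + (Real.log (2 * (2 * M + 1 : ℕ) + 1) + Real.log (2 * (4 : ℕ) + 1))) -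
      2 * η * (α * m + C)) + P * c * g / 2 ≤
      hEnt φ p C₀ (i + T * m) - hEnt φ p C₀ i + 2 * Real.log 3 := by
  have hK := hR.Kpos
  have hK1 := hR.one_le
  have hρ := hR.pos
  have l2 : 0 < Real.log 2 := Real.log_pos (by norm_num)
  have hp0 : ∀ i, 0 ≤ p i := fun i => (hp i).le
  have hn₁ := wpi_nonneg hp0 n₁
  have hn₂ := wpi_nonneg hp0 n₂
  obtain ⟨hi1, hi2⟩ := two_pow_ceil_bounds (x := a + b + 3 * d) (by linarith)
  rw [← hi] at hi1 hi2
  obtain ⟨hq1, hq2⟩ := two_pow_floor_bounds (x := a - d) (by linarith)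
  rw [← hq] at hq1 hq2
  have hqi : q ≤ i := by
    have : (2 : ℝ) ^ q ≤ 2 ^ i := hq2.trans ((Real.exp_le_exp.2 (by linarith)).trans hi1)
    exact (pow_le_pow_iff_right₀ (by norm_num)).1 this
  set κ : (Fin n₁ → Λ) → ℕ := fun u => scale |dWord φ (List.ofFn u) 0| with hκ
  set b' := ⌊(a + d) / Real.log 2⌋₊ with hb'
  set S := Finset.Icc q b' with hS
  set M₂ := ⌈4 * K ^ 2 * Real.exp (5 * d)⌉₊ with hM₂
  obtain ⟨k₁, hk₁⟩ := exists_pow_mul_le hR.rho_one_nonneg hR.lt_one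
    (K * (2 ^ (i + T * m) * (2 ^ m * K) * (2 * K))) one_pos
  set N := C₀ * m + k₁ + k₁ + C₀ * (i + T * m) with hN
  have hD1 : ∀ u : Fin n₁ → Λ, |dWord φ (List.ofFn u) 0| ≤ 1 := fun u =>
    (hR.abs_dWord_le _ zero_mem_unitI).trans (pow_le_one₀ hR.rho_one_nonneg hR.lt_one.le)
  set A₀ := hEnt φ p C₀ m -
    (C + (Real.log (2 * (2 * M + 1 : ℕ) + 1) + Real.log (2 * (4 : ℕ) + 1))) with hA₀
  set R := Real.log (2 * (2 ^ (i - q) * (2 * M + 1)) + 1) + 2 ^ k * Real.log (2 * M₂ + 1) with hRdef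
  have hM0 : (0 : ℝ) ≤ M := Nat.cast_nonneg _
  have hR0 : 0 ≤ R := by
    refine add_nonneg (Real.log_nonneg ?_) (mul_nonneg (by positivity) (Real.log_nonneg ?_))
    · exact le_add_of_nonneg_left (by positivity)
    · exact le_add_of_nonneg_left (by positivity)
  have hRle : R ≤ b + 4 * d + Real.log (8 * (2 * M + 1) + 1) +
      2 ^ k * (5 * d + Real.log (8 * K ^ 2 + 4)) := by
    refine add_le_add ?_ (mul_le_mul_of_nonneg_left ?_ (by positivity))
    · exact log_scale_gap_le hqi hi2 hq1 (by linarith) hM0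
    · exact log_ceil_le hd
  set Pu := ∑ u, if κ u ∈ S then wpi p n₁ u else 0 with hPu
  set Pw := ∑ w, if ¬ d < |(Real.log |dWord φ (List.ofFn w) 0| + b)| then wpi p n₂ w else 0 with hPw
  have hPu1 : Pu ≤ 1 := by
    rw [← sum_wpi hp1 n₁]
    exact Finset.sum_le_sum fun u _ => by split_ifs; exacts [le_rfl, hn₁ u]
  have hPu0 : 1 - η ≤ Pu := by
    have : 1 ≤ Pu + ∑ u, (if d < |(Real.log |dWord φ (List.ofFn u) 0| + a)| then wpi p n₁ u else 0) := by
      rw [← sum_wpi hp1 n₁, hPu, ← Finset.sum_add_distrib]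
      refine Finset.sum_le_sum fun u _ => ?_
      by_cases h : d < |(Real.log |dWord φ (List.ofFn u) 0| + a)|
      · rw [if_pos h]
        have : 0 ≤ (if κ u ∈ S then wpi p n₁ u else 0) := by split_ifs; exacts [hn₁ u, le_rfl]
        linarith
      · have h2 : κ u ∈ S := by rw [hS, hq]; exact scale_mem_Icc (not_lt.1 h)
        rw [if_neg h, if_pos h2, add_zero]
    linarith
  have hPw1 : Pw ≤ 1 := by
    rw [← sum_wpi hp1 n₂]
    exact Finset.sum_le_sum fun u _ => by split_ifs; exacts [hn₂ u, le_rfl]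
  have hPw0 : 1 - η ≤ Pw := by
    have : 1 ≤ Pw + ∑ w, (if d < |(Real.log |dWord φ (List.ofFn w) 0| + b)| then wpi p n₂ w else 0) := by
      rw [← sum_wpi hp1 n₂, hPw, ← Finset.sum_add_distrib]
      refine Finset.sum_le_sum fun u _ => ?_
      by_cases h : d < |(Real.log |dWord φ (List.ofFn u) 0| + b)|
      · rw [if_pos h, if_neg (not_not.2 h), zero_add]
      · rw [if_neg h, if_pos h, add_zero]
    linarith
  set E₁ : ℕ → ℝ := fun z => ent (fun x : {u // κ u = z} => wpi p n₁ x) (fun x => x) with hE₁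
  set E₂ : ℕ → ℝ := fun z => ent (fun x : {u // κ u = z} => wpi p n₁ x)
      (fun x => ⌊2 ^ q * compWord φ (List.ofFn x.1) 0⌋) with hE₂
  set Q : ℕ → ℝ := fun z => ∑ x : {u // κ u = z}, wpi p n₁ x with hQ
  have main := increment_ge hp0 (L := L) (N := N) (i := i) (m := m) (T := T) κ S
    (fun w : Fin n₂ → Λ => ¬ d < |(Real.log |dWord φ (List.ofFn w) 0| + b)|)
    (fun z => T * (Q z * A₀) + P * (c * (E₁ z - E₂ z - Q z * R - ε * m * (T * 2 ^ k) * Q z)))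
    (by
      intro w hw' z hz
      rw [not_lt, abs_le] at hw'
      have hwpos := hR.dWord_pos (List.ofFn w) zero_mem_unitI
      have hw1 : Real.exp (-b - d) ≤ |dWord φ (List.ofFn w) 0| := by
        rw [← Real.le_log_iff_exp_le hwpos]; linarith
      have hw2 : |dWord φ (List.ofFn w) 0| ≤ Real.exp (d - b) := by
        rw [← Real.log_le_iff_le_exp hwpos]; linarith
      obtain ⟨hz1, hz2⟩ := half_pow_bounds hda hd (by rw [← hq]; exact hz)
      have hwk : |dWord φ (List.ofFn w) 0| ^ k ≤ Real.exp (k * (d - b)) := by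
        rw [mul_comm, Real.exp_mul, Real.rpow_natCast]
        exact pow_le_pow_left₀ hwpos.le hw2 k
      have hprod : Real.exp (-a - b - 2 * d) ≤ (1 / 2) ^ z * |dWord φ (List.ofFn w) 0| := by
        rw [show -a - b - 2 * d = (-a - d) + (-b - d) by ring, Real.exp_add]
        gcongr
      have hi3 : 1 / (2 : ℝ) ^ i ≤ Real.exp (-(a + b + 3 * d)) := by
        rw [Real.exp_neg, one_div]
        exact inv_anti₀ (Real.exp_pos _) hi1
      refine hR.sum_windows_ge hp0 hp1 hC₀ hB hM hC hc hG hv hCk hclose hP0 hP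
        (fun x => hn₁ x.1) (fun x : {u // κ u = z} => List.ofFn x.1) (D := (1 / 2) ^ z)
        (by positivity) ?_ ?_ (List.ofFn w) (k₁ := k₁) (s := s) ?_ ?_ ?_ ?_ ?_ ?_ ?_ ?_ hqi ?_ ?_
      · intro x
        have := half_pow_scale_le (hR.dWord_pos (List.ofFn x.1) zero_mem_unitI)
        rwa [show scale |dWord φ (List.ofFn x.1) 0| = z from x.2] at this
      · intro x
        have := le_half_pow_scale (hR.dWord_pos (List.ofFn x.1) zero_mem_unitI) (hD1 x.1)
        rwa [show scale |dWord φ (List.ofFn x.1) 0| = z from x.2] at this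
      · intro x x' hxx
        obtain ⟨y, hy, h⟩ := hsep (List.ofFn x.1 ++ List.ofFn w) (List.ofFn x'.1 ++ List.ofFn w)
          (by simp) (by simp) (fun h => hxx (Subtype.ext (List.ofFn_injective
            (List.append_cancel_right h))))
        rw [compWord_append, compWord_append] at h
        exact ⟨_, ⟨y, hy, rfl⟩, h⟩
      · refine lt_of_le_of_lt ?_ hs
        gcongr
        · norm_num
        · omega
      · refine le_trans ?_ (hder.trans hprod)
        gcongr
      · refine hquad.trans ?_
        rw [show b + 2 * d = (a + b + 3 * d) + (-a - d) by ring, Real.exp_add]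
        gcongr
      · refine hx.trans ?_
        gcongr
        have h6 : Real.exp d = Real.exp (a + b + 3 * d) * Real.exp (-a - b - 2 * d) := by
          rw [← Real.exp_add]; congr 1; ring
        rw [h6, mul_assoc]
        gcongr
      · refine le_trans (le_of_eq ?_) hk₁
        ring
      · exact pow_le_one₀ (by norm_num) (by norm_num)
      · rw [hN]; exact Nat.le_add_right _ _
      · have : q ≤ z := (Finset.mem_Icc.1 hz).1
        calc (2 : ℝ) ^ q * (1 / 2) ^ z ≤ 2 ^ q * (1 / 2) ^ q := by
              gcongr 2 ^ q * ?_
              exact pow_le_pow_of_le_one (by norm_num) (by norm_num) this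
          _ = 1 := by rw [← mul_pow]; norm_num
      · refine le_trans ?_ (Nat.le_ceil _)
        calc (2 : ℝ) ^ i * (K * (1 / 2) ^ z * (K * |dWord φ (List.ofFn w) 0|))
            ≤ (2 * Real.exp (a + b + 3 * d)) * (K * (2 * Real.exp (d - a)) * (K * Real.exp (d - b))) := by
              gcongr
          _ = 4 * K ^ 2 * (Real.exp (a + b + 3 * d) * Real.exp (d - a) * Real.exp (d - b)) := by ring
          _ = _ := by rw [← Real.exp_add, ← Real.exp_add]; congr 2; ring)
  have hE₁' := sum_fibers_ent_word_ge hp hp1 (J := J) κ (fun u => by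
    have h1 := hR.le_abs_dWord (List.ofFn u) zero_mem_unitI
    have h2 := hR.dWord_pos (List.ofFn u) zero_mem_unitI
    rw [List.length_ofFn] at h1
    have h3 := Real.log_le_log (by positivity) h1
    rw [Real.log_pow] at h3
    refine (Nat.floor_lt (div_nonneg (neg_nonneg.2 (Real.log_nonpos h2.le (hD1 u))) l2.le)).2 ?_
    refine lt_of_le_of_lt ?_ hJ
    gcongr
    linarith) S
  have hE₂' := sum_fibers_ent_floor_le hR hp0 hp1 hC₀ (q := q) (M := M) κ S
    (by nlinarith) (fun u hu' => by
      have h1 := le_half_pow_scale (hR.dWord_pos (List.ofFn u) zero_mem_unitI) (hD1 u)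
      have h2 : q ≤ scale |dWord φ (List.ofFn u) 0| := (Finset.mem_Icc.1 hu').1
      calc (2 : ℝ) ^ q * |dWord φ (List.ofFn u) 0| ≤ 2 ^ q * (1 / 2) ^ q := by
            gcongr 2 ^ q * ?_
            exact h1.trans (pow_le_pow_of_le_one (by norm_num) (by norm_num) h2)
        _ = 1 := by rw [← mul_pow]; norm_num)
  have hQs : ∑ z ∈ S, Q z = Pu := sum_fibers _ κ S
  have hsum : ∑ z ∈ S, (T * (Q z * A₀) + P * (c * (E₁ z - E₂ z - Q z * R - ε * m * (T * 2 ^ k) * Q z)))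
      = T * (Pu * A₀) + P * (c * (∑ z ∈ S, E₁ z - ∑ z ∈ S, E₂ z - Pu * R -
        ε * m * (T * 2 ^ k) * Pu)) := by
    rw [← hQs]
    simp only [Finset.sum_add_distrib, Finset.mul_sum, Finset.sum_mul, Finset.sum_sub_distrib, mul_sub]
  rw [hsum] at main
  have hcard : 0 ≤ (n₁ * Real.log (Fintype.card Λ) : ℝ) := mul_nonneg (by positivity)
    (Real.log_nonneg (by exact_mod_cast Fintype.card_pos))
  have hgle : g ≤ ∑ z ∈ S, E₁ z - ∑ z ∈ S, E₂ z - Pu * R - ε * m * (T * 2 ^ k) * Pu := by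
    have h1 : Pu * R ≤ R := mul_le_of_le_one_left hR0 hPu1
    have h2 : ε * m * (T * 2 ^ k) * Pu ≤ ε * m * (T * 2 ^ k) :=
      mul_le_of_le_one_right (by positivity) hPu1
    have h3 : (1 - Pu) * (n₁ * Real.log (Fintype.card Λ)) ≤ η * (n₁ * Real.log (Fintype.card Λ)) :=
      mul_le_mul_of_nonneg_right (by linarith) hcard
    rw [hg]
    linarith
  have hF1 := (abs_le.1 (hEnt_trunc hR hp0 hp1 hC₀ (r := i + T * m) (N := n₁ + (n₂ + (L + N)))
    (by omega))).2
  have hF2 := (abs_le.1 (hEnt_trunc hR hp0 hp1 hC₀ (r := i) (N := n₁ + (n₂ + (L + N)))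
    (by have : C₀ * i ≤ C₀ * (i + T * m) := Nat.mul_le_mul_left _ (Nat.le_add_right _ _)
        omega))).1
  have hη0 : 0 ≤ η := by linarith
  have hA₀le : A₀ ≤ α * m + C := by
    have h5 : 0 ≤ Real.log (2 * (2 * M + 1 : ℕ) + 1) := Real.log_nonneg (by
        have : (0 : ℝ) ≤ (2 * M + 1 : ℕ) := Nat.cast_nonneg _
        linarith)
    have h6 : 0 ≤ Real.log (2 * (4 : ℕ) + 1) := Real.log_nonneg (by norm_num)
    have h7 : 0 ≤ Real.log 3 := Real.log_nonneg (by norm_num)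
    have h8 : 0 ≤ Real.log (2 * B + 1) := Real.log_nonneg (by
        have : (0 : ℝ) ≤ B := Nat.cast_nonneg _
        linarith)
    linarith
  have hαC : 0 ≤ α * m + C := (hEnt_nonneg hp0 C₀ m).trans hle
  have harith := typical_gain_le (Nat.cast_nonneg T) hη hPu0 hPu1 hPw0 hPw1 hαC hA₀le
    (mul_nonneg hP0 hc) hg0 hgle
  have hfin := harith.trans main
  linarith only [hfin, hF1, hF2]

end SelfConformal

namespace SelfConformal

lemma eventually_le_mul (A : ℝ) {κ : ℝ} (hκ : 0 < κ) : ∀ᶠ n : ℕ in atTop, A ≤ κ * n :=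
  (tendsto_natCast_atTop_atTop.const_mul_atTop hκ).eventually_ge_atTop A

lemma eventually_le_exp (A : ℝ) {κ : ℝ} (hκ : 0 < κ) : ∀ᶠ n : ℕ in atTop, A ≤ Real.exp (κ * n) := by
  filter_upwards [eventually_le_mul A hκ] with n hn
  linarith [Real.add_one_le_exp (κ * n)]

lemma eventually_log_le {D κ : ℝ} (hD : 0 ≤ D) (hκ : 0 < κ) :
    ∀ᶠ n : ℕ in atTop, Real.log (D * n + 1) ≤ κ * n := by
  filter_upwards [eventually_le_mul (2 * D) (pow_pos hκ 2)] with n hn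
  have h0 : (0 : ℝ) ≤ n := Nat.cast_nonneg n
  rw [Real.log_le_iff_le_exp (by positivity)]
  refine le_trans ?_ (Real.quadratic_le_exp_of_nonneg (by positivity : 0 ≤ κ * n))
  have h1 := mul_le_mul_of_nonneg_right hn h0
  have h2 : 0 ≤ κ * n := by positivity
  nlinarith

variable {Λ : Type} [Fintype Λ] {φ : Λ → ℝ → ℝ} {ρ₀ ρ₁ K : ℝ} {p : Λ → ℝ} [Nonempty Λ]
  {μ : Measure ℝ}

lemma Reg.lyap_pos [IsProbabilityMeasure μ] (hR : Reg φ ρ₀ ρ₁ K) (hp : ∀ i, 0 ≤ p i)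
    (hp1 : ∑ i, p i = 1) (hμI : μ unitIᶜ = 0) : 0 < lyap φ p μ := by
  have h1 : ∀ i, ∫ x, Real.log |deriv (φ i) x| ∂μ ≤ Real.log ρ₁ := by
    intro i
    have h2 : ∫ _x, Real.log ρ₁ ∂μ = Real.log ρ₁ := by simp
    rw [← h2]
    refine integral_mono_ae (integrable_of_continuousOn hμI (hR.continuousOn_log_deriv i))
      (integrable_const _) ?_
    filter_upwards [ae_mem_unitI hμI] with x hx
    exact Real.log_le_log (hR.pos.trans_le (hR.lower i x hx)) (hR.upper i x hx)
  have h3 : ∑ i, p i * ∫ x, Real.log |deriv (φ i) x| ∂μ ≤ Real.log ρ₁ := by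
    calc _ ≤ ∑ i, p i * Real.log ρ₁ :=
          Finset.sum_le_sum fun i _ => mul_le_mul_of_nonneg_left (h1 i) (hp i)
      _ = _ := by rw [← Finset.sum_mul, hp1, one_mul]
  have h4 := Real.log_neg hR.rho_one_pos hR.lt_one
  unfold lyap
  linarith

lemma exists_ofFn_eq {k L : ℕ} {v : (Fin k → Bool) → List Λ} (hv : ∀ b, (v b).length = L) :
    ∃ v' : (Fin k → Bool) → Fin L → Λ, ∀ b, List.ofFn (v' b) = v b := by
  refine ⟨fun b j => (v b).get (j.cast (hv b).symm), fun b => ?_⟩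
  refine List.ext_getElem (by simp [hv]) fun n h1 h2 => ?_
  simp

lemma exists_pos_le_wpi (hp : ∀ i, 0 < p i) {k L : ℕ} (v : (Fin k → Bool) → Fin L → Λ) :
    ∃ P, 0 < P ∧ ∀ l, P ≤ wpi p L (v l) := by
  have h : ∀ l, 0 < wpi p L (v l) := fun l => Finset.prod_pos fun i _ => hp _
  obtain ⟨l, hl⟩ := Finite.exists_min fun l => wpi p L (v l)
  exact ⟨_, h l, hl⟩

end SelfConformal

namespace SelfConformal

variable {Λ : Type} [Fintype Λ] {φ : Λ → ℝ → ℝ} {ρ₀ ρ₁ K : ℝ} {p : Λ → ℝ} [Nonempty Λ]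
  {μ : Measure ℝ}

lemma exists_rate_of_expSep (h : ExpSep φ) : ∃ γ : ℝ, 0 < γ ∧ ∀ N : ℕ, ∃ n, N ≤ n ∧
    ∀ u₁ u₂ : List Λ, u₁.length = n → u₂.length = n → u₁ ≠ u₂ →
      ∃ x ∈ unitI, Real.exp (-(γ * n)) ≤ |compWord φ u₁ x - compWord φ u₂ x| := by
  obtain ⟨c, hc, h⟩ := h
  have h1 : 0 < min c (1 / 2) := lt_min hc (by norm_num)
  have h2 : min c (1 / 2) < 1 := (min_le_right _ _).trans_lt (by norm_num)
  refine ⟨-Real.log (min c (1 / 2)), neg_pos.2 (Real.log_neg h1 h2), fun N => ?_⟩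
  obtain ⟨n, hn, h⟩ := h N
  refine ⟨n, hn, fun u₁ u₂ l₁ l₂ hne => ?_⟩
  obtain ⟨x, hx, hle⟩ := h u₁ u₂ l₁ l₂ hne
  refine ⟨x, hx, le_trans ?_ hle⟩
  rw [neg_mul, neg_neg, mul_comm, Real.exp_nat_mul, Real.exp_log h1]
  exact pow_le_pow_left₀ h1.le (min_le_left _ _) n

lemma surplus_ge {x₁ x₂ N h χ δ H αχ Q lJ η lΛ hq c₁ c₂ k2 e ε Tm : ℝ}
    (hx : x₁ + x₂ = N) (hN : 0 ≤ N) (hx1 : x₁ ≤ N) (hx2 : Q * x₂ ≤ N) (hx20 : 0 ≤ x₂)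
    (hQ2 : 2 ≤ Q) (hQ : 4 * χ ≤ Q * h) (hh : h = H - αχ) (hδ : δ = h / 4) (hχ : 0 ≤ χ)
    (hh0 : 0 < h)
    (h1 : lJ ≤ δ / 16 * N) (hη : η * lΛ ≤ δ / 16) (hηl : 0 ≤ η * lΛ)
    (h2 : hq ≤ αχ * x₁ + c₁) (he : (4 + 5 * k2) * e ≤ δ / 16)
    (hc : c₁ + c₂ ≤ δ / 16 * N) (hT : ε * k2 * Tm ≤ δ / 8 * N) :
    δ * N / 2 ≤ x₁ * H - lJ - η * (x₁ * lΛ) - hq - (χ * x₂ + (4 + 5 * k2) * (e * N)) - c₂ -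
      ε * k2 * Tm := by
  have a1 : η * (x₁ * lΛ) ≤ δ / 16 * N := by
    calc η * (x₁ * lΛ) = η * lΛ * x₁ := by ring
      _ ≤ η * lΛ * N := mul_le_mul_of_nonneg_left hx1 hηl
      _ ≤ _ := mul_le_mul_of_nonneg_right hη hN
  have a2 : (4 + 5 * k2) * (e * N) ≤ δ / 16 * N := by
    rw [← mul_assoc]; exact mul_le_mul_of_nonneg_right he hN
  have a3 : χ * x₂ ≤ h / 4 * N := by
    have b1 := mul_le_mul_of_nonneg_right hQ hx20
    have b2 := mul_le_mul_of_nonneg_left hx2 hh0.le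
    nlinarith
  have a4 : h * x₁ ≥ h * N / 2 := by
    have : x₂ ≤ N / 2 := by nlinarith
    nlinarith
  have a5 : x₁ * H = h * x₁ + αχ * x₁ := by rw [hh]; ring
  rw [a5]
  have a6 : h = 4 * δ := by linarith
  rw [a6] at a3 a4 ⊢
  have a7 : 0 ≤ δ * N := mul_nonneg (by linarith) hN
  linarith

lemma no_gain {θ N T m α C C₂ hm ε₁ ε₂ η M₀ Δ i hi hiT l3 χ ℓ : ℝ}
    (hT : 0 ≤ T) (hN : 0 ≤ N)
    (main : T * (hm - C₂ - 2 * η * (α * m + C)) + Δ ≤ hiT - hi + 2 * l3)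
    (hΔ : θ * N ≤ Δ) (hup : hiT ≤ α * (i + T * m) + C) (hlow : (α - ε₁) * i ≤ hi)
    (hmlow : (α - ε₂) * m ≤ hm) (hC₂ : C₂ ≤ ε₂ * m) (hC : C ≤ m) (hη : 0 ≤ η) (hε₂ : 0 ≤ ε₂)
    (hα : 0 ≤ α)
    (hε₁ : 0 ≤ ε₁) (hTm : T * m ≤ M₀ * N + m) (hi' : i ≤ 3 * χ / ℓ * N + 1)
    (h1 : M₀ * (2 * ε₂) ≤ θ / 8) (h2 : M₀ * (2 * η * (α + 1)) ≤ θ / 8)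
    (h3 : ε₁ * (3 * χ / ℓ) ≤ θ / 8)
    (h4 : m * (2 * ε₂ + 2 * η * (α + 1)) + ε₁ + C + 2 * l3 ≤ θ / 8 * N) (hθ : 0 < θ)
    (hN1 : 0 < N) : False := by
  have a1 : T * (2 * η * (α * m + C)) ≤ 2 * η * (α + 1) * (T * m) := by
    have : T * (2 * η * (α * m + C)) ≤ T * (2 * η * (α * m + m)) := by gcongr
    linarith
  have a2 : T * ((α - ε₂) * m - ε₂ * m) ≤ T * (hm - C₂) :=
    mul_le_mul_of_nonneg_left (by linarith) hT
  have a3 : (2 * ε₂ + 2 * η * (α + 1)) * (T * m) ≤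
      (2 * ε₂ + 2 * η * (α + 1)) * (M₀ * N + m) := by gcongr
  have a4 : ε₁ * i ≤ ε₁ * (3 * χ / ℓ * N + 1) := by gcongr
  have a5 := mul_le_mul_of_nonneg_right h1 hN
  have a6 := mul_le_mul_of_nonneg_right h2 hN
  have a7 := mul_le_mul_of_nonneg_right h3 hN
  have a8 : 0 < θ * N := mul_pos hθ hN1
  linarith

set_option maxHeartbeats 1000000 in
/-- The entropy dimension is either full or at least the ratio of entropy to Lyapunov exponent. -/
theorem Reg.entropy_dim_dichotomy [IsProbabilityMeasure μ] (hR : Reg φ ρ₀ ρ₁ K)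
    (hp : ∀ i, 0 < p i) (hp1 : ∑ i, p i = 1) (hμI : μ unitIᶜ = 0)
    (hμ : μ = ∑ i : Λ, ENNReal.ofReal (p i) • Measure.map (φ i) μ)
    (hnofix : ¬ ∃ x ∈ unitI, ∀ i, φ i x = x) (hsep : ExpSep φ) {C₀ : ℕ}
    (hC₀ : ρ₁ ^ C₀ ≤ 1 / 2) {α C₁ : ℝ} (hα : 0 ≤ α) (hC₁ : 0 ≤ C₁)
    (hle : ∀ r : ℕ, hEnt φ p C₀ r ≤ α * r + C₁)
    (hlim : Tendsto (fun r : ℕ => hEnt φ p C₀ r / r) atTop (𝓝 α)) :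
    Real.log 2 ≤ α ∨ (-∑ i, p i * Real.log (p i)) * Real.log 2 ≤ α * lyap φ p μ := by
  by_contra! hcon
  obtain ⟨hα2, hαχ⟩ := hcon
  have hp0 : ∀ i, 0 ≤ p i := fun i => (hp i).le
  have hχ := hR.lyap_pos hp0 hp1 hμI
  obtain ⟨D, hD0, hD⟩ := hR.log_deviation hp0 hp1 hμI hμ
  have l2 : 0 < Real.log 2 := Real.log_pos (by norm_num)
  have hK1 := hR.one_le
  have hρ := hR.pos
  have hK := hR.Kpos
  obtain ⟨B, hB⟩ : ∃ B : ℕ, K ≤ B * (ρ₀ / K * (1 / (2 * K))) := by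
    have h : 0 < ρ₀ / K * (1 / (2 * K)) := by positivity
    obtain ⟨B, hB⟩ := exists_nat_ge (K / (ρ₀ / K * (1 / (2 * K))))
    exact ⟨B, (div_le_iff₀ h).1 hB⟩
  obtain ⟨M, hM⟩ := exists_nat_ge (K ^ 2)
  obtain ⟨γ, hγ, hsep⟩ := exists_rate_of_expSep hsep
  generalize lyap φ p μ = χ at *
  obtain ⟨H, hH⟩ : ∃ H, H = -∑ i, p i * Real.log (p i) := ⟨_, rfl⟩
  rw [← hH] at hαχ
  obtain ⟨C, hC⟩ : ∃ C, C = max C₁ (2 * Real.log 3 + Real.log (2 * B + 1)) := ⟨_, rfl⟩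
  have hC0 : 0 ≤ C := hC₁.trans (hC ▸ le_max_left _ _)
  have hCB : 2 * Real.log 3 + Real.log (2 * B + 1) ≤ C := hC ▸ le_max_right _ _
  have hle' : ∀ r : ℕ, hEnt φ p C₀ r ≤ α * r + C := fun r =>
    (hle r).trans (add_le_add le_rfl (hC ▸ le_max_left _ _))
  set C₂ := C + (Real.log (2 * (2 * M + 1 : ℕ) + 1) + Real.log (2 * (4 : ℕ) + 1)) with hC₂
  obtain ⟨h, hh⟩ : ∃ h, h = H - α * χ / Real.log 2 := ⟨_, rfl⟩
  have hh0 : 0 < h := by rw [hh, sub_pos, div_lt_iff₀ l2]; exact hαχ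
  obtain ⟨δ, hδ⟩ : ∃ δ, δ = h / 4 := ⟨_, rfl⟩
  have hδ0 : 0 < δ := by linarith
  obtain ⟨M₀, hM₀⟩ : ∃ M₀, M₀ = (γ + 1) / Real.log 2 := ⟨_, rfl⟩
  have hM₀0 : 0 < M₀ := by rw [hM₀]; positivity
  obtain ⟨Q, hQ⟩ := exists_nat_ge (2 + 4 * χ / h)
  have hQ2 : (2 : ℝ) ≤ Q := by have : 0 ≤ 4 * χ / h := by positivity
                               linarith
  have hQχ : 4 * χ ≤ Q * h := by
    rw [← div_le_iff₀ hh0]; linarith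
  obtain ⟨G, hGdef⟩ : ∃ G, G = γ + 2 * χ + 2 := ⟨_, rfl⟩
  have hG0 : 0 < G := by linarith
  obtain ⟨k, hk⟩ : ∃ k : ℕ, k = ⌈2 * Q * G / χ⌉₊ := ⟨_, rfl⟩
  have hk1 : 1 ≤ k := by rw [hk, Nat.one_le_ceil_iff]; positivity
  have hkG : G ≤ k * (χ / (2 * Q)) := by
    have : 2 * Q * G / χ ≤ k := hk ▸ Nat.le_ceil _
    rw [div_le_iff₀ hχ] at this
    rw [← mul_div_assoc, le_div_iff₀ (by positivity)]
    linarith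
  obtain ⟨L, v₀, s₀, hs₀, hlen, hv₀⟩ := hR.exists_cylinders hnofix k
  obtain ⟨v, hv⟩ := exists_ofFn_eq hlen
  obtain ⟨P, hP0, hP⟩ := exists_pos_le_wpi hp v
  have hvinj : Function.Injective v := by
    intro b b' hbb
    by_contra hne
    have h1 := hv₀ b b' hne 0 zero_mem_unitI 0 zero_mem_unitI
    rw [← hv b, ← hv b', hbb, sub_self, abs_zero] at h1
    linarith
  obtain ⟨Ck, hCk, hclose⟩ := hR.exists_close hk1 hs₀ hv₀
  simp only [← hv] at hclose
  obtain ⟨ε, hε⟩ : ∃ ε, ε = δ / (16 * 2 ^ k * M₀) := ⟨_, rfl⟩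
  have hε0 : 0 < ε := by rw [hε]; positivity
  obtain ⟨c, hc, m₀, hgrow⟩ := entropy_growth hα hα2 hle' hlim hε0
  obtain ⟨θ, hθ⟩ : ∃ θ, θ = P * c * δ / 4 := ⟨_, rfl⟩
  have hθ0 : 0 < θ := by rw [hθ]; positivity
  obtain ⟨ε₂, hε₂⟩ : ∃ ε₂, ε₂ = θ / (16 * M₀) := ⟨_, rfl⟩
  have hε₂0 : 0 < ε₂ := by rw [hε₂]; positivity
  obtain ⟨ε₁, hε₁⟩ : ∃ ε₁, ε₁ = θ * Real.log 2 / (24 * χ) := ⟨_, rfl⟩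
  have hε₁0 : 0 < ε₁ := by rw [hε₁]; positivity
  have hlow : ∀ ε' : ℝ, 0 < ε' → ∀ᶠ r : ℕ in atTop, (α - ε') * r ≤ hEnt φ p C₀ r := by
    intro ε' hε'
    filter_upwards [hlim.eventually_const_le (by linarith : α - ε' < α), eventually_gt_atTop 0]
      with r h1 h2
    rwa [le_div_iff₀ (by exact_mod_cast h2)] at h1
  obtain ⟨m, hm₀, hmlow, hmC₂, hmC, hm1⟩ := ((eventually_ge_atTop m₀).and
    ((hlow ε₂ hε₂0).and ((eventually_le_mul C₂ hε₂0).and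
      ((eventually_le_mul C one_pos).and (eventually_ge_atTop 1))))).exists
  rw [one_mul] at hmC
  have hm1' : (1 : ℝ) ≤ m := by exact_mod_cast hm1
  have hGrow : GrowthAt (hEnt φ p C₀) C c ε m := hgrow m hm₀
  obtain ⟨e, he⟩ : ∃ e, e = min (χ / (2 * Q)) (δ / (16 * (4 + 5 * 2 ^ k))) := ⟨_, rfl⟩
  have he0 : 0 < e := by rw [he]; exact lt_min (by positivity) (by positivity)
  have heQ : e ≤ χ / (2 * Q) := he ▸ min_le_left _ _
  have heχ : e ≤ χ / 2 := heQ.trans (by gcongr; linarith)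
  have heδ : (4 + 5 * 2 ^ k) * e ≤ δ / 16 := by
    have : e ≤ δ / (16 * (4 + 5 * 2 ^ k)) := he ▸ min_le_right _ _
    rw [le_div_iff₀ (by positivity)] at this
    linarith
  have hlΛ : 0 ≤ Real.log (Fintype.card Λ) :=
    Real.log_nonneg (by exact_mod_cast Fintype.card_pos)
  obtain ⟨η, hη⟩ : ∃ η, η = min (1 / 2) (min (δ / (16 * (Real.log (Fintype.card Λ) + 1)))
    (θ / (16 * M₀ * (α + 1)))) := ⟨_, rfl⟩
  have hη0 : 0 < η := by
    rw [hη]; exact lt_min (by norm_num) (lt_min (by positivity) (by positivity))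
  have hη2 : η ≤ 1 / 2 := hη ▸ min_le_left _ _
  have hηΛ : η * Real.log (Fintype.card Λ) ≤ δ / 16 := by
    have : η ≤ δ / (16 * (Real.log (Fintype.card Λ) + 1)) :=
      hη ▸ (min_le_right _ _).trans (min_le_left _ _)
    rw [le_div_iff₀ (by positivity)] at this
    linarith
  have hηθ : M₀ * (2 * η * (α + 1)) ≤ θ / 8 := by
    have : η ≤ θ / (16 * M₀ * (α + 1)) :=
      hη ▸ (min_le_right _ _).trans (min_le_right _ _)
    rw [le_div_iff₀ (by positivity)] at this
    linarith
  obtain ⟨I₀, hI₀⟩ := eventually_atTop.1 (hlow ε₁ hε₁0)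
  have hlρ : 0 < -Real.log ρ₀ / Real.log 2 := by
    have h1 : ρ₀ ≤ ρ₁ := by
      obtain ⟨i⟩ := ‹Nonempty Λ›
      exact (hR.lower i 0 zero_mem_unitI).trans (hR.upper i 0 zero_mem_unitI)
    exact div_pos (neg_pos.2 (Real.log_neg hρ (h1.trans_lt hR.lt_one))) l2
  obtain ⟨c₂, hc₂⟩ : ∃ c₂, c₂ = Real.log 3 + Real.log (2 * M + 1) +
    Real.log (8 * (2 * M + 1) + 1) + 2 ^ k * Real.log (8 * K ^ 2 + 4) := ⟨_, rfl⟩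
  have hδ16 : 0 < δ / 16 := by positivity
  obtain ⟨N₀, hN₀⟩ := eventually_atTop.1 <| (eventually_ge_atTop Q).and <|
    (eventually_le_exp (Ck * (1 + Real.exp (k * χ)) + 1) one_pos).and <|
    (eventually_le_exp (2 * (2 ^ m * K * Ck)) he0).and <|
    (eventually_le_exp (2 * (2 ^ m * K * Ck * Real.exp (k * χ))) one_pos).and <|
    (eventually_le_exp (2 ^ m * K ^ 4) he0).and <|
    (eventually_le_exp (1 / ρ₀ ^ L) he0).and <|
    (eventually_log_le hlρ.le hδ16).and <|
    (eventually_le_mul (C + c₂) hδ16).and <|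
    (eventually_le_mul (ε * 2 ^ k * m) hδ16).and <|
    (eventually_le_mul (I₀ : ℝ) (div_pos hχ l2)).and <|
    (eventually_le_mul (m * (2 * ε₂ + 2 * η * (α + 1)) + ε₁ + C + 2 * Real.log 3)
      (by positivity : 0 < θ / 8)).and <|
    (eventually_le_mul D (by positivity : 0 < η * e ^ 2))
  obtain ⟨n, hn, hsepn⟩ := hsep N₀
  obtain ⟨hnQ, f1, f2, f3, f4, f5, f6, f7, f8, f9, f10, f11⟩ := hN₀ n hn
  clear hsep hN₀ hgrow
  have hQn : 0 < Q := by
    have : (0 : ℝ) < Q := by linarith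
    exact_mod_cast this
  have hn0 : 0 < n := hQn.trans_le hnQ
  obtain ⟨n₂, hn₂⟩ : ∃ n₂, n₂ = n / Q := ⟨_, rfl⟩
  obtain ⟨n₁, hn₁⟩ : ∃ n₁, n₁ = n - n₂ := ⟨_, rfl⟩
  have hn2n : n₂ ≤ n := hn₂ ▸ Nat.div_le_self _ _
  have hnn : n₁ + n₂ = n := by omega
  have hn₂1 : 1 ≤ n₂ := by rw [hn₂]; exact Nat.div_pos hnQ hQn
  have hmod := Nat.div_add_mod n Q
  have hmodlt := Nat.mod_lt n hQn
  rw [← hn₂] at hmod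
  have hx2 : (Q : ℝ) * n₂ ≤ n := by exact_mod_cast (by omega : Q * n₂ ≤ n)
  have hx2' : (n : ℝ) ≤ Q * n₂ + Q := by exact_mod_cast (by omega : n ≤ Q * n₂ + Q)
  have hx : (n₁ : ℝ) + n₂ = n := by exact_mod_cast hnn
  have hx20 : (0 : ℝ) ≤ n₂ := Nat.cast_nonneg _
  have hx10 : (0 : ℝ) ≤ n₁ := Nat.cast_nonneg _
  have hN0 : (0 : ℝ) < n := by exact_mod_cast hn0
  have hx2h : (n₂ : ℝ) ≤ n / 2 := by
    have := mul_le_mul_of_nonneg_right hQ2 hx20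
    linarith
  have hn₁1 : 1 ≤ n₁ := by
    have : (0 : ℝ) < n₁ := by linarith
    exact_mod_cast this
  have hdev : ∀ n' : ℕ, 1 ≤ n' → n' ≤ n → ∑ u, (if e * n <
      |(Real.log |dWord φ (List.ofFn u) 0| + n' * χ)| then wpi p n' u else 0) ≤ η := by
    intro n' h1 h2
    refine (hD n' h1 (e * n) (by positivity)).trans ?_
    rw [div_le_iff₀ (by positivity)]
    have h3 : (n' : ℝ) ≤ n := by exact_mod_cast h2
    calc D * n' ≤ η * e ^ 2 * n * n := by gcongr
      _ = _ := by ring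
  have hkd : k * (e * n - n₂ * χ) ≤ -(G * n) + k * χ := by
    have h1 : e * n ≤ χ / (2 * Q) * n := by gcongr
    have h2 : (n : ℝ) / Q - 1 ≤ n₂ := by
      rw [sub_le_iff_le_add, div_le_iff₀ (by linarith)]; linarith
    have h3 : χ * (n / Q - 1) ≤ χ * n₂ := by gcongr
    have h4 : e * n - n₂ * χ ≤ -(χ / (2 * Q)) * n + χ := by
      have h5 : χ * (n / Q - 1) = 2 * (χ / (2 * Q) * n) - χ := by
        field_simp
      linarith
    have h6 := mul_le_mul_of_nonneg_left h4 (Nat.cast_nonneg k : (0 : ℝ) ≤ k)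
    have h7 := mul_le_mul_of_nonneg_right hkG hN0.le
    linarith
  obtain ⟨T, hT⟩ : ∃ T, T = ⌈M₀ * n / m⌉₊ := ⟨_, rfl⟩
  have hmpos : (0 : ℝ) < m := by linarith
  have hT1 : M₀ * n ≤ T * m := by
    rw [← div_le_iff₀ hmpos, hT]; exact Nat.le_ceil _
  have hT2 : (T : ℝ) * m ≤ M₀ * n + m := by
    have h1 := (Nat.ceil_lt_add_one (by positivity : 0 ≤ M₀ * n / m)).le
    rw [← hT] at h1
    have := mul_le_mul_of_nonneg_right h1 hmpos.le
    rwa [add_mul, div_mul_cancel₀ _ hmpos.ne', one_mul] at this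
  have henχ : e * n ≤ χ / 2 * n := by gcongr
  have hab : n₁ * χ + n₂ * χ = χ * n := by rw [← hx]; ring
  have hen0 : 0 < e * n := by positivity
  have hen : e * n ≤ n₁ * χ := by
    refine henχ.trans ?_
    have := mul_le_mul_of_nonneg_left (by linarith : (n : ℝ) / 2 ≤ n₁) hχ.le
    linarith
  obtain ⟨J, hJ⟩ : ∃ J, J = ⌊n₁ * -Real.log ρ₀ / Real.log 2⌋₊ + 1 := ⟨_, rfl⟩
  obtain ⟨q, hq⟩ : ∃ q, q = ⌊(n₁ * χ - e * n) / Real.log 2⌋₊ := ⟨_, rfl⟩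
  obtain ⟨i, hi⟩ : ∃ i, i = ⌈(n₁ * χ + n₂ * χ + 3 * (e * n)) / Real.log 2⌉₊ := ⟨_, rfl⟩
  have hJn : Real.log J ≤ δ / 16 * n := by
    refine le_trans (Real.log_le_log (by rw [hJ]; positivity) ?_) f6
    rw [hJ]
    push_cast
    gcongr
    refine (Nat.floor_le (by rw [mul_div_assoc]; positivity)).trans ?_
    rw [mul_div_assoc, mul_comm]
    gcongr
    linarith
  have hqn : hEnt φ p C₀ q ≤ α * χ / Real.log 2 * n₁ + C := by
    refine (hle' q).trans (add_le_add ?_ le_rfl)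
    have h1 : (q : ℝ) ≤ (n₁ * χ - e * n) / Real.log 2 := by
      rw [hq]; exact Nat.floor_le (div_nonneg (by linarith) l2.le)
    have h2 : (q : ℝ) ≤ n₁ * χ / Real.log 2 := h1.trans (by gcongr; have : 0 ≤ e * n := by positivity
                                                            linarith)
    calc α * q ≤ α * (n₁ * χ / Real.log 2) := by gcongr
      _ = _ := by ring
  have hTε : ε * 2 ^ k * (T * m) ≤ δ / 8 * n := by
    have h1 : ε * 2 ^ k * (T * m) ≤ ε * 2 ^ k * (M₀ * n + m) := by gcongr
    have h2 : ε * 2 ^ k * M₀ = δ / 16 := by rw [hε]; field_simp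
    have h3 : ε * 2 ^ k * (M₀ * n + m) = ε * 2 ^ k * M₀ * n + ε * 2 ^ k * m := by ring
    rw [h3, h2] at h1
    linarith
  have hsurplus := surplus_ge hx hN0.le (by linarith) hx2 hx20 hQ2 hQχ hh hδ hχ.le hh0 hJn hηΛ
    (by positivity) hqn heδ f7 hTε
  obtain ⟨g, hg⟩ : ∃ g, g = n₁ * (-∑ i, p i * Real.log (p i)) - Real.log J -
      η * (n₁ * Real.log (Fintype.card Λ)) -
      (hEnt φ p C₀ q + Real.log 3 + Real.log (2 * M + 1)) -
      (n₂ * χ + 4 * (e * n) + Real.log (8 * (2 * M + 1) + 1) +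
        2 ^ k * (5 * (e * n) + Real.log (8 * K ^ 2 + 4))) -
      ε * m * (T * 2 ^ k) := ⟨_, rfl⟩
  have hgn : δ * n / 2 ≤ g := by
    rw [← hH] at hg
    linarith
  clear hsurplus
  have step := hR.step_inequality hp hp1 hC₀ hB hM hCB (hle' m) hc.le hε0.le hGrow hvinj hCk
    hclose hP0.le hP (n₁ := n₁) (n₂ := n₂) (T := T)
    (J := J) (s := Real.exp (-(γ * n))) (a := n₁ * χ)
    (b := n₂ * χ) (d := e * n) (η := η) (by rw [hnn]; exact hsepn) (by positivity)
    hen (by positivity) (hdev n₁ hn₁1 (by omega)) (hdev n₂ hn₂1 hn2n) hη2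
    (by rw [hJ]; push_cast; exact Nat.lt_floor_add_one _) ?_ ?_ ?_ ?_ hi hq hg ?_
  · refine no_gain (ε₁ := ε₁) (ε₂ := ε₂) (η := η) (M₀ := M₀) (χ := χ) (ℓ := Real.log 2)
      (Nat.cast_nonneg T) hN0.le step (θ := θ) ?_
      (by have := hle' (i + T * m); push_cast at this; exact this) (hI₀ i ?_) hmlow hmC₂ hmC hη0.le
      hε₂0.le hα hε₁0.le hT2 ?_ ?_ hηθ ?_ f10 hθ0 hN0
    · have h1 := mul_le_mul_of_nonneg_left hgn (by positivity : 0 ≤ P * c)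
      rw [hθ]
      linarith
    · have h1 : χ / Real.log 2 * n ≤ i := by
        rw [hi]
        refine le_trans ?_ (Nat.le_ceil _)
        rw [div_mul_eq_mul_div]
        gcongr
        linarith
      exact_mod_cast f9.trans h1
    · rw [hi]
      refine (Nat.ceil_lt_add_one (by positivity)).le.trans ?_
      gcongr
      rw [div_mul_eq_mul_div]
      gcongr
      linarith
    · rw [hε₂]; apply le_of_eq; field_simp; norm_num
    · rw [hε₁]; apply le_of_eq; field_simp; norm_num
  · have h1 : 1 / (2 : ℝ) ^ (T * m) ≤ Real.exp (-((γ + 1) * n)) := by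
      rw [← one_div_pow, half_pow_eq_exp]
      refine Real.exp_le_exp.2 (neg_le_neg ?_)
      have h2 := mul_le_mul_of_nonneg_right hT1 l2.le
      have h3 : M₀ * n * Real.log 2 = (γ + 1) * n := by rw [hM₀]; field_simp
      push_cast
      linarith
    have h4 : Real.exp (k * (e * n - n₂ * χ)) ≤ Real.exp (-((γ + 1) * n)) * Real.exp (k * χ) := by
      rw [← Real.exp_add]
      refine Real.exp_le_exp.2 (hkd.trans ?_)
      have : (γ + 1) * n ≤ G * n := by gcongr; linarith
      linarith
    have h5 := Real.exp_pos (-((γ + 1) * n))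
    have h6 : Real.exp (-(γ * n)) = Real.exp (1 * n) * Real.exp (-((γ + 1) * n)) := by
      rw [← Real.exp_add]; congr 1; ring
    calc _ ≤ Ck * (Real.exp (-((γ + 1) * n)) + Real.exp (-((γ + 1) * n)) * Real.exp (k * χ)) := by
          gcongr
      _ = Ck * (1 + Real.exp (k * χ)) * Real.exp (-((γ + 1) * n)) := by ring
      _ < _ := by rw [h6]; exact mul_lt_mul_of_pos_right (by linarith) h5
  · have h1 : -(n₁ * χ) - n₂ * χ = -(χ * n) := by rw [← hx]; ring
    have h2 : Real.exp (-(n₁ * χ + n₂ * χ + 3 * (e * n))) =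
        Real.exp (-(χ * n) - 2 * (e * n)) * Real.exp (-(e * n)) := by
      rw [← Real.exp_add]; congr 1; linarith
    have h4 : Real.exp (k * (e * n - n₂ * χ)) ≤
        Real.exp (-(χ * n) - 2 * (e * n)) * (Real.exp (-(1 * n)) * Real.exp (k * χ)) := by
      rw [← Real.exp_add, ← Real.exp_add]
      refine Real.exp_le_exp.2 (hkd.trans ?_)
      have : (χ + χ + 1) * n ≤ G * n := by gcongr; linarith
      linarith
    rw [h1, h2]
    have h5 : 2 ^ m * K * Ck * Real.exp (-(e * n)) ≤ 1 / 2 := by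
      rw [Real.exp_neg, ← div_eq_mul_inv, div_le_iff₀ (Real.exp_pos _)]; linarith
    have h6 : 2 ^ m * K * Ck * (Real.exp (-(1 * n)) * Real.exp (k * χ)) ≤ 1 / 2 := by
      rw [mul_comm (Real.exp (-(1 * n))), ← mul_assoc, Real.exp_neg, ← div_eq_mul_inv,
        div_le_iff₀ (Real.exp_pos _)]
      linarith
    calc _ ≤ 2 ^ m * K * Ck * (Real.exp (-(χ * n) - 2 * (e * n)) * Real.exp (-(e * n)) +
          Real.exp (-(χ * n) - 2 * (e * n)) * (Real.exp (-(1 * n)) * Real.exp (k * χ))) := by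
          gcongr
      _ = Real.exp (-(χ * n) - 2 * (e * n)) * (2 ^ m * K * Ck * Real.exp (-(e * n)) +
          2 ^ m * K * Ck * (Real.exp (-(1 * n)) * Real.exp (k * χ))) := by ring
      _ ≤ Real.exp (-(χ * n) - 2 * (e * n)) * 1 :=
          mul_le_mul_of_nonneg_left (by linarith) (Real.exp_pos _).le
      _ = _ := mul_one _
  · refine f4.trans (Real.exp_le_exp.2 ?_)
    have : 0 ≤ e * n := by positivity
    have : 0 ≤ n₂ * χ := by positivity
    linarith
  · rw [div_le_iff₀ (by positivity)] at f5
    linarith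
  · refine le_trans (by positivity) hgn

end SelfConformal

namespace SelfConformal

variable {Λ : Type} [Fintype Λ] {φ : Λ → ℝ → ℝ} {ρ₀ ρ₁ K : ℝ} {p : Λ → ℝ} [Nonempty Λ]
variable {μ : Measure ℝ}

lemma Reg.aemeasurable (hR : Reg φ ρ₀ ρ₁ K) (hμI : μ unitIᶜ = 0) (v : List Λ) :
    AEMeasurable (compWord φ v) μ :=
  aemeasurable_of_continuousOn hμI (hR.analytic v).continuousOn

lemma Reg.measureReal_preimage_eq_sum [IsProbabilityMeasure μ] (hR : Reg φ ρ₀ ρ₁ K)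
    (hp : ∀ i, 0 ≤ p i) (hμI : μ unitIᶜ = 0)
    (hμ : μ = ∑ i : Λ, ENNReal.ofReal (p i) • Measure.map (φ i) μ)
    {E : Set ℝ} (hE : MeasurableSet E) (v : List Λ) :
    μ.real (compWord φ v ⁻¹' E) = ∑ i, p i * μ.real (compWord φ (v ++ [i]) ⁻¹' E) := by
  have h1 : μ (compWord φ v ⁻¹' E) =
      ∑ i, ENNReal.ofReal (p i) * μ (compWord φ (v ++ [i]) ⁻¹' E) := by
    conv_lhs => rw [hμ]
    rw [Measure.finsetSum_apply]
    refine Finset.sum_congr rfl fun i _ => ?_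
    rw [Measure.smul_apply, smul_eq_mul, Measure.map_apply₀
      (aemeasurable_of_continuousOn hμI (hR.continuousOn i))
      ((hR.aemeasurable (map_unitI_compl hR hμI i) v).nullMeasurableSet_preimage hE)]
    congr 2
    ext x
    simp [compWord_append, compWord]
  rw [measureReal_def, h1, ENNReal.toReal_sum fun i _ =>
    ENNReal.mul_ne_top ENNReal.ofReal_ne_top (measure_ne_top _ _)]
  simp [ENNReal.toReal_mul, measureReal_def, ENNReal.toReal_ofReal (hp _)]

lemma sum_wpi_harmonic {G : List Λ → ℝ} (hG : ∀ v, G v = ∑ i, p i * G (v ++ [i])) (n : ℕ) :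
    ∑ u, wpi p n u * G (List.ofFn u) = G [] := by
  induction n with
  | zero => simp [wpi]
  | succ n ih => rw [sum_wpi_snoc, ← ih]; exact Finset.sum_congr rfl fun u _ => by rw [← hG]

open Classical in
/-- Extend `v` by letters of the given list until the derivative at `0` is at most `τ`. -/
def cutWord (φ : Λ → ℝ → ℝ) (τ : ℝ) : List Λ → List Λ → List Λ
  | v, [] => v
  | v, i :: Y => if |dWord φ v 0| ≤ τ then v else cutWord φ τ (v ++ [i]) Y

lemma sum_wpi_cutWord {G : List Λ → ℝ} (hG : ∀ v, G v = ∑ i, p i * G (v ++ [i]))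
    (hp1 : ∑ i, p i = 1) (τ : ℝ) (N : ℕ) (v : List Λ) :
    ∑ Y, wpi p N Y * G (cutWord φ τ v (List.ofFn Y)) = G v := by
  induction N generalizing v with
  | zero => simp [wpi, cutWord]
  | succ N ih =>
    rw [sum_pi_succ]
    simp only [wpi_cons, List.ofFn_cons, cutWord]
    by_cases h : |dWord φ v 0| ≤ τ
    · simp only [h, if_true]
      have : ∀ a, ∑ y, p a * wpi p N y * G v = p a * G v := fun a => by
        rw [← Finset.sum_mul, ← Finset.mul_sum, sum_wpi hp1, mul_one]
      simp only [this, ← Finset.sum_mul, hp1, one_mul]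
    · simp only [h, if_false]
      rw [hG v]
      refine Finset.sum_congr rfl fun a _ => ?_
      rw [← ih (v ++ [a]), Finset.mul_sum]
      exact Finset.sum_congr rfl fun y _ => by ring

lemma Reg.dWord_cutWord_le (hR : Reg φ ρ₀ ρ₁ K) {τ : ℝ} (Y : List Λ) (v : List Λ)
    (h : ρ₁ ^ (v.length + Y.length) ≤ τ) : |dWord φ (cutWord φ τ v Y) 0| ≤ τ := by
  induction Y generalizing v with
  | nil => exact (hR.abs_dWord_le v zero_mem_unitI).trans (by simpa using h)
  | cons i Y ih =>
    rw [cutWord]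
    split_ifs with h1
    · exact h1
    · refine ih (v ++ [i]) ?_
      rw [List.length_append, List.length_singleton, add_assoc, add_comm 1]
      simpa using h

lemma Reg.le_dWord_cutWord (hR : Reg φ ρ₀ ρ₁ K) {τ : ℝ} (Y : List Λ) (v : List Λ)
    (h : ρ₀ / K * τ ≤ |dWord φ v 0|) : ρ₀ / K * τ ≤ |dWord φ (cutWord φ τ v Y) 0| := by
  induction Y generalizing v with
  | nil => exact h
  | cons i Y ih =>
    rw [cutWord]
    split_ifs with h1
    · exact h
    · refine ih (v ++ [i]) ((mul_le_mul_of_nonneg_left (not_le.1 h1).le ?_).trans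
        (hR.le_dWord_append_singleton v i))
      exact div_nonneg hR.pos.le hR.Kpos.le

end SelfConformal

namespace SelfConformal

variable {Λ : Type} [Fintype Λ] {φ : Λ → ℝ → ℝ} {ρ₀ ρ₁ K : ℝ} {p : Λ → ℝ} [Nonempty Λ]
variable {μ : Measure ℝ}

lemma ae_exp_le_measureReal_closedBall [IsProbabilityMeasure μ] {ε : ℝ} (hε : 0 < ε) :
    ∀ᵐ x ∂μ, ∀ᶠ s in atTop, Real.exp (-((1 + ε) * s)) ≤ μ.real (closedBall x (Real.exp (-s))) := by
  filter_upwards [Besicovitch.ae_tendsto_rnDeriv (volume : Measure ℝ) μ,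
    Measure.rnDeriv_lt_top (volume : Measure ℝ) μ] with x h1 h2
  have hexp : Tendsto (fun s : ℝ => Real.exp (-s)) atTop (𝓝[>] 0) :=
    tendsto_nhdsWithin_iff.2 ⟨Real.tendsto_exp_neg_atTop_nhds_zero,
      Eventually.of_forall fun s => Real.exp_pos _⟩
  have hlt : (volume : Measure ℝ).rnDeriv μ x < (volume : Measure ℝ).rnDeriv μ x + 1 :=
    ENNReal.lt_add_right h2.ne one_ne_zero
  have h3 := hexp.eventually (h1.eventually_lt_const hlt)
  obtain ⟨L, hL⟩ : ∃ L, L = ((volume : Measure ℝ).rnDeriv μ x + 1).toReal := ⟨_, rfl⟩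
  have hLtop : (volume : Measure ℝ).rnDeriv μ x + 1 ≠ ⊤ :=
    ENNReal.add_ne_top.2 ⟨h2.ne, ENNReal.one_ne_top⟩
  have hL0 : 0 ≤ L := hL ▸ ENNReal.toReal_nonneg
  have h4 : ∀ᶠ s in atTop, Real.exp (-(ε * s)) < 1 / (L + 1) := by
    have : Tendsto (fun s : ℝ => Real.exp (-(ε * s))) atTop (𝓝 0) :=
      Real.tendsto_exp_neg_atTop_nhds_zero.comp (tendsto_id.const_mul_atTop hε)
    exact this.eventually_lt_const (by positivity)
  filter_upwards [h3, h4] with s hs hs'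
  have h5 := (ENNReal.div_le_iff_le_mul (Or.inr hLtop) (Or.inl (measure_ne_top _ _))).1 hs.le
  rw [Real.volume_closedBall] at h5
  have h6 := ENNReal.toReal_mono (ENNReal.mul_ne_top hLtop (measure_ne_top _ _)) h5
  rw [ENNReal.toReal_ofReal (by positivity), ENNReal.toReal_mul, ← hL, ← measureReal_def] at h6
  have h7 : Real.exp (-((1 + ε) * s)) = Real.exp (-s) * Real.exp (-(ε * s)) := by
    rw [← Real.exp_add]; ring_nf
  have h8 : (0 : ℝ) ≤ μ.real (closedBall x (Real.exp (-s))) := measureReal_nonneg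
  have h9 := Real.exp_pos (-s)
  rw [h7]
  calc Real.exp (-s) * Real.exp (-(ε * s)) ≤ Real.exp (-s) * (1 / (L + 1)) := by gcongr
    _ ≤ _ := by
      rw [mul_one_div, div_le_iff₀ (by positivity)]
      nlinarith

lemma Reg.exists_exceptional_set [IsProbabilityMeasure μ] (hR : Reg φ ρ₀ ρ₁ K) (hp : ∀ i, 0 < p i)
    (hp1 : ∑ i, p i = 1) (hμI : μ unitIᶜ = 0)
    (hμ : μ = ∑ i : Λ, ENNReal.ofReal (p i) • Measure.map (φ i) μ) {e : ℝ} (he : 0 < e) :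
    ∃ C, 0 ≤ C ∧ ∀ n : ℕ, 1 ≤ n → ∃ E, μ.real E ≤ C / n ∧ ∀ x ∉ E,
      Real.exp (-(n * ((-∑ i, p i * Real.log (p i)) + e))) ≤
        μ.real (closedBall x (K * Real.exp (-(n * (lyap φ p μ - e))))) := by
  classical
  obtain ⟨C₁, hC₁, h₁⟩ := hR.log_deviation (fun i => (hp i).le) hp1 hμI hμ
  obtain ⟨C₂, hC₂, h₂⟩ := hR.weight_deviation hp hp1 hμI hμ
  refine ⟨C₁ / e ^ 2 + C₂ / e ^ 2, by positivity, fun n hn => ?_⟩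
  obtain ⟨H, hH⟩ : ∃ H, H = -∑ i, p i * Real.log (p i) := ⟨_, rfl⟩
  obtain ⟨χ, hχ⟩ : ∃ χ, χ = lyap φ p μ := ⟨_, rfl⟩
  rw [← hH, ← hχ]
  rw [← hχ] at h₁
  rw [← hH] at h₂
  have hn0 : (0 : ℝ) < n := by exact_mod_cast hn
  have h₁' := h₁ n hn (e * n) (by positivity)
  have h₂' := h₂ n hn (e * n) (by positivity)
  have hp0 := fun i => (hp i).le
  obtain ⟨good, hgood⟩ : ∃ good : (Fin n → Λ) → Prop, ∀ u, good u ↔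
      (|(Real.log |dWord φ (List.ofFn u) 0| + n * χ)| ≤ e * n ∧
        |Real.log (wpi p n u) + n * H| ≤ e * n) := ⟨_, fun _ => Iff.rfl⟩
  have hclosed : IsClosed (⋃ u ∈ {u | good u}, compWord φ (List.ofFn u) '' unitI) :=
    (Set.toFinite _).isClosed_biUnion fun u _ =>
      (isCompact_Icc.image_of_continuousOn (hR.analytic _).continuousOn).isClosed
  refine ⟨(⋃ u ∈ {u | good u}, compWord φ (List.ofFn u) '' unitI)ᶜ, ?_, fun x hx => ?_⟩
  · have hE := hclosed.measurableSet.compl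
    have h3 := sum_wpi_harmonic (hR.measureReal_preimage_eq_sum hp0 hμI hμ hE) n
    simp only [compWord, preimage_id] at h3
    rw [← h3]
    calc _ ≤ ∑ u, ((if e * n < |(Real.log |dWord φ (List.ofFn u) 0| + n * χ)| then wpi p n u else 0)
          + (if e * n < |Real.log (wpi p n u) + n * H| then wpi p n u else 0)) := by
          refine Finset.sum_le_sum fun u _ => ?_
          have hw := wpi_nonneg hp0 n u
          by_cases hu : good u
          · have : μ.real (compWord φ (List.ofFn u) ⁻¹'
                (⋃ u ∈ {u | good u}, compWord φ (List.ofFn u) '' unitI)ᶜ) = 0 := by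
              rw [measureReal_def, measure_mono_null _ hμI, ENNReal.toReal_zero]
              intro y hy hyI
              exact hy (mem_biUnion (show u ∈ {u | good u} from hu) (mem_image_of_mem _ hyI))
            rw [this, mul_zero]
            split_ifs <;> linarith
          · have h5 : wpi p n u * μ.real (compWord φ (List.ofFn u) ⁻¹'
                (⋃ u ∈ {u | good u}, compWord φ (List.ofFn u) '' unitI)ᶜ) ≤ wpi p n u :=
              mul_le_of_le_one_right hw measureReal_le_one
            rw [hgood, not_and_or, not_le, not_le] at hu
            rcases hu with hu | hu
            · rw [if_pos hu]
              split_ifs <;> linarith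
            · rw [if_pos hu]
              split_ifs <;> linarith
      _ ≤ C₁ * n / (e * n) ^ 2 + C₂ * n / (e * n) ^ 2 := by
          rw [Finset.sum_add_distrib]
          exact add_le_add h₁' h₂'
      _ = _ := by field_simp
  · rw [mem_compl_iff, not_not] at hx
    obtain ⟨u, hu, y, hy, rfl⟩ := mem_iUnion₂.1 hx
    obtain ⟨hu1, hu2⟩ := (hgood u).1 hu
    have hd := hR.dWord_pos (List.ofFn u) zero_mem_unitI
    have hwpos : 0 < wpi p n u := Finset.prod_pos fun i _ => hp _
    have h6 : |dWord φ (List.ofFn u) 0| ≤ Real.exp (-(n * (χ - e))) := by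
      rw [← Real.log_le_iff_le_exp hd]
      have := (abs_le.1 hu1).2
      linarith
    have h7 : Real.exp (-(n * (H + e))) ≤ wpi p n u := by
      rw [← Real.le_log_iff_exp_le hwpos]
      have := (abs_le.1 hu2).1
      linarith
    refine h7.trans ?_
    obtain ⟨B, hB⟩ : ∃ B, B = closedBall (compWord φ (List.ofFn u) y)
      (K * Real.exp (-(n * (χ - e)))) := ⟨_, rfl⟩
    rw [← hB]
    have h3 := sum_wpi_harmonic (hR.measureReal_preimage_eq_sum hp0 hμI hμ
      (E := B) (hB ▸ isClosed_closedBall.measurableSet)) n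
    simp only [compWord, preimage_id] at h3
    rw [← h3]
    have h8 : μ.real (compWord φ (List.ofFn u) ⁻¹' B) = 1 := by
      have : ∀ᵐ z ∂μ, z ∈ compWord φ (List.ofFn u) ⁻¹' B := by
        filter_upwards [ae_mem_unitI hμI] with z hz
        rw [mem_preimage, hB, mem_closedBall, Real.dist_eq]
        have h9 := hR.abs_sub_le (List.ofFn u) hz hy zero_mem_unitI
        have h10 := abs_sub_le_one hz hy
        have := hR.Kpos
        calc _ ≤ _ := h9
          _ ≤ K * |dWord φ (List.ofFn u) 0| * 1 := by gcongr
          _ ≤ _ := by rw [mul_one]; gcongr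
      have h0 : μ (compWord φ (List.ofFn u) ⁻¹' B) = μ univ := measure_congr (eventuallyEq_univ.2 this)
      rw [measureReal_def, h0, measure_univ, ENNReal.toReal_one]
    have h9 := Finset.single_le_sum (f := fun u => wpi p n u *
      μ.real (compWord φ (List.ofFn u) ⁻¹' B)) (fun v _ => mul_nonneg (wpi_nonneg hp0 n v)
      measureReal_nonneg) (Finset.mem_univ u)
    simp only [h8, mul_one] at h9
    exact h9

lemma Reg.ae_eventually_sq [IsProbabilityMeasure μ] (hR : Reg φ ρ₀ ρ₁ K) (hp : ∀ i, 0 < p i)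
    (hp1 : ∑ i, p i = 1) (hμI : μ unitIᶜ = 0)
    (hμ : μ = ∑ i : Λ, ENNReal.ofReal (p i) • Measure.map (φ i) μ) {e : ℝ} (he : 0 < e) :
    ∀ᵐ x ∂μ, ∀ᶠ j : ℕ in atTop,
      Real.exp (-(((j : ℝ) + 1) ^ 2 * ((-∑ i, p i * Real.log (p i)) + e))) ≤
        μ.real (closedBall x (K * Real.exp (-(((j : ℝ) + 1) ^ 2 * (lyap φ p μ - e))))) := by
  obtain ⟨C, hC, h⟩ := hR.exists_exceptional_set hp hp1 hμI hμ he
  choose E hE1 hE2 using fun j : ℕ => h ((j + 1) ^ 2) (Nat.one_le_pow _ _ (Nat.succ_pos j))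
  have hsum : Summable fun j : ℕ => C / (((j + 1) ^ 2 : ℕ) : ℝ) := by
    have h1 : Summable fun n : ℕ => 1 / (n : ℝ) ^ 2 := Real.summable_one_div_nat_pow.2 one_lt_two
    have h2 := ((summable_nat_add_iff 1).2 h1).mul_left C
    refine h2.congr fun j => ?_
    push_cast
    rw [mul_one_div]
  have htop : ∑' j, μ (E j) ≠ ⊤ := by
    refine ne_top_of_le_ne_top hsum.tsum_ofReal_ne_top (ENNReal.tsum_le_tsum fun j => ?_)
    rw [← ofReal_measureReal]
    exact ENNReal.ofReal_le_ofReal (hE1 j)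
  filter_upwards [ae_eventually_notMem htop] with x hx
  filter_upwards [hx] with j hj
  have := hE2 j x hj
  push_cast at this
  exact this

lemma entropy_nonneg (hp : ∀ i, 0 < p i) (hp1 : ∑ i, p i = 1) :
    0 ≤ -∑ i, p i * Real.log (p i) := by
  rw [← Finset.sum_neg_distrib]
  refine Finset.sum_nonneg fun i _ => ?_
  have h1 : p i ≤ 1 := hp1 ▸ Finset.single_le_sum (fun j _ => (hp j).le) (Finset.mem_univ i)
  have := Real.log_nonpos (hp i).le h1
  nlinarith [hp i]

lemma Reg.ae_exp_entropy_le [IsProbabilityMeasure μ] (hR : Reg φ ρ₀ ρ₁ K) (hp : ∀ i, 0 < p i)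
    (hp1 : ∑ i, p i = 1) (hμI : μ unitIᶜ = 0)
    (hμ : μ = ∑ i : Λ, ENNReal.ofReal (p i) • Measure.map (φ i) μ) {ε : ℝ} (hε : 0 < ε) :
    ∀ᵐ x ∂μ, ∀ᶠ s in atTop,
      Real.exp (-(((-∑ i, p i * Real.log (p i)) / lyap φ p μ + ε) * s)) ≤
        μ.real (closedBall x (Real.exp (-s))) := by
  have hχ := hR.lyap_pos (fun i => (hp i).le) hp1 hμI
  have hH := entropy_nonneg hp hp1
  have hsq := fun e (he : 0 < e) => hR.ae_eventually_sq hp hp1 hμI hμ (e := e) he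
  obtain ⟨H, hHe⟩ : ∃ H, H = -∑ i, p i * Real.log (p i) := ⟨_, rfl⟩
  obtain ⟨χ, hχe⟩ : ∃ χ, χ = lyap φ p μ := ⟨_, rfl⟩
  rw [← hHe] at hH ⊢
  rw [← hχe] at hχ ⊢
  rw [← hHe, ← hχe] at hsq
  obtain ⟨c, hc⟩ : ∃ c, c = H / χ + ε := ⟨_, rfl⟩
  obtain ⟨e, he, heχ, hec⟩ : ∃ e, 0 < e ∧ e < χ ∧ (H + e) < c * (χ - e) := by
    refine ⟨min (χ / 2) (ε * χ / (2 * (1 + c))), ?_, ?_, ?_⟩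
    · have : 0 ≤ H / χ := by positivity
      have : 0 < 1 + c := by linarith
      positivity
    · exact (min_le_left _ _).trans_lt (by linarith)
    · have : 0 ≤ H / χ := by positivity
      have h0 : 0 < 1 + c := by linarith
      have h1 := min_le_right (χ / 2) (ε * χ / (2 * (1 + c)))
      rw [le_div_iff₀ (by positivity)] at h1
      have h2 : c * χ = H + ε * χ := by rw [hc]; field_simp
      have h3 : 0 < ε * χ := by positivity
      nlinarith
  obtain ⟨a, ha⟩ : ∃ a, a = H + e := ⟨_, rfl⟩
  obtain ⟨b, hb⟩ : ∃ b, b = χ - e := ⟨_, rfl⟩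
  have hc0 : 0 < c := by
    have : 0 ≤ H / χ := by positivity
    linarith
  have ha0 : 0 ≤ a := by linarith
  have hb0 : 0 < b := by linarith
  have hK : 0 ≤ Real.log K := Real.log_nonneg hR.one_le
  filter_upwards [hsq e he] with x hx
  rw [← ha, ← hb] at hx
  rw [← ha, ← hb] at hec
  rw [← hc]
  have ht : Tendsto (fun s : ℝ => √((s + Real.log K) / b)) atTop atTop :=
    Real.tendsto_sqrt_atTop.comp ((tendsto_atTop_add_const_right _ _ tendsto_id).atTop_div_const hb0)
  have hj : Tendsto (fun s : ℝ => ⌈√((s + Real.log K) / b)⌉₊) atTop atTop :=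
    tendsto_nat_ceil_atTop.comp ht
  filter_upwards [hj.eventually hx, ht.eventually_ge_atTop 1,
    ht.eventually_ge_atTop ((8 * a + c * Real.log K) / (c * b - a)), eventually_ge_atTop 0]
    with s h1 h2 h3 hs
  have hcb : 0 < c * b - a := by linarith
  rw [div_le_iff₀ hcb] at h3
  obtain ⟨t, htdef⟩ : ∃ t, t = √((s + Real.log K) / b) := ⟨_, rfl⟩
  have ht2 : t ^ 2 * b = s + Real.log K := by
    rw [htdef, Real.sq_sqrt (by positivity)]; field_simp
  rw [← htdef] at h1 h2 h3
  obtain ⟨j, hjdef⟩ : ∃ j : ℕ, j = ⌈t⌉₊ := ⟨_, rfl⟩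
  rw [← hjdef] at h1
  have hj1 : t ≤ j := hjdef ▸ Nat.le_ceil t
  have hj2 : (j : ℝ) ≤ t + 1 := hjdef ▸ (Nat.ceil_lt_add_one (by linarith)).le
  refine le_trans (Real.exp_le_exp.2 ?_) (h1.trans (measureReal_mono (closedBall_subset_closedBall ?_)))
  · have h4 : ((j : ℝ) + 1) ^ 2 ≤ (t + 2) ^ 2 :=
      pow_le_pow_left₀ (by positivity) (by linarith) 2
    have h5 : ((j : ℝ) + 1) ^ 2 * a ≤ (t + 2) ^ 2 * a := by gcongr
    have h6 : (8 * a + c * Real.log K) * t ≤ t * (c * b - a) * t := by gcongr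
    have h7 : c * Real.log K ≤ c * Real.log K * t := by
      have : 0 ≤ c * Real.log K := by positivity
      nlinarith
    have h8 : c * s = c * (t ^ 2 * b) - c * Real.log K := by rw [ht2]; ring
    nlinarith
  · rw [← Real.exp_log hR.Kpos, ← Real.exp_add]
    refine Real.exp_le_exp.2 ?_
    have h4 : t ^ 2 ≤ ((j : ℝ) + 1) ^ 2 :=
      pow_le_pow_left₀ (by linarith) (by linarith) 2
    have h5 : t ^ 2 * b ≤ ((j : ℝ) + 1) ^ 2 * b := by gcongr
    linarith

lemma Reg.ae_exp_le [IsProbabilityMeasure μ] (hR : Reg φ ρ₀ ρ₁ K) (hp : ∀ i, 0 < p i)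
    (hp1 : ∑ i, p i = 1) (hμI : μ unitIᶜ = 0)
    (hμ : μ = ∑ i : Λ, ENNReal.ofReal (p i) • Measure.map (φ i) μ) {ε : ℝ} (hε : 0 < ε) :
    ∀ᵐ x ∂μ, ∀ᶠ s in atTop,
      Real.exp (-((min 1 ((-∑ i, p i * Real.log (p i)) / lyap φ p μ) + ε) * s)) ≤
        μ.real (closedBall x (Real.exp (-s))) := by
  rcases min_choice 1 ((-∑ i, p i * Real.log (p i)) / lyap φ p μ) with h | h <;> rw [h]
  · exact ae_exp_le_measureReal_closedBall hε
  · exact hR.ae_exp_entropy_le hp hp1 hμI hμ hε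

end SelfConformal

namespace SelfConformal

variable {Λ : Type} [Fintype Λ] {φ : Λ → ℝ → ℝ} {ρ₀ ρ₁ K : ℝ} {p : Λ → ℝ} [Nonempty Λ]
variable {μ : Measure ℝ}

/-- The dyadic cell of level `r` and index `c`. -/
def cell (r : ℕ) (c : ℤ) : Set ℝ := {x | ⌊2 ^ r * x⌋ = c}

/-- The points lying in a dyadic cell of level `r` whose index is at distance at most `J` from
`c`. -/
def cellNhd (J r : ℕ) (c : ℤ) : Set ℝ := {x | |⌊2 ^ r * x⌋ - c| ≤ (J : ℤ)}

/-- The indices of the dyadic cells of level `r` meeting `[0,1]`. -/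
def cellIdx (r : ℕ) : Finset ℤ := Finset.Icc 0 (2 ^ r)

/-- The moment sum of order `q` at level `r`. -/
def moment (μ : Measure ℝ) (r : ℕ) (q : ℝ) : ℝ := ∑ c ∈ cellIdx r, μ.real (cell r c) ^ q

lemma measurable_floor_two_pow (r : ℕ) : Measurable fun x : ℝ => ⌊2 ^ r * x⌋ :=
  Int.measurable_floor.comp (measurable_const_mul _)

lemma measurableSet_cell (r : ℕ) (c : ℤ) : MeasurableSet (cell r c) :=
  measurable_floor_two_pow r (measurableSet_singleton c)

lemma floor_mem_cellIdx (r : ℕ) {x : ℝ} (hx : x ∈ unitI) : ⌊2 ^ r * x⌋ ∈ cellIdx r := by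
  have h2 : (0 : ℝ) < 2 ^ r := by positivity
  rw [cellIdx, Finset.mem_Icc, Int.floor_nonneg]
  refine ⟨mul_nonneg h2.le hx.1, Int.cast_le (R := ℝ).1 ((Int.floor_le _).trans ?_)⟩
  push_cast
  exact mul_le_of_le_one_right h2.le hx.2

lemma exists_mem_of_measureReal_ne_zero (hμI : μ unitIᶜ = 0) {B : Set ℝ} (h : μ.real B ≠ 0) :
    ∃ x ∈ unitI, x ∈ B := by
  by_contra! h1
  refine h ?_
  rw [measureReal_def, measure_mono_null (fun x hx hxI => h1 x hxI hx) hμI, ENNReal.toReal_zero]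

lemma measureReal_cell_eq_zero (hμI : μ unitIᶜ = 0) {r : ℕ} {c : ℤ} (hc : c ∉ cellIdx r) :
    μ.real (cell r c) = 0 := by
  by_contra h
  obtain ⟨x, hx, hxc⟩ := exists_mem_of_measureReal_ne_zero hμI h
  exact hc (hxc ▸ floor_mem_cellIdx r hx)

lemma sum_cellIdx_shift_le {r : ℕ} (f : ℤ → ℝ) (hf : ∀ c, 0 ≤ f c) (h0 : ∀ c ∉ cellIdx r, f c = 0)
    (k : ℤ) : ∑ c ∈ cellIdx r, f (c + k) ≤ ∑ c ∈ cellIdx r, f c := by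
  classical
  have h1 : ∑ c ∈ cellIdx r, f (c + k) = ∑ c ∈ (cellIdx r).map (addRightEmbedding k), f c := by
    rw [Finset.sum_map]; rfl
  rw [h1, ← Finset.sum_filter_add_sum_filter_not _ (· ∈ cellIdx r)]
  rw [Finset.sum_eq_zero (s := Finset.filter (fun x => ¬ x ∈ cellIdx r) _)
    fun c hc => h0 c (Finset.mem_filter.1 hc).2, add_zero]
  exact Finset.sum_le_sum_of_subset_of_nonneg (fun c hc => (Finset.mem_filter.1 hc).2)
    fun c _ _ => hf c

lemma measureReal_cellNhd_le [IsFiniteMeasure μ] (J r : ℕ) (c : ℤ) :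
    μ.real (cellNhd J r c) ≤ ∑ k ∈ Finset.Icc (-(J : ℤ)) J, μ.real (cell r (c + k)) := by
  refine (measureReal_mono (s₂ := ⋃ k ∈ Finset.Icc (-(J : ℤ)) J, cell r (c + k)) ?_ (measure_ne_top _ _)).trans
    (measureReal_biUnion_finset_le _ _)
  intro x hx
  refine mem_biUnion (x := ⌊2 ^ r * x⌋ - c) ?_ ?_
  · exact Finset.mem_coe.2 (Finset.mem_Icc.2 (abs_le.1 hx))
  · simp [cell]

lemma moment_nonneg (r : ℕ) (q : ℝ) : 0 ≤ moment μ r q :=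
  Finset.sum_nonneg fun _ _ => Real.rpow_nonneg measureReal_nonneg _

lemma card_Icc_neg (J : ℕ) : (Finset.Icc (-(J : ℤ)) J).card = 2 * J + 1 := by
  rw [Int.card_Icc]; omega

lemma sum_cellNhd_rpow_le [IsFiniteMeasure μ] (hμI : μ unitIᶜ = 0) (J r : ℕ) {q : ℝ} (hq : 1 ≤ q)
    (hq2 : q ≤ 2) :
    ∑ c ∈ cellIdx r, μ.real (cellNhd J r c) ^ q ≤ (2 * J + 1) ^ 2 * moment μ r q := by
  have hq0 : 0 < q := by linarith
  have hJ : (1 : ℝ) ≤ 2 * J + 1 := by have : (0 : ℝ) ≤ J := J.cast_nonneg; linarith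
  have h1 : ∀ c, μ.real (cellNhd J r c) ^ q ≤ (2 * J + 1 : ℝ) ^ (q - 1) *
      ∑ k ∈ Finset.Icc (-(J : ℤ)) J, μ.real (cell r (c + k)) ^ q := fun c => by
    refine (Real.rpow_le_rpow measureReal_nonneg (measureReal_cellNhd_le J r c) hq0.le).trans ?_
    have := Real.rpow_sum_le_const_mul_sum_rpow_of_nonneg (Finset.Icc (-(J : ℤ)) J) hq
      (f := fun k => μ.real (cell r (c + k))) fun _ _ => measureReal_nonneg
    rw [card_Icc_neg] at this
    push_cast at this
    exact this
  calc _ ≤ ∑ c ∈ cellIdx r, (2 * J + 1 : ℝ) ^ (q - 1) *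
      ∑ k ∈ Finset.Icc (-(J : ℤ)) J, μ.real (cell r (c + k)) ^ q := Finset.sum_le_sum fun c _ => h1 c
    _ = (2 * J + 1 : ℝ) ^ (q - 1) *
      ∑ k ∈ Finset.Icc (-(J : ℤ)) J, ∑ c ∈ cellIdx r, μ.real (cell r (c + k)) ^ q := by
        rw [← Finset.mul_sum, Finset.sum_comm]
    _ ≤ (2 * J + 1 : ℝ) ^ (q - 1) * ∑ k ∈ Finset.Icc (-(J : ℤ)) J, moment μ r q := by
        gcongr with k
        refine sum_cellIdx_shift_le (fun c => μ.real (cell r c) ^ q)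
          (fun c => Real.rpow_nonneg measureReal_nonneg _) (fun c hc => ?_) k
        rw [measureReal_cell_eq_zero hμI hc, Real.zero_rpow hq0.ne']
    _ = (2 * J + 1 : ℝ) ^ (q - 1) * (2 * J + 1) * moment μ r q := by
        rw [Finset.sum_const, card_Icc_neg, nsmul_eq_mul]; push_cast; ring
    _ ≤ _ := by
        refine mul_le_mul_of_nonneg_right ?_ (moment_nonneg r q)
        have : (2 * J + 1 : ℝ) ^ (q - 1) ≤ (2 * J + 1 : ℝ) ^ (1 : ℝ) :=
          Real.rpow_le_rpow_of_exponent_le hJ (by linarith)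
        rw [Real.rpow_one] at this
        rw [sq]
        gcongr

lemma sum_mul_rpow_le {ι : Type*} (s : Finset ι) (w f : ι → ℝ) (hw : ∀ i, 0 ≤ w i)
    (hf : ∀ i, 0 ≤ f i) {q : ℝ} (hq : 1 ≤ q) :
    (∑ i ∈ s, w i * f i) ^ q ≤ (∑ i ∈ s, w i) ^ (q - 1) * ∑ i ∈ s, w i * f i ^ q := by
  have hq0 : 0 < q := by linarith
  have h1 := Real.inner_le_weight_mul_Lp_of_nonneg s hq w f hw hf
  have hA : 0 ≤ ∑ i ∈ s, w i := Finset.sum_nonneg fun i _ => hw i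
  have hB : 0 ≤ ∑ i ∈ s, w i * f i ^ q :=
    Finset.sum_nonneg fun i _ => mul_nonneg (hw i) (Real.rpow_nonneg (hf i) _)
  have h2 := Real.rpow_le_rpow (Finset.sum_nonneg fun i _ => mul_nonneg (hw i) (hf i)) h1 hq0.le
  rwa [Real.mul_rpow (Real.rpow_nonneg hA _) (Real.rpow_nonneg hB _), ← Real.rpow_mul hA,
    ← Real.rpow_mul hB, inv_mul_cancel₀ hq0.ne', Real.rpow_one, sub_mul, one_mul,
    inv_mul_cancel₀ hq0.ne'] at h2

lemma one_le_sum_preimage_cell [IsProbabilityMeasure μ] (hR : Reg φ ρ₀ ρ₁ K) (hμI : μ unitIᶜ = 0)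
    (w : List Λ) (r : ℕ) : 1 ≤ ∑ c ∈ cellIdx r, μ.real (compWord φ w ⁻¹' cell r c) := by
  have h1 : μ.real unitI = 1 := by
    have : μ unitI = μ univ := measure_congr (eventuallyEq_univ.2 (ae_mem_unitI hμI))
    rw [measureReal_def, this, measure_univ, ENNReal.toReal_one]
  rw [← h1]
  refine (measureReal_mono (s₂ := ⋃ c ∈ cellIdx r, compWord φ w ⁻¹' cell r c) ?_ (measure_ne_top _ _)).trans
    (measureReal_biUnion_finset_le _ _)
  intro x hx
  exact mem_biUnion (x := ⌊2 ^ r * compWord φ w x⌋)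
    (Finset.mem_coe.2 (floor_mem_cellIdx r (hR.mem w hx))) rfl

lemma Reg.sum_preimage_cell_rpow_le [IsProbabilityMeasure μ] (hR : Reg φ ρ₀ ρ₁ K)
    (hμI : μ unitIᶜ = 0) {w : List Λ} {r t J : ℕ} (hw1 : K * |dWord φ w 0| * 2 ^ r ≤ 1)
    (hw2 : K ≤ J * (|dWord φ w 0| * 2 ^ r)) {q : ℝ} (hq : 1 ≤ q) (hq2 : q ≤ 2) :
    ∑ c ∈ cellIdx (r + t), μ.real (compWord φ w ⁻¹' cell (r + t) c) ^ q ≤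
      3 * ((2 * J + 1) ^ 2 * moment μ t q) := by
  classical
  have hq0 : 0 < q := by linarith
  obtain ⟨d, hd⟩ : ∃ d, d = |dWord φ w 0| := ⟨_, rfl⟩
  have hd0 : 0 < d := hd ▸ hR.dWord_pos w zero_mem_unitI
  rw [← hd] at hw1 hw2
  have h2r : (0 : ℝ) < 2 ^ r := by positivity
  have h2t : (0 : ℝ) < 2 ^ t := by positivity
  have hch : ∀ c, ∃ y ∈ unitI, μ.real (compWord φ w ⁻¹' cell (r + t) c) ≠ 0 →
      y ∈ compWord φ w ⁻¹' cell (r + t) c := fun c => by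
    by_cases h : μ.real (compWord φ w ⁻¹' cell (r + t) c) = 0
    · exact ⟨0, zero_mem_unitI, fun h' => absurd h h'⟩
    · obtain ⟨y, hy, hyc⟩ := exists_mem_of_measureReal_ne_zero hμI h
      exact ⟨y, hy, fun _ => hyc⟩
  choose y hyI hyc using hch
  obtain ⟨S, hS⟩ : ∃ S, S = (cellIdx (r + t)).filter
    fun c => μ.real (compWord φ w ⁻¹' cell (r + t) c) ≠ 0 := ⟨_, rfl⟩
  obtain ⟨G, hG⟩ : ∃ G : ℤ → ℝ, ∀ b, G b = μ.real (cellNhd J t b) ^ q := ⟨_, fun _ => rfl⟩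
  have hG0 : ∀ b, 0 ≤ G b := fun b => hG b ▸ Real.rpow_nonneg measureReal_nonneg _
  have hbound : ∀ c ∈ S, μ.real (compWord φ w ⁻¹' cell (r + t) c) ^ q ≤ G ⌊2 ^ t * y c⌋ := by
    intro c hc
    rw [hS, Finset.mem_filter] at hc
    rw [hG]
    refine Real.rpow_le_rpow measureReal_nonneg ?_ hq0.le
    refine ENNReal.toReal_mono (measure_ne_top _ _) (measure_mono_ae ?_)
    filter_upwards [ae_mem_unitI hμI] with z hz hzc
    refine abs_floor_sub_le ?_
    have h1 := abs_sub_le_one_of_floor_eq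
      ((show ⌊2 ^ (r + t) * compWord φ w z⌋ = c from hzc).trans (hyc c hc.2).symm)
    rw [← mul_sub, abs_mul, abs_of_pos (by positivity), pow_add] at h1
    have h2 := hR.le_abs_sub w hz (hyI c) zero_mem_unitI
    rw [← hd] at h2
    rw [← mul_sub, abs_mul, abs_of_pos h2t]
    have h3 : K * (2 ^ t * |z - y c|) ≤ K * J := by
      calc K * (2 ^ t * |z - y c|) ≤ J * (d * 2 ^ r) * (2 ^ t * |z - y c|) := by gcongr
        _ = J * (2 ^ r * 2 ^ t) * (d * |z - y c|) := by ring
        _ ≤ J * (2 ^ r * 2 ^ t) * (K * |compWord φ w z - compWord φ w (y c)|) := by gcongr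
        _ = J * K * (2 ^ r * 2 ^ t * |compWord φ w z - compWord φ w (y c)|) := by ring
        _ ≤ J * K * 1 := by
          have := hR.Kpos
          gcongr
        _ = K * J := by ring
    exact le_of_mul_le_mul_left h3 hR.Kpos
  have hcard : ∀ b ∈ cellIdx t, (S.filter fun c => ⌊2 ^ t * y c⌋ = b).card ≤ 3 := by
    intro b _
    rcases (S.filter fun c => ⌊2 ^ t * y c⌋ = b).eq_empty_or_nonempty with h | ⟨c₀, hc₀⟩
    · simp [h]
    have hsub : (S.filter fun c => ⌊2 ^ t * y c⌋ = b) ⊆ Finset.Icc (c₀ - 1) (c₀ + 1) := by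
      intro c hc
      rw [Finset.mem_filter, hS, Finset.mem_filter] at hc hc₀
      have h1 := abs_sub_le_one_of_floor_eq (hc.2.trans hc₀.2.symm)
      rw [← mul_sub, abs_mul, abs_of_pos h2t] at h1
      have h2 := hR.abs_sub_le w (hyI c) (hyI c₀) zero_mem_unitI
      rw [← hd] at h2
      have h3 : |2 ^ (r + t) * compWord φ w (y c) - 2 ^ (r + t) * compWord φ w (y c₀)| ≤
          ((1 : ℕ) : ℝ) := by
        rw [← mul_sub, abs_mul, abs_of_pos (by positivity), pow_add]
        calc _ ≤ 2 ^ r * 2 ^ t * (K * d * |y c - y c₀|) := by gcongr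
          _ = (K * d * 2 ^ r) * (2 ^ t * |y c - y c₀|) := by ring
          _ ≤ 1 * 1 := by gcongr
          _ = _ := by norm_num
      have h4 := abs_floor_sub_le h3
      rw [show ⌊2 ^ (r + t) * compWord φ w (y c)⌋ = c from hyc c hc.1.2,
        show ⌊2 ^ (r + t) * compWord φ w (y c₀)⌋ = c₀ from hyc c₀ hc₀.1.2] at h4
      rw [Finset.mem_Icc]
      have := abs_le.1 h4
      omega
    refine (Finset.card_le_card hsub).trans ?_
    rw [Int.card_Icc]; omega
  calc _ = ∑ c ∈ S, μ.real (compWord φ w ⁻¹' cell (r + t) c) ^ q := by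
        rw [hS, Finset.sum_filter_of_ne]
        intro c _ h h'
        rw [h', Real.zero_rpow hq0.ne'] at h
        exact h rfl
    _ ≤ ∑ c ∈ S, G ⌊2 ^ t * y c⌋ := Finset.sum_le_sum hbound
    _ = ∑ b ∈ cellIdx t, ∑ c ∈ S with ⌊2 ^ t * y c⌋ = b, G ⌊2 ^ t * y c⌋ :=
        (Finset.sum_fiberwise_of_maps_to (fun c _ => floor_mem_cellIdx t (hyI c)) _).symm
    _ ≤ ∑ b ∈ cellIdx t, 3 * G b := by
        refine Finset.sum_le_sum fun b hb => ?_
        rw [Finset.sum_congr rfl fun c hc => by rw [(Finset.mem_filter.1 hc).2], Finset.sum_const,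
          nsmul_eq_mul]
        have : (((S.filter fun c => ⌊2 ^ t * y c⌋ = b).card : ℕ) : ℝ) ≤ 3 := by
          exact_mod_cast hcard b hb
        exact mul_le_mul_of_nonneg_right this (hG0 b)
    _ ≤ _ := by
        rw [← Finset.mul_sum]
        simp only [hG]
        exact mul_le_mul_of_nonneg_left (sum_cellNhd_rpow_le hμI J t hq hq2) (by norm_num)

end SelfConformal

namespace SelfConformal

variable {Λ : Type} [Fintype Λ] {φ : Λ → ℝ → ℝ} {ρ₀ ρ₁ K : ℝ} {p : Λ → ℝ} [Nonempty Λ]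
variable {μ : Measure ℝ}

lemma measureReal_preimage_eq_one [IsProbabilityMeasure μ] (hμI : μ unitIᶜ = 0) {w : List Λ} {B : Set ℝ} (h : ∀ z ∈ unitI, compWord φ w z ∈ B) :
    μ.real (compWord φ w ⁻¹' B) = 1 := by
  have h0 : μ (compWord φ w ⁻¹' B) = μ univ := by
    refine measure_congr (eventuallyEq_univ.2 ?_)
    filter_upwards [ae_mem_unitI hμI] with z hz using h z hz
  rw [measureReal_def, h0, measure_univ, ENNReal.toReal_one]

lemma Reg.moment_add_le [IsProbabilityMeasure μ] (hR : Reg φ ρ₀ ρ₁ K) (hp : ∀ i, 0 ≤ p i)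
    (hp1 : ∑ i, p i = 1) (hμI : μ unitIᶜ = 0)
    (hμ : μ = ∑ i : Λ, ENNReal.ofReal (p i) • Measure.map (φ i) μ) :
    ∃ C, 0 < C ∧ ∀ r t : ℕ, ∀ q : ℝ, 1 ≤ q → q ≤ 2 →
      moment μ (r + t) q ≤ C * moment μ r q * moment μ t q := by
  classical
  obtain ⟨J, hJ⟩ := exists_nat_ge (K ^ 3 / ρ₀)
  refine ⟨81 * (3 * (2 * J + 1) ^ 2), by positivity, fun r t q hq hq2 => ?_⟩
  have hq0 : 0 < q := by linarith
  have hq1 : 0 ≤ q - 1 := by linarith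
  have hK := hR.Kpos
  have hρ₀ := hR.pos
  have h2r : (0 : ℝ) < 2 ^ r := by positivity
  have h2t : (0 : ℝ) < 2 ^ t := by positivity
  obtain ⟨τ, hτ⟩ : ∃ τ, τ = 1 / (K * 2 ^ r) := ⟨_, rfl⟩
  have hτ0 : 0 < τ := by rw [hτ]; positivity
  have hτ1 : τ ≤ 1 := by
    rw [hτ, div_le_one (by positivity)]
    exact one_le_mul_of_one_le_of_one_le hR.one_le (one_le_pow₀ one_le_two)
  obtain ⟨N, hN⟩ := exists_pow_lt_of_lt_one hτ0 hR.lt_one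
  obtain ⟨w, hw⟩ : ∃ w : (Fin N → Λ) → List Λ, w = fun Y => cutWord φ τ [] (List.ofFn Y) := ⟨_, rfl⟩
  have hD1 : ∀ Y, K * |dWord φ (w Y) 0| * 2 ^ r ≤ 1 := fun Y => by
    have : |dWord φ (w Y) 0| ≤ τ := by
      rw [hw]; exact hR.dWord_cutWord_le _ _ (by simpa using hN.le)
    calc _ ≤ K * τ * 2 ^ r := by gcongr
      _ = 1 := by rw [hτ]; field_simp
  have hD2 : ∀ Y, K ≤ J * (|dWord φ (w Y) 0| * 2 ^ r) := fun Y => by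
    have h1 : ρ₀ / K * τ ≤ |dWord φ (w Y) 0| := by
      rw [hw]
      refine hR.le_dWord_cutWord _ _ ?_
      rw [dWord, abs_one]
      have h2 : ρ₀ ≤ 1 := by
        obtain ⟨i⟩ := ‹Nonempty Λ›
        exact (hR.lower i 0 zero_mem_unitI).trans
          ((hR.upper i 0 zero_mem_unitI).trans hR.lt_one.le)
      have h3 : ρ₀ / K ≤ 1 := (div_le_one hK).2 (h2.trans hR.one_le)
      exact mul_le_one₀ h3 hτ0.le hτ1
    rw [div_le_iff₀ hρ₀] at hJ
    have h2 : ρ₀ / K * τ * 2 ^ r = ρ₀ / K ^ 2 := by rw [hτ]; field_simp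
    calc K = K ^ 3 / K ^ 2 := by field_simp
      _ ≤ J * ρ₀ / K ^ 2 := by gcongr
      _ = J * (ρ₀ / K * τ * 2 ^ r) := by rw [h2]; ring
      _ ≤ _ := by gcongr
  have hdiam : ∀ Y, ∀ y ∈ unitI, ∀ z ∈ unitI,
      |2 ^ r * compWord φ (w Y) y - 2 ^ r * compWord φ (w Y) z| ≤ 1 := fun Y y hy z hz => by
    have h1 := hR.abs_sub_le (w Y) hy hz zero_mem_unitI
    have h2 := abs_sub_le_one hy hz
    rw [← mul_sub, abs_mul, abs_of_pos h2r]
    calc _ ≤ 2 ^ r * (K * |dWord φ (w Y) 0| * 1) := by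
          refine mul_le_mul_of_nonneg_left (h1.trans ?_) h2r.le
          gcongr
      _ ≤ 1 := by linarith [hD1 Y]
  have hharm : ∀ B, MeasurableSet B →
      ∑ Y, wpi p N Y * μ.real (compWord φ (w Y) ⁻¹' B) = μ.real B := fun B hB => by
    have := sum_wpi_cutWord (φ := φ) (hR.measureReal_preimage_eq_sum hp hμI hμ hB) hp1 τ N []
    simpa only [compWord, preimage_id, hw] using this
  have hP : ∀ Y, 0 ≤ wpi p N Y := fun Y => wpi_nonneg hp N Y
  obtain ⟨Nb, hNb⟩ : ∃ Nb : (Fin N → Λ) → Set ℝ,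
      ∀ Y, Nb Y = {x | |2 ^ r * x - 2 ^ r * compWord φ (w Y) 0| ≤ 3} := ⟨_, fun _ => rfl⟩
  have hNbm : ∀ Y, MeasurableSet (Nb Y) := fun Y => by
    rw [hNb]; exact measurableSet_le (by fun_prop) measurable_const
  -- bound for a single cell
  have step1 : ∀ c, μ.real (cell (r + t) c) ^ q ≤
      ∑ Y, wpi p N Y * μ.real (Nb Y) ^ (q - 1) *
        μ.real (compWord φ (w Y) ⁻¹' cell (r + t) c) ^ q := by
    intro c
    obtain ⟨X, hX⟩ : ∃ X : (Fin N → Λ) → ℝ,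
      ∀ Y, X Y = μ.real (compWord φ (w Y) ⁻¹' cell (r + t) c) := ⟨_, fun _ => rfl⟩
    have hX0 : ∀ Y, 0 ≤ X Y := fun Y => hX Y ▸ measureReal_nonneg
    have hmem : ∀ Y, X Y ≠ 0 → ∃ y ∈ unitI, y ∈ compWord φ (w Y) ⁻¹' cell (r + t) c := fun Y h =>
      exists_mem_of_measureReal_ne_zero hμI (hX Y ▸ h)
    have hle : ∀ Y, X Y ≠ 0 → ∑ Y' with X Y' ≠ 0, wpi p N Y' ≤ μ.real (Nb Y) := by
      intro Y hY
      obtain ⟨y, hy, hyc⟩ := hmem Y hY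
      rw [← hharm _ (hNbm Y), Finset.sum_filter]
      refine Finset.sum_le_sum fun Y' _ => ?_
      split_ifs with hY'
      · obtain ⟨y', hy', hyc'⟩ := hmem Y' hY'
        rw [measureReal_preimage_eq_one hμI, mul_one]
        intro z hz
        rw [hNb, Set.mem_ofPred_eq]
        have e1 := hdiam Y y hy 0 zero_mem_unitI
        have e2 := hdiam Y' z hz y' hy'
        have e3 := abs_sub_le_one_of_floor_eq
          ((show ⌊2 ^ (r + t) * compWord φ (w Y') y'⌋ = c from hyc').trans
          (show ⌊2 ^ (r + t) * compWord φ (w Y) y⌋ = c from hyc).symm)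
        have e4 : |2 ^ r * compWord φ (w Y') y' - 2 ^ r * compWord φ (w Y) y| ≤ 1 := by
          rw [← mul_sub, abs_mul, abs_of_pos (by positivity), pow_add] at e3
          rw [← mul_sub, abs_mul, abs_of_pos h2r]
          have : (1 : ℝ) ≤ 2 ^ t := one_le_pow₀ one_le_two
          refine le_trans ?_ e3
          gcongr
          exact le_mul_of_one_le_right h2r.le this
        have a1 := abs_le.1 e1
        have a2 := abs_le.1 e2
        have a4 := abs_le.1 e4
        rw [abs_le]
        constructor <;> linarith
      · exact mul_nonneg (hP Y') measureReal_nonneg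
    have hsum : μ.real (cell (r + t) c) = ∑ Y with X Y ≠ 0, wpi p N Y * X Y := by
      rw [← hharm _ (measurableSet_cell (r + t) c), Finset.sum_filter_of_ne]
      · exact Finset.sum_congr rfl fun Y _ => by rw [hX]
      · intro Y _ h h'
        rw [h', mul_zero] at h
        exact h rfl
    rw [hsum]
    refine (sum_mul_rpow_le _ _ _ hP hX0 hq).trans ?_
    rw [Finset.mul_sum, Finset.sum_filter]
    refine Finset.sum_le_sum fun Y _ => ?_
    rw [← hX]
    have hXq := Real.rpow_nonneg (hX0 Y) q
    split_ifs with hY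
    · have h1 : (∑ Y' with X Y' ≠ 0, wpi p N Y') ^ (q - 1) ≤ μ.real (Nb Y) ^ (q - 1) :=
        Real.rpow_le_rpow (Finset.sum_nonneg fun Y' _ => hP Y') (hle Y hY) hq1
      have h2 := mul_le_mul_of_nonneg_right h1 (mul_nonneg (hP Y) hXq)
      linarith
    · exact mul_nonneg (mul_nonneg (hP Y) (Real.rpow_nonneg measureReal_nonneg _)) hXq
  -- bound for the remaining weights
  have step2 : ∑ Y, wpi p N Y * μ.real (Nb Y) ^ (q - 1) ≤ 81 * moment μ r q := by
    have h1 : ∀ Y, μ.real (Nb Y) ^ (q - 1) ≤ ∑ b ∈ cellIdx r,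
        μ.real (compWord φ (w Y) ⁻¹' cell r b) * μ.real (cellNhd 4 r b) ^ (q - 1) := by
      intro Y
      have h2 := one_le_sum_preimage_cell hR hμI (w Y) r
      have hV : 0 ≤ μ.real (Nb Y) ^ (q - 1) := Real.rpow_nonneg measureReal_nonneg _
      refine (le_mul_of_one_le_left hV h2).trans ?_
      rw [Finset.sum_mul]
      refine Finset.sum_le_sum fun b _ => ?_
      by_cases hb : μ.real (compWord φ (w Y) ⁻¹' cell r b) = 0
      · rw [hb, zero_mul, zero_mul]
      · refine mul_le_mul_of_nonneg_left ?_ measureReal_nonneg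
        refine Real.rpow_le_rpow measureReal_nonneg (measureReal_mono ?_) hq1
        obtain ⟨y, hy, hyb⟩ := exists_mem_of_measureReal_ne_zero hμI hb
        intro x hx
        rw [hNb, Set.mem_ofPred_eq] at hx
        have e1 := abs_le.1 (hdiam Y y hy 0 zero_mem_unitI)
        have e2 := abs_le.1 hx
        have e3 : |2 ^ r * x - 2 ^ r * compWord φ (w Y) y| ≤ ((4 : ℕ) : ℝ) := by
          rw [abs_le]; push_cast; constructor <;> linarith
        have e4 := abs_floor_sub_le e3
        rwa [show ⌊2 ^ r * compWord φ (w Y) y⌋ = b from hyb] at e4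
    calc _ ≤ ∑ Y, wpi p N Y * ∑ b ∈ cellIdx r,
          μ.real (compWord φ (w Y) ⁻¹' cell r b) * μ.real (cellNhd 4 r b) ^ (q - 1) :=
          Finset.sum_le_sum fun Y _ => mul_le_mul_of_nonneg_left (h1 Y) (hP Y)
      _ = ∑ b ∈ cellIdx r, μ.real (cell r b) * μ.real (cellNhd 4 r b) ^ (q - 1) := by
          simp only [Finset.mul_sum]
          rw [Finset.sum_comm]
          refine Finset.sum_congr rfl fun b _ => ?_
          rw [← hharm _ (measurableSet_cell r b), Finset.sum_mul]
          exact Finset.sum_congr rfl fun Y _ => by ring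
      _ ≤ ∑ b ∈ cellIdx r, μ.real (cellNhd 4 r b) ^ q := by
          refine Finset.sum_le_sum fun b _ => ?_
          have h3 : μ.real (cellNhd 4 r b) ^ q =
              μ.real (cellNhd 4 r b) * μ.real (cellNhd 4 r b) ^ (q - 1) := by
            rw [← Real.rpow_one_add' measureReal_nonneg (by linarith)]
            congr 1; ring
          rw [h3]
          refine mul_le_mul_of_nonneg_right (measureReal_mono fun x hx => ?_)
            (Real.rpow_nonneg measureReal_nonneg _)
          rw [cellNhd, Set.mem_ofPred_eq, show ⌊2 ^ r * x⌋ = b from hx]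
          simp
      _ ≤ _ := by
          have := sum_cellNhd_rpow_le hμI 4 r hq hq2
          norm_num at this
          exact this
  have hmt := moment_nonneg (μ := μ) t q
  calc moment μ (r + t) q ≤ ∑ c ∈ cellIdx (r + t), ∑ Y, wpi p N Y * μ.real (Nb Y) ^ (q - 1) *
        μ.real (compWord φ (w Y) ⁻¹' cell (r + t) c) ^ q := Finset.sum_le_sum fun c _ => step1 c
    _ = ∑ Y, wpi p N Y * μ.real (Nb Y) ^ (q - 1) * ∑ c ∈ cellIdx (r + t),
        μ.real (compWord φ (w Y) ⁻¹' cell (r + t) c) ^ q := by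
        rw [Finset.sum_comm]
        exact Finset.sum_congr rfl fun Y _ => by rw [Finset.mul_sum]
    _ ≤ ∑ Y, wpi p N Y * μ.real (Nb Y) ^ (q - 1) * (3 * ((2 * J + 1) ^ 2 * moment μ t q)) := by
        refine Finset.sum_le_sum fun Y _ => mul_le_mul_of_nonneg_left
          (hR.sum_preimage_cell_rpow_le hμI (hD1 Y) (hD2 Y) hq hq2)
          (mul_nonneg (hP Y) (Real.rpow_nonneg measureReal_nonneg _))
    _ ≤ 81 * moment μ r q * (3 * ((2 * J + 1) ^ 2 * moment μ t q)) := by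
        rw [← Finset.sum_mul]
        exact mul_le_mul_of_nonneg_right step2 (by positivity)
    _ = _ := by ring

end SelfConformal

namespace SelfConformal

variable {Λ : Type} [Fintype Λ] {φ : Λ → ℝ → ℝ} {ρ₀ ρ₁ K : ℝ} {p : Λ → ℝ} [Nonempty Λ]
variable {μ : Measure ℝ}

lemma sum_measureReal_cell [IsFiniteMeasure μ] (r : ℕ) (s : Finset ℤ) :
    ∑ c ∈ s, μ.real (cell r c) = μ.real {x | ⌊2 ^ r * x⌋ ∈ s} := by
  rw [← measureReal_biUnion_finset]
  · congr 1
    ext x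
    simp [cell]
  · intro a _ b _ hab
    refine Set.disjoint_left.2 fun x hxa hxb => hab ?_
    exact (show ⌊2 ^ r * x⌋ = a from hxa).symm.trans hxb
  · exact fun c _ => measurableSet_cell r c

lemma sum_measureReal_cellIdx [IsProbabilityMeasure μ] (hμI : μ unitIᶜ = 0) (r : ℕ) :
    ∑ c ∈ cellIdx r, μ.real (cell r c) = 1 := by
  rw [sum_measureReal_cell]
  exact measureReal_preimage_eq_one (φ := fun _ : Unit => id) (w := [])
    (B := {x | ⌊2 ^ r * x⌋ ∈ cellIdx r}) hμI fun z hz => floor_mem_cellIdx r hz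

lemma sum_cellNhd_le [IsProbabilityMeasure μ] (J r : ℕ) (s : Finset ℤ) :
    ∑ c ∈ s, μ.real (cellNhd J r c) ≤ 2 * J + 1 := by
  have h1 : ∀ k : ℤ, ∑ c ∈ s, μ.real (cell r (c + k)) ≤ 1 := fun k => by
    have h2 : ∑ c ∈ s, μ.real (cell r (c + k)) =
        ∑ c ∈ s.map (addRightEmbedding k), μ.real (cell r c) := by rw [Finset.sum_map]; rfl
    rw [h2, sum_measureReal_cell]
    exact measureReal_le_one
  calc _ ≤ ∑ c ∈ s, ∑ k ∈ Finset.Icc (-(J : ℤ)) J, μ.real (cell r (c + k)) :=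
        Finset.sum_le_sum fun c _ => measureReal_cellNhd_le J r c
    _ = ∑ k ∈ Finset.Icc (-(J : ℤ)) J, ∑ c ∈ s, μ.real (cell r (c + k)) := Finset.sum_comm
    _ ≤ ∑ k ∈ Finset.Icc (-(J : ℤ)) J, 1 := Finset.sum_le_sum fun k _ => h1 k
    _ = _ := by rw [Finset.sum_const, card_Icc_neg, nsmul_eq_mul]; push_cast; ring

lemma cell_subset_cellNhd (J r : ℕ) (c : ℤ) : cell r c ⊆ cellNhd J r c := fun x hx => by
  rw [cellNhd, Set.mem_ofPred_eq, show ⌊2 ^ r * x⌋ = c from hx]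
  simp

lemma hEnt_le_sum_cellNhd [IsProbabilityMeasure μ] (hR : Reg φ ρ₀ ρ₁ K) (hp : ∀ i, 0 < p i)
    (hp1 : ∑ i, p i = 1) (hμI : μ unitIᶜ = 0)
    (hμ : μ = ∑ i : Λ, ENNReal.ofReal (p i) • Measure.map (φ i) μ) {C₀ : ℕ}
    (hC₀ : ρ₁ ^ C₀ ≤ 1 / 2) (r : ℕ) :
    hEnt φ p C₀ r ≤ Real.log 5 +
      ∑ c ∈ cellIdx r, μ.real (cell r c) * -Real.log (μ.real (cellNhd 1 r c)) := by
  classical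
  have hp0 := fun i => (hp i).le
  obtain ⟨N, hN⟩ : ∃ N, N = C₀ * r := ⟨_, rfl⟩
  obtain ⟨X, hX⟩ : ∃ X : (Fin N → Λ) → ℤ → ℝ,
    ∀ Y c, X Y c = μ.real (compWord φ (List.ofFn Y) ⁻¹' cell r c) := ⟨_, fun _ _ => rfl⟩
  have hX0 : ∀ Y c, 0 ≤ X Y c := fun Y c => hX Y c ▸ measureReal_nonneg
  have hharm : ∀ c, ∑ Y, wpi p N Y * X Y c = μ.real (cell r c) := fun c => by
    have := sum_wpi_harmonic (hR.measureReal_preimage_eq_sum hp0 hμI hμ (measurableSet_cell r c)) N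
    simpa only [compWord, preimage_id, hX] using this
  have hsumX : ∀ Y, 1 ≤ ∑ c ∈ cellIdx r, X Y c := fun Y => by
    simp only [hX]; exact one_le_sum_preimage_cell hR hμI _ r
  have hwpos : ∀ Y, 0 < wpi p N Y := fun Y => Finset.prod_pos fun i _ => hp _
  have hsub : ∀ Y c, X Y c ≠ 0 → cellNhd 1 r c ⊆ cellNhd 2 r ⌊2 ^ r * pt φ Y⌋ := by
    intro Y c h
    obtain ⟨y, hy, hyc⟩ := exists_mem_of_measureReal_ne_zero hμI (hX Y c ▸ h)
    have h1 := hR.abs_sub_le_pow (List.ofFn Y) hy zero_mem_unitI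
    rw [List.length_ofFn] at h1
    have h2 := two_pow_mul_rho_le hR.rho_one_nonneg hC₀ r
    rw [← hN] at h2
    have h3 : |2 ^ r * compWord φ (List.ofFn Y) y - 2 ^ r * pt φ Y| ≤ ((1 : ℕ) : ℝ) := by
      rw [← mul_sub, abs_mul, abs_of_pos (by positivity), pt]
      refine le_trans ?_ (h2.trans (by norm_num))
      gcongr
    have h4 := abs_floor_sub_le h3
    rw [show ⌊2 ^ r * compWord φ (List.ofFn Y) y⌋ = c from hyc] at h4
    intro x hx
    have h5 : |⌊2 ^ r * x⌋ - c| ≤ ((1 : ℕ) : ℤ) := hx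
    change |⌊2 ^ r * x⌋ - _| ≤ ((2 : ℕ) : ℤ)
    rw [abs_le] at h4 h5 ⊢
    push_cast at h4 h5 ⊢
    constructor <;> linarith [h4.1, h4.2, h5.1, h5.2]
  have hpos : ∀ Y c, X Y c ≠ 0 → 0 < μ.real (cellNhd 1 r c) := by
    intro Y c h
    have h1 : 0 < wpi p N Y * X Y c := mul_pos (hwpos Y) ((hX0 Y c).lt_of_ne' h)
    have h2 := Finset.single_le_sum (f := fun Y => wpi p N Y * X Y c)
      (fun Y' _ => mul_nonneg (hwpos Y').le (hX0 Y' c)) (Finset.mem_univ Y)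
    rw [hharm] at h2
    exact h1.trans_le (h2.trans (measureReal_mono (cell_subset_cellNhd 1 r c)))
  have hq : ∀ Y : Fin N → Λ, 0 < μ.real (cellNhd 2 r ⌊2 ^ r * pt φ Y⌋) := by
    intro Y
    obtain ⟨c, _, hc⟩ : ∃ c ∈ cellIdx r, X Y c ≠ 0 := by
      by_contra! h
      have := hsumX Y
      rw [Finset.sum_eq_zero h] at this
      linarith
    exact (hpos Y c hc).trans_le (measureReal_mono (hsub Y c hc))
  have hg := ent_gibbs (fun Y => (hwpos Y).le) (fun Y : Fin N → Λ => ⌊2 ^ r * pt φ Y⌋)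
    (fun b => μ.real (cellNhd 2 r b) / 5) (fun b => by positivity)
    (fun Y _ => by have := hq Y; positivity) (fun s => by
      rw [← Finset.sum_div, div_le_one (by norm_num)]
      refine (sum_cellNhd_le 2 r s).trans (by norm_num))
  rw [hEnt, ← hN]
  refine hg.trans ?_
  have h1 : ∀ Y : Fin N → Λ, -Real.log (μ.real (cellNhd 2 r ⌊2 ^ r * pt φ Y⌋) / 5) ≤ Real.log 5 +
      ∑ c ∈ cellIdx r, X Y c * -Real.log (μ.real (cellNhd 1 r c)) := by
    intro Y
    rw [Real.log_div (hq Y).ne' (by norm_num), neg_sub, sub_eq_add_neg]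
    refine add_le_add le_rfl ?_
    have h2 : 0 ≤ -Real.log (μ.real (cellNhd 2 r ⌊2 ^ r * pt φ Y⌋)) :=
      neg_nonneg.2 (Real.log_nonpos measureReal_nonneg measureReal_le_one)
    refine (le_mul_of_one_le_left h2 (hsumX Y)).trans ?_
    rw [Finset.sum_mul]
    refine Finset.sum_le_sum fun c _ => ?_
    by_cases hc : X Y c = 0
    · rw [hc, zero_mul, zero_mul]
    · refine mul_le_mul_of_nonneg_left (neg_le_neg (Real.log_le_log (hpos Y c hc) ?_)) (hX0 Y c)
      exact measureReal_mono (hsub Y c hc)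
  calc _ ≤ ∑ Y, wpi p N Y * (Real.log 5 +
        ∑ c ∈ cellIdx r, X Y c * -Real.log (μ.real (cellNhd 1 r c))) :=
        Finset.sum_le_sum fun Y _ => mul_le_mul_of_nonneg_left (h1 Y) (hwpos Y).le
    _ = _ := by
        simp only [mul_add, Finset.sum_add_distrib, ← Finset.sum_mul, sum_wpi hp1, one_mul]
        congr 1
        simp only [Finset.mul_sum]
        rw [Finset.sum_comm]
        refine Finset.sum_congr rfl fun c _ => ?_
        rw [← hharm, Finset.sum_mul]
        exact Finset.sum_congr rfl fun Y _ => by ring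

lemma mul_neg_log_le {x N : ℝ} (hx : 0 ≤ x) (hN : 0 < N) :
    x * -Real.log x ≤ x * Real.log N + 1 / N := by
  rcases hx.eq_or_lt with rfl | hx
  · simp only [zero_mul, zero_add]; positivity
  have h1 := Real.add_one_le_exp (-Real.log (x * N))
  rw [Real.exp_neg, Real.exp_log (by positivity), Real.log_mul hx.ne' hN.ne'] at h1
  have h2 : x * (x * N)⁻¹ = 1 / N := by field_simp
  have h3 := mul_le_mul_of_nonneg_left h1 hx.le
  rw [h2] at h3
  linarith

lemma sum_cell_neg_log_le [IsProbabilityMeasure μ] (r : ℕ) {s : Finset ℤ} (hs : s ⊆ cellIdx r) :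
    ∑ c ∈ s, μ.real (cell r c) * -Real.log (μ.real (cellNhd 1 r c)) ≤
      μ.real {x | ⌊2 ^ r * x⌋ ∈ s} * ((r + 1) * Real.log 2) + 1 := by
  have hcard : (s.card : ℝ) ≤ 2 ^ (r + 1) := by
    have h1 := Finset.card_le_card hs
    rw [cellIdx, Int.card_Icc] at h1
    have h2 : (s.card : ℤ) ≤ 2 ^ r + 1 := by
      have h0 : (0 : ℤ) ≤ 2 ^ r := by positivity
      have : (0 : ℤ) ≤ 2 ^ r + 1 - 0 := by linarith
      have h3 := Int.toNat_of_nonneg this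
      omega
    have h3 : (s.card : ℝ) ≤ 2 ^ r + 1 := by exact_mod_cast h2
    have h4 : (1 : ℝ) ≤ 2 ^ r := one_le_pow₀ one_le_two
    rw [pow_succ]
    linarith
  have hN : (0 : ℝ) < 2 ^ (r + 1) := by positivity
  have hlog : Real.log (2 ^ (r + 1)) = (r + 1) * Real.log 2 := by
    rw [Real.log_pow]; push_cast; ring
  calc _ ≤ ∑ c ∈ s, (μ.real (cell r c) * ((r + 1) * Real.log 2) + 1 / 2 ^ (r + 1)) := by
        refine Finset.sum_le_sum fun c _ => ?_
        rw [← hlog]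
        refine le_trans ?_ (mul_neg_log_le measureReal_nonneg hN)
        rcases (measureReal_nonneg : 0 ≤ μ.real (cell r c)).eq_or_lt with h | h
        · rw [← h, zero_mul, zero_mul]
        · exact mul_le_mul_of_nonneg_left (neg_le_neg (Real.log_le_log h
            (measureReal_mono (cell_subset_cellNhd 1 r c)))) h.le
    _ = μ.real {x | ⌊2 ^ r * x⌋ ∈ s} * ((r + 1) * Real.log 2) + s.card / 2 ^ (r + 1) := by
        rw [Finset.sum_add_distrib, ← Finset.sum_mul, sum_measureReal_cell, Finset.sum_const,
          nsmul_eq_mul, mul_one_div]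
    _ ≤ _ := by
        gcongr
        exact (div_le_one hN).2 hcard

end SelfConformal

namespace SelfConformal

variable {Λ : Type} [Fintype Λ] {φ : Λ → ℝ → ℝ} {ρ₀ ρ₁ K : ℝ} {p : Λ → ℝ} [Nonempty Λ]
variable {μ : Measure ℝ}

lemma closedBall_subset_cellNhd (n : ℕ) (x : ℝ) :
    closedBall x (Real.exp (-(n * Real.log 2))) ⊆ cellNhd 1 n ⌊2 ^ n * x⌋ := by
  intro y hy
  rw [mem_closedBall, Real.dist_eq, Real.exp_neg, Real.exp_nat_mul,
    Real.exp_log two_pos] at hy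
  refine abs_floor_sub_le ?_
  rw [← mul_sub, abs_mul, abs_of_pos (by positivity)]
  calc (2 : ℝ) ^ n * |y - x| ≤ 2 ^ n * (2 ^ n)⁻¹ := by gcongr
    _ = ((1 : ℕ) : ℝ) := by rw [mul_inv_cancel₀ (by positivity), Nat.cast_one]

lemma tendsto_mul_log_two : Tendsto (fun n : ℕ => n * Real.log 2) atTop atTop :=
  tendsto_natCast_atTop_atTop.atTop_mul_const (Real.log_pos one_lt_two)

/-- The cells whose neighbourhoods have mass below `t`. -/
def lightCells (μ : Measure ℝ) (r : ℕ) (t : ℝ) : Finset ℤ :=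
  (cellIdx r).filter fun c => μ.real (cellNhd 1 r c) < t

/-- The cells whose neighbourhoods have mass above `t`. -/
def heavyCells (μ : Measure ℝ) (r : ℕ) (t : ℝ) : Finset ℤ :=
  (cellIdx r).filter fun c => t < μ.real (cellNhd 1 r c)

lemma tendsto_lightCells [IsProbabilityMeasure μ] {D : ℝ}
    (hD : ∀ᵐ x ∂μ, ∀ᶠ s in atTop, Real.exp (-(D * s)) ≤ μ.real (closedBall x (Real.exp (-s)))) :
    Tendsto (fun r : ℕ => μ.real {x | ⌊2 ^ r * x⌋ ∈
      lightCells μ r (Real.exp (-(D * (r * Real.log 2))))}) atTop (𝓝 0) := by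
  have h := tendsto_measure_of_ae_tendsto_indicator_of_isFiniteMeasure (μ := μ)
    (L := atTop) (A := ∅) (As := fun r : ℕ => {x | ⌊2 ^ r * x⌋ ∈
      lightCells μ r (Real.exp (-(D * (r * Real.log 2))))}) MeasurableSet.empty
    (fun r => measurable_floor_two_pow r
      (.of_discrete : MeasurableSet {c : ℤ | c ∈ lightCells μ r _})) (by
      filter_upwards [hD] with x hx
      filter_upwards [tendsto_mul_log_two.eventually hx] with r hr
      simp only [mem_empty_iff_false, iff_false, lightCells, Finset.mem_filter,
        not_and, not_lt]
      exact fun _ => hr.trans (measureReal_mono (closedBall_subset_cellNhd r x)))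
  rw [measure_empty] at h
  exact (ENNReal.tendsto_toReal ENNReal.zero_ne_top).comp h

lemma sum_neg_log_cellNhd_le [IsProbabilityMeasure μ] (hμI : μ unitIᶜ = 0) {d δ ε : ℝ}
    (hd : 0 ≤ d) (hδ : 0 ≤ δ) (hε : 0 ≤ ε) (r : ℕ) {s : ℝ} (hs : 0 ≤ s) :
    ∑ c ∈ cellIdx r, μ.real (cell r c) * -Real.log (μ.real (cellNhd 1 r c)) ≤
      μ.real {x | ⌊2 ^ r * x⌋ ∈ lightCells μ r (Real.exp (-((d + ε) * s)))} *
        ((r + 1) * Real.log 2) + 1 + (d + ε) * s -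
      μ.real {x | ⌊2 ^ r * x⌋ ∈ heavyCells μ r (Real.exp (-((d - δ) * s)))} * (δ * s) := by
  have h1 := sum_cell_neg_log_le (μ := μ) r
    (s := lightCells μ r (Real.exp (-((d + ε) * s)))) (Finset.filter_subset _ _)
  have h2 : ∑ c ∈ cellIdx r, μ.real (cell r c) * -Real.log (μ.real (cellNhd 1 r c)) ≤
      ∑ c ∈ lightCells μ r (Real.exp (-((d + ε) * s))),
        μ.real (cell r c) * -Real.log (μ.real (cellNhd 1 r c)) +
      ∑ c ∈ cellIdx r, μ.real (cell r c) * ((d + ε) * s) -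
      ∑ c ∈ heavyCells μ r (Real.exp (-((d - δ) * s))), μ.real (cell r c) * (δ * s) := by
    rw [lightCells, heavyCells, Finset.sum_filter, Finset.sum_filter, ← Finset.sum_add_distrib,
      ← Finset.sum_sub_distrib]
    refine Finset.sum_le_sum fun c _ => ?_
    have hm : 0 ≤ μ.real (cell r c) := measureReal_nonneg
    have hlog : ∀ {t}, Real.exp (-t) ≤ μ.real (cellNhd 1 r c) →
        -Real.log (μ.real (cellNhd 1 r c)) ≤ t := fun {t} h => by
      have := Real.log_le_log (Real.exp_pos _) h
      rw [Real.log_exp] at this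
      linarith
    have hδs := mul_nonneg hδ hs
    have hεs := mul_nonneg hε hs
    have hds := mul_nonneg hd hs
    split_ifs with hA hB hB
    · have := (Real.exp_lt_exp.1 (hB.trans hA))
      nlinarith
    · have := mul_nonneg hm (add_nonneg hds hεs)
      nlinarith
    · have := mul_le_mul_of_nonneg_left (hlog hB.le) hm
      have := mul_nonneg hm hεs
      nlinarith
    · have := mul_le_mul_of_nonneg_left (hlog (not_lt.1 hA)) hm
      nlinarith
  rw [← Finset.sum_mul, ← Finset.sum_mul, sum_measureReal_cellIdx hμI, sum_measureReal_cell,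
    one_mul] at h2
  linarith

lemma tendsto_heavyCells [IsProbabilityMeasure μ] (hR : Reg φ ρ₀ ρ₁ K) (hp : ∀ i, 0 < p i)
    (hp1 : ∑ i, p i = 1) (hμI : μ unitIᶜ = 0)
    (hμ : μ = ∑ i : Λ, ENNReal.ofReal (p i) • Measure.map (φ i) μ) {C₀ : ℕ}
    (hC₀ : ρ₁ ^ C₀ ≤ 1 / 2) {α d δ : ℝ}
    (hlim : Tendsto (fun r : ℕ => hEnt φ p C₀ r / r) atTop (𝓝 α)) (hd : 0 ≤ d)
    (hdα : d * Real.log 2 ≤ α) (hδ : 0 < δ)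
    (hup : ∀ ε : ℝ, 0 < ε → ∀ᵐ x ∂μ, ∀ᶠ s in atTop,
      Real.exp (-((d + ε) * s)) ≤ μ.real (closedBall x (Real.exp (-s)))) :
    Tendsto (fun r : ℕ => μ.real {x | ⌊2 ^ r * x⌋ ∈
      heavyCells μ r (Real.exp (-((d - δ) * (r * Real.log 2))))}) atTop (𝓝 0) := by
  have hl : 0 < Real.log 2 := Real.log_pos one_lt_two
  refine tendsto_order.2 ⟨fun a ha => .of_forall fun r => ha.trans_le measureReal_nonneg,
    fun η hη => ?_⟩
  obtain ⟨ε, hε⟩ : ∃ ε, ε = δ * η / 8 := ⟨_, rfl⟩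
  have hε0 : 0 < ε := by rw [hε]; positivity
  filter_upwards [(tendsto_lightCells (hup ε hε0)).eventually_lt_const hε0,
    hlim.eventually_const_lt (show α - ε * Real.log 2 < α by nlinarith [mul_pos hε0 hl]),
    eventually_le_mul (Real.log 5 + 1) (mul_pos hε0 hl), eventually_ge_atTop 1]
    with r h1 h2 h3 hr
  have hr1 : (1 : ℝ) ≤ r := by exact_mod_cast hr
  have hr0 : (0 : ℝ) < r := by linarith
  obtain ⟨s, hs⟩ : ∃ s, s = r * Real.log 2 := ⟨_, rfl⟩
  rw [← hs] at h1 ⊢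
  have hs0 : 0 < s := by rw [hs]; positivity
  rw [lt_div_iff₀ hr0] at h2
  have h4 := hEnt_le_sum_cellNhd hR hp hp1 hμI hμ hC₀ r
  have h5 := sum_neg_log_cellNhd_le hμI hd hδ.le hε0.le r hs0.le
  have h6 : μ.real {x | ⌊2 ^ r * x⌋ ∈ lightCells μ r (Real.exp (-((d + ε) * s)))} *
      ((r + 1) * Real.log 2) ≤ ε * (2 * s) := by
    refine mul_le_mul h1.le ?_ (by positivity) hε0.le
    rw [hs]; nlinarith
  have h7 : (d - ε) * s ≤ (α - ε * Real.log 2) * r := by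
    rw [hs]; nlinarith [mul_le_mul_of_nonneg_right hdα hr0.le]
  have h8 : ε * Real.log 2 * r = ε * s := by rw [hs]; ring
  have h9 : μ.real {x | ⌊2 ^ r * x⌋ ∈ heavyCells μ r (Real.exp (-((d - δ) * s)))} * (δ * s) ≤
      5 / 8 * η * (δ * s) := by
    have : 5 / 8 * η * (δ * s) = 5 * (ε * s) := by rw [hε]; ring
    rw [this]
    linarith
  have h10 := le_of_mul_le_mul_right h9 (by positivity)
  linarith

lemma moment_le_one [IsProbabilityMeasure μ] (hμI : μ unitIᶜ = 0) (r : ℕ) {q : ℝ} (hq : 1 ≤ q) :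
    moment μ r q ≤ 1 := by
  rw [← sum_measureReal_cellIdx hμI r]
  exact Finset.sum_le_sum fun c _ =>
    (Real.rpow_le_rpow_of_exponent_ge' measureReal_nonneg measureReal_le_one zero_le_one hq).trans
      (Real.rpow_one _).le

lemma moment_le_heavyCells [IsProbabilityMeasure μ] (hμI : μ unitIᶜ = 0) (r : ℕ) {κ : ℝ}
    (hκ : 0 ≤ κ) {t : ℝ} (ht : 0 ≤ t) :
    moment μ r (1 + κ) ≤ μ.real {x | ⌊2 ^ r * x⌋ ∈ heavyCells μ r t} + t ^ κ := by
  have h1 : ∑ c ∈ cellIdx r, μ.real (cell r c) * t ^ κ = t ^ κ := by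
    rw [← Finset.sum_mul, sum_measureReal_cellIdx hμI, one_mul]
  rw [← sum_measureReal_cell, ← h1, heavyCells, Finset.sum_filter, ← Finset.sum_add_distrib]
  refine Finset.sum_le_sum fun c _ => ?_
  have hm : 0 ≤ μ.real (cell r c) := measureReal_nonneg
  have htκ : 0 ≤ t ^ κ := Real.rpow_nonneg ht _
  rw [Real.rpow_add_of_nonneg hm zero_le_one hκ, Real.rpow_one]
  split_ifs with h
  · have h2 : μ.real (cell r c) ^ κ ≤ 1 := Real.rpow_le_one hm measureReal_le_one hκ
    nlinarith [mul_nonneg hm htκ]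
  · rw [zero_add]
    refine mul_le_mul_of_nonneg_left (Real.rpow_le_rpow hm ?_ hκ) hm
    exact (measureReal_mono (cell_subset_cellNhd 1 r c)).trans (not_lt.1 h)

lemma heavyCells_le_moment [IsProbabilityMeasure μ] (hμI : μ unitIᶜ = 0) (r : ℕ) {κ : ℝ}
    (hκ : 0 ≤ κ) (hκ1 : κ ≤ 1) {t : ℝ} (ht : 0 < t) :
    μ.real {x | ⌊2 ^ r * x⌋ ∈ heavyCells μ r t} ≤ (t ^ κ)⁻¹ * (9 * moment μ r (1 + κ)) := by
  have htκ : 0 < t ^ κ := Real.rpow_pos_of_pos ht _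
  have h1 := sum_cellNhd_rpow_le hμI 1 r (q := 1 + κ) (by linarith) (by linarith)
  norm_num at h1
  rw [← sum_measureReal_cell, inv_mul_eq_div, le_div_iff₀ htκ, Finset.sum_mul]
  refine le_trans ?_ h1
  refine le_trans ?_ (Finset.sum_le_sum_of_subset_of_nonneg
    (Finset.filter_subset (fun c => t < μ.real (cellNhd 1 r c)) _) fun c _ _ => Real.rpow_nonneg measureReal_nonneg _)
  refine Finset.sum_le_sum fun c hc => ?_
  rw [Real.rpow_add_of_nonneg measureReal_nonneg zero_le_one hκ, Real.rpow_one]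
  exact mul_le_mul (measureReal_mono (cell_subset_cellNhd 1 r c))
    (Real.rpow_le_rpow ht.le (Finset.mem_filter.1 hc).2.le hκ) htκ.le measureReal_nonneg

lemma moment_mul_le [IsProbabilityMeasure μ] (hμI : μ unitIᶜ = 0) {C q : ℝ} (hC : 0 ≤ C)
    (hq : 1 ≤ q)
    (h : ∀ r t : ℕ, moment μ (r + t) q ≤ C * moment μ r q * moment μ t q) (r j : ℕ) :
    moment μ (j * r) q ≤ (C * moment μ r q) ^ j := by
  have h0 : 0 ≤ C * moment μ r q := mul_nonneg hC (moment_nonneg _ _)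
  induction j with
  | zero => simpa using moment_le_one hμI 0 hq
  | succ j ih =>
    rw [add_mul, one_mul, add_comm, pow_succ']
    exact (h r (j * r)).trans (mul_le_mul_of_nonneg_left ih h0)

end SelfConformal

namespace SelfConformal

variable {Λ : Type} [Fintype Λ] {φ : Λ → ℝ → ℝ} {ρ₀ ρ₁ K : ℝ} {p : Λ → ℝ} [Nonempty Λ]
variable {μ : Measure ℝ}

lemma Reg.exists_heavyCells_le [IsProbabilityMeasure μ] (hR : Reg φ ρ₀ ρ₁ K)
    (hp : ∀ i, 0 < p i) (hp1 : ∑ i, p i = 1) (hμI : μ unitIᶜ = 0)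
    (hμ : μ = ∑ i : Λ, ENNReal.ofReal (p i) • Measure.map (φ i) μ) {C₀ : ℕ}
    (hC₀ : ρ₁ ^ C₀ ≤ 1 / 2) {α d δ : ℝ}
    (hlim : Tendsto (fun r : ℕ => hEnt φ p C₀ r / r) atTop (𝓝 α)) (hd : 0 ≤ d)
    (hdα : d * Real.log 2 ≤ α) (hδ : 0 < δ)
    (hup : ∀ ε : ℝ, 0 < ε → ∀ᵐ x ∂μ, ∀ᶠ s in atTop,
      Real.exp (-((d + ε) * s)) ≤ μ.real (closedBall x (Real.exp (-s)))) :
    ∃ r : ℕ, 1 ≤ r ∧ ∀ j : ℕ, μ.real {x | ⌊2 ^ (j * r) * x⌋ ∈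
      heavyCells μ (j * r) (Real.exp (-((d - 2 * δ) * (j * (r * Real.log 2)))))} ≤
        9 * (1 / 2) ^ j := by
  obtain ⟨C, hC, hmom⟩ := hR.moment_add_le (fun i => (hp i).le) hp1 hμI hμ
  have hk : 0 < Real.log (4 * C + 1) / δ := div_pos (Real.log_pos (by linarith)) hδ
  have hkδ : Real.exp (-(Real.log (4 * C + 1) / δ * δ)) = (4 * C + 1)⁻¹ := by
    rw [div_mul_cancel₀ _ hδ.ne', Real.exp_neg, Real.exp_log (by linarith)]
  obtain ⟨k, hkk⟩ : ∃ k, k = Real.log (4 * C + 1) / δ := ⟨_, rfl⟩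
  rw [← hkk] at hk hkδ
  have hev := (tendsto_heavyCells hR hp hp1 hμI hμ hC₀ hlim hd hdα hδ hup).eventually_le_const
    (Real.exp_pos (-(k * (d - δ))))
  obtain ⟨r, hr1, hr2, hr3⟩ := (hev.and ((tendsto_mul_log_two.eventually_ge_atTop k).and
    (eventually_ge_atTop 1))).exists
  refine ⟨r, hr3, fun j => ?_⟩
  obtain ⟨s, hs⟩ : ∃ s, s = r * Real.log 2 := ⟨_, rfl⟩
  rw [← hs] at hr1 hr2 ⊢
  have hs0 : 0 < s := hk.trans_le hr2
  have hκ : 0 ≤ k / s := by positivity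
  have hκ1 : k / s ≤ 1 := (div_le_one hs0).2 hr2
  have hq : 1 ≤ 1 + k / s := by linarith
  have hq2 : 1 + k / s ≤ 2 := by linarith
  have h1 : moment μ r (1 + k / s) ≤ 2 * Real.exp (-(k * (d - δ))) := by
    have h2 := moment_le_heavyCells hμI r hκ (Real.exp_pos (-((d - δ) * s))).le
    rw [← Real.exp_mul, show -((d - δ) * s) * (k / s) = -(k * (d - δ)) by field_simp] at h2
    linarith
  have h3 := moment_mul_le hμI hC.le hq (fun r t => hmom r t _ hq hq2) r j
  have h4 : (C * moment μ r (1 + k / s)) ^ j ≤ (C * (2 * Real.exp (-(k * (d - δ))))) ^ j :=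
    pow_le_pow_left₀ (mul_nonneg hC.le (moment_nonneg _ _))
      (mul_le_mul_of_nonneg_left h1 hC.le) j
  have h5 := heavyCells_le_moment hμI (j * r) hκ hκ1
    (Real.exp_pos (-((d - 2 * δ) * (j * s))))
  have h6 : (Real.exp (-((d - 2 * δ) * (j * s))) ^ (k / s))⁻¹ =
      Real.exp (k * (d - 2 * δ)) ^ j := by
    rw [← Real.exp_mul, ← Real.exp_neg, ← Real.exp_nat_mul]
    congr 1
    field_simp
  rw [h6] at h5
  have h7 : Real.exp (k * (d - 2 * δ)) * (C * (2 * Real.exp (-(k * (d - δ))))) ≤ 1 / 2 := by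
    have : Real.exp (k * (d - 2 * δ)) * Real.exp (-(k * (d - δ))) = (4 * C + 1)⁻¹ := by
      rw [← hkδ, ← Real.exp_add]; congr 1; ring
    rw [show Real.exp (k * (d - 2 * δ)) * (C * (2 * Real.exp (-(k * (d - δ))))) =
      2 * C * (Real.exp (k * (d - 2 * δ)) * Real.exp (-(k * (d - δ)))) by ring, this,
      mul_inv_le_iff₀ (by linarith)]
    linarith
  calc _ ≤ Real.exp (k * (d - 2 * δ)) ^ j * (9 * moment μ (j * r) (1 + k / s)) := h5
    _ ≤ Real.exp (k * (d - 2 * δ)) ^ j * (9 * (C * (2 * Real.exp (-(k * (d - δ))))) ^ j) := by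
        gcongr; exact h3.trans h4
    _ = 9 * (Real.exp (k * (d - 2 * δ)) * (C * (2 * Real.exp (-(k * (d - δ)))))) ^ j := by
        rw [mul_pow (Real.exp (k * (d - 2 * δ)))]; ring
    _ ≤ _ := by gcongr

lemma Reg.ae_le_exp [IsProbabilityMeasure μ] (hR : Reg φ ρ₀ ρ₁ K)
    (hp : ∀ i, 0 < p i) (hp1 : ∑ i, p i = 1) (hμI : μ unitIᶜ = 0)
    (hμ : μ = ∑ i : Λ, ENNReal.ofReal (p i) • Measure.map (φ i) μ) {C₀ : ℕ}
    (hC₀ : ρ₁ ^ C₀ ≤ 1 / 2) {α d δ : ℝ}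
    (hlim : Tendsto (fun r : ℕ => hEnt φ p C₀ r / r) atTop (𝓝 α)) (hd : 0 ≤ d)
    (hdα : d * Real.log 2 ≤ α) (hδ : 0 < δ)
    (hup : ∀ ε : ℝ, 0 < ε → ∀ᵐ x ∂μ, ∀ᶠ s in atTop,
      Real.exp (-((d + ε) * s)) ≤ μ.real (closedBall x (Real.exp (-s)))) :
    ∀ᵐ x ∂μ, ∀ᶠ s in atTop,
      μ.real (closedBall x (Real.exp (-s))) ≤ Real.exp (-((d - 3 * δ) * s)) := by
  obtain ⟨r, hr, h⟩ := hR.exists_heavyCells_le hp hp1 hμI hμ hC₀ hlim hd hdα hδ hup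
  obtain ⟨s, hs⟩ : ∃ s, s = r * Real.log 2 := ⟨_, rfl⟩
  have hs0 : 0 < s := by
    rw [hs]; exact mul_pos (by exact_mod_cast hr) (Real.log_pos one_lt_two)
  rw [← hs] at h
  have hsum : Summable fun j : ℕ => μ.real {x | ⌊2 ^ (j * r) * x⌋ ∈
      heavyCells μ (j * r) (Real.exp (-((d - 2 * δ) * (j * s))))} :=
    Summable.of_nonneg_of_le (fun _ => measureReal_nonneg) h
      ((summable_geometric_of_lt_one (by norm_num) (by norm_num)).mul_left 9)
  have hbc := hsum.tsum_ofReal_ne_top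
  simp only [fun s : Set ℝ => ofReal_measureReal (μ := μ) (s := s)] at hbc
  filter_upwards [ae_eventually_notMem hbc, ae_mem_unitI hμI] with x hx hxI
  obtain ⟨j₀, hj₀⟩ := eventually_atTop.1 (hx.and (eventually_le_mul (d - 3 * δ) hδ))
  filter_upwards [eventually_ge_atTop (((j₀ : ℝ) + 1) * s), eventually_ge_atTop 0] with S hS hS0
  rcases le_or_gt (d - 3 * δ) 0 with h0 | h0
  · refine measureReal_le_one.trans (Real.one_le_exp ?_)
    nlinarith
  have hSs : 0 ≤ S / s := by positivity
  obtain ⟨j, hj⟩ : ∃ j, j = ⌊S / s⌋₊ := ⟨_, rfl⟩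
  have hj1 : (j : ℝ) * s ≤ S := by
    rw [← le_div_iff₀ hs0, hj]; exact Nat.floor_le hSs
  have hj2 : S < ((j : ℝ) + 1) * s := by
    rw [← div_lt_iff₀ hs0, hj]; exact Nat.lt_floor_add_one _
  have hjj : j₀ ≤ j := by
    have : (j₀ : ℝ) + 1 < j + 1 := lt_of_mul_lt_mul_right (hS.trans_lt hj2) hs0.le
    exact_mod_cast (add_lt_add_iff_right (1 : ℝ)).1 this |>.le
  obtain ⟨hj3, hj4⟩ := hj₀ j hjj
  have hball : closedBall x (Real.exp (-S)) ⊆ cellNhd 1 (j * r) ⌊2 ^ (j * r) * x⌋ := by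
    refine (closedBall_subset_closedBall (Real.exp_le_exp.2 (neg_le_neg ?_))).trans
      (closedBall_subset_cellNhd (j * r) x)
    push_cast
    rwa [mul_assoc, ← hs]
  refine (measureReal_mono hball).trans ?_
  simp only [heavyCells, Finset.mem_filter, not_and, not_lt] at hj3
  refine (hj3 (floor_mem_cellIdx _ hxI)).trans (Real.exp_le_exp.2 (neg_le_neg ?_))
  calc (d - 3 * δ) * S ≤ (d - 3 * δ) * ((j + 1) * s) := by gcongr
    _ ≤ _ := by nlinarith

lemma exactDimWith_of_ae [IsProbabilityMeasure μ] {d : ℝ}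
    (hup : ∀ ε : ℝ, 0 < ε → ∀ᵐ x ∂μ, ∀ᶠ s in atTop,
      Real.exp (-((d + ε) * s)) ≤ μ.real (closedBall x (Real.exp (-s))))
    (hlow : ∀ ε : ℝ, 0 < ε → ∀ᵐ x ∂μ, ∀ᶠ s in atTop,
      μ.real (closedBall x (Real.exp (-s))) ≤ Real.exp (-((d - ε) * s))) :
    ExactDimWith μ d := by
  have hn : ∀ n : ℕ, (0 : ℝ) < 1 / ((n : ℝ) + 1) := fun n => Nat.one_div_pos_of_nat
  filter_upwards [ae_all_iff.2 fun n => hup _ (hn n), ae_all_iff.2 fun n => hlow _ (hn n)]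
    with x h1 h2
  have hS : Tendsto (fun t : ℝ => -Real.log t) (𝓝[>] 0) atTop :=
    tendsto_neg_atBot_atTop.comp Real.tendsto_log_nhdsGT_zero
  refine Metric.tendsto_nhds.2 fun ε hε => ?_
  obtain ⟨n, hn'⟩ := exists_nat_one_div_lt hε
  filter_upwards [hS.eventually (h1 n), hS.eventually (h2 n), hS.eventually_gt_atTop 0,
    self_mem_nhdsWithin] with t ht1 ht2 ht3 ht0
  rw [neg_neg, Real.exp_log ht0] at ht1 ht2
  have hpos := (Real.exp_pos _).trans_le ht1
  have h3 := Real.log_le_log (Real.exp_pos _) ht1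
  have h4 := Real.log_le_log hpos ht2
  rw [Real.log_exp] at h3 h4
  change dist (Real.log (μ.real (closedBall x t)) / Real.log t) d < ε
  have hL : 0 < -Real.log t := ht3
  obtain ⟨L, hLL⟩ : ∃ L, L = -Real.log t := ⟨_, rfl⟩
  have hlt : Real.log t = -L := by rw [hLL, neg_neg]
  rw [← hLL] at h3 h4 hL
  rw [hlt, Real.dist_eq, div_neg, abs_sub_lt_iff, sub_lt_iff_lt_add, sub_lt_comm, ← neg_div,
    div_lt_iff₀ hL, lt_div_iff₀ hL]
  constructor <;> nlinarith

theorem Reg.exactDimWith [IsProbabilityMeasure μ] (hR : Reg φ ρ₀ ρ₁ K)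
    (hp : ∀ i, 0 < p i) (hp1 : ∑ i, p i = 1) (hμI : μ unitIᶜ = 0)
    (hμ : μ = ∑ i : Λ, ENNReal.ofReal (p i) • Measure.map (φ i) μ)
    (hnofix : ¬ ∃ x ∈ unitI, ∀ i, φ i x = x) (hsep : ExpSep φ) :
    ExactDimWith μ
      (min 1 ((-∑ i, p i * Real.logb 2 (p i)) /
        (-∑ i, p i * ∫ x, Real.logb 2 |deriv (φ i) x| ∂μ))) := by
  have hp0 := fun i => (hp i).le
  have hl : 0 < Real.log 2 := Real.log_pos one_lt_two
  have hχ := hR.lyap_pos hp0 hp1 hμI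
  have hH := entropy_nonneg hp hp1
  have hratio : (-∑ i, p i * Real.logb 2 (p i)) /
      (-∑ i, p i * ∫ x, Real.logb 2 |deriv (φ i) x| ∂μ) =
      (-∑ i, p i * Real.log (p i)) / lyap φ p μ := by
    simp only [Real.logb, integral_div, ← mul_div_assoc, ← Finset.sum_div, lyap, ← neg_div]
    exact div_div_div_cancel_right₀ hl.ne' _ _
  rw [hratio]
  obtain ⟨C₀, hC₀⟩ := exists_pow_lt_of_lt_one (by norm_num : (0 : ℝ) < 1 / 2) hR.lt_one
  obtain ⟨α, C₁, hα, hC₁, hle, hlim⟩ := exists_entropy_dim hR hp0 hp1 hC₀.le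
  obtain ⟨d, hd⟩ : ∃ d, d = min 1 ((-∑ i, p i * Real.log (p i)) / lyap φ p μ) := ⟨_, rfl⟩
  have hup := fun (ε : ℝ) (hε : 0 < ε) => hR.ae_exp_le hp hp1 hμI hμ hε
  simp only [← hd] at hup ⊢
  have hd0 : 0 ≤ d := hd ▸ le_min zero_le_one (by positivity)
  have hdα : d * Real.log 2 ≤ α := by
    rcases hR.entropy_dim_dichotomy hp hp1 hμI hμ hnofix hsep hC₀.le hα hC₁ hle hlim with h | h
    · have : d ≤ 1 := hd ▸ min_le_left _ _
      nlinarith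
    · refine (mul_le_mul_of_nonneg_right (hd ▸ min_le_right _ _) hl.le).trans ?_
      rwa [div_mul_eq_mul_div, div_le_iff₀ hχ]
  refine exactDimWith_of_ae hup fun ε hε => ?_
  have h := hR.ae_le_exp hp hp1 hμI hμ hC₀.le hlim hd0 hdα (show 0 < ε / 3 by positivity) hup
  rwa [mul_div_cancel₀ ε three_ne_zero] at h

end SelfConformal

theorem dimension_of_self_conformal_measure
    {Λ : Type} [Fintype Λ] [Nonempty Λ]
    (φ : Λ → ℝ → ℝ)
    (hanal : ∀ i, AnalyticOnNhd ℝ (φ i) unitI)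
    (hmaps : ∀ i, Set.MapsTo (φ i) unitI unitI)
    (hderiv : ∀ i, ∀ x ∈ unitI, 0 < |deriv (φ i) x| ∧ |deriv (φ i) x| < 1)
    (hnofix : ¬ ∃ x ∈ unitI, ∀ i, φ i x = x)
    (hsep : ExpSep φ)
    (p : Λ → ℝ) (hp : ∀ i, 0 < p i) (hp1 : ∑ i, p i = 1)
    (μ : Measure ℝ) (hprob : IsProbabilityMeasure μ) (hμI : μ unitIᶜ = 0)
    (hμ : μ = ∑ i : Λ, ENNReal.ofReal (p i) • Measure.map (φ i) μ) :
    ExactDimWith μ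
      (min 1 ((-∑ i, p i * Real.logb 2 (p i)) /
        (-∑ i, p i * ∫ x, Real.logb 2 |deriv (φ i) x| ∂μ))) := by
  obtain ⟨ρ₀, ρ₁, K, hR⟩ := SelfConformal.exists_reg hanal hmaps hderiv
  exact hR.exactDimWith hp hp1 hμI hμ hnofix hsep
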